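/- Let n ≥ 2 and 2 < p < ∞. Then there exists a constant C ∈ (0,∞) such that for every continuous compactly supported function f : ℝⁿ → ℂ one has ‖ sup_{t>0} |A_t f(·)| ‖_{L^p(ℝⁿ)} ≤ C ‖f‖_{L^p(ℝⁿ)}. (This is the case α = 0 of the main theorem: the spherical maximal theorem of Stein for n ≥ 3 and of Bourgain for n = 2.) -/

import Mathlib

open MeasureTheory Filter Metric
open scoped ENNReal Topology

/-- The (unnormalized) rotation-invariant surface measure on the unit sphere `S^{n-1} ⊂ ℝⁿ`,
obtained from Lebesgue measure by the polar decomposition. -/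
noncomputable def surfMeasure (n : ℕ) : Measure (Metric.sphere (0 : EuclideanSpace ℝ (Fin n)) 1) :=
  (volume : Measure (EuclideanSpace ℝ (Fin n))).toSphere

/-- The normalized (total mass one) rotation-invariant surface measure on `S^{n-1}`. -/
noncomputable def surfMeasureNorm (n : ℕ) :
    Measure (Metric.sphere (0 : EuclideanSpace ℝ (Fin n)) 1) :=
  (surfMeasure n Set.univ)⁻¹ • surfMeasure n

/-- The spherical mean `A_t f(x) = ∫_{S^{n-1}} f(x + tω) dσ(ω)` with respect to the normalized
surface measure `σ`. -/
noncomputable def sphAvg (n : ℕ) (t : ℝ) (f : EuclideanSpace ℝ (Fin n) → ℂ)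
    (x : EuclideanSpace ℝ (Fin n)) : ℂ :=
  ∫ ω, f (x + t • (ω : EuclideanSpace ℝ (Fin n))) ∂(surfMeasureNorm n)

namespace SphericalMaximal

lemma volume_abs_sin_lt (s : ℝ) (hs : 0 < s) :
    volume {α : ℝ | α ∈ Set.Icc (-Real.pi) Real.pi ∧ |Real.sin α| < s} ≤
      ENNReal.ofReal (8 * s) := by
  have hpi := Real.pi_pos
  have hpi4 := Real.pi_lt_four
  have key : ∀ β : ℝ, |β| ≤ Real.pi / 2 → |Real.sin β| < s → |β| ≤ Real.pi * s / 2 := by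
    intro β hβ h
    have h1 := Real.mul_abs_le_abs_sin hβ
    have h2 : 2 / Real.pi * |β| < s := lt_of_le_of_lt h1 h
    rw [div_mul_eq_mul_div, div_lt_iff₀ hpi] at h2
    linarith
  have hsub : {α : ℝ | α ∈ Set.Icc (-Real.pi) Real.pi ∧ |Real.sin α| < s} ⊆
      (Set.Icc (-(Real.pi * s / 2)) (Real.pi * s / 2) ∪
        Set.Icc (Real.pi - Real.pi * s / 2) Real.pi) ∪
        Set.Icc (-Real.pi) (-Real.pi + Real.pi * s / 2) := by
    rintro α ⟨⟨h1, h2⟩, h3⟩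
    rcases le_or_gt |α| (Real.pi / 2) with h | h
    · have := key α h h3
      rw [abs_le] at this
      exact Or.inl (Or.inl ⟨by linarith, by linarith⟩)
    · rcases lt_abs.1 h with h | h
      · have := key (Real.pi - α) (abs_le.2 ⟨by linarith, by linarith⟩)
          (by rwa [Real.sin_pi_sub])
        rw [abs_le] at this
        exact Or.inl (Or.inr ⟨by linarith, by linarith⟩)
      · have := key (α + Real.pi) (abs_le.2 ⟨by linarith, by linarith⟩)
          (by rwa [Real.sin_add_pi, abs_neg])
        rw [abs_le] at this
        exact Or.inr ⟨by linarith, by linarith⟩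
  have hps : 0 < Real.pi * s := by positivity
  refine (measure_mono hsub).trans ((measure_union_le _ _).trans ?_)
  refine (add_le_add_left (measure_union_le _ _) _).trans ?_
  rw [Real.volume_Icc, Real.volume_Icc, Real.volume_Icc, ← ENNReal.ofReal_add, ← ENNReal.ofReal_add]
  · apply ENNReal.ofReal_le_ofReal
    nlinarith
  all_goals nlinarith

lemma volume_le_of_forall_sub_le {s : Set ℝ} {d : ℝ} (h : ∀ x ∈ s, ∀ y ∈ s, x ≤ y → y - x ≤ d) :
    volume s ≤ ENNReal.ofReal d := by
  refine (Real.volume_le_diam s).trans (Metric.ediam_le ?_)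
  intro x hx y hy
  rw [edist_dist, Real.dist_eq]
  apply ENNReal.ofReal_le_ofReal
  rcases le_total x y with hxy | hxy
  · rw [abs_sub_comm, abs_of_nonneg (by linarith)]
    exact h x hx y hy hxy
  · rw [abs_of_nonneg (by linarith)]
    exact h y hy x hx hxy

/-- On an arc of the upper half circle where the sine is at least `s`, the cosine has slope at
least `s`. -/
lemma mul_sub_le_cos_sub_cos {s x y : ℝ} (hx : x ∈ Set.Icc 0 Real.pi) (hy : y ∈ Set.Icc 0 Real.pi)
    (hxy : x ≤ y) (hsx : s ≤ Real.sin x) (hsy : s ≤ Real.sin y) :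
    s * (y - x) ≤ Real.cos x - Real.cos y := by
  have := (convex_Icc x y).mul_sub_le_image_sub_of_le_deriv (f := fun u => - Real.cos u) (C := s)
    (by fun_prop) (by fun_prop) (fun u hu => by
      rw [interior_Icc] at hu
      have h1 := strictConcaveOn_sin_Icc.concaveOn.min_le_of_mem_Icc hx hy ⟨hu.1.le, hu.2.le⟩
      simp only [deriv.fun_neg, Real.deriv_cos, neg_neg]
      exact (le_min hsx hsy).trans h1) x ⟨le_rfl, hxy⟩ y ⟨hxy, le_rfl⟩ hxy
  linarith

lemma volume_cos_window {s η c : ℝ} (hs : 0 < s) :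
    volume {α : ℝ | α ∈ Set.Icc (-Real.pi) Real.pi ∧ s ≤ |Real.sin α| ∧
      Real.cos α ∈ Set.Icc c (c + η)} ≤ ENNReal.ofReal (2 * (η / s)) := by
  by_cases hη : 0 ≤ η
  swap
  · have : {α : ℝ | α ∈ Set.Icc (-Real.pi) Real.pi ∧ s ≤ |Real.sin α| ∧
      Real.cos α ∈ Set.Icc c (c + η)} = ∅ := by
      ext α
      simp only [Set.mem_ofPred_eq, Set.mem_Icc, Set.mem_empty_iff_false, iff_false]
      rintro ⟨-, -, h1, h2⟩
      linarith
    rw [this, measure_empty]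
    exact zero_le
  have h1 : volume {α : ℝ | α ∈ Set.Icc 0 Real.pi ∧ s ≤ |Real.sin α| ∧
      Real.cos α ∈ Set.Icc c (c + η)} ≤ ENNReal.ofReal (η / s) := by
    apply volume_le_of_forall_sub_le
    rintro x ⟨hx, hsx, hcx⟩ y ⟨hy, hsy, hcy⟩ hxy
    rw [abs_of_nonneg (Real.sin_nonneg_of_mem_Icc hx)] at hsx
    rw [abs_of_nonneg (Real.sin_nonneg_of_mem_Icc hy)] at hsy
    have := mul_sub_le_cos_sub_cos hx hy hxy hsx hsy
    rw [le_div_iff₀ hs]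
    linarith [hcx.2, hcy.1]
  have h2 : volume {α : ℝ | α ∈ Set.Icc (-Real.pi) 0 ∧ s ≤ |Real.sin α| ∧
      Real.cos α ∈ Set.Icc c (c + η)} ≤ ENNReal.ofReal (η / s) := by
    apply volume_le_of_forall_sub_le
    rintro x ⟨hx, hsx, hcx⟩ y ⟨hy, hsy, hcy⟩ hxy
    have hx' : -x ∈ Set.Icc 0 Real.pi := ⟨by linarith [hx.2], by linarith [hx.1]⟩
    have hy' : -y ∈ Set.Icc 0 Real.pi := ⟨by linarith [hy.2], by linarith [hy.1]⟩
    rw [← abs_neg, ← Real.sin_neg, abs_of_nonneg (Real.sin_nonneg_of_mem_Icc hx')] at hsx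
    rw [← abs_neg, ← Real.sin_neg, abs_of_nonneg (Real.sin_nonneg_of_mem_Icc hy')] at hsy
    have := mul_sub_le_cos_sub_cos hy' hx' (by linarith) hsy hsx
    rw [Real.cos_neg, Real.cos_neg] at this
    rw [le_div_iff₀ hs]
    linarith [hcx.1, hcy.2]
  have hsub : {α : ℝ | α ∈ Set.Icc (-Real.pi) Real.pi ∧ s ≤ |Real.sin α| ∧
      Real.cos α ∈ Set.Icc c (c + η)} ⊆ {α : ℝ | α ∈ Set.Icc 0 Real.pi ∧ s ≤ |Real.sin α| ∧
      Real.cos α ∈ Set.Icc c (c + η)} ∪ {α : ℝ | α ∈ Set.Icc (-Real.pi) 0 ∧ s ≤ |Real.sin α| ∧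
      Real.cos α ∈ Set.Icc c (c + η)} := by
    rintro x ⟨hx, h⟩
    rcases le_total 0 x with h0 | h0
    · exact Or.inl ⟨⟨h0, hx.2⟩, h⟩
    · exact Or.inr ⟨⟨hx.1, h0⟩, h⟩
  refine (measure_mono hsub).trans ((measure_union_le _ _).trans ((add_le_add h1 h2).trans ?_))
  rw [← ENNReal.ofReal_add (by positivity) (by positivity)]
  apply ENNReal.ofReal_le_ofReal
  linarith

/-- Angles at which the circle of radius `a` about `r` meets a thin annulus transversally. -/
lemma volume_norm_window {a r t δ s : ℝ} (ha : 7 / 8 ≤ a) (hr : 0 < r) (ht : t ∈ Set.Icc (1 : ℝ) 2)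
    (hδ : 0 < δ) (hδ' : δ ≤ 1 / 16) (hs : 0 < s) {b : ℝ → ℝ} (hb : ∀ α, 0 ≤ b α)
    (hb2 : ∀ α, b α ^ 2 = a ^ 2 + r ^ 2 + 2 * a * r * Real.cos α) :
    volume {α : ℝ | α ∈ Set.Icc (-Real.pi) Real.pi ∧ s ≤ |Real.sin α| ∧ |b α - t| ≤ δ} ≤
      ENNReal.ofReal (10 * (δ / (r * s))) := by
  have hsub : {α : ℝ | α ∈ Set.Icc (-Real.pi) Real.pi ∧ s ≤ |Real.sin α| ∧ |b α - t| ≤ δ} ⊆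
      {α : ℝ | α ∈ Set.Icc (-Real.pi) Real.pi ∧ s ≤ |Real.sin α| ∧
      Real.cos α ∈ Set.Icc (((t - δ) ^ 2 - a ^ 2 - r ^ 2) / (2 * a * r))
        (((t - δ) ^ 2 - a ^ 2 - r ^ 2) / (2 * a * r) + 5 * (δ / r))} := by
    rintro α ⟨h1, h2, h3⟩
    refine ⟨h1, h2, ?_, ?_⟩
    · rw [div_le_iff₀ (by positivity)]
      have := hb2 α
      have := hb α
      rw [abs_le] at h3
      nlinarith [ht.1]
    · have e : Real.cos α - ((t - δ) ^ 2 - a ^ 2 - r ^ 2) / (2 * a * r) =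
        (b α ^ 2 - (t - δ) ^ 2) / (2 * a * r) := by
        rw [hb2]; field_simp; ring
      have h4 : b α ^ 2 - (t - δ) ^ 2 ≤ 8 * δ := by
        have := hb α
        rw [abs_le] at h3
        nlinarith [ht.1, ht.2]
      have h5 : (b α ^ 2 - (t - δ) ^ 2) / (2 * a * r) ≤ 5 * (δ / r) := by
        rw [div_le_iff₀ (by positivity)]
        have : 5 * (δ / r) * (2 * a * r) = 10 * δ * a := by field_simp; norm_num
        rw [this]
        nlinarith
      linarith
  refine (measure_mono hsub).trans ((volume_cos_window hs).trans ?_)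
  apply ENNReal.ofReal_le_ofReal
  apply le_of_eq
  field_simp
  norm_num

/-- A radial profile `Φ` at height `A`, with derivative `φ`, supported within `δ` of `t`. -/
structure IsProfile (A δ t : ℝ) (Φ φ : ℝ → ℝ) : Prop where
  hasDerivAt : ∀ s, HasDerivAt Φ (φ s) s
  bound : ∀ s, |Φ s| ≤ A
  deriv_bound : ∀ s, |φ s| ≤ A / δ
  deriv_lip : ∀ s s', |φ s - φ s'| ≤ A / δ ^ 2 * |s - s'|
  eq_zero : ∀ s, δ < |s - t| → Φ s = 0
  deriv_eq_zero : ∀ s, δ < |s - t| → φ s = 0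

/-- A `0`-homogeneous cutoff to the sector of aperture `ε` about the direction `θ`. -/
structure IsCutoff (B ε : ℝ) (θ : ℂ) (Y : ℂ → ℝ) : Prop where
  measurable : Measurable Y
  nonneg : ∀ w, 0 ≤ Y w
  le_one : ∀ w, Y w ≤ 1
  homog : ∀ (s : ℝ) (w : ℂ), 0 < s → Y (s * w) = Y w
  diff : ∀ w, 1 / 2 ≤ ‖w‖ → DifferentiableAt ℝ Y w
  fderiv_le : ∀ w, 1 / 2 ≤ ‖w‖ → ‖fderiv ℝ Y w‖ ≤ B / ε
  norm_center : ‖θ‖ = 1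
  eq_zero : ∀ w, ε * ‖w‖ < ‖w - ‖w‖ * θ‖ → Y w = 0

lemma IsProfile.continuous {A δ t : ℝ} {Φ φ : ℝ → ℝ} (h : IsProfile A δ t Φ φ) : Continuous Φ :=
  continuous_iff_continuousAt.2 fun s => (h.hasDerivAt s).continuousAt

lemma IsProfile.deriv_continuous {A δ t : ℝ} {Φ φ : ℝ → ℝ} (h : IsProfile A δ t Φ φ) :
    Continuous φ := by
  have : φ = deriv Φ := funext fun s => (h.hasDerivAt s).deriv.symm
  have hA : 0 ≤ A := (abs_nonneg _).trans (h.bound 0)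
  refine (LipschitzWith.of_dist_le_mul (K := (A / δ ^ 2).toNNReal) fun s s' => ?_).continuous
  rw [Real.coe_toNNReal _ (by positivity)]
  exact h.deriv_lip s s'

lemma abs_setIntegral_le {X : Type*} [MeasurableSpace X] {μ : Measure X} {f : X → ℝ} {S T : Set X}
    {M V : ℝ} (hT : MeasurableSet T) (h0 : ∀ x ∈ T, x ∉ S → f x = 0)
    (hM : ∀ x ∈ T, |f x| ≤ M) (hM0 : 0 ≤ M) (hV0 : 0 ≤ V) (hV : μ (T ∩ S) ≤ ENNReal.ofReal V) :
    |∫ x in T, f x ∂μ| ≤ M * V := by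
  have h1 : ∫ x in T, f x ∂μ = ∫ x in T ∩ S, f x ∂μ := by
    refine (setIntegral_eq_of_subset_of_forall_sdiff_eq_zero hT Set.inter_subset_left ?_)
    rintro x ⟨hx, hx'⟩
    exact h0 x hx fun h => hx' ⟨hx, h⟩
  rw [h1, ← Real.norm_eq_abs]
  refine (norm_setIntegral_le_of_norm_le_const (hV.trans_lt ENNReal.ofReal_lt_top)
    fun x hx => hM x hx.1).trans ?_
  gcongr
  exact ENNReal.toReal_le_of_le_ofReal hV0 hV

/-- The point at angle `α` on the circle of radius `a` centred at `r`. -/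
noncomputable def circ (a r α : ℝ) : ℂ := a * Complex.exp (α * Complex.I) + r

lemma circ_re (a r α : ℝ) : (circ a r α).re = a * Real.cos α + r := by
  simp [circ, Complex.exp_ofReal_mul_I_re]

lemma circ_im (a r α : ℝ) : (circ a r α).im = a * Real.sin α := by
  simp [circ, Complex.exp_ofReal_mul_I_im]

lemma norm_circ_sq (a r α : ℝ) :
    ‖circ a r α‖ ^ 2 = a ^ 2 + r ^ 2 + 2 * a * r * Real.cos α := by
  rw [Complex.sq_norm, Complex.normSq_apply, circ_re, circ_im]
  linear_combination a ^ 2 * Real.cos_sq_add_sin_sq α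

lemma hasDerivAt_circ (a r α : ℝ) :
    HasDerivAt (circ a r) (a * Complex.exp (α * Complex.I) * Complex.I) α := by
  have h : HasDerivAt (fun x : ℂ => a * Complex.exp (x * Complex.I) + r)
      (a * (Complex.exp (α * Complex.I) * (1 * Complex.I))) (α : ℂ) :=
    ((((hasDerivAt_id (α : ℂ)).mul_const Complex.I).cexp).const_mul (a : ℂ)).add_const _
  have := h.comp_ofReal
  rwa [one_mul, ← mul_assoc] at this

lemma continuous_circ (a r : ℝ) : Continuous (circ a r) := by
  unfold circ; fun_prop

lemma hasDerivAt_norm_circ {a r α : ℝ} (h : 0 < ‖circ a r α‖) :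
    HasDerivAt (fun α => ‖circ a r α‖) (-(a * r * Real.sin α) / ‖circ a r α‖) α := by
  have h1 : (fun α => ‖circ a r α‖) =
      fun α => Real.sqrt (a ^ 2 + r ^ 2 + 2 * a * r * Real.cos α) := by
    funext α
    rw [← norm_circ_sq, Real.sqrt_sq (norm_nonneg _)]
  have h2 : HasDerivAt (fun α => a ^ 2 + r ^ 2 + 2 * a * r * Real.cos α)
      (2 * a * r * (-Real.sin α)) α :=
    ((Real.hasDerivAt_cos α).const_mul _).const_add _
  have h3 := h2.sqrt (by rw [← norm_circ_sq]; positivity)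
  rw [h1]
  convert h3 using 1
  rw [← norm_circ_sq, Real.sqrt_sq (norm_nonneg _)]
  field_simp

/-- Derivative of a cutoff along a circle. -/
lemma IsCutoff.hasDerivAt_circ {B ε a r α : ℝ} {θ : ℂ} {Y : ℂ → ℝ} (hY : IsCutoff B ε θ Y)
    (ha : 0 ≤ a) (h : 1 / 2 ≤ ‖circ a r α‖) :
    ∃ y, HasDerivAt (fun α => Y (circ a r α)) y α ∧ |y| ≤ B / ε * a := by
  refine ⟨_, (hY.diff _ h).hasFDerivAt.comp_hasDerivAt α (SphericalMaximal.hasDerivAt_circ a r α), ?_⟩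
  rw [← Real.norm_eq_abs]
  refine (ContinuousLinearMap.le_opNorm _ _).trans ?_
  have : ‖(a * Complex.exp (α * Complex.I) * Complex.I : ℂ)‖ = a := by
    simp [Complex.norm_exp_ofReal_mul_I, abs_of_nonneg ha]
  rw [this]
  exact mul_le_mul_of_nonneg_right (hY.fderiv_le _ h) ha

/-- The product of the cutoffs evaluated on the unit circle and on the translated circle. -/
noncomputable def cutoffProd (Y : ℂ → ℝ) (a r α : ℝ) : ℝ := Y (circ 1 0 α) * Y (circ a r α)

section Angular

variable {A δ t B ε a r s : ℝ} {Φ φ : ℝ → ℝ} {θ : ℂ} {Y : ℂ → ℝ}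

lemma IsCutoff.abs_le_one (hY : IsCutoff B ε θ Y) (w : ℂ) : |Y w| ≤ 1 := by
  rw [abs_of_nonneg (hY.nonneg w)]; exact hY.le_one w

lemma norm_circ_one (α : ℝ) : ‖circ 1 0 α‖ = 1 := by
  simp [circ, Complex.norm_exp_ofReal_mul_I]

lemma IsCutoff.cutoffProd_hasDerivAt (hY : IsCutoff B ε θ Y) (ha : a ∈ Set.Icc (7 / 8 : ℝ) 3)
    (hBε : 0 ≤ B / ε) {α : ℝ} (h : 1 / 2 ≤ ‖circ a r α‖) :
    HasDerivAt (cutoffProd Y a r) (deriv (cutoffProd Y a r) α) α ∧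
      |deriv (cutoffProd Y a r) α| ≤ 4 * (B / ε) := by
  obtain ⟨y1, h1, h1'⟩ := hY.hasDerivAt_circ (a := 1) (r := 0) (α := α) zero_le_one
    (by rw [norm_circ_one]; norm_num)
  obtain ⟨y2, h2, h2'⟩ := hY.hasDerivAt_circ (a := a) (r := r) (α := α) (by linarith [ha.1]) h
  have h3 : HasDerivAt (cutoffProd Y a r) (y1 * Y (circ a r α) + Y (circ 1 0 α) * y2) α :=
    h1.mul h2
  rw [h3.deriv]
  refine ⟨h3, (abs_add_le _ _).trans ?_⟩
  rw [abs_mul, abs_mul]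
  have e1 := hY.abs_le_one (circ a r α)
  have e2 := hY.abs_le_one (circ 1 0 α)
  have := mul_le_mul h1' e1 (abs_nonneg _) (by positivity)
  have := mul_le_mul e2 h2' (abs_nonneg _) (by positivity)
  nlinarith [ha.2]

lemma half_le_of_abs_sub_le (ht : t ∈ Set.Icc (1 : ℝ) 2) (hδ' : δ ≤ 1 / 16) {b : ℝ}
    (h : |b - t| ≤ δ) : 7 / 8 ≤ b := by
  rw [abs_le] at h; linarith [ht.1]

lemma continuousAt_norm_circ (a r α : ℝ) : ContinuousAt (fun α => ‖circ a r α‖) α :=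
  (continuous_circ a r).norm.continuousAt

lemma hasDerivAt_angular (hΦ : IsProfile A δ t Φ φ) (hY : IsCutoff B ε θ Y)
    (ha : a ∈ Set.Icc (7 / 8 : ℝ) 3) (hr : 0 < r) (ht : t ∈ Set.Icc (1 : ℝ) 2)
    (hδ' : δ ≤ 1 / 16) (hs : 0 < s) (hBε : 0 ≤ B / ε)
    (H : ∀ α, |‖circ a r α‖ - t| ≤ δ → Y (circ 1 0 α) ≠ 0 → Y (circ a r α) ≠ 0 →
      s ≤ |Real.sin α|) (α : ℝ) :
    HasDerivAt (fun α => Φ ‖circ a r α‖ * (cutoffProd Y a r α / (a * r * Real.sin α)))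
      (Φ ‖circ a r α‖ * (deriv (cutoffProd Y a r) α / (a * r * Real.sin α) -
        cutoffProd Y a r α * Real.cos α / (a * r * Real.sin α ^ 2)) -
        cutoffProd Y a r α * (‖circ a r α‖⁻¹ * φ ‖circ a r α‖)) α := by
  have ha0 : 0 < a := by linarith [ha.1]
  by_cases hfar : δ < |‖circ a r α‖ - t|
  · have hev : ∀ᶠ β in 𝓝 α, δ < |‖circ a r β‖ - t| :=
      (((continuousAt_norm_circ a r α).sub continuousAt_const).abs).eventually (lt_mem_nhds hfar)
    have h1 : (fun α => Φ ‖circ a r α‖ * (cutoffProd Y a r α / (a * r * Real.sin α))) =ᶠ[𝓝 α]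
        fun _ => 0 := by
      filter_upwards [hev] with β hβ
      rw [hΦ.eq_zero _ hβ, zero_mul]
    rw [hΦ.eq_zero _ hfar, hΦ.deriv_eq_zero _ hfar]
    simpa using (hasDerivAt_const α (0 : ℝ)).congr_of_eventuallyEq h1
  have hnear : |‖circ a r α‖ - t| ≤ δ := not_lt.1 hfar
  have hb := half_le_of_abs_sub_le ht hδ' hnear
  by_cases hsin : s ≤ |Real.sin α|
  · have hsin0 : Real.sin α ≠ 0 := by
      intro h; rw [h, abs_zero] at hsin; linarith
    have h1 := (hY.cutoffProd_hasDerivAt (r := r) (α := α) ha hBε (by linarith)).1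
    have h2 : HasDerivAt (fun α => a * r * Real.sin α) (a * r * Real.cos α) α :=
      (Real.hasDerivAt_sin α).const_mul _
    have h3 := h1.div h2 (by positivity)
    have h4 : HasDerivAt (fun α => Φ ‖circ a r α‖)
        (φ ‖circ a r α‖ * (-(a * r * Real.sin α) / ‖circ a r α‖)) α :=
      (hΦ.hasDerivAt _).comp α (hasDerivAt_norm_circ (by linarith))
    refine (h4.mul h3).congr_deriv ?_
    have : ‖circ a r α‖ ≠ 0 := by linarith
    simp only [Pi.div_apply]
    field_simp
    ring
  · push Not at hsin
    have hev : ∀ᶠ β in 𝓝 α, |Real.sin β| < s :=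
      (Real.continuous_sin.abs.continuousAt).eventually (gt_mem_nhds hsin)
    have hzero : ∀ β, |Real.sin β| < s → |‖circ a r β‖ - t| ≤ δ → cutoffProd Y a r β = 0 := by
      intro β h1 h2
      by_contra h3
      rw [cutoffProd, mul_eq_zero, not_or] at h3
      exact absurd (H β h2 h3.1 h3.2) (not_le.2 h1)
    have h1 : (fun α => Φ ‖circ a r α‖ * (cutoffProd Y a r α / (a * r * Real.sin α))) =ᶠ[𝓝 α]
        fun _ => 0 := by
      filter_upwards [hev] with β hβ
      by_cases h : δ < |‖circ a r β‖ - t|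
      · rw [hΦ.eq_zero _ h, zero_mul]
      · rw [hzero β hβ (not_lt.1 h), zero_div, mul_zero]
    have h2 : Φ ‖circ a r α‖ * (deriv (cutoffProd Y a r) α / (a * r * Real.sin α)) = 0 := by
      by_cases h : Φ ‖circ a r α‖ = 0
      · rw [h, zero_mul]
      · have hev2 : ∀ᶠ β in 𝓝 α, Φ ‖circ a r β‖ ≠ 0 :=
          ((hΦ.continuous.comp (continuous_circ a r).norm).continuousAt).eventually_ne h
        have : cutoffProd Y a r =ᶠ[𝓝 α] fun _ => 0 := by
          filter_upwards [hev, hev2] with β hβ hβ2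
          refine hzero β hβ (not_lt.1 fun h => hβ2 (hΦ.eq_zero _ h))
        rw [this.deriv_eq]
        simp
    rw [mul_sub, h2, hzero α hsin hnear]
    simpa using (hasDerivAt_const α (0 : ℝ)).congr_of_eventuallyEq h1

lemma cutoffProd_abs_le (hY : IsCutoff B ε θ Y) (α : ℝ) : |cutoffProd Y a r α| ≤ 1 := by
  rw [cutoffProd, abs_mul]
  exact mul_le_one₀ (hY.abs_le_one _) (abs_nonneg _) (hY.abs_le_one _)

lemma measurable_cutoffProd (hY : IsCutoff B ε θ Y) : Measurable (cutoffProd Y a r) :=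
  (hY.measurable.comp (continuous_circ 1 0).measurable).mul
    (hY.measurable.comp (continuous_circ a r).measurable)

lemma abs_angular_le (hΦ : IsProfile A δ t Φ φ) (hY : IsCutoff B ε θ Y)
    (ht : t ∈ Set.Icc (1 : ℝ) 2) (hδ' : δ ≤ 1 / 16) (hδ : 0 < δ) (α : ℝ) :
    |cutoffProd Y a r α * (‖circ a r α‖⁻¹ * φ ‖circ a r α‖)| ≤ 2 * (A / δ) := by
  have hA : 0 ≤ A := (abs_nonneg _).trans (hΦ.bound 0)
  by_cases hfar : δ < |‖circ a r α‖ - t|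
  · rw [hΦ.deriv_eq_zero _ hfar]
    simp only [mul_zero, abs_zero]
    positivity
  have hb := half_le_of_abs_sub_le ht hδ' (not_lt.1 hfar)
  rw [abs_mul, abs_mul, abs_inv, abs_norm]
  have h1 : ‖circ a r α‖⁻¹ ≤ 2 := by
    rw [inv_le_comm₀ (by linarith) (by norm_num)]; linarith
  have h2 := mul_le_mul h1 (hΦ.deriv_bound ‖circ a r α‖) (abs_nonneg _) (by norm_num)
  have h3 := mul_le_mul (cutoffProd_abs_le (a := a) (r := r) hY α) h2 (by positivity) zero_le_one
  linarith

lemma measurable_angular (hΦ : IsProfile A δ t Φ φ) (hY : IsCutoff B ε θ Y) :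
    Measurable fun α => cutoffProd Y a r α * (‖circ a r α‖⁻¹ * φ ‖circ a r α‖) := by
  have := measurable_cutoffProd (a := a) (r := r) hY
  have h2 := hΦ.deriv_continuous.measurable.comp (continuous_circ a r).norm.measurable
  exact this.mul ((continuous_circ a r).norm.measurable.inv.mul h2)

/-- Integration by parts along a circle. -/
lemma abs_angular_integral_le (hΦ : IsProfile A δ t Φ φ) (hY : IsCutoff B ε θ Y)
    (ha : a ∈ Set.Icc (7 / 8 : ℝ) 3) (hr : 0 < r) (ht : t ∈ Set.Icc (1 : ℝ) 2)
    (hδ : 0 < δ) (hδ' : δ ≤ 1 / 16) (hs : 0 < s) (hε : 0 < ε) (hBε : 1 ≤ B / ε)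
    (H : ∀ α, |‖circ a r α‖ - t| ≤ δ → Y (circ 1 0 α) ≠ 0 → Y (circ a r α) ≠ 0 →
      s ≤ |Real.sin α|) :
    |∫ α in -Real.pi..Real.pi, cutoffProd Y a r α * (‖circ a r α‖⁻¹ * φ ‖circ a r α‖)| ≤
      80 * A * (B / ε) * (δ / (r ^ 2 * s ^ 3)) := by
  have hpi := Real.pi_pos
  have ha0 : 0 < a := by linarith [ha.1]
  have hA : 0 ≤ A := (abs_nonneg _).trans (hΦ.bound 0)
  set S : Set ℝ := {α | s ≤ |Real.sin α| ∧ |‖circ a r α‖ - t| ≤ δ}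
  set R : ℝ → ℝ := fun α => Φ ‖circ a r α‖ * (deriv (cutoffProd Y a r) α / (a * r * Real.sin α) -
        cutoffProd Y a r α * Real.cos α / (a * r * Real.sin α ^ 2)) with hR
  have hzero : ∀ α, α ∉ S → R α = 0 := by
    intro α hα
    simp only [hR]
    by_cases h : Φ ‖circ a r α‖ = 0
    · rw [h, zero_mul]
    have hn : ∀ β, Φ ‖circ a r β‖ ≠ 0 → |‖circ a r β‖ - t| ≤ δ := fun β hβ =>
      not_lt.1 fun h' => hβ (hΦ.eq_zero _ h')
    have hsin : |Real.sin α| < s := not_le.1 fun h' => hα ⟨h', hn α h⟩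
    have hev : ∀ᶠ β in 𝓝 α, |Real.sin β| < s :=
      (Real.continuous_sin.abs.continuousAt).eventually (gt_mem_nhds hsin)
    have hev2 : ∀ᶠ β in 𝓝 α, Φ ‖circ a r β‖ ≠ 0 :=
      ((hΦ.continuous.comp (continuous_circ a r).norm).continuousAt).eventually_ne h
    have : cutoffProd Y a r =ᶠ[𝓝 α] fun _ => 0 := by
      filter_upwards [hev, hev2] with β hβ hβ2
      by_contra h3
      rw [cutoffProd, mul_eq_zero, not_or] at h3
      exact absurd (H β (hn β hβ2) h3.1 h3.2) (not_le.2 hβ)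
    rw [this.deriv_eq, this.eq_of_nhds]
    simp
  have hbound : ∀ α, |R α| ≤ 8 * A * (B / ε) / (r * s ^ 2) := by
    intro α
    by_cases hα : α ∈ S
    swap
    · rw [hzero α hα, abs_zero]; positivity
    obtain ⟨h1, h2⟩ := hα
    have hb := half_le_of_abs_sub_le ht hδ' h2
    have hd := (hY.cutoffProd_hasDerivAt (r := r) (α := α) ha (by linarith) (by linarith)).2
    have hs1 : s ≤ 1 := h1.trans (Real.abs_sin_le_one α)
    have hsin0 : 0 < |Real.sin α| := by linarith
    simp only [hR]
    rw [abs_mul]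
    have e1 : |deriv (cutoffProd Y a r) α / (a * r * Real.sin α)| ≤
        4 * (B / ε) / (7 / 8 * r * s ^ 2) := by
      rw [abs_div, abs_mul, abs_of_pos (mul_pos ha0 hr)]
      apply div_le_div₀ (by positivity) hd (by positivity)
      have : s ^ 2 ≤ |Real.sin α| := by nlinarith
      have h78 := ha.1
      gcongr
    have e2 : |cutoffProd Y a r α * Real.cos α / (a * r * Real.sin α ^ 2)| ≤
        (B / ε) / (7 / 8 * r * s ^ 2) := by
      rw [abs_div, abs_mul, abs_of_pos (a := a * r * Real.sin α ^ 2)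
        (mul_pos (mul_pos ha0 hr) (by rw [← sq_abs]; positivity))]
      have h78 := ha.1
      apply div_le_div₀ (by positivity) _ (by positivity)
      · have : s ^ 2 ≤ Real.sin α ^ 2 := by rw [← sq_abs (Real.sin α)]; gcongr
        gcongr
      · exact (mul_le_one₀ (cutoffProd_abs_le hY α) (abs_nonneg _) (Real.abs_cos_le_one α)).trans hBε
    have e3 := (abs_sub _ _).trans (add_le_add e1 e2)
    refine (mul_le_mul (hΦ.bound _) e3 (abs_nonneg _) hA).trans ?_
    rw [← add_div, mul_div_assoc', div_le_div_iff₀ (by positivity) (by positivity)]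
    have : 0 ≤ A * (B / ε) * (r * s ^ 2) := by positivity
    nlinarith
  have hRm : Measurable R := by
    have h1 := measurable_cutoffProd (a := a) (r := r) hY
    have h2 := hΦ.continuous.measurable.comp (continuous_circ a r).norm.measurable
    have h3 := measurable_deriv (cutoffProd Y a r)
    refine h2.mul ((h3.div ?_).sub ((h1.mul Real.measurable_cos).div ?_))
    · exact Real.measurable_sin.const_mul _
    · exact (Real.measurable_sin.pow_const 2).const_mul _
  have hRi : IntervalIntegrable R volume (-Real.pi) Real.pi := by
    rw [intervalIntegrable_iff]
    refine Measure.integrableOn_of_bounded (M := 8 * A * (B / ε) / (r * s ^ 2)) (by simp)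
      hRm.aestronglyMeasurable (ae_of_all _ fun α => hbound α)
  have hPi : IntervalIntegrable
      (fun α => cutoffProd Y a r α * (‖circ a r α‖⁻¹ * φ ‖circ a r α‖))
      volume (-Real.pi) Real.pi := by
    rw [intervalIntegrable_iff]
    refine Measure.integrableOn_of_bounded (M := 2 * (A / δ)) (by simp)
      (measurable_angular hΦ hY).aestronglyMeasurable
      (ae_of_all _ fun α => abs_angular_le hΦ hY ht hδ' hδ α)
  have hftc := intervalIntegral.integral_eq_sub_of_hasDerivAt
    (fun α _ => hasDerivAt_angular hΦ hY ha hr ht hδ' hs (by linarith) H α) (hRi.sub hPi)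
  rw [intervalIntegral.integral_sub hRi hPi] at hftc
  simp only [Real.sin_pi, Real.sin_neg, mul_zero, neg_zero, div_zero, sub_zero] at hftc
  rw [← sub_eq_zero.1 hftc, intervalIntegral.integral_of_le (by linarith)]
  refine (abs_setIntegral_le measurableSet_Ioc (S := S) (fun α _ h => hzero α h) (fun α _ => hbound α)
    (by positivity) (V := 10 * (δ / (r * s))) (by positivity) ?_).trans (le_of_eq ?_)
  · refine (measure_mono ?_).trans (volume_norm_window ha.1 hr ht hδ hδ' hs
      (fun α => norm_nonneg (circ a r α)) (norm_circ_sq a r))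
    rintro α ⟨h1, h2, h3⟩
    exact ⟨⟨h1.1.le, h1.2⟩, h2, h3⟩
  · field_simp
    ring

/-- The measure of the angles seen by a thin annulus, with no transversality. -/
lemma abs_angular_integral_le_sqrt (hΦ : IsProfile A δ t Φ φ) (hY : IsCutoff B ε θ Y)
    (ha : a ∈ Set.Icc (7 / 8 : ℝ) 3) (hr : 0 < r) (ht : t ∈ Set.Icc (1 : ℝ) 2)
    (hδ : 0 < δ) (hδ' : δ ≤ 1 / 16) :
    |∫ α in -Real.pi..Real.pi, cutoffProd Y a r α * (‖circ a r α‖⁻¹ * φ ‖circ a r α‖)| ≤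
      36 * A * (√(δ * r))⁻¹ := by
  have hpi := Real.pi_pos
  have hA : 0 ≤ A := (abs_nonneg _).trans (hΦ.bound 0)
  set s := √(δ / r)
  have hs : 0 < s := by positivity
  rw [intervalIntegral.integral_of_le (by linarith)]
  refine (abs_setIntegral_le measurableSet_Ioc (S := {α | |‖circ a r α‖ - t| ≤ δ})
    (fun α _ h => ?_) (fun α _ => abs_angular_le hΦ hY ht hδ' hδ α)
    (by positivity) (V := 8 * s + 10 * (δ / (r * s))) (by positivity) ?_).trans (le_of_eq ?_)
  · rw [hΦ.deriv_eq_zero _ (not_le.1 h), mul_zero, mul_zero]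
  · rw [ENNReal.ofReal_add (by positivity) (by positivity)]
    refine (measure_mono ?_).trans ((measure_union_le _ _).trans (add_le_add
      (volume_abs_sin_lt s hs) (volume_norm_window ha.1 hr ht hδ hδ' hs
      (fun α => norm_nonneg (circ a r α)) (norm_circ_sq a r))))
    rintro α ⟨h1, h2⟩
    by_cases h : s ≤ |Real.sin α|
    · exact Or.inr ⟨⟨h1.1.le, h1.2⟩, h, h2⟩
    · exact Or.inl ⟨⟨h1.1.le, h1.2⟩, not_le.1 h⟩
  · have h1 : δ / (r * s) = s := by
      have : s * s = δ / r := Real.mul_self_sqrt (by positivity)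
      rw [div_eq_iff (by positivity)]
      calc δ = δ / r * r := by field_simp
        _ = s * (r * s) := by rw [← this]; ring
    have h2 : s = δ * (√(δ * r))⁻¹ := by
      rw [← div_eq_mul_inv, eq_div_iff (by positivity), ← Real.sqrt_mul (by positivity)]
      rw [show δ / r * (δ * r) = δ ^ 2 by field_simp]
      exact Real.sqrt_sq hδ.le
    rw [h1, h2]
    field_simp
    ring

lemma abs_angular_integral_le_inv (hΦ : IsProfile A δ t Φ φ) (hY : IsCutoff B ε θ Y)
    (ht : t ∈ Set.Icc (1 : ℝ) 2) (hδ : 0 < δ) (hδ' : δ ≤ 1 / 16) :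
    |∫ α in -Real.pi..Real.pi, cutoffProd Y a r α * (‖circ a r α‖⁻¹ * φ ‖circ a r α‖)| ≤
      16 * A * δ⁻¹ := by
  have hpi := Real.pi_pos
  have hA : 0 ≤ A := (abs_nonneg _).trans (hΦ.bound 0)
  have := intervalIntegral.norm_integral_le_of_norm_le_const (a := -Real.pi) (b := Real.pi)
    (f := fun α => cutoffProd Y a r α * (‖circ a r α‖⁻¹ * φ ‖circ a r α‖))
    (fun α _ => abs_angular_le hΦ hY ht hδ' hδ α)
  rw [Real.norm_eq_abs] at this
  refine this.trans ?_
  rw [abs_of_pos (by linarith), div_eq_mul_inv]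
  have h4 := Real.pi_lt_four
  have : 0 ≤ A * δ⁻¹ := by positivity
  nlinarith

end Angular

/-- The localized circular kernel with radial density `φ` and angular cutoff `Y`. -/
noncomputable def ker (φ : ℝ → ℝ) (Y : ℂ → ℝ) (w : ℂ) : ℝ := ‖w‖⁻¹ * φ ‖w‖ * Y w

/-- The correlation of two localized circular kernels. -/
noncomputable def interact (φ φ' : ℝ → ℝ) (Y : ℂ → ℝ) (z : ℂ) : ℝ :=
  ∫ w, ker φ Y w * ker φ' Y (w + z)

section Interact

variable {A δ t t' B ε : ℝ} {Φ φ Φ' φ' : ℝ → ℝ} {θ : ℂ} {Y : ℂ → ℝ}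

lemma IsCutoff.rotate (hY : IsCutoff B ε θ Y) {u : ℂ} (hu : ‖u‖ = 1) :
    IsCutoff B ε (star u * θ) (fun w => Y (u * w)) := by
  have hm : ∀ w, HasFDerivAt (fun w : ℂ => u * w) (ContinuousLinearMap.mul ℝ ℂ u) w := fun w =>
    (ContinuousLinearMap.mul ℝ ℂ u).hasFDerivAt
  have hn : ∀ w, 1 / 2 ≤ ‖w‖ → 1 / 2 ≤ ‖u * w‖ := fun w hw => by rwa [norm_mul, hu, one_mul]
  refine ⟨hY.measurable.comp (measurable_const_mul u), fun w => hY.nonneg _, fun w => hY.le_one _,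
    fun s w hs => ?_, fun w hw => ?_, fun w hw => ?_, ?_, fun w hw => ?_⟩
  · rw [mul_left_comm, hY.homog s _ hs]
  · exact (hY.diff _ (hn w hw)).comp w (hm w).differentiableAt
  · have h := ((hY.diff _ (hn w hw)).hasFDerivAt.comp w (hm w))
    change ‖fderiv ℝ (Y ∘ fun w => u * w) w‖ ≤ _
    rw [h.fderiv]
    refine (ContinuousLinearMap.opNorm_comp_le _ _).trans ?_
    have h1 : ‖ContinuousLinearMap.mul ℝ ℂ u‖ ≤ 1 :=
      (ContinuousLinearMap.opNorm_mul_apply_le ℝ ℂ u).trans hu.le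
    have h2 := hY.fderiv_le _ (hn w hw)
    have := mul_le_mul h2 h1 (norm_nonneg _) ((norm_nonneg _).trans h2)
    rwa [mul_one] at this
  · rw [norm_mul, norm_star, hu, hY.norm_center, one_mul]
  · apply hY.eq_zero
    rw [norm_mul, hu, one_mul]
    refine hw.trans_le (le_of_eq ?_)
    have h1 : u * star u = 1 := by
      rw [Complex.star_def, Complex.mul_conj, Complex.normSq_eq_norm_sq, hu]; simp
    have : u * w - ‖w‖ * θ = u * (w - ‖w‖ * (star u * θ)) := by
      linear_combination (‖w‖ : ℂ) * θ * h1
    rw [this, norm_mul, hu, one_mul]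

lemma IsProfile.nonneg (hΦ : IsProfile A δ t Φ φ) : 0 ≤ A := (abs_nonneg _).trans (hΦ.bound 0)

lemma interact_rotate {u : ℂ} (hu : ‖u‖ = 1) (r : ℝ) :
    interact φ φ' Y (u * r) = interact φ φ' (fun w => Y (u * w)) r := by
  have hmp := (rotation ⟨u, by simpa [Submonoid.unitSphere] using hu⟩).measurePreserving
  have := hmp.integral_comp'
      (f := (rotation ⟨u, by simpa [Submonoid.unitSphere] using hu⟩).toMeasurableEquiv)
    (fun w => ker φ Y w * ker φ' Y (w + u * r))
  rw [interact, ← this, interact]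
  congr 1
  funext w
  have e : (rotation ⟨u, by simpa [Submonoid.unitSphere] using hu⟩).toMeasurableEquiv w = u * w := rfl
  simp only [e, ker]
  rw [← mul_add, norm_mul, norm_mul, hu, one_mul, one_mul]

lemma abs_interact_le_of_angular (hΦ : IsProfile A δ t Φ φ)
    (hY : IsCutoff B ε θ Y) {r M : ℝ} (hM : 0 ≤ M) (ht : t ∈ Set.Icc (1 : ℝ) 2)
    (hδ : 0 < δ) (hδ' : δ ≤ 1 / 16)
    (H : ∀ a ∈ Set.Icc (7 / 8 : ℝ) 3, |a - t| ≤ δ → |∫ α in -Real.pi..Real.pi,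
      cutoffProd Y a r α * (‖circ a r α‖⁻¹ * φ' ‖circ a r α‖)| ≤ M) :
    |interact φ φ' Y r| ≤ 2 * A * M := by
  have hpi := Real.pi_pos
  have hA := hΦ.nonneg
  rw [interact, ← Complex.integral_comp_polarCoord_symm, polarCoord_target]
  have hcongr : ∫ p in Set.Ioi (0 : ℝ) ×ˢ Set.Ioo (-Real.pi) Real.pi,
      p.1 • (ker φ Y (Complex.polarCoord.symm p) * ker φ' Y (Complex.polarCoord.symm p + r)) =
      ∫ p in Set.Ioi (0 : ℝ) ×ˢ Set.Ioo (-Real.pi) Real.pi,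
        φ p.1 * (cutoffProd Y p.1 r p.2 * (‖circ p.1 r p.2‖⁻¹ * φ' ‖circ p.1 r p.2‖)) := by
    refine setIntegral_congr_fun (measurableSet_Ioi.prod measurableSet_Ioo) ?_
    rintro ⟨a, α⟩ ⟨ha, -⟩
    have ha : 0 < a := ha
    have e1 : Complex.polarCoord.symm (a, α) = a * circ 1 0 α := by
      rw [Complex.polarCoord_symm_apply, circ, Complex.exp_mul_I]
      push_cast
      ring
    have e2 : (a : ℂ) * circ 1 0 α + r = circ a r α := by
      simp only [circ]; push_cast; ring
    have e3 : ‖(a : ℂ) * circ 1 0 α‖ = a := by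
      rw [norm_mul, norm_circ_one, Complex.norm_real, Real.norm_eq_abs, abs_of_pos ha, mul_one]
    simp only [smul_eq_mul]
    rw [e1, ker, ker, e2, e3, hY.homog a _ ha, cutoffProd]
    field_simp
  rw [hcongr]
  by_cases hintg : IntegrableOn (fun p : ℝ × ℝ =>
      φ p.1 * (cutoffProd Y p.1 r p.2 * (‖circ p.1 r p.2‖⁻¹ * φ' ‖circ p.1 r p.2‖)))
      (Set.Ioi (0 : ℝ) ×ˢ Set.Ioo (-Real.pi) Real.pi)
  swap
  · rw [integral_undef hintg, abs_zero]; positivity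
  rw [Measure.volume_eq_prod] at hintg ⊢
  rw [setIntegral_prod _ hintg]
  refine (abs_setIntegral_le measurableSet_Ioi (S := Set.Icc (t - δ) (t + δ)) (M := A / δ * M)
    (V := 2 * δ) ?_ ?_ (by positivity) (by positivity) ?_).trans (le_of_eq ?_)
  · intro a _ ha'
    have : φ a = 0 := hΦ.deriv_eq_zero _ (not_le.1 fun h => ha' (by
      rw [abs_le] at h; constructor <;> linarith))
    simp [this]
  · intro a ha
    dsimp only
    rw [integral_const_mul, abs_mul]
    by_cases h : |a - t| ≤ δ
    · refine mul_le_mul (hΦ.deriv_bound a) ?_ (abs_nonneg _) (by positivity)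
      have h' := abs_le.1 h
      have := H a ⟨by linarith [ht.1], by linarith [ht.2]⟩ h
      rwa [intervalIntegral.integral_of_le (by linarith), integral_Ioc_eq_integral_Ioo] at this
    · rw [hΦ.deriv_eq_zero _ (not_le.1 h), abs_zero, zero_mul]; positivity
  · refine (measure_mono Set.inter_subset_right).trans ?_
    rw [Real.volume_Icc]
    apply ENNReal.ofReal_le_ofReal; linarith
  · field_simp

/-- The signed length of `z` in the direction `θ`. -/
noncomputable def sgnNorm (θ z : ℂ) : ℝ := if 0 ≤ (star θ * z).re then ‖z‖ else -‖z‖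

/-- `z` is nearly parallel to `θ`. -/
def IsDir (ε : ℝ) (θ z : ℂ) : Prop := ‖z - sgnNorm θ z * θ‖ ≤ 4 * ε * ‖z‖

lemma sgnNorm_rotate {u : ℂ} (hu : ‖u‖ = 1) (θ : ℂ) (z : ℂ) :
    sgnNorm (star u * θ) z = sgnNorm θ (u * z) := by
  simp only [sgnNorm, norm_mul, hu, one_mul, star_mul, star_star]
  rw [mul_assoc]

lemma isDir_rotate {u : ℂ} (hu : ‖u‖ = 1) (θ : ℂ) (z : ℂ) :
    IsDir ε (star u * θ) z ↔ IsDir ε θ (u * z) := by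
  have h1 : u * star u = 1 := by
    rw [Complex.star_def, Complex.mul_conj, Complex.normSq_eq_norm_sq, hu]; simp
  have : u * z - sgnNorm θ (u * z) * θ = u * (z - sgnNorm θ (u * z) * (star u * θ)) := by
    linear_combination (sgnNorm θ (u * z) : ℂ) * θ * h1
  rw [IsDir, IsDir, sgnNorm_rotate hu, this, norm_mul, norm_mul, hu, one_mul, one_mul]

lemma exists_eq_mul_norm (z : ℂ) : ∃ u : ℂ, ‖u‖ = 1 ∧ z = u * ‖z‖ := by
  by_cases h : z = 0
  · exact ⟨1, by simp, by simp [h]⟩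
  · have : ‖z‖ ≠ 0 := norm_ne_zero_iff.2 h
    have h2 : (‖z‖ : ℂ) ≠ 0 := by exact_mod_cast this
    refine ⟨z / ‖z‖, by simp [h], by field_simp⟩

lemma abs_interact_le_inv (hΦ : IsProfile A δ t Φ φ) (hΦ' : IsProfile A δ t' Φ' φ')
    (hY : IsCutoff B ε θ Y) (ht : t ∈ Set.Icc (1 : ℝ) 2) (ht' : t' ∈ Set.Icc (1 : ℝ) 2)
    (hδ : 0 < δ) (hδ' : δ ≤ 1 / 16) (z : ℂ) :
    |interact φ φ' Y z| ≤ 32 * A ^ 2 * δ⁻¹ := by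
  have hA := hΦ.nonneg
  obtain ⟨u, hu, hz⟩ := exists_eq_mul_norm z
  rw [hz, interact_rotate hu]
  refine (abs_interact_le_of_angular hΦ (hY.rotate hu) (M := 16 * A * δ⁻¹) (by positivity) ht hδ hδ'
    fun a _ _ => abs_angular_integral_le_inv hΦ' (hY.rotate hu) ht' hδ hδ').trans (le_of_eq ?_)
  ring

lemma abs_interact_le_sqrt (hΦ : IsProfile A δ t Φ φ) (hΦ' : IsProfile A δ t' Φ' φ')
    (hY : IsCutoff B ε θ Y) (ht : t ∈ Set.Icc (1 : ℝ) 2) (ht' : t' ∈ Set.Icc (1 : ℝ) 2)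
    (hδ : 0 < δ) (hδ' : δ ≤ 1 / 16) {z : ℂ} (hz0 : z ≠ 0) :
    |interact φ φ' Y z| ≤ 72 * A ^ 2 * (√(δ * ‖z‖))⁻¹ := by
  have hA := hΦ.nonneg
  obtain ⟨u, hu, hz⟩ := exists_eq_mul_norm z
  have hr : 0 < ‖z‖ := norm_pos_iff.2 hz0
  nth_rewrite 1 [hz]
  rw [interact_rotate hu]
  refine (abs_interact_le_of_angular hΦ (hY.rotate hu) (M := 36 * A * (√(δ * ‖z‖))⁻¹)
    (by positivity) ht hδ hδ'
    fun a ha _ => abs_angular_integral_le_sqrt hΦ' (hY.rotate hu) ha hr ht' hδ hδ').trans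
    (le_of_eq ?_)
  ring

lemma interact_eq_zero (hΦ : IsProfile A δ t Φ φ) (hΦ' : IsProfile A δ t' Φ' φ')
    (ht : t ∈ Set.Icc (1 : ℝ) 2) (ht' : t' ∈ Set.Icc (1 : ℝ) 2)
    (hδ' : δ ≤ 1 / 16) {z : ℂ} (hz : 8 < ‖z‖) : interact φ φ' Y z = 0 := by
  rw [interact]
  refine integral_eq_zero_of_ae (ae_of_all _ fun w => ?_)
  by_cases h : ‖w‖ ≤ 3
  · have h2 : ‖z‖ ≤ ‖w + z‖ + ‖w‖ := by
      calc ‖z‖ = ‖(w + z) - w‖ := by ring_nf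
        _ ≤ _ := norm_sub_le _ _
    have : φ' ‖w + z‖ = 0 := hΦ'.deriv_eq_zero _ (by rw [lt_abs]; left; linarith [ht'.2])
    simp [ker, this]
  · have : φ ‖w‖ = 0 := hΦ.deriv_eq_zero _ (by rw [lt_abs]; left; linarith [ht.2])
    simp [ker, this]

lemma exists_sign_sgnNorm (θ : ℂ) {r : ℝ} (hr : 0 < r) :
    ∃ σ : ℝ, (σ = 1 ∨ σ = -1) ∧ 0 ≤ σ * θ.re ∧ sgnNorm θ r = σ * r := by
  have hre : (star θ * (r : ℂ)).re = θ.re * r := by simp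
  rw [sgnNorm, hre, Complex.norm_real, Real.norm_eq_abs, abs_of_pos hr]
  split_ifs with h
  · exact ⟨1, Or.inl rfl, by nlinarith, by ring⟩
  · exact ⟨-1, Or.inr rfl, by nlinarith, by ring⟩

lemma norm_sub_sign (θ : ℂ) {r σ : ℝ} (hr : 0 < r) (hσ : σ = 1 ∨ σ = -1) :
    ‖(r : ℂ) - (σ * r : ℝ) * θ‖ = r * ‖θ - σ‖ := by
  have hσ2 : (σ : ℂ) * σ = 1 := by rcases hσ with h | h <;> simp [h]
  have hσn : ‖(σ : ℂ)‖ = 1 := by rcases hσ with h | h <;> simp [h]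
  have : (r : ℂ) - (σ * r : ℝ) * θ = -(r * (σ * (θ - σ))) := by
    push_cast; linear_combination (-r : ℂ) * hσ2
  rw [this, norm_neg, norm_mul, norm_mul, hσn, one_mul, Complex.norm_real, Real.norm_eq_abs,
    abs_of_pos hr]

lemma norm_circ_sub_sign_sq (α : ℝ) {σ : ℝ} (hσ : σ = 1 ∨ σ = -1) :
    ‖circ 1 0 α - σ‖ ^ 2 = 2 - 2 * (σ * Real.cos α) := by
  have hσ2 : σ * σ = 1 := by rcases hσ with h | h <;> simp [h]
  rw [Complex.sq_norm, Complex.normSq_apply]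
  simp only [Complex.sub_re, Complex.sub_im, circ_re, circ_im, Complex.ofReal_re, Complex.ofReal_im]
  linear_combination Real.cos_sq_add_sin_sq α + hσ2

lemma sin_ge_of_not_isDir (hY : IsCutoff B ε θ Y) (hε : 0 < ε) (hε' : ε ≤ 1 / 20) {r : ℝ}
    (hr : 0 < r) (hd : ¬ IsDir ε θ r) {α : ℝ} (h : Y (circ 1 0 α) ≠ 0) :
    2 * ε ≤ |Real.sin α| := by
  by_contra hlt
  push Not at hlt
  have h1 : ‖circ 1 0 α - θ‖ ≤ ε := by
    by_contra h'
    refine h (hY.eq_zero _ ?_)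
    rw [norm_circ_one]
    simpa using not_le.1 h'
  obtain ⟨σ, hσ, hσc⟩ : ∃ σ : ℝ, (σ = 1 ∨ σ = -1) ∧ σ * Real.cos α = |Real.cos α| := by
    rcases le_total 0 (Real.cos α) with h | h
    · exact ⟨1, Or.inl rfl, by rw [abs_of_nonneg h, one_mul]⟩
    · exact ⟨-1, Or.inr rfl, by rw [abs_of_nonpos h]; ring⟩
  have h2 : ‖circ 1 0 α - σ‖ ≤ 3 * ε := by
    apply abs_le_of_sq_le_sq' _ (by positivity) |>.2
    rw [norm_circ_sub_sign_sq α hσ, hσc]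
    have e1 : |Real.cos α| ≤ 1 := Real.abs_cos_le_one α
    have e2 : |Real.cos α| ^ 2 + |Real.sin α| ^ 2 = 1 := by
      rw [sq_abs, sq_abs]; exact Real.cos_sq_add_sin_sq α
    have e3 : 0 ≤ |Real.cos α| := abs_nonneg _
    have e4 : 0 ≤ |Real.sin α| := abs_nonneg _
    nlinarith
  have h3 : ‖θ - σ‖ ≤ 4 * ε := by
    calc ‖θ - σ‖ = ‖(circ 1 0 α - σ) - (circ 1 0 α - θ)‖ := by ring_nf
      _ ≤ _ := norm_sub_le _ _
      _ ≤ _ := by linarith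
  have h4 : 0 < σ * θ.re := by
    have h5 : |(θ - σ).re| ≤ 4 * ε := (Complex.abs_re_le_norm _).trans h3
    rw [Complex.sub_re, Complex.ofReal_re, abs_le] at h5
    rcases hσ with h | h <;> subst h <;> linarith
  obtain ⟨σ', hσ', h5, h6⟩ := exists_sign_sgnNorm θ hr
  have : σ' = σ := by
    rcases hσ with h | h <;> rcases hσ' with h' | h' <;> subst h <;> subst h' <;> first | rfl | linarith
  subst this
  apply hd
  rw [IsDir, h6, norm_sub_sign θ hr hσ, Complex.norm_real, Real.norm_eq_abs, abs_of_pos hr]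
  nlinarith

lemma sin_sq_ge_of_isDir (hY : IsCutoff B ε θ Y) (hε' : ε ≤ 1 / 20) {r a : ℝ}
    (hr : 0 < r) (hd : IsDir ε θ r) (ha : a ∈ Set.Icc (7 / 8 : ℝ) 3) (hat : |a - t| ≤ δ)
    (hΔ : 8 * δ ≤ |t - t' + sgnNorm θ r|) {α : ℝ} (ht' : t' ∈ Set.Icc (1 : ℝ) 2)
    (hδ' : δ ≤ 1 / 16) (hb : |‖circ a r α‖ - t'| ≤ δ)
    (h : Y (circ 1 0 α) ≠ 0) (h' : Y (circ a r α) ≠ 0) :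
    |t - t' + sgnNorm θ r| / (10 * r) ≤ Real.sin α ^ 2 := by
  obtain ⟨σ, hσ, h5, h6⟩ := exists_sign_sgnNorm θ hr
  rw [IsDir, h6, norm_sub_sign θ hr hσ, Complex.norm_real, Real.norm_eq_abs, abs_of_pos hr] at hd
  rw [h6] at hΔ ⊢
  have hθ : ‖θ - σ‖ ≤ 1 / 5 := by
    have : ‖θ - σ‖ ≤ 4 * ε := by
      by_contra hc
      nlinarith
    linarith
  have hcone : ∀ w, Y w ≠ 0 → 3 / 4 * ‖w‖ ≤ σ * w.re := by
    intro w hw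
    have h1 : ‖w - ‖w‖ * θ‖ ≤ ε * ‖w‖ := not_lt.1 fun hc => hw (hY.eq_zero _ hc)
    have h2 : ‖w - ‖w‖ * (σ : ℂ)‖ ≤ 1 / 4 * ‖w‖ := by
      calc ‖w - ‖w‖ * (σ : ℂ)‖ = ‖(w - ‖w‖ * θ) + ‖w‖ * (θ - σ)‖ := by ring_nf
        _ ≤ ‖w - ‖w‖ * θ‖ + ‖w‖ * ‖θ - σ‖ := by
          refine (norm_add_le _ _).trans ?_
          rw [norm_mul, Complex.norm_real, norm_norm]
        _ ≤ _ := by nlinarith [norm_nonneg w]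
    have h3 := (Complex.abs_re_le_norm _).trans h2
    rw [abs_le] at h3
    simp only [Complex.sub_re, Complex.mul_re, Complex.ofReal_re, Complex.ofReal_im, mul_zero,
      sub_zero] at h3
    rcases hσ with h | h <;> subst h <;> linarith
  have hc1 := hcone _ h
  have hc2 := hcone _ h'
  rw [norm_circ_one, circ_re] at hc1
  rw [circ_re] at hc2
  have hb78 := half_le_of_abs_sub_le ht' hδ' hb
  have hsq := norm_circ_sq a r α
  set b := ‖circ a r α‖
  set c := Real.cos α
  have hc : |c| ≤ 1 := Real.abs_cos_le_one α
  rw [abs_le] at hc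
  have hsin : Real.sin α ^ 2 = 1 - c ^ 2 := Real.sin_sq α
  have hpos : 0 ≤ a + σ * r := by
    rcases hσ with h | h
    · subst h; linarith [ha.1]
    · subst h; nlinarith [ha.1]
  have hdiff : |b - (a + σ * r)| ≤ 7 * r * Real.sin α ^ 2 := by
    have ha1 := ha.1
    have ha3 := ha.2
    have har : 0 < a * r := by nlinarith
    have hs0 : 0 ≤ Real.sin α ^ 2 := sq_nonneg _
    have e : |b - (a + σ * r)| * (b + (a + σ * r)) ≤ 2 * (a * r) * Real.sin α ^ 2 := by
      rw [← abs_of_nonneg (a := b + (a + σ * r)) (by linarith), ← abs_mul]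
      have : (b - (a + σ * r)) * (b + (a + σ * r)) = 2 * (a * r) * (c - σ) := by
        rcases hσ with h | h <;> subst h <;> linear_combination hsq
      rw [this, abs_mul, abs_of_pos (a := 2 * (a * r)) (by linarith)]
      refine mul_le_mul_of_nonneg_left ?_ (by linarith)
      rw [hsin, abs_le]
      rcases hσ with h | h <;> subst h <;> constructor <;> nlinarith
    have e2 : |b - (a + σ * r)| * (7 / 8) ≤ |b - (a + σ * r)| * (b + (a + σ * r)) :=
      mul_le_mul_of_nonneg_left (by linarith) (abs_nonneg _)
    have e3 : (a * r) * Real.sin α ^ 2 ≤ 3 * r * Real.sin α ^ 2 := by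
      gcongr
    nlinarith
  have hΔ2 : |t - t' + σ * r| ≤ 2 * δ + 7 * r * Real.sin α ^ 2 := by
    have : t - t' + σ * r = -(a - t) + -(b - (a + σ * r)) + (b - t') := by ring
    rw [this]
    refine (abs_add_le _ _).trans ?_
    have := abs_add_le (-(a - t)) (-(b - (a + σ * r)))
    rw [abs_neg, abs_neg] at this
    linarith
  have : 0 ≤ r * Real.sin α ^ 2 := by positivity
  rw [div_le_iff₀ (by positivity)]
  linarith

/-- The decay profile of the correlation off the tangency locus. -/
noncomputable def wt (u : ℝ) : ℝ := (√((1 + |u|) ^ 3))⁻¹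

lemma wt_pos (u : ℝ) : 0 < wt u := by unfold wt; positivity

lemma wt_le_one (u : ℝ) : wt u ≤ 1 := by
  unfold wt
  apply inv_le_one_of_one_le₀
  rw [Real.one_le_sqrt]
  apply one_le_pow₀
  linarith [abs_nonneg u]

lemma abs_interact_le_of_not_isDir (hΦ : IsProfile A δ t Φ φ) (hΦ' : IsProfile A δ t' Φ' φ')
    (hY : IsCutoff B ε θ Y) (ht : t ∈ Set.Icc (1 : ℝ) 2) (ht' : t' ∈ Set.Icc (1 : ℝ) 2)
    (hδ : 0 < δ) (hδ' : δ ≤ 1 / 16) (hε : 0 < ε) (hε' : ε ≤ 1 / 20) (hB : 1 ≤ B) {z : ℂ}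
    (hz0 : z ≠ 0) (hd : ¬ IsDir ε θ z) :
    |interact φ φ' Y z| ≤ 20 * A ^ 2 * B * ε⁻¹ ^ 4 * (δ / ‖z‖ ^ 2) := by
  have hA := hΦ.nonneg
  obtain ⟨u, hu, hz⟩ := exists_eq_mul_norm z
  have hr : 0 < ‖z‖ := norm_pos_iff.2 hz0
  rw [hz, ← isDir_rotate hu] at hd
  have hBε : 1 ≤ B / ε := by rw [le_div_iff₀ hε]; linarith
  nth_rewrite 1 [hz]
  rw [interact_rotate hu]
  refine (abs_interact_le_of_angular hΦ (hY.rotate hu)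
    (M := 80 * A * (B / ε) * (δ / (‖z‖ ^ 2 * (2 * ε) ^ 3))) (by positivity) ht hδ hδ'
    fun a ha _ => abs_angular_integral_le hΦ' (hY.rotate hu) ha hr ht' hδ hδ' (by positivity) hε hBε
      fun α _ h1 _ => sin_ge_of_not_isDir (hY.rotate hu) hε hε' hr hd h1).trans (le_of_eq ?_)
  field_simp
  ring

lemma abs_interact_le_of_isDir (hΦ : IsProfile A δ t Φ φ) (hΦ' : IsProfile A δ t' Φ' φ')
    (hY : IsCutoff B ε θ Y) (ht : t ∈ Set.Icc (1 : ℝ) 2) (ht' : t' ∈ Set.Icc (1 : ℝ) 2)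
    (hδ : 0 < δ) (hδ' : δ ≤ 1 / 16) (hε : 0 < ε) (hε' : ε ≤ 1 / 20) (hB : 1 ≤ B) {z : ℂ}
    (hz0 : z ≠ 0) (hd : IsDir ε θ z) :
    |interact φ φ' Y z| ≤ 7200 * A ^ 2 * B * ε⁻¹ * (√(δ * ‖z‖))⁻¹ *
      wt ((t - t' + sgnNorm θ z) / δ) := by
  have hA := hΦ.nonneg
  have hr : 0 < ‖z‖ := norm_pos_iff.2 hz0
  set Δ := |t - t' + sgnNorm θ z| with hΔdef
  have hΔ0 : 0 ≤ Δ := abs_nonneg _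
  have habs : |(t - t' + sgnNorm θ z) / δ| = Δ / δ := by rw [abs_div, abs_of_pos hδ]
  have hBε : 1 ≤ B * ε⁻¹ := by rw [← div_eq_mul_inv, le_div_iff₀ hε]; linarith
  rw [wt, habs]
  rcases lt_or_ge Δ (8 * δ) with hlt | hge
  · refine (abs_interact_le_sqrt hΦ hΦ' hY ht ht' hδ hδ' hz0).trans ?_
    have h1 : (27 : ℝ)⁻¹ ≤ (√((1 + Δ / δ) ^ 3))⁻¹ := by
      apply inv_anti₀ (by positivity)
      rw [show (27 : ℝ) = √(9 ^ 3) by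
        rw [show (9 : ℝ) ^ 3 = 27 ^ 2 by norm_num, Real.sqrt_sq (by norm_num)]]
      apply Real.sqrt_le_sqrt
      have : Δ / δ ≤ 8 := by rw [div_le_iff₀ hδ]; linarith
      gcongr
      linarith
    calc 72 * A ^ 2 * (√(δ * ‖z‖))⁻¹ ≤ 7200 * A ^ 2 * 1 * (√(δ * ‖z‖))⁻¹ * 27⁻¹ := by
          have : 0 ≤ A ^ 2 * (√(δ * ‖z‖))⁻¹ := by positivity
          linarith
      _ ≤ 7200 * A ^ 2 * (B * ε⁻¹) * (√(δ * ‖z‖))⁻¹ * (√((1 + Δ / δ) ^ 3))⁻¹ := by gcongr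
      _ = _ := by ring
  · obtain ⟨u, hu, hz⟩ := exists_eq_mul_norm z
    have hd' := hd
    rw [hz, ← isDir_rotate hu] at hd'
    have hsg : sgnNorm θ z = sgnNorm (star u * θ) ‖z‖ := by rw [sgnNorm_rotate hu, ← hz]
    have hΔpos : 0 < Δ := by linarith
    have hge' := hge
    rw [hΔdef, hsg] at hge'
    nth_rewrite 1 [hz]
    rw [interact_rotate hu]
    set s := √(Δ / (10 * ‖z‖)) with hs
    have hspos : 0 < s := by positivity
    refine (abs_interact_le_of_angular hΦ (hY.rotate hu)
      (M := 80 * A * (B / ε) * (δ / (‖z‖ ^ 2 * s ^ 3))) (by positivity) ht hδ hδ'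
      fun a ha hat => abs_angular_integral_le hΦ' (hY.rotate hu) ha hr ht' hδ hδ' hspos hε
      (by rwa [div_eq_mul_inv])
      fun α hb h1 h2 => ?_).trans ?_
    · have := sin_sq_ge_of_isDir (hY.rotate hu) hε' hr hd' ha hat hge' ht' hδ' hb h1 h2
      rw [← Real.sqrt_sq_eq_abs]
      apply Real.sqrt_le_sqrt
      rwa [hΔdef, hsg]
    · have key : δ / (‖z‖ ^ 2 * s ^ 3) ≤ 45 * (√(δ * ‖z‖))⁻¹ * (√((1 + Δ / δ) ^ 3))⁻¹ := by
        apply abs_le_of_sq_le_sq' _ (by positivity) |>.2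
        have e1 : s ^ 6 = (Δ / (10 * ‖z‖)) ^ 3 := by
          rw [hs, show 6 = 2 * 3 by norm_num, pow_mul, Real.sq_sqrt (by positivity)]
        have e2 : (δ / (‖z‖ ^ 2 * s ^ 3)) ^ 2 = 1000 * δ ^ 2 / (‖z‖ * Δ ^ 3) := by
          rw [div_pow, mul_pow, ← pow_mul s, e1]
          field_simp
          norm_num
        have e3 : (45 * (√(δ * ‖z‖))⁻¹ * (√((1 + Δ / δ) ^ 3))⁻¹) ^ 2 =
            2025 * δ ^ 2 / (‖z‖ * (δ + Δ) ^ 3) := by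
          rw [mul_pow, mul_pow, inv_pow, inv_pow, Real.sq_sqrt (by positivity),
            Real.sq_sqrt (by positivity)]
          field_simp
          norm_num
        rw [e2, e3, div_le_div_iff₀ (by positivity) (by positivity)]
        have e4 : (δ + Δ) ^ 3 ≤ (9 / 8 * Δ) ^ 3 := by gcongr; linarith
        have e5 : 0 ≤ δ ^ 2 * ‖z‖ := by positivity
        have e6 : 1000 * (δ + Δ) ^ 3 ≤ 2025 * Δ ^ 3 := by
          have : 0 ≤ Δ ^ 3 := by positivity
          nlinarith
        nlinarith
      calc 2 * A * (80 * A * (B / ε) * (δ / (‖z‖ ^ 2 * s ^ 3)))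
          ≤ 2 * A * (80 * A * (B / ε) *
            (45 * (√(δ * ‖z‖))⁻¹ * (√((1 + Δ / δ) ^ 3))⁻¹)) := by gcongr
        _ = _ := by rw [div_eq_mul_inv]; ring

end Interact

section Duality

lemma lintegral_mul_sq_le {Y : Type*} [MeasurableSpace Y] {ν : Measure Y} {f h : Y → ℝ≥0∞}
    (hf : AEMeasurable f ν) (hh : AEMeasurable h ν) :
    (∫⁻ y, f y * h y ∂ν) ^ 2 ≤ (∫⁻ y, f y ^ 2 ∂ν) * ∫⁻ y, h y ^ 2 ∂ν := by
  have := ENNReal.lintegral_mul_le_Lp_mul_Lq ν Real.HolderConjugate.two_two hf hh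
  have h2 := pow_le_pow_left' this 2
  simp only [Pi.mul_apply, ENNReal.rpow_two] at h2
  refine h2.trans (le_of_eq ?_)
  rw [mul_pow, ← ENNReal.rpow_natCast, ← ENNReal.rpow_natCast, ← ENNReal.rpow_mul,
    ← ENNReal.rpow_mul]
  norm_num

variable {X Y : Type*} [MeasurableSpace X] [MeasurableSpace Y] {μ : Measure X} {ν : Measure Y}
  [IsFiniteMeasure μ] [SFinite ν]

/-- The linearized `T T*` bound: if `|∫ K(x,y) f(y) dy| ≥ l` on a set then its measure is controlled
by the average of the correlation kernel. -/
lemma sq_measure_le_of_correlation {K : X → Y → ℝ} (hK : Measurable (Function.uncurry K)) {M : ℝ}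
    (hM : ∀ x y, |K x y| ≤ M) (hKi : Integrable (Function.uncurry K) (μ.prod ν)) {f : Y → ℝ}
    (hf : Measurable f) (hfi : Integrable f ν) {l : ℝ≥0∞}
    (hl : ∀ᵐ x ∂μ, l ≤ ‖∫ y, K x y * f y ∂ν‖ₑ) :
    (l * μ Set.univ) ^ 2 ≤ (∫⁻ y, ‖f y‖ₑ ^ 2 ∂ν) *
      ∫⁻ x, ∫⁻ x', ‖∫ y, K x y * K x' y ∂ν‖ₑ ∂μ ∂μ := by
  rcases isEmpty_or_nonempty X with hX | ⟨⟨x0⟩⟩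
  · have : μ Set.univ = 0 := by rw [Set.univ_eq_empty_iff.2 hX, measure_empty]
    rw [this, mul_zero, zero_pow two_ne_zero]; exact zero_le
  rcases isEmpty_or_nonempty Y with hY | ⟨⟨y0⟩⟩
  · have h0 : ∀ᵐ x ∂μ, l = 0 := by
      filter_upwards [hl] with x hx
      rw [integral_of_isEmpty, enorm_zero] at hx
      exact le_zero_iff.1 hx
    by_cases hμ : μ Set.univ = 0
    · rw [hμ, mul_zero, zero_pow two_ne_zero]; exact zero_le
    · have : l = 0 := by
        by_contra hl0
        apply hμ
        rw [ae_iff] at h0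
        simpa [hl0] using h0
      rw [this, zero_mul, zero_pow two_ne_zero]; exact zero_le
  have hM0 : 0 ≤ M := (abs_nonneg _).trans (hM x0 y0)
  have hKf : Measurable (Function.uncurry fun x y => K x y * f y) :=
    hK.mul (hf.comp measurable_snd)
  set T : X → ℝ := fun x => ∫ y, K x y * f y ∂ν with hT
  have hTm : Measurable T := (hKf.stronglyMeasurable.integral_prod_right).measurable
  set g : X → ℝ := fun x => if 0 ≤ T x then 1 else -1 with hg
  have hgm : Measurable g := Measurable.ite (measurableSet_le measurable_const hTm)
    measurable_const measurable_const
  have hg1 : ∀ x, |g x| = 1 := by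
    intro x; simp only [hg]; split_ifs <;> simp
  have hgT : ∀ x, g x * T x = |T x| := by
    intro x; simp only [hg]; split_ifs with h
    · rw [abs_of_nonneg h, one_mul]
    · rw [abs_of_neg (not_le.1 h)]; ring
  set h : Y → ℝ := fun y => ∫ x, g x * K x y ∂μ with hh
  have hgK : Measurable (Function.uncurry fun x y => g x * K x y) :=
    (hgm.comp measurable_fst).mul hK
  have hhm : Measurable h := (hgK.stronglyMeasurable.integral_prod_left).measurable
  have hhb : ∀ y, |h y| ≤ M * μ.real Set.univ := by
    intro y
    rw [← Real.norm_eq_abs]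
    refine norm_integral_le_of_norm_le_const (ae_of_all _ fun x => ?_)
    rw [Real.norm_eq_abs, abs_mul, hg1, one_mul]; exact hM x y
  -- lower bound
  have hTi : Integrable T μ := by
    refine Integrable.of_bound hTm.aestronglyMeasurable (M * ∫ y, ‖f y‖ ∂ν) (ae_of_all _ fun x => ?_)
    refine (norm_integral_le_integral_norm _).trans ?_
    rw [← integral_const_mul]
    refine integral_mono_of_nonneg (ae_of_all _ fun y => norm_nonneg _) (hfi.norm.const_mul _)
      (ae_of_all _ fun y => ?_)
    simp only [norm_mul]
    exact mul_le_mul_of_nonneg_right (hM x y) (norm_nonneg _)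
  have hfub1 : ∫ x, g x * T x ∂μ = ∫ y, h y * f y ∂ν := by
    have e1 : ∀ x, g x * T x = ∫ y, g x * (K x y * f y) ∂ν := fun x => by
      rw [integral_const_mul]
    have e2 : ∀ y, h y * f y = ∫ x, g x * (K x y * f y) ∂μ := fun y => by
      simp only [hh]
      rw [← integral_mul_const]
      congr 1; funext x; ring
    simp_rw [e1, e2]
    refine integral_integral_swap ?_
    have hmaj : Integrable (fun p : X × Y => M * ‖f p.2‖) (μ.prod ν) :=
      (hfi.comp_snd μ).norm.const_mul M
    refine hmaj.mono' ((hgm.comp measurable_fst).mul hKf).aestronglyMeasurable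
      (ae_of_all _ fun p => ?_)
    simp only [Function.uncurry, norm_mul, Real.norm_eq_abs, hg1, one_mul]
    exact mul_le_mul_of_nonneg_right (hM _ _) (abs_nonneg _)
  have hlow : l * μ Set.univ ≤ ∫⁻ y, ‖f y‖ₑ * ‖h y‖ₑ ∂ν := by
    calc l * μ Set.univ = ∫⁻ _, l ∂μ := by rw [lintegral_const]
      _ ≤ ∫⁻ x, ‖T x‖ₑ ∂μ := lintegral_mono_ae hl
      _ = ENNReal.ofReal (∫ x, ‖T x‖ ∂μ) := (ofReal_integral_norm_eq_lintegral_enorm hTi).symm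
      _ = ENNReal.ofReal (∫ y, h y * f y ∂ν) := by
          rw [← hfub1]; simp_rw [hgT, Real.norm_eq_abs]
      _ ≤ ‖∫ y, h y * f y ∂ν‖ₑ := Real.ofReal_le_enorm _
      _ ≤ ∫⁻ y, ‖h y * f y‖ₑ ∂ν := enorm_integral_le_lintegral_enorm _
      _ = _ := by simp_rw [enorm_mul, mul_comm]
  -- the square function of the adjoint
  have hhi : Integrable h ν := by
    have : Integrable (Function.uncurry fun x y => g x * K x y) (μ.prod ν) := by
      refine hKi.norm.mono' hgK.aestronglyMeasurable (ae_of_all _ fun p => ?_)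
      simp only [Function.uncurry, norm_mul, Real.norm_eq_abs, hg1, one_mul, le_refl]
    exact this.integral_prod_right
  have hup : ∫⁻ y, ‖h y‖ₑ ^ 2 ∂ν ≤ ∫⁻ x, ∫⁻ x', ‖∫ y, K x y * K x' y ∂ν‖ₑ ∂μ ∂μ := by
    have hsq : Integrable (fun y => h y * h y) ν :=
      hhi.bdd_mul hhm.aestronglyMeasurable (ae_of_all _ fun y => hhb y)
    have e0 : ∫⁻ y, ‖h y‖ₑ ^ 2 ∂ν = ‖∫ y, h y * h y ∂ν‖ₑ := by
      rw [Real.enorm_of_nonneg (integral_nonneg fun y => mul_self_nonneg _),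
        ofReal_integral_eq_lintegral_ofReal hsq (ae_of_all _ fun y => mul_self_nonneg _)]
      refine lintegral_congr fun y => ?_
      rw [← Real.enorm_of_nonneg (mul_self_nonneg _), enorm_mul, sq]
    have e1 : ∫ y, h y * h y ∂ν = ∫ x, g x * ∫ y, K x y * h y ∂ν ∂μ := by
      have a1 : ∀ x, g x * ∫ y, K x y * h y ∂ν = ∫ y, g x * (K x y * h y) ∂ν := fun x => by
        rw [integral_const_mul]
      have a2 : ∀ y, h y * h y = ∫ x, g x * (K x y * h y) ∂μ := fun y => by
        nth_rewrite 1 [hh]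
        rw [← integral_mul_const]
        congr 1; funext x; ring
      simp_rw [a1, a2]
      refine (integral_integral_swap ?_).symm
      refine (hKi.norm.const_mul (M * μ.real Set.univ)).mono'
        ((hgm.comp measurable_fst).mul (hK.mul (hhm.comp measurable_snd))).aestronglyMeasurable
        (ae_of_all _ fun p => ?_)
      simp only [Function.uncurry, norm_mul, Real.norm_eq_abs, hg1, one_mul]
      rw [mul_comm]
      exact mul_le_mul_of_nonneg_right (hhb _) (abs_nonneg _)
    have e2 : ∀ x, ∫ y, K x y * h y ∂ν = ∫ x', g x' * ∫ y, K x y * K x' y ∂ν ∂μ := by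
      intro x
      have a1 : ∀ x', g x' * ∫ y, K x y * K x' y ∂ν = ∫ y, K x y * (g x' * K x' y) ∂ν := fun x' => by
        rw [← integral_const_mul]
        congr 1; funext y; ring
      have a2 : ∀ y, K x y * h y = ∫ x', K x y * (g x' * K x' y) ∂μ := fun y => by
        rw [integral_const_mul]
      simp_rw [a1, a2]
      refine (integral_integral_swap ?_).symm
      refine (hKi.norm.const_mul M).mono'
        (((hK.comp measurable_prodMk_left).comp measurable_snd).mul hgK).aestronglyMeasurable
        (ae_of_all _ fun p => ?_)
      simp only [Function.uncurry, norm_mul, Real.norm_eq_abs, hg1, one_mul]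
      exact mul_le_mul_of_nonneg_right (hM _ _) (abs_nonneg _)
    rw [e0, e1]
    refine (enorm_integral_le_lintegral_enorm _).trans (lintegral_mono fun x => ?_)
    have hge : ∀ x, ‖g x‖ₑ = 1 := fun x => by
      rw [← enorm_norm, Real.norm_eq_abs, hg1, enorm_one]
    rw [enorm_mul, e2, hge, one_mul]
    refine (enorm_integral_le_lintegral_enorm _).trans (lintegral_mono fun x' => ?_)
    rw [enorm_mul, hge, one_mul]
  calc (l * μ Set.univ) ^ 2 ≤ (∫⁻ y, ‖f y‖ₑ * ‖h y‖ₑ ∂ν) ^ 2 := pow_le_pow_left' hlow 2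
    _ ≤ (∫⁻ y, ‖f y‖ₑ ^ 2 ∂ν) * ∫⁻ y, ‖h y‖ₑ ^ 2 ∂ν :=
      lintegral_mul_sq_le hf.enorm.aemeasurable hhm.enorm.aemeasurable
    _ ≤ _ := by gcongr

end Duality

lemma integral_scale (g h : ℂ → ℝ) {s : ℝ} (hs : 0 < s) (x : ℂ) :
    ∫ y, g y * ((s ^ 2)⁻¹ * h (s⁻¹ • (y - x))) = ∫ v, g (x + s • v) * h v := by
  have h1 := Measure.integral_comp_smul (volume : Measure ℂ)
    (fun y => g (x + y) * h (s⁻¹ • y)) s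
  rw [Complex.finrank_real_complex, abs_of_pos (by positivity)] at h1
  have h2 : ∀ v : ℂ, s⁻¹ • s • v = v := fun v => inv_smul_smul₀ hs.ne' v
  simp only [h2] at h1
  rw [h1, ← integral_add_left_eq_self (fun y => g y * ((s ^ 2)⁻¹ * h (s⁻¹ • (y - x)))) x,
    smul_eq_mul, ← integral_const_mul]
  congr 1
  funext y
  rw [add_sub_cancel_left]
  ring

lemma lintegral_comp_smul_complex (h : ℂ → ℝ≥0∞) {c : ℝ} (hc : c ≠ 0) :
    ∫⁻ y, h (c • y) = ENNReal.ofReal |(c ^ Module.finrank ℝ ℂ)⁻¹| * ∫⁻ v, h v := by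
  rw [← smul_eq_mul, ← lintegral_smul_measure, ← Measure.map_addHaar_smul volume hc]
  exact (lintegral_map_equiv h
    (Homeomorph.smulOfNeZero c hc : ℂ ≃ₜ ℂ).toMeasurableEquiv).symm

lemma lintegral_scale (h : ℂ → ℝ≥0∞) {s : ℝ} (hs : 0 < s) (x : ℂ) :
    ∫⁻ y, ENNReal.ofReal (s ^ 2)⁻¹ * h (s⁻¹ • (y - x)) = ∫⁻ v, h v := by
  have h1 := lintegral_comp_smul_complex h (c := s⁻¹) (by positivity)
  rw [lintegral_const_mul' _ _ ENNReal.ofReal_ne_top,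
    lintegral_sub_right_eq_self (fun y => h (s⁻¹ • y)), h1, Complex.finrank_real_complex,
    ← mul_assoc, ← ENNReal.ofReal_mul (by positivity), abs_of_pos (by positivity),
    inv_pow, inv_inv, inv_mul_cancel₀ (by positivity), ENNReal.ofReal_one, one_mul]

/-- The kernel `ker` dilated to scale `s`. -/
noncomputable def kerS (s : ℝ) (φ : ℝ → ℝ) (Y : ℂ → ℝ) (w : ℂ) : ℝ := (s ^ 2)⁻¹ * ker φ Y (s⁻¹ • w)

section Kernel

variable {A δ t t' B ε : ℝ} {Φ φ Φ' φ' : ℝ → ℝ} {θ : ℂ} {Y : ℂ → ℝ}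

lemma measurable_ker (hΦ : IsProfile A δ t Φ φ) (hY : Measurable Y) : Measurable (ker φ Y) :=
  (measurable_norm.inv.mul (hΦ.deriv_continuous.measurable.comp measurable_norm)).mul hY

lemma measurable_kerS (hΦ : IsProfile A δ t Φ φ) (hY : Measurable Y) (s : ℝ) :
    Measurable (kerS s φ Y) :=
  ((measurable_ker hΦ hY).comp (measurable_const_smul s⁻¹)).const_mul _

lemma IsProfile.eq_zero_of_norm (hΦ : IsProfile A δ t Φ φ) (ht : t ∈ Set.Icc (1 : ℝ) 2)
    (hδ' : δ ≤ 1 / 16) {a : ℝ} (h : a < 15 / 16 ∨ 3 < a) : φ a = 0 := by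
  apply hΦ.deriv_eq_zero
  rcases h with h | h
  · rw [lt_abs]; right; linarith [ht.1]
  · rw [lt_abs]; left; linarith [ht.2]

lemma ker_eq_zero (hΦ : IsProfile A δ t Φ φ) (ht : t ∈ Set.Icc (1 : ℝ) 2)
    (hδ' : δ ≤ 1 / 16) {w : ℂ} (h : ‖w‖ < 15 / 16 ∨ 3 < ‖w‖) : ker φ Y w = 0 := by
  rw [ker, hΦ.eq_zero_of_norm ht hδ' h]; ring

lemma abs_ker_le (hΦ : IsProfile A δ t Φ φ) (hY : ∀ w, |Y w| ≤ 1) (ht : t ∈ Set.Icc (1 : ℝ) 2)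
    (hδ : 0 < δ) (hδ' : δ ≤ 1 / 16) (w : ℂ) : |ker φ Y w| ≤ 2 * (A / δ) := by
  have hA := hΦ.nonneg
  by_cases h : ‖w‖ < 15 / 16 ∨ 3 < ‖w‖
  · rw [ker_eq_zero hΦ ht hδ' h, abs_zero]; positivity
  · push Not at h
    rw [ker, abs_mul, abs_mul, abs_inv, abs_norm]
    have h1 : ‖w‖⁻¹ ≤ 2 := by
      rw [inv_le_comm₀ (by linarith [h.1]) (by norm_num)]; linarith [h.1]
    have h2 := mul_le_mul h1 (hΦ.deriv_bound ‖w‖) (abs_nonneg _) (by norm_num)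
    have h3 := mul_le_mul h2 (hY w) (abs_nonneg _) (by positivity)
    linarith

lemma kerS_eq_zero (hΦ : IsProfile A δ t Φ φ) (ht : t ∈ Set.Icc (1 : ℝ) 2)
    (hδ' : δ ≤ 1 / 16) {s : ℝ} (hs : 0 < s) {w : ℂ} (h : 3 * s < ‖w‖) : kerS s φ Y w = 0 := by
  rw [kerS, ker_eq_zero hΦ ht hδ' (Or.inr _), mul_zero]
  rw [norm_smul, norm_inv, Real.norm_eq_abs, abs_of_pos hs, ← div_eq_inv_mul, lt_div_iff₀ hs]
  exact h

lemma abs_kerS_le (hΦ : IsProfile A δ t Φ φ) (hY : ∀ w, |Y w| ≤ 1) (ht : t ∈ Set.Icc (1 : ℝ) 2)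
    (hδ : 0 < δ) (hδ' : δ ≤ 1 / 16) (s : ℝ) (w : ℂ) :
    |kerS s φ Y w| ≤ (s ^ 2)⁻¹ * (2 * (A / δ)) := by
  rw [kerS, abs_mul, abs_of_nonneg (a := (s ^ 2)⁻¹) (by positivity)]
  exact mul_le_mul_of_nonneg_left (abs_ker_le hΦ hY ht hδ hδ' _) (by positivity)

lemma polarCoord_symm_eq (a α : ℝ) : Complex.polarCoord.symm (a, α) = a * circ 1 0 α := by
  rw [Complex.polarCoord_symm_apply, circ, Complex.exp_mul_I]
  push_cast
  ring

lemma norm_polar {a : ℝ} (ha : 0 < a) (α : ℝ) : ‖(a : ℂ) * circ 1 0 α‖ = a := by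
  rw [norm_mul, norm_circ_one, Complex.norm_real, Real.norm_eq_abs, abs_of_pos ha, mul_one]

lemma measurable_circ (a r : ℝ) : Measurable (circ a r) := (continuous_circ a r).measurable

/-- Integration in polar coordinates of a radial density against a `0`-homogeneous weight. -/
lemma lintegral_radial_le (hΦ : IsProfile A δ t Φ φ) (hδ : 0 < δ) {g : ℂ → ℝ≥0∞}
    (hg : Measurable g) (hgh : ∀ (s : ℝ) (w : ℂ), 0 < s → g (s * w) = g w) :
    ∫⁻ w, ‖‖w‖⁻¹ * φ ‖w‖‖ₑ * g w ≤
      ENNReal.ofReal (2 * A) * ∫⁻ α in Set.Ioo (-Real.pi) Real.pi, g (circ 1 0 α) := by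
  have hA := hΦ.nonneg
  rw [← Complex.lintegral_comp_polarCoord_symm, polarCoord_target]
  have hcongr : ∫⁻ p in Set.Ioi (0 : ℝ) ×ˢ Set.Ioo (-Real.pi) Real.pi,
      ENNReal.ofReal p.1 • (‖‖Complex.polarCoord.symm p‖⁻¹ * φ ‖Complex.polarCoord.symm p‖‖ₑ *
        g (Complex.polarCoord.symm p)) =
      ∫⁻ p in Set.Ioi (0 : ℝ) ×ˢ Set.Ioo (-Real.pi) Real.pi, ‖φ p.1‖ₑ * g (circ 1 0 p.2) := by
    refine setLIntegral_congr_fun (measurableSet_Ioi.prod measurableSet_Ioo) ?_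
    rintro ⟨a, α⟩ ⟨ha, -⟩
    have ha : 0 < a := ha
    simp only [smul_eq_mul]
    rw [polarCoord_symm_eq, norm_polar ha, hgh a _ ha, ← mul_assoc,
      ← Real.enorm_of_nonneg ha.le, ← enorm_mul, mul_inv_cancel_left₀ ha.ne']
  rw [hcongr, Measure.volume_eq_prod, ← Measure.prod_restrict]
  rw [lintegral_prod_mul (f := fun a => ‖φ a‖ₑ) (g := fun α => g (circ 1 0 α))
    hΦ.deriv_continuous.measurable.enorm.aemeasurable
    (hg.comp (measurable_circ 1 0)).aemeasurable]
  gcongr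
  have h1 : ∀ a, ‖φ a‖ₑ ≤ (Set.Icc (t - δ) (t + δ)).indicator (fun _ => ENNReal.ofReal (A / δ)) a := by
    intro a
    by_cases h : |a - t| ≤ δ
    · have h' := abs_le.1 h
      have hm : a ∈ Set.Icc (t - δ) (t + δ) := ⟨by linarith, by linarith⟩
      rw [Set.indicator_of_mem hm, Real.enorm_eq_ofReal_abs]
      exact ENNReal.ofReal_le_ofReal (hΦ.deriv_bound a)
    · rw [hΦ.deriv_eq_zero _ (not_le.1 h), enorm_zero]; exact zero_le
  calc ∫⁻ a in Set.Ioi 0, ‖φ a‖ₑ ≤ ∫⁻ a, ‖φ a‖ₑ := setLIntegral_le_lintegral _ _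
    _ ≤ ∫⁻ a, (Set.Icc (t - δ) (t + δ)).indicator (fun _ => ENNReal.ofReal (A / δ)) a :=
      lintegral_mono h1
    _ = ENNReal.ofReal (2 * A) := by
      rw [lintegral_indicator_const measurableSet_Icc, Real.volume_Icc,
        ← ENNReal.ofReal_mul (by positivity)]
      congr 1
      field_simp
      ring

lemma lintegral_ker_le (hΦ : IsProfile A δ t Φ φ) (hδ : 0 < δ) (hY : ∀ w, |Y w| ≤ 1) :
    ∫⁻ w, ‖ker φ Y w‖ₑ ≤ ENNReal.ofReal (16 * A) := by
  have hpi := Real.pi_pos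
  have hA := hΦ.nonneg
  have h4 := Real.pi_lt_four
  calc ∫⁻ w, ‖ker φ Y w‖ₑ ≤ ∫⁻ w, ‖‖w‖⁻¹ * φ ‖w‖‖ₑ * 1 := by
        refine lintegral_mono fun w => ?_
        rw [ker, enorm_mul]
        gcongr
        rw [Real.enorm_eq_ofReal_abs, ENNReal.ofReal_le_one]
        exact hY w
    _ ≤ ENNReal.ofReal (2 * A) * ∫⁻ α in Set.Ioo (-Real.pi) Real.pi, 1 :=
        lintegral_radial_le hΦ hδ measurable_const fun _ _ _ => rfl
    _ ≤ _ := by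
        rw [setLIntegral_one, Real.volume_Ioo, ← ENNReal.ofReal_mul (by positivity)]
        apply ENNReal.ofReal_le_ofReal
        nlinarith

lemma integral_profile_deriv (hΦ : IsProfile A δ t Φ φ) (ht : t ∈ Set.Icc (1 : ℝ) 2)
    (hδ' : δ ≤ 1 / 16) : ∫ a in Set.Ioi (0 : ℝ), φ a = 0 := by
  have h1 : ∫ a in Set.Ioi (0 : ℝ), φ a = ∫ a in Set.Ioc (0 : ℝ) 4, φ a := by
    refine setIntegral_eq_of_subset_of_forall_sdiff_eq_zero measurableSet_Ioi
      (fun x hx => hx.1) ?_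
    rintro x ⟨hx, hx'⟩
    refine hΦ.eq_zero_of_norm ht hδ' (Or.inr ?_)
    have : ¬ x ≤ 4 := fun h => hx' ⟨hx, h⟩
    linarith
  rw [h1, ← intervalIntegral.integral_of_le (by norm_num),
    intervalIntegral.integral_eq_sub_of_hasDerivAt (fun x _ => hΦ.hasDerivAt x)
      (hΦ.deriv_continuous.intervalIntegrable _ _), hΦ.eq_zero 4, hΦ.eq_zero 0, sub_zero]
  · rw [lt_abs]; right; linarith [ht.1]
  · rw [lt_abs]; left; linarith [ht.2]

lemma integral_ker_eq_zero (hΦ : IsProfile A δ t Φ φ) (hY : IsCutoff B ε θ Y)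
    (ht : t ∈ Set.Icc (1 : ℝ) 2) (hδ' : δ ≤ 1 / 16) : ∫ w, ker φ Y w = 0 := by
  rw [← Complex.integral_comp_polarCoord_symm, polarCoord_target]
  have hcongr : ∫ p in Set.Ioi (0 : ℝ) ×ˢ Set.Ioo (-Real.pi) Real.pi,
      p.1 • ker φ Y (Complex.polarCoord.symm p) =
      ∫ p in Set.Ioi (0 : ℝ) ×ˢ Set.Ioo (-Real.pi) Real.pi, φ p.1 * Y (circ 1 0 p.2) := by
    refine setIntegral_congr_fun (measurableSet_Ioi.prod measurableSet_Ioo) ?_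
    rintro ⟨a, α⟩ ⟨ha, -⟩
    have ha : 0 < a := ha
    simp only [smul_eq_mul]
    rw [polarCoord_symm_eq, ker, norm_polar ha, hY.homog a _ ha]
    field_simp
  rw [hcongr, Measure.volume_eq_prod, setIntegral_prod_mul φ (fun α => Y (circ 1 0 α)),
    integral_profile_deriv hΦ ht hδ', zero_mul]

lemma abs_cutoff_sub_le (hY : IsCutoff B ε θ Y) {w w' : ℂ} (hw : 13 / 16 ≤ ‖w‖)
    (hww : ‖w - w'‖ ≤ 1 / 8) : |Y w - Y w'| ≤ B / ε * ‖w - w'‖ := by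
  have hball : ∀ v ∈ Metric.closedBall w (1 / 8), 1 / 2 ≤ ‖v‖ := by
    intro v hv
    rw [mem_closedBall, dist_eq_norm] at hv
    have := norm_sub_norm_le w v
    rw [norm_sub_rev] at hv
    linarith
  have := (convex_closedBall w (1 / 8)).norm_image_sub_le_of_norm_fderiv_le (f := Y)
    (fun v hv => hY.diff v (hball v hv)) (fun v hv => hY.fderiv_le v (hball v hv))
    (x := w') (y := w) (by rwa [mem_closedBall, dist_eq_norm, norm_sub_rev])
    (mem_closedBall_self (by norm_num))
  rwa [Real.norm_eq_abs] at this

/-- The localized kernels are Lipschitz at small distances. -/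
lemma abs_ker_sub_le (hΦ : IsProfile A δ t Φ φ) (hY : IsCutoff B ε θ Y)
    (ht : t ∈ Set.Icc (1 : ℝ) 2) (hδ : 0 < δ) (hδ' : δ ≤ 1 / 16) (hε : 0 < ε) (hε' : ε ≤ 1)
    (hB : 1 ≤ B) {w w' : ℂ} (hww : ‖w - w'‖ ≤ 1 / 8) :
    |ker φ Y w - ker φ Y w'| ≤ 8 * A * B * ε⁻¹ * (δ ^ 2)⁻¹ * ‖w - w'‖ := by
  have hA := hΦ.nonneg
  have hn := abs_norm_sub_norm_le w w'
  have hn' := abs_le.1 hn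
  by_cases hw : ‖w‖ < 13 / 16
  · rw [ker_eq_zero hΦ ht hδ' (Or.inl (by linarith)),
      ker_eq_zero hΦ ht hδ' (Or.inl (by linarith)), sub_zero, abs_zero]
    positivity
  by_cases hw' : ‖w'‖ < 13 / 16
  · rw [ker_eq_zero hΦ ht hδ' (Or.inl (by linarith)),
      ker_eq_zero hΦ ht hδ' (Or.inl (by linarith)), sub_zero, abs_zero]
    positivity
  push Not at hw hw'
  have hd := norm_nonneg (w - w')
  set d := ‖w - w'‖
  have hεi : 1 ≤ ε⁻¹ := (one_le_inv₀ hε).2 hε'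
  have hδi : 1 ≤ δ⁻¹ := (one_le_inv₀ hδ).2 (by linarith)
  have e1 : |‖w‖⁻¹ - ‖w'‖⁻¹| ≤ 2 * d := by
    rw [inv_sub_inv (by linarith) (by linarith), abs_div, abs_sub_comm,
      abs_of_pos (a := ‖w‖ * ‖w'‖) (by nlinarith), div_le_iff₀ (by nlinarith)]
    have h5 : 1 / 2 ≤ ‖w‖ * ‖w'‖ := by nlinarith
    nlinarith
  have e2 := hΦ.deriv_lip ‖w‖ ‖w'‖
  have e3 := abs_cutoff_sub_le hY hw hww
  have i1 : |‖w'‖⁻¹| ≤ 2 := by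
    rw [abs_inv, abs_norm, inv_le_comm₀ (by linarith) (by norm_num)]; linarith
  have hid : ker φ Y w - ker φ Y w' = (‖w‖⁻¹ - ‖w'‖⁻¹) * φ ‖w‖ * Y w +
      ‖w'‖⁻¹ * (φ ‖w‖ - φ ‖w'‖) * Y w + ‖w'‖⁻¹ * φ ‖w'‖ * (Y w - Y w') := by
    simp only [ker]; ring
  have f1 : |(‖w‖⁻¹ - ‖w'‖⁻¹) * φ ‖w‖ * Y w| ≤ 2 * d * (A / δ) * 1 := by
    rw [abs_mul, abs_mul]
    gcongr
    · exact hΦ.deriv_bound _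
    · exact hY.abs_le_one w
  have f2 : |‖w'‖⁻¹ * (φ ‖w‖ - φ ‖w'‖) * Y w| ≤ 2 * (A / δ ^ 2 * d) * 1 := by
    rw [abs_mul, abs_mul]
    gcongr
    · exact e2.trans (by gcongr)
    · exact hY.abs_le_one w
  have f3 : |‖w'‖⁻¹ * φ ‖w'‖ * (Y w - Y w')| ≤ 2 * (A / δ) * (B / ε * d) := by
    rw [abs_mul, abs_mul]
    gcongr
    exact hΦ.deriv_bound _
  rw [hid]
  refine (abs_add_three _ _ _).trans ((add_le_add_three f1 f2 f3).trans ?_)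
  have hBε : 1 ≤ B * ε⁻¹ := by nlinarith
  have g1 : 2 * d * (A / δ) * 1 ≤ 2 * (A * d * (B * ε⁻¹) * δ⁻¹ ^ 2) := by
    calc 2 * d * (A / δ) * 1 = 2 * (A * d * 1 * (δ⁻¹ * 1)) := by rw [div_eq_mul_inv]; ring
      _ ≤ 2 * (A * d * (B * ε⁻¹) * (δ⁻¹ * δ⁻¹)) := by gcongr
      _ = _ := by ring
  have g2 : 2 * (A / δ ^ 2 * d) * 1 ≤ 2 * (A * d * (B * ε⁻¹) * δ⁻¹ ^ 2) := by
    calc 2 * (A / δ ^ 2 * d) * 1 = 2 * (A * d * 1 * δ⁻¹ ^ 2) := by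
          rw [div_eq_mul_inv, inv_pow]; ring
      _ ≤ _ := by gcongr
  have g3 : 2 * (A / δ) * (B / ε * d) ≤ 2 * (A * d * (B * ε⁻¹) * δ⁻¹ ^ 2) := by
    calc 2 * (A / δ) * (B / ε * d) = 2 * (A * d * (B * ε⁻¹) * (δ⁻¹ * 1)) := by
          rw [div_eq_mul_inv, div_eq_mul_inv]; ring
      _ ≤ 2 * (A * d * (B * ε⁻¹) * (δ⁻¹ * δ⁻¹)) := by gcongr
      _ = _ := by ring
  have : 0 ≤ A * d * (B * ε⁻¹) * δ⁻¹ ^ 2 := by positivity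
  calc _ ≤ 8 * (A * d * (B * ε⁻¹) * δ⁻¹ ^ 2) := by linarith
    _ = _ := by rw [inv_pow]; ring

lemma integral_kerS_mul_kerS (φ φ' : ℝ → ℝ) (Y : ℂ → ℝ) {s : ℝ} (hs : 0 < s) (x x' : ℂ) :
    ∫ y, kerS s φ Y (y - x) * kerS s φ' Y (y - x') =
      (s ^ 2)⁻¹ * interact φ φ' Y (s⁻¹ • (x - x')) := by
  have := integral_scale (fun y => kerS s φ' Y (y - x')) (ker φ Y) hs x
  simp_rw [mul_comm (kerS s φ Y _)]
  refine this.trans ?_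
  rw [interact, ← integral_const_mul]
  congr 1
  funext v
  rw [kerS, show s⁻¹ • (x + s • v - x') = v + s⁻¹ • (x - x') by
    rw [add_sub_right_comm, add_comm, smul_add, inv_smul_smul₀ hs.ne']]
  ring

lemma integrable_ker (hΦ : IsProfile A δ t Φ φ) (hY : IsCutoff B ε θ Y) (hδ : 0 < δ) :
    Integrable (ker φ Y) :=
  ⟨(measurable_ker hΦ hY.measurable).aestronglyMeasurable,
    (lintegral_ker_le hΦ hδ hY.abs_le_one).trans_lt ENNReal.ofReal_lt_top⟩

/-- Correlations of kernels at very different scales decay. -/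
lemma abs_integral_kerS_mul_kerS_le (hΦ : IsProfile A δ t Φ φ) (hΦ' : IsProfile A δ t' Φ' φ')
    (hY : IsCutoff B ε θ Y) (ht : t ∈ Set.Icc (1 : ℝ) 2) (ht' : t' ∈ Set.Icc (1 : ℝ) 2)
    (hδ : 0 < δ) (hδ' : δ ≤ 1 / 16) (hε : 0 < ε) (hε' : ε ≤ 1)
    (hB : 1 ≤ B) {s s' : ℝ} (hs' : 0 < s') (hss : 32 * s' ≤ s) (x x' : ℂ) :
    |∫ y, kerS s φ Y (y - x) * kerS s' φ' Y (y - x')| ≤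
      384 * A ^ 2 * B * ε⁻¹ * (δ ^ 2)⁻¹ * (s' / s) * (s ^ 2)⁻¹ := by
  have hA := hΦ.nonneg
  have hs : 0 < s := by linarith
  have h1 := integral_scale (fun y => kerS s φ Y (y - x)) (ker φ' Y) hs' x'
  have h2 : ∫ v, kerS s φ Y (x' + s' • v - x) * ker φ' Y v =
      ∫ v, (kerS s φ Y (x' + s' • v - x) - kerS s φ Y (x' - x)) * ker φ' Y v := by
    simp_rw [sub_mul]
    rw [integral_sub, integral_const_mul, integral_ker_eq_zero hΦ' hY ht' hδ', mul_zero, sub_zero]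
    · refine (integrable_ker hΦ' hY hδ).bdd_mul (c := (s ^ 2)⁻¹ * (2 * (A / δ))) ?_ ?_
      · exact ((measurable_kerS hΦ hY.measurable s).comp (by fun_prop)).aestronglyMeasurable
      · exact ae_of_all _ fun v => abs_kerS_le hΦ hY.abs_le_one ht hδ hδ' s _
    · exact (integrable_ker hΦ' hY hδ).const_mul _
  have hmain : ∀ v, ‖(kerS s φ Y (x' + s' • v - x) - kerS s φ Y (x' - x)) * ker φ' Y v‖ ≤
      24 * A * B * ε⁻¹ * (δ ^ 2)⁻¹ * (s' / s) * (s ^ 2)⁻¹ * ‖ker φ' Y v‖ := by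
    intro v
    by_cases hv : 3 < ‖v‖
    · rw [ker_eq_zero hΦ' ht' hδ' (Or.inr hv)]; simp
    rw [norm_mul]
    refine mul_le_mul_of_nonneg_right ?_ (norm_nonneg _)
    push Not at hv
    rw [kerS, kerS, ← mul_sub, Real.norm_eq_abs, abs_mul, abs_of_nonneg (a := (s ^ 2)⁻¹)
      (by positivity)]
    have hd : ‖s⁻¹ • (x' + s' • v - x) - s⁻¹ • (x' - x)‖ ≤ 3 * (s' / s) := by
      rw [← smul_sub, show x' + s' • v - x - (x' - x) = s' • v by ring, norm_smul, norm_smul,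
        norm_inv, Real.norm_eq_abs, Real.norm_eq_abs, abs_of_pos hs, abs_of_pos hs']
      calc s⁻¹ * (s' * ‖v‖) ≤ s⁻¹ * (s' * 3) := by gcongr
        _ = _ := by rw [div_eq_mul_inv]; ring
    have hr : s' / s ≤ 1 / 32 := by rw [div_le_div_iff₀ hs (by norm_num)]; linarith
    have := abs_ker_sub_le hΦ hY ht hδ hδ' hε hε' hB (hd.trans (by linarith))
    calc (s ^ 2)⁻¹ * |_| ≤ (s ^ 2)⁻¹ * (8 * A * B * ε⁻¹ * (δ ^ 2)⁻¹ * (3 * (s' / s))) := by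
          refine mul_le_mul_of_nonneg_left (this.trans ?_) (by positivity)
          exact mul_le_mul_of_nonneg_left hd (by positivity)
      _ = _ := by ring
  have h3 : ∫ y, kerS s φ Y (y - x) * kerS s' φ' Y (y - x') =
    ∫ v, kerS s φ Y (x' + s' • v - x) * ker φ' Y v := h1
  rw [h3, h2, ← Real.norm_eq_abs]
  have hintg : ∫ v, ‖ker φ' Y v‖ ≤ 16 * A := by
    rw [integral_norm_eq_lintegral_enorm (integrable_ker hΦ' hY hδ).aestronglyMeasurable]
    exact ENNReal.toReal_le_of_le_ofReal (by positivity) (lintegral_ker_le hΦ' hδ hY.abs_le_one)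
  refine (norm_integral_le_of_norm_le ((integrable_ker hΦ' hY hδ).norm.const_mul _)
    (ae_of_all _ hmain)).trans ?_
  rw [integral_const_mul]
  refine (mul_le_mul_of_nonneg_left hintg (by positivity)).trans (le_of_eq (by ring))

lemma integral_kerS_mul_kerS_eq_zero (hΦ : IsProfile A δ t Φ φ) (hΦ' : IsProfile A δ t' Φ' φ')
    (ht : t ∈ Set.Icc (1 : ℝ) 2) (ht' : t' ∈ Set.Icc (1 : ℝ) 2)
    (hδ' : δ ≤ 1 / 16) {s s' : ℝ} (hs' : 0 < s') (hss : s' ≤ s) {x x' : ℂ} 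
    (h : 8 * s < ‖x - x'‖) :
    ∫ y, kerS s φ Y (y - x) * kerS s' φ' Y (y - x') = 0 := by
  refine integral_eq_zero_of_ae (ae_of_all _ fun y => ?_)
  by_cases hy : 3 * s < ‖y - x‖
  · simp [kerS_eq_zero hΦ ht hδ' (by linarith) hy]
  · have h2 : ‖x - x'‖ ≤ ‖y - x'‖ + ‖y - x‖ := by
      calc ‖x - x'‖ = ‖(y - x') - (y - x)‖ := by ring_nf
        _ ≤ _ := norm_sub_le _ _
    simp [kerS_eq_zero hΦ' ht' hδ' hs' (w := y - x') (by linarith)]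

end Kernel

section Family

/-- A finite family of profiles at thickness `δ`. -/
structure IsFamily {N : ℕ} (A δ : ℝ) (t : Fin N → ℝ) (Φ φ : Fin N → ℝ → ℝ) : Prop where
  profile : ∀ i, IsProfile A δ (t i) (Φ i) (φ i)
  center : ∀ i, t i ∈ Set.Icc (1 : ℝ) 2
  pos : 0 < δ
  le : δ ≤ 1 / 16
  card : N * δ ≤ 4
  nonneg : 0 ≤ A

/-- The kernel at dyadic scale `2 ^ a.1` with profile `φ a.2`. -/
noncomputable def labK {N : ℕ} (φ : Fin N → ℝ → ℝ) (Y : ℂ → ℝ) (a : ℤ × Fin N) (w : ℂ) : ℝ :=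
  kerS (2 ^ a.1) (φ a.2) Y w

/-- The normalized indicator of a disc. -/
noncomputable def discW (s : ℝ) (z : ℂ) : ℝ≥0∞ :=
  (closedBall (0 : ℂ) (8 * s)).indicator (fun _ => ENNReal.ofReal (s ^ 2)⁻¹) z

lemma lintegral_discW_le {s : ℝ} (hs : 0 < s) : ∫⁻ z, discW s z ≤ ENNReal.ofReal 256 := by
  unfold discW
  rw [lintegral_indicator_const measurableSet_closedBall, Complex.volume_closedBall,
    ← ENNReal.ofReal_pow (by positivity), ← ENNReal.ofReal_coe_nnreal, NNReal.coe_real_pi,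
    ← ENNReal.ofReal_mul (by positivity), ← ENNReal.ofReal_mul (by positivity)]
  apply ENNReal.ofReal_le_ofReal
  have : (s ^ 2)⁻¹ * ((8 * s) ^ 2 * Real.pi) = 64 * Real.pi := by field_simp; norm_num
  rw [this]
  linarith [Real.pi_lt_four]

variable {N : ℕ} {A δ B ε : ℝ} {t : Fin N → ℝ} {Φ φ : Fin N → ℝ → ℝ} {θ : ℂ} {Y : ℂ → ℝ}

lemma IsFamily.measurable_labK (hF : IsFamily A δ t Φ φ) (hY : Measurable Y) :
    Measurable (fun p : (ℤ × Fin N) × ℂ => labK φ Y p.1 p.2) :=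
  measurable_from_prod_countable_right fun a => by
    exact measurable_kerS (hF.profile a.2) hY (2 ^ a.1)

lemma lintegral_kerS (φ : ℝ → ℝ) (Y : ℂ → ℝ) {s : ℝ} (hs : 0 < s) (x : ℂ) :
    ∫⁻ y, ‖kerS s φ Y (y - x)‖ₑ = ∫⁻ v, ‖ker φ Y v‖ₑ := by
  rw [← lintegral_scale (fun v => ‖ker φ Y v‖ₑ) hs x]
  refine lintegral_congr fun y => ?_
  rw [kerS, enorm_mul, Real.enorm_of_nonneg (by positivity)]

/-- The duality inequality for a measurable choice of labels. -/
lemma IsFamily.sq_measure_le (hF : IsFamily A δ t Φ φ) (hY : Measurable Y)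
    (hY1 : ∀ w, |Y w| ≤ 1) {q : ℂ → ℤ × Fin N} (hq : Measurable q) {T : Finset (ℤ × Fin N)}
    (hqT : ∀ x, q x ∈ T) {G : Set ℂ} (hG : volume G ≠ ⊤) {f : ℂ → ℝ}
    (hf : Measurable f) (hfi : Integrable f) {l : ℝ≥0∞}
    (hl : ∀ᵐ x ∂(volume.restrict G), l ≤ ‖∫ y, labK φ Y (q x) (y - x) * f y‖ₑ) :
    (l * volume G) ^ 2 ≤ (∫⁻ y, ‖f y‖ₑ ^ 2) * ∫⁻ x in G, ∫⁻ x' in G,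
      ‖∫ y, labK φ Y (q x) (y - x) * labK φ Y (q x') (y - x')‖ₑ := by
  have : IsFiniteMeasure (volume.restrict G) := ⟨by
    rw [Measure.restrict_apply_univ]; exact hG.lt_top⟩
  have hKm : Measurable (Function.uncurry fun x y => labK φ Y (q x) (y - x)) := by
    have h : Measurable (fun p : ℂ × ℂ => (q p.1, p.2 - p.1)) :=
      (hq.comp measurable_fst).prodMk (measurable_snd.sub measurable_fst)
    exact (hF.measurable_labK hY).comp h
  obtain ⟨M, hM⟩ : ∃ M : ℝ, ∀ a ∈ T, ∀ w, |labK φ Y a w| ≤ M := by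
    refine ⟨∑ a ∈ T, ((2 ^ a.1 : ℝ) ^ 2)⁻¹ * (2 * (A / δ)), fun a ha w => ?_⟩
    have h0 := hF.pos
    have h1 := hF.nonneg
    refine (abs_kerS_le (hF.profile a.2) hY1 (hF.center _) hF.pos hF.le _ _).trans ?_
    exact Finset.single_le_sum (f := fun a : ℤ × Fin N => ((2 ^ a.1 : ℝ) ^ 2)⁻¹ * (2 * (A / δ)))
      (fun _ _ => by positivity) ha
  have hKi : Integrable (Function.uncurry fun x y => labK φ Y (q x) (y - x))
      ((volume.restrict G).prod volume) := by
    refine ⟨hKm.aestronglyMeasurable, ?_⟩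
    rw [hasFiniteIntegral_iff_enorm, lintegral_prod _ hKm.enorm.aemeasurable]
    calc ∫⁻ x in G, ∫⁻ y, ‖labK φ Y (q x) (y - x)‖ₑ
        ≤ ∫⁻ x in G, ENNReal.ofReal (16 * A) := lintegral_mono fun x => by
          unfold labK
          rw [lintegral_kerS _ _ (by positivity)]
          exact lintegral_ker_le (hF.profile _) hF.pos hY1
      _ < ⊤ := by
          rw [setLIntegral_const]
          exact ENNReal.mul_lt_top ENNReal.ofReal_lt_top hG.lt_top
  have := sq_measure_le_of_correlation (μ := volume.restrict G) (ν := volume)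
    (K := fun x y => labK φ Y (q x) (y - x)) (f := f) (l := l) hKm (M := M)
    (fun x y => hM _ (hqT x) _) hKi hf hfi hl
  rwa [Measure.restrict_apply_univ] at this

/-- `T` only involves scales separated by at least `2 ^ L`. -/
def IsSep {N : ℕ} (L : ℕ) (T : Finset (ℤ × Fin N)) : Prop :=
  ∀ a ∈ T, ∀ b ∈ T, b.1 < a.1 → b.1 + L ≤ a.1

lemma IsFamily.enorm_corr_le_discW (hF : IsFamily A δ t Φ φ) (hY : IsCutoff B ε θ Y)
    (hε : 0 < ε) (hε' : ε ≤ 1) (hB : 1 ≤ B) {L : ℕ} (hL : (1 / 2 : ℝ) ^ L ≤ δ ^ 3)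
    {a b : ℤ × Fin N} (hab : b.1 + L ≤ a.1) (x x' : ℂ) :
    ‖∫ y, labK φ Y a (y - x) * labK φ Y b (y - x')‖ₑ ≤
      ENNReal.ofReal (384 * A ^ 2 * B * ε⁻¹ * δ) * discW (2 ^ a.1) (x' - x) := by
  have hδ := hF.pos
  have hδ' := hF.le
  have hA := hF.nonneg
  have hs : (0 : ℝ) < 2 ^ a.1 := by positivity
  have hs' : (0 : ℝ) < 2 ^ b.1 := by positivity
  have hr : (2 : ℝ) ^ b.1 ≤ (1 / 2) ^ L * 2 ^ a.1 := by
    have h1 : (2 : ℝ) ^ (b.1 + L) ≤ 2 ^ a.1 := zpow_le_zpow_right₀ (by norm_num) hab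
    rw [zpow_add₀ (by norm_num), zpow_natCast] at h1
    rw [one_div, inv_pow, inv_mul_eq_div, le_div_iff₀ (by positivity)]
    exact h1
  have hr3 : (2 : ℝ) ^ b.1 ≤ δ ^ 3 * 2 ^ a.1 := hr.trans (by gcongr)
  have hd3 : δ ^ 3 ≤ 1 / 32 := by
    calc δ ^ 3 ≤ (1 / 16) ^ 3 := by gcongr
      _ ≤ _ := by norm_num
  have hr2 : 32 * (2 : ℝ) ^ b.1 ≤ 2 ^ a.1 := by nlinarith
  have h32 : (2 : ℝ) ^ b.1 ≤ 2 ^ a.1 := by linarith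
  unfold labK discW
  by_cases h : ‖x - x'‖ ≤ 8 * 2 ^ a.1
  · rw [Set.indicator_of_mem (by rwa [mem_closedBall_zero_iff, norm_sub_rev]),
      ← ENNReal.ofReal_mul (by positivity), Real.enorm_eq_ofReal_abs]
    apply ENNReal.ofReal_le_ofReal
    refine (abs_integral_kerS_mul_kerS_le (hF.profile _) (hF.profile _) hY (hF.center _)
      (hF.center _) hδ hδ' hε hε' hB hs' hr2 x x').trans ?_
    refine mul_le_mul_of_nonneg_right ?_ (by positivity)
    have h3 : (2 : ℝ) ^ b.1 / 2 ^ a.1 ≤ δ ^ 3 := by rwa [div_le_iff₀ hs]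
    calc 384 * A ^ 2 * B * ε⁻¹ * (δ ^ 2)⁻¹ * (2 ^ b.1 / 2 ^ a.1)
        ≤ 384 * A ^ 2 * B * ε⁻¹ * (δ ^ 2)⁻¹ * δ ^ 3 := by gcongr
      _ = _ := by field_simp
  · rw [integral_kerS_mul_kerS_eq_zero (hF.profile _) (hF.profile _) (hF.center _)
      (hF.center _) hδ' hs' h32 (not_le.1 h)]
    simp

lemma measurable_discW (s : ℝ) : Measurable (discW s) := by
  unfold discW
  exact measurable_const.indicator measurableSet_closedBall

lemma measurable_discW_comp {q : ℂ → ℤ × Fin N} (hq : Measurable q) :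
    Measurable (fun p : ℂ × ℂ => discW (2 ^ (q p.1).1) (p.2 - p.1)) := by
  have h : Measurable (fun p : (ℤ × Fin N) × ℂ => discW (2 ^ p.1.1) p.2) :=
    measurable_from_prod_countable_right fun a => by
      exact measurable_discW (2 ^ a.1)
  exact h.comp ((hq.comp measurable_fst).prodMk (measurable_snd.sub measurable_fst))

lemma setLIntegral_row_le {G : Set ℂ} (hGm : MeasurableSet G) {J W P H : ℂ → ℂ → ℝ≥0∞}
    {κ ρ c e : ℝ≥0∞} (hPm : ∀ x, Measurable (P x)) (hHm : Measurable (Function.uncurry H))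
    (hpt : ∀ x ∈ G, ∀ x' ∈ G, J x x' ≤ W x x' + (P x x' + (c * H x x' + c * H x' x)))
    (hκ : ∀ x ∈ G, ∫⁻ x' in G, W x x' ≤ κ) (hρ : ∀ x, ∫⁻ x' in G, P x x' ≤ ρ)
    (he : ∀ x, ∫⁻ x' in G, H x x' ≤ e) :
    ∫⁻ x in G, ∫⁻ x' in G, J x x' ≤ (κ + (ρ + 2 * (c * e))) * volume G := by
  have hHm1 : ∀ x, Measurable (H x) := fun x => hHm.comp measurable_prodMk_left
  have hHm2 : ∀ x, Measurable (fun x' => H x' x) := fun x => hHm.comp measurable_prodMk_right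
  have hHsw : ∫⁻ x in G, ∫⁻ x' in G, H x' x = ∫⁻ x in G, ∫⁻ x' in G, H x x' :=
    lintegral_lintegral_swap (f := fun x x' => H x' x)
      (hHm.comp measurable_swap).aemeasurable
  have hHH : ∫⁻ x in G, ∫⁻ x' in G, H x x' ≤ e * volume G :=
    (lintegral_mono fun x => he x).trans (by rw [setLIntegral_const])
  have hmeas1 : Measurable fun x => ∫⁻ x' in G, H x' x := by
    exact Measurable.lintegral_prod_right' (f := fun p : ℂ × ℂ => H p.2 p.1)
      (hHm.comp measurable_swap)
  have hrow : ∀ x ∈ G, ∫⁻ x' in G, J x x' ≤ κ + (ρ + c * e) + c * ∫⁻ x' in G, H x' x := by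
    intro x hx
    have m1 : Measurable fun x' => c * H x x' := (hHm1 x).const_mul c
    have m2 : Measurable fun x' => c * H x' x := (hHm2 x).const_mul c
    have m3 : Measurable fun x' => c * H x x' + c * H x' x := m1.add m2
    have m4 : Measurable fun x' => P x x' + (c * H x x' + c * H x' x) := (hPm x).add m3
    calc _ ≤ ∫⁻ x' in G, (W x x' + (P x x' + (c * H x x' + c * H x' x))) :=
          setLIntegral_mono' hGm fun x' hx' => hpt x hx x' hx'
      _ = (∫⁻ x' in G, W x x') + ((∫⁻ x' in G, P x x') + (c * (∫⁻ x' in G, H x x') +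
            c * ∫⁻ x' in G, H x' x)) := by
          rw [lintegral_add_right _ m4, lintegral_add_left (hPm x), lintegral_add_left m1,
            lintegral_const_mul _ (hHm1 x), lintegral_const_mul _ (hHm2 x)]
      _ ≤ κ + (ρ + (c * e + c * ∫⁻ x' in G, H x' x)) := by
          gcongr
          · exact hκ x hx
          · exact hρ x
          · exact he x
      _ = _ := by ring
  calc _ ≤ ∫⁻ x in G, (κ + (ρ + c * e) + c * ∫⁻ x' in G, H x' x) :=
        setLIntegral_mono' hGm hrow
    _ = (κ + (ρ + c * e)) * volume G + c * ∫⁻ x in G, ∫⁻ x' in G, H x' x := by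
        rw [lintegral_add_left measurable_const, setLIntegral_const,
          lintegral_const_mul _ hmeas1]
    _ ≤ (κ + (ρ + c * e)) * volume G + c * (e * volume G) := by
        rw [hHsw]; gcongr
    _ = _ := by ring

lemma sq_mul_le_of_sq_mul_le {l v a b k : ℝ≥0∞} (h : (l * v) ^ 2 ≤ a * b) (hb : b ≤ k * v)
    (hv : v ≠ ⊤) : l ^ 2 * v ≤ a * k := by
  by_cases h0 : v = 0
  · rw [h0, mul_zero]; exact zero_le
  have hmul := h.trans (mul_le_mul_right hb _)
  rw [mul_pow, sq v, ← mul_assoc, ← mul_assoc] at hmul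
  exact (ENNReal.mul_le_mul_iff_left h0 hv).1 hmul

/-- A weak type `L²` estimate from bounds for the correlations at equal scales. -/
lemma IsFamily.weak_of_row_bound (hF : IsFamily A δ t Φ φ) (hY : IsCutoff B ε θ Y)
    (hε : 0 < ε) (hε' : ε ≤ 1) (hB : 1 ≤ B) {L : ℕ} (hL : (1 / 2 : ℝ) ^ L ≤ δ ^ 3)
    {q : ℂ → ℤ × Fin N} (hq : Measurable q) {T : Finset (ℤ × Fin N)} (hT : IsSep L T)
    (hqT : ∀ x, q x ∈ T) {G : Set ℂ} (hGm : MeasurableSet G) (hG : volume G ≠ ⊤) {f : ℂ → ℝ}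
    (hf : Measurable f) (hfi : Integrable f) {l : ℝ≥0∞}
    (hl : ∀ x ∈ G, l ≤ ‖∫ y, labK φ Y (q x) (y - x) * f y‖ₑ)
    {W : ℂ → ℂ → ℝ≥0∞} {R : ℂ → ℝ≥0∞} {κ ρ : ℝ≥0∞} (hR : Measurable R) (hρ : ∫⁻ z, R z ≤ ρ)
    (hκ : ∀ x ∈ G, ∫⁻ x' in G, W x x' ≤ κ)
    (hW : ∀ x ∈ G, ∀ x' ∈ G, (q x).1 = (q x').1 →
      ENNReal.ofReal ((2 ^ (q x).1 : ℝ) ^ 2)⁻¹ *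
        ‖interact (φ (q x).2) (φ (q x').2) Y ((2 ^ (q x).1 : ℝ)⁻¹ • (x - x'))‖ₑ ≤
      W x x' + ENNReal.ofReal ((2 ^ (q x).1 : ℝ) ^ 2)⁻¹ *
        R ((2 ^ (q x).1 : ℝ)⁻¹ • (x - x'))) :
    l ^ 2 * volume G ≤ (∫⁻ y, ‖f y‖ₑ ^ 2) *
      (κ + (ρ + ENNReal.ofReal (196608 * A ^ 2 * B * ε⁻¹ * δ))) := by
  have hA := hF.nonneg
  have hδ := hF.pos
  set c := ENNReal.ofReal (384 * A ^ 2 * B * ε⁻¹ * δ) with hc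
  set H : ℂ → ℂ → ℝ≥0∞ := fun x x' => discW (2 ^ (q x).1) (x' - x) with hH
  have hHm : Measurable (Function.uncurry H) := measurable_discW_comp hq
  set P : ℂ → ℂ → ℝ≥0∞ := fun x x' => ENNReal.ofReal ((2 ^ (q x).1 : ℝ) ^ 2)⁻¹ *
        R ((2 ^ (q x).1 : ℝ)⁻¹ • (x - x')) with hP
  have hPm : ∀ x, Measurable (P x) := fun x => by
    have h : Measurable fun x' : ℂ => (2 ^ (q x).1 : ℝ)⁻¹ • (x - x') := by fun_prop
    exact (hR.comp h).const_mul _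
  have hpt : ∀ x ∈ G, ∀ x' ∈ G,
      ‖∫ y, labK φ Y (q x) (y - x) * labK φ Y (q x') (y - x')‖ₑ ≤
        W x x' + (P x x' + (c * H x x' + c * H x' x)) := by
    intro x hx x' hx'
    rcases lt_trichotomy (q x).1 (q x').1 with h | h | h
    · have := hF.enorm_corr_le_discW hY hε hε' hB hL (hT _ (hqT x') _ (hqT x) h) x' x
      rw [show (fun y => labK φ Y (q x) (y - x) * labK φ Y (q x') (y - x')) =
        fun y => labK φ Y (q x') (y - x') * labK φ Y (q x) (y - x) from
          funext fun y => mul_comm _ _]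
      exact this.trans (le_add_left (le_add_left (le_add_left le_rfl)))
    · have := hW x hx x' hx' h
      unfold labK
      rw [← h, integral_kerS_mul_kerS _ _ _ (by positivity), enorm_mul,
        Real.enorm_of_nonneg (by positivity)]
      refine this.trans ?_
      rw [← add_assoc]
      exact le_add_right le_rfl
    · have := hF.enorm_corr_le_discW hY hε hε' hB hL (hT _ (hqT x) _ (hqT x') h) x x'
      exact this.trans (le_add_left (le_add_left (le_add_right le_rfl)))
  have hHrow : ∀ x, ∫⁻ x' in G, H x x' ≤ ENNReal.ofReal 256 := fun x =>
    (setLIntegral_le_lintegral _ _).trans (by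
      rw [hH]
      simp only
      rw [lintegral_sub_right_eq_self (fun z => discW (2 ^ (q x).1) z)]
      exact lintegral_discW_le (by positivity))
  have hprow : ∀ x, ∫⁻ x' in G, P x x' ≤ ρ := fun x =>
    (setLIntegral_le_lintegral _ _).trans (by
      refine le_trans (le_of_eq ?_) hρ
      have h1 := lintegral_scale (fun z => R (-z)) (s := (2 ^ (q x).1 : ℝ)) (by positivity) x
      rw [lintegral_neg_eq_self] at h1
      rw [← h1]
      refine lintegral_congr fun y => ?_
      rw [hP, ← smul_neg, neg_sub])
  have hcorr := setLIntegral_row_le hGm hPm hHm hpt hκ hprow hHrow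
  have hmain := hF.sq_measure_le hY.measurable hY.abs_le_one hq hqT hG hf hfi
    ((ae_restrict_mem hGm).mono hl)
  have h2 : 2 * (c * ENNReal.ofReal 256) = ENNReal.ofReal (196608 * A ^ 2 * B * ε⁻¹ * δ) := by
    rw [hc, ← ENNReal.ofReal_mul (by positivity), ← ENNReal.ofReal_ofNat 2,
      ← ENNReal.ofReal_mul (by norm_num)]
    ring_nf
  rw [h2] at hcorr
  exact sq_mul_le_of_sq_mul_le hmain hcorr hG

end Family

/-- The derivative of the standard smooth transition function. -/
noncomputable def bump (s : ℝ) : ℝ := deriv Real.smoothTransition s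

lemma contDiff_smoothTransition : ContDiff ℝ 2 Real.smoothTransition :=
  Real.smoothTransition.contDiff (n := 2)

lemma hasDerivAt_smoothTransition (s : ℝ) : HasDerivAt Real.smoothTransition (bump s) s :=
  (contDiff_smoothTransition.differentiable (by norm_num) s).hasDerivAt

lemma contDiff_bump : ContDiff ℝ 1 bump := by
  have h : ContDiff ℝ (1 + 1) Real.smoothTransition := contDiff_smoothTransition
  exact (contDiff_succ_iff_deriv.1 h).2.2

lemma continuous_bump : Continuous bump := contDiff_bump.continuous

lemma bump_eq_zero {s : ℝ} (hs : s < 0 ∨ 1 < s) : bump s = 0 := by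
  rcases hs with hs | hs
  · have : Real.smoothTransition =ᶠ[𝓝 s] fun _ => 0 := by
      filter_upwards [eventually_lt_nhds hs] with y hy
      exact Real.smoothTransition.zero_of_nonpos hy.le
    rw [bump, this.deriv_eq, deriv_const]
  · have : Real.smoothTransition =ᶠ[𝓝 s] fun _ => 1 := by
      filter_upwards [eventually_gt_nhds hs] with y hy
      exact Real.smoothTransition.one_of_one_le hy.le
    rw [bump, this.deriv_eq, deriv_const]

lemma bump_nonneg (s : ℝ) : 0 ≤ bump s := Real.smoothTransition.monotone.deriv_nonneg

lemma exists_bump_bounds : ∃ A : ℝ, 1 ≤ A ∧ (∀ s, |bump s| ≤ A) ∧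
    (∀ s s', |bump s - bump s'| ≤ A * |s - s'|) ∧
    ∀ s s', |Real.smoothTransition s - Real.smoothTransition s'| ≤ A * |s - s'| := by
  have hb : HasCompactSupport bump :=
    HasCompactSupport.intro (isCompact_Icc (a := (0 : ℝ)) (b := 1)) fun x hx => bump_eq_zero (by
      by_contra h
      push Not at h
      exact hx ⟨h.1, h.2⟩)
  have hd : Continuous (deriv bump) := contDiff_bump.continuous_deriv le_rfl
  obtain ⟨A1, h1⟩ := hb.exists_bound_of_continuous continuous_bump
  obtain ⟨A2, h2⟩ := hb.deriv.exists_bound_of_continuous hd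
  refine ⟨max 1 (max A1 A2), le_max_left _ _, fun s => ?_, fun s s' => ?_, fun s s' => ?_⟩
  · exact (h1 s).trans ((le_max_left _ _).trans (le_max_right _ _))
  · exact convex_univ.norm_image_sub_le_of_norm_deriv_le (𝕜 := ℝ) (f := bump) (x := s') (y := s)
      (fun x _ => contDiff_bump.differentiable (by norm_num) x)
      (fun x _ => (h2 x).trans ((le_max_right _ _).trans (le_max_right _ _)))
      (Set.mem_univ _) (Set.mem_univ _)
  · exact convex_univ.norm_image_sub_le_of_norm_deriv_le (𝕜 := ℝ)
      (f := Real.smoothTransition) (x := s') (y := s)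
      (fun x _ => contDiff_smoothTransition.differentiable (by norm_num) x)
      (fun x _ => (h1 x).trans ((le_max_left _ _).trans (le_max_right _ _)))
      (Set.mem_univ _) (Set.mem_univ _)

/-- Differences of smooth cutoffs at consecutive dyadic thicknesses are profiles. -/
lemma isProfile_smoothTransition {A δ : ℝ} (hδ : 0 < δ) (hA : 1 ≤ A) (hb : ∀ s, |bump s| ≤ A)
    (hl : ∀ s s', |bump s - bump s'| ≤ A * |s - s'|) {τ τ' : ℝ} (h1 : τ ≤ τ')
    (h2 : τ' ≤ τ + δ / 2) :
    IsProfile (5 * A) δ τ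
      (fun s => Real.smoothTransition (2 / δ * (s - τ')) - Real.smoothTransition (1 / δ * (s - τ)))
      (fun s => 2 / δ * bump (2 / δ * (s - τ')) - 1 / δ * bump (1 / δ * (s - τ))) := by
  have key : ∀ s, δ < |s - τ| → (2 / δ * (s - τ') < 0 ∧ 1 / δ * (s - τ) < 0) ∨
      (1 < 2 / δ * (s - τ') ∧ 1 < 1 / δ * (s - τ)) := by
    intro s hs
    rcases lt_abs.1 hs with h | h
    · right
      rw [div_mul_eq_mul_div, div_mul_eq_mul_div, one_lt_div hδ, one_lt_div hδ]
      constructor <;> linarith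
    · left
      constructor <;> exact mul_neg_of_pos_of_neg (by positivity) (by linarith)
  constructor
  · intro s
    have e1 : HasDerivAt (fun s : ℝ => 2 / δ * (s - τ')) (2 / δ) s := by
      simpa using ((hasDerivAt_id s).sub_const τ').const_mul (2 / δ)
    have e2 : HasDerivAt (fun s : ℝ => 1 / δ * (s - τ)) (1 / δ) s := by
      simpa using ((hasDerivAt_id s).sub_const τ).const_mul (1 / δ)
    have f1 := (hasDerivAt_smoothTransition (2 / δ * (s - τ'))).comp s e1
    have f2 := (hasDerivAt_smoothTransition (1 / δ * (s - τ))).comp s e2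
    have := f1.sub f2
    rw [mul_comm (bump _), mul_comm (bump _)] at this
    exact this
  · intro s
    have a1 := Real.smoothTransition.nonneg (2 / δ * (s - τ'))
    have a2 := Real.smoothTransition.le_one (2 / δ * (s - τ'))
    have a3 := Real.smoothTransition.nonneg (1 / δ * (s - τ))
    have a4 := Real.smoothTransition.le_one (1 / δ * (s - τ))
    rw [abs_le]
    constructor <;> linarith
  · intro s
    refine (abs_sub _ _).trans ?_
    rw [abs_mul, abs_mul, abs_of_pos (a := 2 / δ) (by positivity),
      abs_of_pos (a := 1 / δ) (by positivity)]
    calc 2 / δ * |_| + 1 / δ * |_| ≤ 2 / δ * A + 1 / δ * A := by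
          gcongr <;> apply hb
      _ = 3 * A / δ := by ring
      _ ≤ _ := by gcongr; norm_num
  · intro s s'
    have e1 := hl (2 / δ * (s - τ')) (2 / δ * (s' - τ'))
    have e2 := hl (1 / δ * (s - τ)) (1 / δ * (s' - τ))
    rw [← mul_sub, sub_sub_sub_cancel_right, abs_mul, abs_of_pos (a := 2 / δ)
      (by positivity)] at e1
    rw [← mul_sub, sub_sub_sub_cancel_right, abs_mul, abs_of_pos (a := 1 / δ)
      (by positivity)] at e2
    rw [show ∀ a b c d : ℝ, 2 / δ * a - 1 / δ * b - (2 / δ * c - 1 / δ * d) =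
      2 / δ * (a - c) - 1 / δ * (b - d) by intros; ring]
    refine (abs_sub _ _).trans ?_
    rw [abs_mul, abs_mul, abs_of_pos (a := 2 / δ) (by positivity),
      abs_of_pos (a := 1 / δ) (by positivity)]
    calc 2 / δ * |_| + 1 / δ * |_|
        ≤ 2 / δ * (A * (2 / δ * |s - s'|)) + 1 / δ * (A * (1 / δ * |s - s'|)) := by gcongr
      _ = _ := by field_simp; ring
  · intro s hs
    rcases key s hs with ⟨h, h'⟩ | ⟨h, h'⟩
    · rw [Real.smoothTransition.zero_of_nonpos h.le, Real.smoothTransition.zero_of_nonpos h'.le,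
        sub_zero]
    · rw [Real.smoothTransition.one_of_one_le h.le, Real.smoothTransition.one_of_one_le h'.le,
        sub_self]
  · intro s hs
    rcases key s hs with ⟨h, h'⟩ | ⟨h, h'⟩
    · rw [bump_eq_zero (Or.inl h), bump_eq_zero (Or.inl h')]; ring
    · rw [bump_eq_zero (Or.inr h), bump_eq_zero (Or.inr h')]; ring

/-- A compactly supported piece of a partition of unity of the line by translates. -/
noncomputable def hat (s : ℝ) : ℝ := Real.smoothTransition (s + 1) - Real.smoothTransition s

lemma hat_nonneg (s : ℝ) : 0 ≤ hat s :=
  sub_nonneg.2 (Real.smoothTransition.monotone (by linarith))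

lemma hat_le_one (s : ℝ) : hat s ≤ 1 := by
  have a1 := Real.smoothTransition.le_one (s + 1)
  have a2 := Real.smoothTransition.nonneg s
  unfold hat
  linarith

lemma hat_eq_zero {s : ℝ} (hs : 1 < |s|) : hat s = 0 := by
  unfold hat
  rcases lt_abs.1 hs with h | h
  · rw [Real.smoothTransition.one_of_one_le h.le,
      Real.smoothTransition.one_of_one_le (by linarith), sub_self]
  · rw [Real.smoothTransition.zero_of_nonpos (by linarith),
      Real.smoothTransition.zero_of_nonpos (by linarith), sub_self]

lemma continuous_hat : Continuous hat :=
  (Real.smoothTransition.continuous.comp (continuous_id.add continuous_const)).sub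
    Real.smoothTransition.continuous

lemma differentiable_hat : Differentiable ℝ hat := by
  have h := contDiff_smoothTransition.differentiable (by norm_num)
  unfold hat
  fun_prop

lemma sum_hat {m : ℕ} {s : ℝ} (hs : |s| ≤ m) :
    ∑ i ∈ Finset.range (2 * m + 1), hat (s - ((i : ℝ) - m)) = 1 := by
  have h := abs_le.1 hs
  have h1 : ∀ i : ℕ, hat (s - ((i : ℝ) - m)) =
      (fun i : ℕ => Real.smoothTransition (s - ((i : ℝ) - m) + 1)) i -
      (fun i : ℕ => Real.smoothTransition (s - ((i : ℝ) - m) + 1)) (i + 1) := by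
    intro i
    simp only [hat]
    push_cast
    congr 2
    ring
  rw [Finset.sum_congr rfl fun i _ => h1 i, Finset.sum_range_sub',
    Real.smoothTransition.one_of_one_le, Real.smoothTransition.zero_of_nonpos, sub_zero]
  · push_cast; linarith
  · push_cast; linarith

lemma abs_hat_sub_le {A : ℝ} (hl : ∀ s s', |Real.smoothTransition s - Real.smoothTransition s'| ≤
    A * |s - s'|) (s s' : ℝ) : |hat s - hat s'| ≤ 2 * A * |s - s'| := by
  have e1 := hl (s + 1) (s' + 1)
  have e2 := hl s s'
  rw [add_sub_add_right_eq_sub] at e1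
  unfold hat
  rw [show ∀ a b c d : ℝ, a - b - (c - d) = (a - c) - (b - d) by intros; ring]
  exact (abs_sub _ _).trans (by linarith)

/-- The angular cutoff centred at the point `c / M` in the plane. -/
noncomputable def angCut (M : ℝ) (c w : ℂ) : ℝ :=
  hat (M * (w.re / ‖w‖) - c.re) * hat (M * (w.im / ‖w‖) - c.im)

lemma norm_unit_sub_le {w w' : ℂ} (hw : 1 / 2 ≤ ‖w‖) :
    ‖w / (‖w‖ : ℂ) - w' / (‖w'‖ : ℂ)‖ ≤ 4 * ‖w - w'‖ := by
  by_cases hw' : w' = 0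
  · subst hw'
    have : (‖w‖ : ℂ) ≠ 0 := by exact_mod_cast (by linarith : ‖w‖ ≠ 0)
    simp only [norm_zero, Complex.ofReal_zero, div_zero, sub_zero, norm_div, Complex.norm_real,
      norm_norm]
    rw [div_self (by linarith)]
    linarith
  have h0 : (‖w‖ : ℂ) ≠ 0 := by
    intro h
    have : ‖w‖ = 0 := by exact_mod_cast h
    linarith
  have h0' : (‖w'‖ : ℂ) ≠ 0 := by
    intro h
    have : ‖w'‖ = 0 := by exact_mod_cast h
    exact hw' (norm_eq_zero.1 this)
  have hid : w / (‖w‖ : ℂ) - w' / (‖w'‖ : ℂ) = (w - w') / (‖w‖ : ℂ) +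
      w' / (‖w'‖ : ℂ) * (((‖w'‖ - ‖w‖ : ℝ) : ℂ) / (‖w‖ : ℂ)) := by
    push_cast
    field_simp
    ring
  have hw'n : ‖w'‖ ≠ 0 := norm_ne_zero_iff.2 hw'
  rw [hid]
  refine (norm_add_le _ _).trans ?_
  rw [norm_mul, norm_div, norm_div, norm_div, Complex.norm_real, Complex.norm_real,
    Complex.norm_real, norm_norm, norm_norm, div_self hw'n, one_mul, Real.norm_eq_abs, ← add_div,
    div_le_iff₀ (by linarith)]
  have h1 := abs_norm_sub_norm_le w' w
  rw [norm_sub_rev w' w] at h1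
  nlinarith [norm_nonneg (w - w')]

lemma exists_partition : ∃ B : ℝ, 1 ≤ B ∧ ∀ ε : ℝ, 0 < ε → ε ≤ 1 → ∃ (S : Finset (ℕ × ℕ))
    (θ : ℕ × ℕ → ℂ) (Y : ℕ × ℕ → ℂ → ℝ), (S.card : ℝ) ≤ 121 * ε⁻¹ ^ 2 ∧
    (∀ c, IsCutoff B ε (θ c) (Y c)) ∧ ∀ w, ∑ c ∈ S, Y c w = 1 := by
  obtain ⟨A, hA, -, -, hl⟩ := exists_bump_bounds
  refine ⟨64 * A, by linarith, fun ε hε hε1 => ?_⟩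
  set M : ℝ := 4 / ε with hM
  have hM0 : 0 < M := by positivity
  set m : ℕ := ⌈M⌉₊ with hm
  have hmM : M ≤ m := Nat.le_ceil M
  have hmM' : (m : ℝ) < M + 1 := Nat.ceil_lt_add_one hM0.le
  set z : ℕ × ℕ → ℂ := fun c => ⟨(c.1 : ℝ) - m, (c.2 : ℝ) - m⟩ with hz
  have hre : ∀ w : ℂ, |w.re / ‖w‖| ≤ 1 := fun w => by
    rw [abs_div, abs_norm]; exact div_le_one_of_le₀ (Complex.abs_re_le_norm w) (norm_nonneg _)
  have him : ∀ w : ℂ, |w.im / ‖w‖| ≤ 1 := fun w => by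
    rw [abs_div, abs_norm]; exact div_le_one_of_le₀ (Complex.abs_im_le_norm w) (norm_nonneg _)
  have hunit : ∀ w : ℂ, (w / (‖w‖ : ℂ)).re = w.re / ‖w‖ ∧ (w / (‖w‖ : ℂ)).im = w.im / ‖w‖ :=
    fun w => ⟨Complex.div_ofReal_re _ _, Complex.div_ofReal_im _ _⟩
  have hclose : ∀ (c w w' : ℂ), angCut M c w ≠ 0 → angCut M c w' ≠ 0 →
      ‖w / (‖w‖ : ℂ) - w' / (‖w'‖ : ℂ)‖ ≤ ε := by
    intro c w w' h h'
    have p : ∀ v, angCut M c v ≠ 0 → |M * (v.re / ‖v‖) - c.re| ≤ 1 ∧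
        |M * (v.im / ‖v‖) - c.im| ≤ 1 := by
      intro v hv
      constructor
      · by_contra hh
        exact hv (by rw [angCut, hat_eq_zero (not_le.1 hh), zero_mul])
      · by_contra hh
        exact hv (by rw [angCut, hat_eq_zero (not_le.1 hh), mul_zero])
    have q : ∀ a b e : ℝ, |M * a - e| ≤ 1 → |M * b - e| ≤ 1 → |a - b| ≤ ε / 2 := by
      intro a b e h1 h2
      have h3 : |M * (a - b)| ≤ 2 := by
        rw [show M * (a - b) = (M * a - e) - (M * b - e) by ring]
        exact (abs_sub _ _).trans (by linarith)
      rw [abs_mul, abs_of_pos hM0, hM, div_mul_eq_mul_div, div_le_iff₀ hε] at h3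
      linarith
    refine (Complex.norm_le_abs_re_add_abs_im _).trans ?_
    rw [Complex.sub_re, Complex.sub_im, (hunit w).1, (hunit w').1, (hunit w).2, (hunit w').2]
    have := q _ _ _ (p w h).1 (p w' h').1
    have := q _ _ _ (p w h).2 (p w' h').2
    linarith
  have hzero : ∀ c w : ℂ, angCut M c w ≠ 0 → w ≠ 0 → ‖w / (‖w‖ : ℂ)‖ = 1 := by
    intro c w _ hw
    rw [norm_div, Complex.norm_real, norm_norm, div_self (norm_ne_zero_iff.2 hw)]
  have hcenter : ∀ c : ℂ, ∃ θ : ℂ, ‖θ‖ = 1 ∧ ∀ w, w ≠ 0 → angCut M c w ≠ 0 →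
      ‖w / (‖w‖ : ℂ) - θ‖ ≤ ε := by
    intro c
    by_cases h : ∃ w0 : ℂ, w0 ≠ 0 ∧ angCut M c w0 ≠ 0
    · obtain ⟨w0, h0, h1⟩ := h
      exact ⟨w0 / (‖w0‖ : ℂ), hzero c w0 h1 h0, fun w _ h' => hclose c w w0 h' h1⟩
    · push Not at h
      exact ⟨1, norm_one, fun w h0 h' => absurd (h w h0) h'⟩
  choose θ hθ1 hθ2 using hcenter
  refine ⟨Finset.range (2 * m + 1) ×ˢ Finset.range (2 * m + 1), fun c => θ (z c),
    fun c => angCut M (z c), ?_, ?_, ?_⟩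
  · rw [Finset.card_product, Finset.card_range]
    have h1 : 2 * (m : ℝ) + 1 ≤ 11 * ε⁻¹ := by
      have h2 : 1 ≤ ε⁻¹ := (one_le_inv₀ hε).2 hε1
      have h3 : M = 4 * ε⁻¹ := by rw [hM, div_eq_mul_inv]
      linarith
    push_cast
    calc (2 * (m : ℝ) + 1) * (2 * m + 1) ≤ (11 * ε⁻¹) * (11 * ε⁻¹) := by gcongr
      _ = _ := by ring
  · intro c
    have hlip : ∀ w w' : ℂ, 1 / 2 ≤ ‖w‖ →
        |angCut M (z c) w - angCut M (z c) w'| ≤ 64 * A / ε * ‖w - w'‖ := by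
      intro w w' hw
      have h1 := norm_unit_sub_le (w' := w') hw
      have h2 := (Complex.abs_re_le_norm _).trans h1
      have h3 := (Complex.abs_im_le_norm _).trans h1
      rw [Complex.sub_re, (hunit w).1, (hunit w').1] at h2
      rw [Complex.sub_im, (hunit w).2, (hunit w').2] at h3
      unfold angCut
      rw [show ∀ a b c d : ℝ, a * b - c * d = (a - c) * b + c * (b - d) by intros; ring]
      refine (abs_add_le _ _).trans ?_
      rw [abs_mul, abs_mul]
      have g1 := abs_hat_sub_le hl (M * (w.re / ‖w‖) - (z c).re) (M * (w'.re / ‖w'‖) - (z c).re)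
      have g2 := abs_hat_sub_le hl (M * (w.im / ‖w‖) - (z c).im) (M * (w'.im / ‖w'‖) - (z c).im)
      rw [sub_sub_sub_cancel_right, ← mul_sub, abs_mul, abs_of_pos hM0] at g1 g2
      have b1 : ∀ s, |hat s| ≤ 1 := fun s => by
        rw [abs_of_nonneg (hat_nonneg s)]; exact hat_le_one s
      calc _ ≤ 2 * A * (M * (4 * ‖w - w'‖)) * 1 + 1 * (2 * A * (M * (4 * ‖w - w'‖))) := by
            gcongr
            · exact g1.trans (by gcongr)
            · exact b1 _
            · exact b1 _
            · exact g2.trans (by gcongr)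
        _ = _ := by rw [hM]; ring
    constructor
    · unfold angCut
      have := continuous_hat.measurable
      fun_prop
    · exact fun w => mul_nonneg (hat_nonneg _) (hat_nonneg _)
    · exact fun w => mul_le_one₀ (hat_le_one _) (hat_nonneg _) (hat_le_one _)
    · intro s w hs
      simp only [angCut]
      rw [norm_mul, Complex.norm_real, Real.norm_eq_abs, abs_of_pos hs, Complex.re_ofReal_mul,
        Complex.im_ofReal_mul, mul_div_mul_left _ _ hs.ne', mul_div_mul_left _ _ hs.ne']
    · intro w hw
      have hw0 : w ≠ 0 := by
        rintro rfl
        rw [norm_zero] at hw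
        linarith
      have d1 : DifferentiableAt ℝ (fun w : ℂ => ‖w‖) w := (contDiffAt_norm ℝ hw0).differentiableAt
        (n := 1) (by norm_num)
      have d2 : DifferentiableAt ℝ (fun w : ℂ => w.re) w := Complex.reCLM.differentiableAt
      have d3 : DifferentiableAt ℝ (fun w : ℂ => w.im) w := Complex.imCLM.differentiableAt
      have hn : ‖w‖ ≠ 0 := norm_ne_zero_iff.2 hw0
      have e1 : DifferentiableAt ℝ (fun w : ℂ => M * (w.re / ‖w‖) - (z c).re) w :=
        by
        simp only [div_eq_mul_inv]
        exact ((d2.mul (d1.inv hn)).const_mul M).sub_const _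
      have e2 : DifferentiableAt ℝ (fun w : ℂ => M * (w.im / ‖w‖) - (z c).im) w :=
        by
        simp only [div_eq_mul_inv]
        exact ((d3.mul (d1.inv hn)).const_mul M).sub_const _
      exact ((differentiable_hat _).comp w e1).mul ((differentiable_hat _).comp w e2)
    · intro w hw
      refine norm_fderiv_le_of_lip' ℝ (by positivity) (Eventually.of_forall fun w' => ?_)
      rw [Real.norm_eq_abs, abs_sub_comm, norm_sub_rev w' w]
      exact hlip w w' hw
    · exact hθ1 _
    · intro w hw
      by_contra h
      have hw0 : w ≠ 0 := by
        rintro rfl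
        simp at hw
      have h1 := hθ2 _ w hw0 h
      have hn : 0 < ‖w‖ := norm_pos_iff.2 hw0
      have hnc : (‖w‖ : ℂ) ≠ 0 := by exact_mod_cast hn.ne'
      have h2 : w - ‖w‖ * θ (z c) = ‖w‖ * (w / (‖w‖ : ℂ) - θ (z c)) := by field_simp
      rw [h2, norm_mul, Complex.norm_real, norm_norm, mul_comm] at hw
      exact absurd h1 (not_le.2 (lt_of_mul_lt_mul_left hw hn.le))
  · intro w
    rw [Finset.sum_product]
    have hb : ∀ a : ℝ, |a| ≤ 1 → |M * a| ≤ m := fun a ha => by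
      rw [abs_mul, abs_of_pos hM0]
      nlinarith
    simp only [angCut, hz]
    simp_rw [← Finset.mul_sum]
    rw [← Finset.sum_mul, sum_hat (hb _ (hre w)), sum_hat (hb _ (him w)), one_mul]

lemma abs_det_eq {a b c : ℂ} (ha : ‖a‖ = 1) (hb : ‖b‖ = 1) (hc : ‖c‖ = 1) :
    2 * |(star (b - a) * (c - a)).im| = ‖b - a‖ * ‖c - a‖ * ‖b - c‖ := by
  have h : ∀ z : ℂ, ‖z‖ = 1 → z * star z = 1 := fun z hz => by
    have := Complex.mul_conj z
    rw [Complex.normSq_eq_norm_sq, hz] at this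
    simpa using this
  have ha' := h a ha
  have hb' := h b hb
  have hc' := h c hc
  have key : (star (b - a) * (c - a) - star (star (b - a) * (c - a))) * (a * b * c) =
      (b - a) * (c - a) * (b - c) := by
    simp only [star_mul, star_sub, star_star]
    linear_combination (a * c * (c - a)) * hb' - (b * c * (c - a)) * ha' -
      (b - a) * (a * b * hc' - b * c * ha')
  have h2 : star (b - a) * (c - a) - star (star (b - a) * (c - a)) =
      ((2 * (star (b - a) * (c - a)).im : ℝ) : ℂ) * Complex.I := Complex.sub_conj _
  have := congrArg norm key
  rw [h2] at this
  simp only [norm_mul, ha, hb, hc, Complex.norm_I, Complex.norm_real, mul_one,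
    Real.norm_eq_abs] at this
  rw [← this, abs_two]

/-- Two transversal approximate linear constraints confine a vector. -/
lemma norm_le_of_two_constraints {A B u : ℂ} {d e D : ℝ} (hA : ‖A‖ ≤ 2) (hB : ‖B‖ ≤ 2)
    (hD : D ≤ |(star A * B).im|) (h1 : |(star A * u).re| ≤ d + e * ‖u‖)
    (h2 : |(star B * u).re| ≤ d + e * ‖u‖) : ‖u‖ * D ≤ 4 * (d + e * ‖u‖) := by
  have hid : u * ((star A * B).im : ℂ) =
      Complex.I * (((star B * u).re : ℂ) * A - ((star A * u).re : ℂ) * B) := by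
    apply Complex.ext
    · simp [Complex.mul_re, Complex.mul_im]; ring
    · simp [Complex.mul_re, Complex.mul_im]; ring
  have := congrArg norm hid
  rw [norm_mul, norm_mul, Complex.norm_I, one_mul, Complex.norm_real, Real.norm_eq_abs] at this
  calc ‖u‖ * D ≤ ‖u‖ * |(star A * B).im| := by gcongr
    _ = _ := this
    _ ≤ |(star B * u).re| * ‖A‖ + |(star A * u).re| * ‖B‖ := by
        refine (norm_sub_le _ _).trans (le_of_eq ?_)
        rw [norm_mul, norm_mul, Complex.norm_real, Complex.norm_real, Real.norm_eq_abs,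
          Real.norm_eq_abs]
    _ ≤ (d + e * ‖u‖) * 2 + (d + e * ‖u‖) * 2 := by
        have := (abs_nonneg _).trans h1
        gcongr
    _ = _ := by ring

lemma sgnNorm_sq (θ z : ℂ) : sgnNorm θ z ^ 2 = ‖z‖ ^ 2 := by
  unfold sgnNorm; split_ifs <;> ring

lemma abs_sgnNorm (θ z : ℂ) : |sgnNorm θ z| = ‖z‖ := by
  unfold sgnNorm; split_ifs <;> simp

lemma abs_re_star_mul_le {θ v : ℂ} (hθ : ‖θ‖ = 1) : |(star θ * v).re| ≤ ‖v‖ := by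
  refine (Complex.abs_re_le_norm _).trans ?_
  rw [norm_mul, norm_star, hθ, one_mul]

/-- On the double cone around `θ`, the signed norm is almost linear. -/
lemma abs_sgnNorm_sub_le {ε : ℝ} {θ z z' : ℂ} (hθ : ‖θ‖ = 1) (hε : 0 < ε) (hε' : ε ≤ 1 / 8)
    (hz : IsDir ε θ z) (hz' : IsDir ε θ z') :
    |sgnNorm θ z - sgnNorm θ z' - (star θ * (z - z')).re| ≤ 8 * ε * ‖z - z'‖ := by
  unfold IsDir at hz hz'
  have hp := sgnNorm_sq θ z
  have hp' := sgnNorm_sq θ z'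
  have ha := abs_sgnNorm θ z
  have ha' := abs_sgnNorm θ z'
  rw [← ha] at hz
  rw [← ha'] at hz'
  set p := sgnNorm θ z
  set p' := sgnNorm θ z'
  have hθθ : (star θ * θ).re = 1 := by
    have := Complex.mul_conj θ
    rw [Complex.normSq_eq_norm_sq, hθ] at this
    rw [mul_comm]
    have h2 := congrArg Complex.re this
    simpa using h2
  by_cases hsig : 0 ≤ p * p'
  · have hsum : |p| + |p'| = |p + p'| := (abs_add_eq_add_abs_iff p p').2 (by
      rcases le_total 0 p with h | h <;> rcases le_total 0 p' with h' | h'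
      · exact Or.inl ⟨h, h'⟩
      · rcases h.eq_or_lt with h0 | h0
        · exact Or.inr ⟨h0.symm.le, h'⟩
        · exact Or.inl ⟨h, by nlinarith⟩
      · rcases h'.eq_or_lt with h0 | h0
        · exact Or.inr ⟨h, h0.symm.le⟩
        · exact Or.inl ⟨by nlinarith, h'⟩
      · exact Or.inr ⟨h, h'⟩) |>.symm
    set e := (z - p * θ) + (z' - p' * θ) with he
    have hen : ‖e‖ ≤ 4 * ε * |p + p'| := by
      rw [← hsum, mul_add]
      exact (norm_add_le _ _).trans (add_le_add hz hz')
    have hprod : (p - p') * (p + p') = (star (z + z') * (z - z')).re := by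
      have h1 : (star (z + z') * (z - z')).re = ‖z‖ ^ 2 - ‖z'‖ ^ 2 := by
        rw [← Complex.normSq_eq_norm_sq, ← Complex.normSq_eq_norm_sq, Complex.normSq_apply,
          Complex.normSq_apply]
        simp [Complex.mul_re]
        ring
      rw [h1, ← hp, ← hp']; ring
    have hzz : z + z' = ((p + p' : ℝ) : ℂ) * θ + e := by rw [he]; push_cast; ring
    have hkey : (p - p' - (star θ * (z - z')).re) * (p + p') = (star e * (z - z')).re := by
      rw [sub_mul, hprod, hzz]
      simp [Complex.mul_re, Complex.mul_im]
      ring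
    have habs : |p - p' - (star θ * (z - z')).re| * |p + p'| ≤
        (4 * ε * ‖z - z'‖) * |p + p'| := by
      rw [← abs_mul, hkey]
      refine (Complex.abs_re_le_norm _).trans ?_
      rw [norm_mul, norm_star]
      calc ‖e‖ * ‖z - z'‖ ≤ 4 * ε * |p + p'| * ‖z - z'‖ := by gcongr
        _ = _ := by ring
    have hn := norm_nonneg (z - z')
    by_cases h0 : p + p' = 0
    · rw [h0, abs_zero] at hsum
      have hp0 : p = 0 := abs_eq_zero.1 (by linarith [abs_nonneg p, abs_nonneg p'])
      have hp0' : p' = 0 := abs_eq_zero.1 (by linarith [abs_nonneg p, abs_nonneg p'])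
      rw [hp0, abs_zero] at ha
      rw [hp0', abs_zero] at ha'
      rw [norm_eq_zero.1 ha.symm, norm_eq_zero.1 ha'.symm, hp0, hp0']
      simp
    · have := le_of_mul_le_mul_right habs (abs_pos.2 h0)
      nlinarith
  · push Not at hsig
    have hsum : |p| + |p'| = |p - p'| := by
      rcases le_total 0 p with h | h <;> rcases le_total 0 p' with h' | h'
      · nlinarith
      · rw [abs_of_nonneg h, abs_of_nonpos h', abs_of_nonneg (by linarith)]; ring
      · rw [abs_of_nonpos h, abs_of_nonneg h', abs_of_nonpos (by linarith)]; ring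
      · nlinarith
    set e := (z - p * θ) - (z' - p' * θ) with he
    have hen : ‖e‖ ≤ 4 * ε * |p - p'| := by
      rw [← hsum, mul_add]
      exact (norm_sub_le _ _).trans (add_le_add hz hz')
    have hzz : z - z' = ((p - p' : ℝ) : ℂ) * θ + e := by rw [he]; push_cast; ring
    have hlow : |p - p'| ≤ 2 * ‖z - z'‖ := by
      have h1 : ‖((p - p' : ℝ) : ℂ) * θ‖ = |p - p'| := by
        rw [norm_mul, hθ, mul_one, Complex.norm_real, Real.norm_eq_abs]
      have h2 : ((p - p' : ℝ) : ℂ) * θ = (z - z') - e := by rw [hzz]; ring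
      rw [h2] at h1
      have := norm_sub_le (z - z') e
      have := abs_nonneg (p - p')
      nlinarith
    have hre : (star θ * (z - z')).re = (p - p') * (star θ * θ).re + (star θ * e).re := by
      rw [hzz]
      simp [Complex.mul_re, Complex.mul_im]
      ring
    rw [hre, hθθ]
    have h3 := abs_re_star_mul_le (v := e) hθ
    rw [show p - p' - ((p - p') * 1 + (star θ * e).re) = -(star θ * e).re by ring, abs_neg]
    refine h3.trans (hen.trans ?_)
    nlinarith

lemma wt_half_le {u : ℝ} {m : ℤ} (hm : m ≤ u) (hm' : u < m + 1) : wt (u / 2) ≤ 3 * wt m := by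
  have h1 : (1 + |(m : ℝ)|) / 2 ≤ 1 + |u / 2| := by
    rw [abs_div, abs_two]
    have : |(m : ℝ)| ≤ |u| + 1 := by
      rw [abs_le]
      constructor
      · linarith [neg_abs_le u]
      · linarith [le_abs_self u]
    linarith
  have h0 : 0 < 1 + |(m : ℝ)| := by positivity
  have h2 : (1 / 8) * (1 + |(m : ℝ)|) ^ 3 ≤ (1 + |u / 2|) ^ 3 := by
    calc (1 / 8) * (1 + |(m : ℝ)|) ^ 3 = ((1 + |(m : ℝ)|) / 2) ^ 3 := by ring
      _ ≤ _ := by gcongr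
  have h3 : 3⁻¹ * √((1 + |(m : ℝ)|) ^ 3) ≤ √((1 + |u / 2|) ^ 3) := by
    apply Real.le_sqrt_of_sq_le
    rw [mul_pow, Real.sq_sqrt (by positivity)]
    refine le_trans ?_ h2
    gcongr
    norm_num
  unfold wt
  calc (√((1 + |u / 2|) ^ 3))⁻¹ ≤ (3⁻¹ * √((1 + |(m : ℝ)|) ^ 3))⁻¹ := by gcongr
    _ = _ := by rw [mul_inv, inv_inv]

lemma wt_le_of_abs_le {u v : ℝ} (h : |u| ≤ |v|) : wt v ≤ wt u := by
  unfold wt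
  gcongr

lemma summable_wt : Summable fun m : ℤ => wt m := by
  have hnat : Summable fun n : ℕ => wt (n : ℝ) := by
    have h := (summable_nat_add_iff 1).2 (Real.summable_nat_rpow_inv (p := 3 / 2).2 (by norm_num))
    refine h.congr fun n => ?_
    have h0 : (0 : ℝ) ≤ 1 + n := by positivity
    rw [wt, abs_of_nonneg (by positivity), Real.sqrt_eq_rpow, ← Real.rpow_natCast,
      ← Real.rpow_mul h0]
    push_cast
    rw [add_comm]
    norm_num
  refine Summable.of_nat_of_neg ?_ ?_
  · simpa using hnat
  · refine hnat.congr fun n => ?_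
    simp [wt]

/-- The `ℓ¹` norm of the lattice weights. -/
noncomputable def wtSum : ℝ := ∑' m : ℤ, wt m

lemma tsum_ofReal_wt : ∑' m : ℤ, ENNReal.ofReal (3 * wt m) = ENNReal.ofReal (3 * wtSum) := by
  rw [wtSum, ← tsum_mul_left, ENNReal.ofReal_tsum_of_nonneg
    (fun m => mul_nonneg (by norm_num) (wt_pos _).le) (summable_wt.mul_left 3)]

/-- A measurable majorant for a product of two weights with transversal level sets. -/
lemma exists_majorant {E : Set ℂ} {g₁ g₂ : ℂ → ℝ} {δ ρ : ℝ} (hδ : 0 < δ) (hρ : 0 ≤ ρ)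
    (hD : ∀ v ∈ E, ∀ v' ∈ E, |g₁ v - g₁ v'| ≤ δ → |g₂ v - g₂ v'| ≤ δ → ‖v - v'‖ ≤ ρ) :
    ∃ H : ℂ → ℝ≥0∞, Measurable H ∧
      (∀ v ∈ E, ENNReal.ofReal (wt (g₁ v / δ / 2) * wt (g₂ v / δ / 2)) ≤ H v) ∧
      ∫⁻ v, H v ≤ ENNReal.ofReal (36 * wtSum ^ 2 * ρ ^ 2) := by
  classical
  let cell : ℤ × ℤ → Set ℂ := fun m => {v | v ∈ E ∧ ⌊g₁ v / δ⌋ = m.1 ∧ ⌊g₂ v / δ⌋ = m.2}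
  let b : ℤ × ℤ → Set ℂ := fun m => if h : (cell m).Nonempty then closedBall h.some ρ else ∅
  have hbm : ∀ m, MeasurableSet (b m) := by
    intro m
    simp only [b]
    split_ifs
    · exact measurableSet_closedBall
    · exact MeasurableSet.empty
  have hbv : ∀ m, volume (b m) ≤ ENNReal.ofReal (4 * ρ ^ 2) := by
    intro m
    simp only [b]
    split_ifs with h
    · rw [Complex.volume_closedBall, ← ENNReal.ofReal_pow hρ, ← ENNReal.ofReal_coe_nnreal,
        NNReal.coe_real_pi, ← ENNReal.ofReal_mul (by positivity)]
      apply ENNReal.ofReal_le_ofReal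
      nlinarith [Real.pi_lt_four, sq_nonneg ρ]
    · simp
  have hfl : ∀ a a' : ℝ, ⌊a / δ⌋ = ⌊a' / δ⌋ → |a - a'| ≤ δ := by
    intro a a' h
    have := Int.abs_sub_lt_one_of_floor_eq_floor h
    rw [← sub_div, abs_div, abs_of_pos hδ, div_lt_one hδ] at this
    exact this.le
  have hcell : ∀ m, cell m ⊆ b m := by
    intro m v hv
    have hne : (cell m).Nonempty := ⟨v, hv⟩
    have hs := hne.some_mem
    simp only [b, dif_pos hne, mem_closedBall, dist_eq_norm]
    exact hD v hv.1 _ hs.1 (hfl _ _ (hv.2.1.trans hs.2.1.symm)) (hfl _ _ (hv.2.2.trans hs.2.2.symm))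
  refine ⟨fun v => ∑' m : ℤ × ℤ, (b m).indicator
    (fun _ => ENNReal.ofReal (3 * wt m.1) * ENNReal.ofReal (3 * wt m.2)) v, ?_, ?_, ?_⟩
  · exact Measurable.tsum fun m => measurable_const.indicator (hbm m)
  · intro v hv
    set m : ℤ × ℤ := (⌊g₁ v / δ⌋, ⌊g₂ v / δ⌋) with hm
    have hvm : v ∈ b m := hcell m ⟨hv, rfl, rfl⟩
    refine le_trans ?_ (ENNReal.le_tsum m)
    rw [Set.indicator_of_mem hvm, ← ENNReal.ofReal_mul (mul_nonneg (by norm_num) (wt_pos _).le)]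
    apply ENNReal.ofReal_le_ofReal
    exact mul_le_mul (wt_half_le (Int.floor_le _) (Int.lt_floor_add_one _))
      (wt_half_le (Int.floor_le _) (Int.lt_floor_add_one _)) (wt_pos _).le
      (mul_nonneg (by norm_num) (wt_pos _).le)
  · rw [lintegral_tsum fun m => (measurable_const.indicator (hbm m)).aemeasurable]
    calc ∑' m : ℤ × ℤ, ∫⁻ v, (b m).indicator
          (fun _ => ENNReal.ofReal (3 * wt m.1) * ENNReal.ofReal (3 * wt m.2)) v
        ≤ ∑' m : ℤ × ℤ, ENNReal.ofReal (3 * wt m.1) * ENNReal.ofReal (3 * wt m.2) *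
          ENNReal.ofReal (4 * ρ ^ 2) := by
          refine ENNReal.tsum_le_tsum fun m => ?_
          rw [lintegral_indicator_const (hbm m)]
          gcongr
          exact hbv m
      _ = ENNReal.ofReal (3 * wtSum) * ENNReal.ofReal (3 * wtSum) * ENNReal.ofReal (4 * ρ ^ 2) := by
          rw [ENNReal.tsum_mul_right, ENNReal.tsum_prod']
          simp_rw [ENNReal.tsum_mul_left]
          rw [ENNReal.tsum_mul_right, tsum_ofReal_wt]
      _ = _ := by
          have hS : 0 ≤ wtSum := tsum_nonneg fun m => (wt_pos _).le
          rw [← ENNReal.ofReal_mul (by positivity), ← ENNReal.ofReal_mul (by positivity)]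
          ring_nf

open Classical in
/-- The tangential part of the kernel bounds. -/
noncomputable def tanK (δ ε r₀ : ℝ) (θ : ℂ) (u : ℝ) (z : ℂ) : ℝ :=
  if IsDir ε θ z ∧ r₀ ≤ ‖z‖ ∧ ‖z‖ ≤ 8 then (√(δ * ‖z‖))⁻¹ * wt ((u + sgnNorm θ z) / δ) else 0

lemma tanK_nonneg (δ ε r₀ : ℝ) (θ : ℂ) (u : ℝ) (z : ℂ) : 0 ≤ tanK δ ε r₀ θ u z := by
  unfold tanK
  split_ifs
  · exact mul_nonneg (by positivity) (wt_pos _).le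
  · exact le_rfl

/-- Transversality of the level sets of the signed distances. -/
lemma norm_sub_le_of_levels {δ ε ν : ℝ} {θ₀ θ₁ θ₂ y₀ y₁ y₂ v v' : ℂ} {τ₀ τ₁ τ₂ : ℝ}
    (hε : 0 < ε) (hν : 0 < ν) (hν1 : ν ≤ 1) (hεν : ε ≤ ν ^ 3 / 256)
    (h0 : ‖θ₀‖ = 1) (h1 : ‖θ₁‖ = 1) (h2 : ‖θ₂‖ = 1)
    (h01 : ν ≤ ‖θ₁ - θ₀‖) (h02 : ν ≤ ‖θ₂ - θ₀‖) (h12 : ν ≤ ‖θ₁ - θ₂‖)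
    (d0 : IsDir ε θ₀ (v - y₀)) (d1 : IsDir ε θ₁ (v - y₁)) (d2 : IsDir ε θ₂ (v - y₂))
    (d0' : IsDir ε θ₀ (v' - y₀)) (d1' : IsDir ε θ₁ (v' - y₁)) (d2' : IsDir ε θ₂ (v' - y₂))
    (hl1 : |(sgnNorm θ₁ (v - y₁) - τ₁ - (sgnNorm θ₀ (v - y₀) - τ₀)) -
      (sgnNorm θ₁ (v' - y₁) - τ₁ - (sgnNorm θ₀ (v' - y₀) - τ₀))| ≤ δ)
    (hl2 : |(sgnNorm θ₂ (v - y₂) - τ₂ - (sgnNorm θ₀ (v - y₀) - τ₀)) -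
      (sgnNorm θ₂ (v' - y₂) - τ₂ - (sgnNorm θ₀ (v' - y₀) - τ₀))| ≤ δ) :
    ‖v - v'‖ ≤ 16 * δ * ν⁻¹ ^ 3 := by
  have hν3 : ν ^ 3 ≤ 1 := pow_le_one₀ hν.le hν1
  have hε8 : ε ≤ 1 / 8 := by linarith
  have e0 := abs_sgnNorm_sub_le h0 hε hε8 d0 d0'
  have e1 := abs_sgnNorm_sub_le h1 hε hε8 d1 d1'
  have e2 := abs_sgnNorm_sub_le h2 hε hε8 d2 d2'
  rw [sub_sub_sub_cancel_right] at e0 e1 e2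
  have hdet := abs_det_eq h0 h1 h2
  have hD : ν ^ 3 / 2 ≤ |(star (θ₁ - θ₀) * (θ₂ - θ₀)).im| := by
    have : ν * ν * ν ≤ ‖θ₁ - θ₀‖ * ‖θ₂ - θ₀‖ * ‖θ₁ - θ₂‖ := by gcongr
    nlinarith
  have hA : ‖θ₁ - θ₀‖ ≤ 2 := (norm_sub_le _ _).trans (by rw [h0, h1]; norm_num)
  have hB : ‖θ₂ - θ₀‖ ≤ 2 := (norm_sub_le _ _).trans (by rw [h0, h2]; norm_num)
  have hre : ∀ a : ℂ, (star (a - θ₀) * (v - v')).re =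
      (star a * (v - v')).re - (star θ₀ * (v - v')).re := fun a => by
    rw [star_sub, sub_mul, Complex.sub_re]
  have c1 : |(star (θ₁ - θ₀) * (v - v')).re| ≤ δ + 16 * ε * ‖v - v'‖ := by
    rw [hre]
    rw [abs_le] at *
    constructor <;> linarith [hl1.1, hl1.2, e0.1, e0.2, e1.1, e1.2]
  have c2 : |(star (θ₂ - θ₀) * (v - v')).re| ≤ δ + 16 * ε * ‖v - v'‖ := by
    rw [hre]
    rw [abs_le] at *
    constructor <;> linarith [hl2.1, hl2.2, e0.1, e0.2, e2.1, e2.2]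
  have := norm_le_of_two_constraints hA hB hD c1 c2
  have hn := norm_nonneg (v - v')
  have h3 : ‖v - v'‖ * ν ^ 3 ≤ 16 * δ := by nlinarith
  rw [inv_pow, ← div_eq_mul_inv, le_div_iff₀ (by positivity)]
  exact h3

lemma wt_mul_wt_mul_wt_le {a b c : ℝ} (hb : |a| ≤ |b|) (hc : |a| ≤ |c|) :
    wt a * wt b * wt c ≤ wt ((b - a) / 2) * wt ((c - a) / 2) := by
  have h : ∀ x, |a| ≤ |x| → wt x ≤ wt ((x - a) / 2) := fun x hx => by
    apply wt_le_of_abs_le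
    rw [abs_div, abs_two]
    linarith [abs_sub x a]
  have h1 := wt_le_one a
  have p := fun x => (wt_pos x).le
  calc wt a * wt b * wt c ≤ 1 * wt b * wt c := by
        gcongr
        · exact p c
        · exact p b
    _ = wt b * wt c := by ring
    _ ≤ _ := mul_le_mul (h b hb) (h c hc) (p _) (p _)

lemma prod_wt_le (a b c : ℝ) : wt a * wt b * wt c ≤ wt ((b - a) / 2) * wt ((c - a) / 2) +
    wt ((a - b) / 2) * wt ((c - b) / 2) + wt ((a - c) / 2) * wt ((b - c) / 2) := by
  have q : ∀ x y, 0 ≤ wt x * wt y := fun x y => mul_nonneg (wt_pos x).le (wt_pos y).le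
  have q1 := q ((b - a) / 2) ((c - a) / 2)
  have q2 := q ((a - b) / 2) ((c - b) / 2)
  have q3 := q ((a - c) / 2) ((b - c) / 2)
  rcases le_total |a| |b| with h | h <;> rcases le_total |a| |c| with h' | h' <;>
    rcases le_total |b| |c| with h'' | h''
  all_goals first
    | (have := wt_mul_wt_mul_wt_le (a := a) (b := b) (c := c) (by linarith) (by linarith); linarith)
    | (have := wt_mul_wt_mul_wt_le (a := b) (b := a) (c := c) (by linarith) (by linarith); linarith)
    | (have := wt_mul_wt_mul_wt_le (a := c) (b := a) (c := b) (by linarith) (by linarith); linarith)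

lemma prod_inv_sqrt_le {δ r₀ a b c d : ℝ} (hδ : 0 < δ) (hr : 0 < r₀) (ha : r₀ ≤ a) (hb : r₀ ≤ b)
    (hc : r₀ ≤ c) (hd : 0 < d) (hab : d ≤ a + b) :
    (√(δ * a))⁻¹ * (√(δ * b))⁻¹ * (√(δ * c))⁻¹ ≤ (√(δ ^ 3))⁻¹ * r₀⁻¹ * (√(d / 2))⁻¹ := by
  have ha0 : 0 < a := hr.trans_le ha
  have hb0 : 0 < b := hr.trans_le hb
  have hc0 : 0 < c := hr.trans_le hc
  rw [← mul_inv, ← mul_inv, ← mul_inv, ← mul_inv, ← Real.sqrt_mul (by positivity),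
    ← Real.sqrt_mul (by positivity)]
  have : √(δ ^ 3) * r₀ * √(d / 2) = √(δ ^ 3 * r₀ ^ 2 * (d / 2)) := by
    rw [Real.sqrt_mul (by positivity), Real.sqrt_mul (by positivity), Real.sqrt_sq hr.le]
  rw [this]
  apply inv_anti₀ (Real.sqrt_pos.2 (by positivity))
  apply Real.sqrt_le_sqrt
  have h0 : r₀ ^ 2 * (d / 2) ≤ a * b * c := by
    rcases le_total a b with h | h
    · calc r₀ ^ 2 * (d / 2) ≤ r₀ ^ 2 * b := by gcongr; linarith
        _ = r₀ * r₀ * b := by ring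
        _ ≤ a * c * b := by gcongr
        _ = _ := by ring
    · calc r₀ ^ 2 * (d / 2) ≤ r₀ ^ 2 * a := by gcongr; linarith
        _ = a * r₀ * r₀ := by ring
        _ ≤ a * b * c := by gcongr
  calc δ ^ 3 * r₀ ^ 2 * (d / 2) = δ ^ 3 * (r₀ ^ 2 * (d / 2)) := by ring
    _ ≤ δ ^ 3 * (a * b * c) := by gcongr
    _ = _ := by ring

/-- The singular weight controlling three-fold interactions. -/
noncomputable def sing (y : ℂ) : ℝ≥0∞ :=
  (closedBall (0 : ℂ) 16).indicator (fun y => (ENNReal.ofReal √(‖y‖ / 2))⁻¹) y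

/-- The indicator of the disc of radius `16`. -/
noncomputable def ind16 (y : ℂ) : ℝ≥0∞ := (closedBall (0 : ℂ) 16).indicator (fun _ => 1) y

/-- The trilinear estimate at unit scale. -/
lemma trilinear_le {δ ε r₀ ν : ℝ} {θ₀ θ₁ θ₂ : ℂ} (hδ : 0 < δ) (hr : 0 < r₀)
    (hε : 0 < ε) (hν : 0 < ν) (hν1 : ν ≤ 1) (hεν : ε ≤ ν ^ 3 / 256)
    (h0 : ‖θ₀‖ = 1) (h1 : ‖θ₁‖ = 1) (h2 : ‖θ₂‖ = 1)
    (h01 : ν ≤ ‖θ₁ - θ₀‖) (h02 : ν ≤ ‖θ₂ - θ₀‖) (h12 : ν ≤ ‖θ₁ - θ₂‖)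
    (y₀ y₁ y₂ : ℂ) (τ₀ τ₁ τ₂ : ℝ) (T : ℂ → ℝ) :
    ∫⁻ v, ENNReal.ofReal (tanK δ ε r₀ θ₀ (T v - τ₀) (v - y₀)) *
      ENNReal.ofReal (tanK δ ε r₀ θ₁ (T v - τ₁) (v - y₁)) *
      ENNReal.ofReal (tanK δ ε r₀ θ₂ (T v - τ₂) (v - y₂)) ≤
    ENNReal.ofReal (27648 * wtSum ^ 2 * ((√(δ ^ 3))⁻¹ * r₀⁻¹ * (δ * ν⁻¹ ^ 3) ^ 2)) *
      (sing (y₁ - y₀) * ind16 (y₂ - y₀)) := by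
  have hw : 0 < wtSum := summable_wt.tsum_pos (fun m => (wt_pos _).le) 0 (wt_pos _)
  have hsup : ∀ (θ : ℂ) (u : ℝ) (z : ℂ), tanK δ ε r₀ θ u z ≠ 0 →
      IsDir ε θ z ∧ r₀ ≤ ‖z‖ ∧ ‖z‖ ≤ 8 := fun θ u z h => by
    by_contra h'
    exact h (if_neg h')
  set F : ℂ → ℝ≥0∞ := fun v => ENNReal.ofReal (tanK δ ε r₀ θ₀ (T v - τ₀) (v - y₀)) *
      ENNReal.ofReal (tanK δ ε r₀ θ₁ (T v - τ₁) (v - y₁)) *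
      ENNReal.ofReal (tanK δ ε r₀ θ₂ (T v - τ₂) (v - y₂)) with hF
  let E : Set ℂ := {v | (IsDir ε θ₀ (v - y₀) ∧ r₀ ≤ ‖v - y₀‖ ∧ ‖v - y₀‖ ≤ 8) ∧
    (IsDir ε θ₁ (v - y₁) ∧ r₀ ≤ ‖v - y₁‖ ∧ ‖v - y₁‖ ≤ 8) ∧
    (IsDir ε θ₂ (v - y₂) ∧ r₀ ≤ ‖v - y₂‖ ∧ ‖v - y₂‖ ≤ 8)}
  have hE : ∀ v, v ∉ E → F v = 0 := fun v hv => by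
    by_contra h
    apply hv
    simp only [hF, mul_ne_zero_iff, Ne, ENNReal.ofReal_eq_zero, not_le] at h
    exact ⟨hsup _ _ _ h.1.1.ne', hsup _ _ _ h.1.2.ne', hsup _ _ _ h.2.ne'⟩
  have hnear : ∀ v ∈ E, ‖y₁ - y₀‖ ≤ ‖v - y₀‖ + ‖v - y₁‖ ∧ ‖y₂ - y₀‖ ≤ ‖v - y₀‖ + ‖v - y₂‖ :=
    fun v _ => by
      constructor
      · rw [show y₁ - y₀ = (v - y₀) - (v - y₁) by ring]
        exact norm_sub_le _ _
      · rw [show y₂ - y₀ = (v - y₀) - (v - y₂) by ring]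
        exact norm_sub_le _ _
  by_cases hfar : ‖y₁ - y₀‖ ≤ 16 ∧ ‖y₂ - y₀‖ ≤ 16
  swap
  · have : ∀ v, F v = 0 := fun v => hE v fun hv => hfar
      ⟨by linarith [(hnear v hv).1, hv.1.2.2, hv.2.1.2.2],
        by linarith [(hnear v hv).2, hv.1.2.2, hv.2.2.2.2]⟩
    rw [lintegral_congr this, lintegral_zero]
    exact zero_le
  have hi : ind16 (y₂ - y₀) = 1 := by
    rw [ind16, Set.indicator_of_mem (by simpa using hfar.2)]
  have hs : sing (y₁ - y₀) = (ENNReal.ofReal √(‖y₁ - y₀‖ / 2))⁻¹ := by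
    rw [sing, Set.indicator_of_mem (by simpa using hfar.1)]
  rw [hi, mul_one, hs]
  by_cases hy : y₁ - y₀ = 0
  · rw [hy, norm_zero, zero_div, Real.sqrt_zero, ENNReal.ofReal_zero, ENNReal.inv_zero,
      ENNReal.mul_top]
    · exact le_top
    · rw [Ne, ENNReal.ofReal_eq_zero, not_le]
      positivity
  have hd : 0 < ‖y₁ - y₀‖ := norm_pos_iff.2 hy
  set ρ := 16 * δ * ν⁻¹ ^ 3 with hρ
  have hρ0 : 0 ≤ ρ := by positivity
  let g₀ : ℂ → ℝ := fun v => sgnNorm θ₀ (v - y₀) - τ₀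
  let g₁ : ℂ → ℝ := fun v => sgnNorm θ₁ (v - y₁) - τ₁
  let g₂ : ℂ → ℝ := fun v => sgnNorm θ₂ (v - y₂) - τ₂
  obtain ⟨H₀, hm₀, hb₀, hI₀⟩ := exists_majorant (E := E) (g₁ := fun v => g₁ v - g₀ v)
    (g₂ := fun v => g₂ v - g₀ v) hδ hρ0 fun v hv v' hv' k1 k2 =>
      norm_sub_le_of_levels hε hν hν1 hεν h0 h1 h2 h01 h02 h12 hv.1.1 hv.2.1.1 hv.2.2.1
        hv'.1.1 hv'.2.1.1 hv'.2.2.1 k1 k2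
  obtain ⟨H₁, hm₁, hb₁, hI₁⟩ := exists_majorant (E := E) (g₁ := fun v => g₀ v - g₁ v)
    (g₂ := fun v => g₂ v - g₁ v) hδ hρ0 fun v hv v' hv' k1 k2 =>
      norm_sub_le_of_levels hε hν hν1 hεν h1 h0 h2 (by rwa [norm_sub_rev])
        (by rwa [norm_sub_rev]) (by rwa [norm_sub_rev]) hv.2.1.1 hv.1.1 hv.2.2.1
        hv'.2.1.1 hv'.1.1 hv'.2.2.1 k1 k2
  obtain ⟨H₂, hm₂, hb₂, hI₂⟩ := exists_majorant (E := E) (g₁ := fun v => g₀ v - g₂ v)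
    (g₂ := fun v => g₁ v - g₂ v) hδ hρ0 fun v hv v' hv' k1 k2 =>
      norm_sub_le_of_levels hε hν hν1 hεν h2 h0 h1 (by rwa [norm_sub_rev])
        h12 (by rwa [norm_sub_rev]) hv.2.2.1 hv.1.1 hv.2.1.1
        hv'.2.2.1 hv'.1.1 hv'.2.1.1 k1 k2
  set M := (√(δ ^ 3))⁻¹ * r₀⁻¹ * (√(‖y₁ - y₀‖ / 2))⁻¹ with hM
  have hM0 : 0 ≤ M := by positivity
  have hpt : ∀ v, F v ≤ ENNReal.ofReal M * (H₀ v + H₁ v + H₂ v) := by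
    intro v
    by_cases hv : v ∈ E
    swap
    · rw [hE v hv]
      exact zero_le
    have p := fun x => (wt_pos x).le
    set a := (T v - τ₀ + sgnNorm θ₀ (v - y₀)) / δ with ha
    set b := (T v - τ₁ + sgnNorm θ₁ (v - y₁)) / δ with hb
    set c := (T v - τ₂ + sgnNorm θ₂ (v - y₂)) / δ with hc
    have hFv : F v = ENNReal.ofReal (((√(δ * ‖v - y₀‖))⁻¹ * (√(δ * ‖v - y₁‖))⁻¹ *
        (√(δ * ‖v - y₂‖))⁻¹) * (wt a * wt b * wt c)) := by
      simp only [hF]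
      rw [← ENNReal.ofReal_mul (tanK_nonneg _ _ _ _ _ _), ← ENNReal.ofReal_mul
        (mul_nonneg (tanK_nonneg _ _ _ _ _ _) (tanK_nonneg _ _ _ _ _ _)), tanK, tanK, tanK,
        if_pos hv.1, if_pos hv.2.1, if_pos hv.2.2]
      congr 1
      ring
    rw [hFv]
    calc _ ≤ ENNReal.ofReal (M * (wt ((b - a) / 2) * wt ((c - a) / 2) +
          wt ((a - b) / 2) * wt ((c - b) / 2) + wt ((a - c) / 2) * wt ((b - c) / 2))) := by
          apply ENNReal.ofReal_le_ofReal
          apply mul_le_mul _ (prod_wt_le a b c) _ hM0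
          · exact prod_inv_sqrt_le hδ hr hv.1.2.1 hv.2.1.2.1 hv.2.2.2.1 hd (hnear v hv).1
          · exact mul_nonneg (mul_nonneg (p a) (p b)) (p c)
      _ ≤ _ := by
          have q : ∀ x y, 0 ≤ wt x * wt y := fun x y => mul_nonneg (p x) (p y)
          rw [ENNReal.ofReal_mul hM0, ENNReal.ofReal_add (add_nonneg (q _ _) (q _ _)) (q _ _),
            ENNReal.ofReal_add (q _ _) (q _ _)]
          gcongr
          · refine le_trans (le_of_eq ?_) (hb₀ v hv)
            simp only [g₀, g₁, g₂, ha, hb, hc]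
            congr 3 <;> ring
          · refine le_trans (le_of_eq ?_) (hb₁ v hv)
            simp only [g₀, g₁, g₂, ha, hb, hc]
            congr 3 <;> ring
          · refine le_trans (le_of_eq ?_) (hb₂ v hv)
            simp only [g₀, g₁, g₂, ha, hb, hc]
            congr 3 <;> ring
  calc ∫⁻ v, F v ≤ ∫⁻ v, ENNReal.ofReal M * (H₀ v + H₁ v + H₂ v) := lintegral_mono hpt
    _ = ENNReal.ofReal M * ((∫⁻ v, H₀ v) + (∫⁻ v, H₁ v) + (∫⁻ v, H₂ v)) := by
        rw [lintegral_const_mul' _ _ ENNReal.ofReal_ne_top, lintegral_add_right _ hm₂,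
          lintegral_add_right _ hm₁]
    _ ≤ ENNReal.ofReal M * (ENNReal.ofReal (36 * wtSum ^ 2 * ρ ^ 2) +
          ENNReal.ofReal (36 * wtSum ^ 2 * ρ ^ 2) + ENNReal.ofReal (36 * wtSum ^ 2 * ρ ^ 2)) := by
        gcongr
    _ = _ := by
        rw [← ENNReal.ofReal_add (by positivity) (by positivity),
          ← ENNReal.ofReal_add (by positivity) (by positivity), ← ENNReal.ofReal_mul hM0,
          ← ENNReal.ofReal_inv_of_pos (Real.sqrt_pos.2 (by positivity)),
          ← ENNReal.ofReal_mul (by positivity), hM, hρ]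
        congr 1
        ring

lemma lintegral_norm_rpow_le {γ : ℝ} (hγ : γ < 2) (R : ℝ) : ∃ C : ℝ, 0 ≤ C ∧
    ∫⁻ z, (closedBall (0 : ℂ) R).indicator (fun z => ENNReal.ofReal (‖z‖ ^ (-γ))) z ≤
      ENNReal.ofReal C := by
  have h1 : Integrable (fun z : ℂ => (Set.Iic R).indicator (fun y : ℝ => y ^ (-γ)) ‖z‖) := by
    rw [integrable_fun_norm_addHaar, Complex.finrank_real_complex]
    have h2 : IntegrableOn (fun y : ℝ => y ^ (1 - γ)) (Set.Ioc 0 R) := by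
      rcases le_total 0 R with h | h
      · rw [← intervalIntegrable_iff_integrableOn_Ioc_of_le h]
        exact intervalIntegral.intervalIntegrable_rpow' (by linarith)
      · rw [Set.Ioc_eq_empty (not_lt.2 h)]
        exact integrableOn_empty
    have h3 := (integrable_indicator_iff measurableSet_Ioc).2 h2
    refine h3.integrableOn.congr_fun (fun y hy => ?_) measurableSet_Ioi
    have hy0 : (0 : ℝ) < y := hy
    by_cases hyR : y ≤ R
    · rw [Set.indicator_of_mem (show y ∈ Set.Ioc 0 R from ⟨hy0, hyR⟩)]
      simp only [Nat.add_one_sub_one, pow_one, smul_eq_mul]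
      rw [Set.indicator_of_mem (show y ∈ Set.Iic R from hyR), sub_eq_add_neg,
        Real.rpow_add hy0, Real.rpow_one]
    · rw [Set.indicator_of_notMem (fun h => hyR h.2)]
      simp [Set.indicator_of_notMem (show y ∉ Set.Iic R from hyR)]
  refine ⟨∫ z : ℂ, ‖(Set.Iic R).indicator (fun y : ℝ => y ^ (-γ)) ‖z‖‖,
    integral_nonneg fun _ => norm_nonneg _, ?_⟩
  rw [ofReal_integral_norm_eq_lintegral_enorm h1]
  refine lintegral_mono fun z => ?_
  by_cases hz : ‖z‖ ≤ R
  · rw [Set.indicator_of_mem (by simpa using hz), Set.indicator_of_mem (show ‖z‖ ∈ Set.Iic R from hz),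
      Real.enorm_of_nonneg (by positivity)]
  · rw [Set.indicator_of_notMem (by simpa using hz)]
    exact zero_le

/-- The singular part of the kernel bounds. -/
noncomputable def badK (A B δ ε r₀ : ℝ) (z : ℂ) : ℝ≥0∞ :=
  (closedBall (0 : ℂ) r₀).indicator (fun z => ENNReal.ofReal (72 * A ^ 2 * (√(δ * ‖z‖))⁻¹)) z +
    (closedBall (0 : ℂ) 8).indicator
      (fun _ => ENNReal.ofReal (20 * A ^ 2 * B * ε⁻¹ ^ 4 * (δ / r₀ ^ 2))) z

lemma measurable_badK (A B δ ε r₀ : ℝ) : Measurable (badK A B δ ε r₀) := by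
  refine Measurable.add (Measurable.indicator ?_ measurableSet_closedBall)
    (Measurable.indicator measurable_const measurableSet_closedBall)
  fun_prop

lemma continuous_wt : Continuous wt := by
  unfold wt
  refine Continuous.inv₀ (by fun_prop) fun u => ?_
  have : 0 < (1 + |u|) ^ 3 := by positivity
  exact (Real.sqrt_pos.2 this).ne'

lemma measurable_sgnNorm (θ : ℂ) : Measurable (sgnNorm θ) := by
  unfold sgnNorm
  refine Measurable.ite (measurableSet_le measurable_const ?_) measurable_norm measurable_norm.neg
  fun_prop

lemma measurableSet_isDir (ε : ℝ) (θ : ℂ) : MeasurableSet {z | IsDir ε θ z} := by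
  unfold IsDir
  have := measurable_sgnNorm θ
  refine measurableSet_le ?_ ?_ <;> fun_prop

lemma measurable_tanK (δ ε r₀ : ℝ) (θ : ℂ) :
    Measurable fun p : ℝ × ℂ => tanK δ ε r₀ θ p.1 p.2 := by
  unfold tanK
  have h1 := measurable_sgnNorm θ
  have h2 := continuous_wt.measurable
  refine Measurable.ite ?_ (Measurable.mul ?_ (h2.comp ?_)) measurable_const
  · have h3 : MeasurableSet {z : ℂ | IsDir ε θ z ∧ r₀ ≤ ‖z‖ ∧ ‖z‖ ≤ 8} :=
      (measurableSet_isDir ε θ).inter ((measurableSet_le measurable_const measurable_norm).inter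
        (measurableSet_le measurable_norm measurable_const))
    exact measurable_snd h3
  · fun_prop
  · fun_prop

section Kernel
variable {A B δ ε t t' : ℝ} {θ : ℂ} {Y : ℂ → ℝ} {Φ φ Φ' φ' : ℝ → ℝ}

/-- The kernel bounds, combined. -/
lemma enorm_interact_le (hΦ : IsProfile A δ t Φ φ) (hΦ' : IsProfile A δ t' Φ' φ')
    (hY : IsCutoff B ε θ Y) (ht : t ∈ Set.Icc (1 : ℝ) 2) (ht' : t' ∈ Set.Icc (1 : ℝ) 2)
    (hδ : 0 < δ) (hδ' : δ ≤ 1 / 16) (hε : 0 < ε) (hε' : ε ≤ 1 / 20) (hB : 1 ≤ B) {r₀ : ℝ}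
    (hr : 0 < r₀) {z : ℂ} (hz : z ≠ 0) :
    ‖interact φ φ' Y z‖ₑ ≤ ENNReal.ofReal (7200 * A ^ 2 * B * ε⁻¹) *
      ENNReal.ofReal (tanK δ ε r₀ θ (t - t') z) + badK A B δ ε r₀ z := by
  have hz0 : 0 < ‖z‖ := norm_pos_iff.2 hz
  rw [← ENNReal.ofReal_mul (by positivity), Real.enorm_eq_ofReal_abs]
  by_cases h8 : 8 < ‖z‖
  · rw [interact_eq_zero hΦ hΦ' ht ht' hδ' h8]
    simp
  push Not at h8
  rcases lt_or_ge ‖z‖ r₀ with h | h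
  · refine le_add_left (le_add_right ?_)
    rw [Set.indicator_of_mem (by simpa using h.le)]
    exact ENNReal.ofReal_le_ofReal (abs_interact_le_sqrt hΦ hΦ' hY ht ht' hδ hδ' hz)
  by_cases hd : IsDir ε θ z
  · refine le_add_right (ENNReal.ofReal_le_ofReal ?_)
    rw [tanK, if_pos ⟨hd, h, h8⟩, ← mul_assoc]
    exact abs_interact_le_of_isDir hΦ hΦ' hY ht ht' hδ hδ' hε hε' hB hz hd
  · refine le_add_left (le_add_left ?_)
    rw [Set.indicator_of_mem (by simpa using h8)]
    refine ENNReal.ofReal_le_ofReal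
      ((abs_interact_le_of_not_isDir hΦ hΦ' hY ht ht' hδ hδ' hε hε' hB hz hd).trans ?_)
    gcongr

/-- The kernel bound for coinciding profiles. -/
lemma enorm_interact_self_le (hΦ : IsProfile A δ t Φ φ)
    (hY : IsCutoff B ε θ Y) (ht : t ∈ Set.Icc (1 : ℝ) 2)
    (hδ : 0 < δ) (hδ' : δ ≤ 1 / 16) (hε : 0 < ε) (hε' : ε ≤ 1 / 20) (hB : 1 ≤ B) {s : ℝ}
    (hs : 0 ≤ s) (hs1 : s ≤ 1) {z : ℂ} (hz : z ≠ 0) :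
    ‖interact φ φ Y z‖ₑ ≤ (closedBall (0 : ℂ) 8).indicator (fun z => ENNReal.ofReal
      (7200 * A ^ 2 * B * ε⁻¹ ^ 4 * δ ^ (1 - 2 * s)) * ENNReal.ofReal (‖z‖ ^ (-(2 - 2 * s)))) z := by
  have hz0 : 0 < ‖z‖ := norm_pos_iff.2 hz
  by_cases h8 : 8 < ‖z‖
  · rw [interact_eq_zero hΦ hΦ ht ht hδ' h8]
    simp
  push Not at h8
  rw [Set.indicator_of_mem (by simpa using h8), ← ENNReal.ofReal_mul (by positivity),
    Real.enorm_eq_ofReal_abs]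
  apply ENNReal.ofReal_le_ofReal
  have hε1 : 1 ≤ ε⁻¹ := (one_le_inv₀ hε).2 (by linarith)
  set K := 7200 * A ^ 2 * B * ε⁻¹ ^ 4 with hK
  have hK0 : 0 ≤ K := by positivity
  have h1 : |interact φ φ Y z| ≤ K * δ⁻¹ := by
    refine (abs_interact_le_inv hΦ hΦ hY ht ht hδ hδ' z).trans ?_
    have : 32 * A ^ 2 * 1 * 1 ^ 4 ≤ K := by rw [hK]; gcongr; norm_num
    have h := inv_pos.2 hδ
    nlinarith
  have h2 : |interact φ φ Y z| ≤ K * (δ / ‖z‖ ^ 2) := by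
    have hq : 0 ≤ δ / ‖z‖ ^ 2 := by positivity
    by_cases hd : IsDir ε θ z
    · refine (abs_interact_le_of_isDir hΦ hΦ hY ht ht hδ hδ' hε hε' hB hz hd).trans ?_
      have e1 : 7200 * A ^ 2 * B * ε⁻¹ ≤ K := by
        rw [hK]
        gcongr
        exact le_self_pow₀ hε1 (by norm_num)
      rw [mul_assoc]
      have e2 : |sgnNorm θ z| = ‖z‖ := abs_sgnNorm θ z
      refine mul_le_mul e1 ?_ (mul_nonneg (by positivity) (wt_pos _).le) hK0
      rw [sub_self, zero_add, wt, abs_div, e2, abs_of_pos hδ, ← mul_inv, ← Real.sqrt_mul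
        (by positivity), ← inv_div (‖z‖ ^ 2) δ]
      apply inv_anti₀ (by positivity)
      apply Real.le_sqrt_of_sq_le
      have e3 : (‖z‖ / δ) ^ 3 ≤ (1 + ‖z‖ / δ) ^ 3 := by gcongr; linarith
      calc (‖z‖ ^ 2 / δ) ^ 2 = δ * ‖z‖ * (‖z‖ / δ) ^ 3 := by field_simp
        _ ≤ _ := by gcongr
    · refine (abs_interact_le_of_not_isDir hΦ hΦ hY ht ht hδ hδ' hε hε' hB hz hd).trans ?_
      gcongr
      rw [hK]
      gcongr
      norm_num
  clear_value K
  rcases le_total ‖z‖ δ with h | h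
  · refine h1.trans ?_
    rw [mul_assoc]
    refine mul_le_mul_of_nonneg_left ?_ hK0
    have : δ ^ (-(2 - 2 * s)) ≤ ‖z‖ ^ (-(2 - 2 * s)) :=
      Real.rpow_le_rpow_of_nonpos hz0 h (by linarith)
    calc δ⁻¹ = δ ^ (1 - 2 * s) * δ ^ (-(2 - 2 * s)) := by
          rw [← Real.rpow_add hδ, ← Real.rpow_neg_one]; ring_nf
      _ ≤ _ := by gcongr
  · refine h2.trans ?_
    rw [mul_assoc]
    refine mul_le_mul_of_nonneg_left ?_ hK0
    have e : δ ^ (2 * s) ≤ ‖z‖ ^ (2 * s) := Real.rpow_le_rpow hδ.le h (by linarith)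
    calc δ / ‖z‖ ^ 2 = δ ^ (1 - 2 * s) * (‖z‖ ^ (-2 : ℝ) * δ ^ (2 * s)) := by
          rw [mul_left_comm, ← Real.rpow_add hδ, Real.rpow_neg hz0.le, Real.rpow_ofNat]
          ring_nf
          rw [Real.rpow_one, mul_comm]
      _ ≤ δ ^ (1 - 2 * s) * (‖z‖ ^ (-2 : ℝ) * ‖z‖ ^ (2 * s)) := by gcongr
      _ = _ := by rw [← Real.rpow_add hz0]; ring_nf

end Kernel

lemma lintegral_badK_le : ∃ C : ℝ, 0 ≤ C ∧ ∀ A B δ ε : ℝ, 0 < δ → δ ≤ 1 → 0 < ε → ε ≤ 1 → 1 ≤ B →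
    ∫⁻ z, badK A B δ ε (δ ^ (3 / 8 : ℝ)) z ≤
      ENNReal.ofReal (C * (A ^ 2 * B * ε⁻¹ ^ 4 * δ ^ (1 / 32 : ℝ))) := by
  obtain ⟨C, hC, h⟩ := lintegral_norm_rpow_le (γ := 23 / 12) (by norm_num) 1
  refine ⟨72 * C + 20 * 256, by positivity, fun A B δ ε hδ hδ1 hε hε1 hB => ?_⟩
  set r₀ := δ ^ (3 / 8 : ℝ) with hr
  have hr0 : 0 < r₀ := Real.rpow_pos_of_pos hδ _
  have hr1 : r₀ ≤ 1 := Real.rpow_le_one hδ.le hδ1 (by norm_num)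
  have hε4 : 1 ≤ ε⁻¹ ^ 4 := one_le_pow₀ ((one_le_inv₀ hε).2 hε1)
  have hd32 : 0 < δ ^ (1 / 32 : ℝ) := Real.rpow_pos_of_pos hδ _
  unfold badK
  rw [lintegral_add_right _ (measurable_const.indicator measurableSet_closedBall),
    lintegral_indicator_const measurableSet_closedBall, Complex.volume_closedBall]
  have h1 : ∫⁻ z, (closedBall (0 : ℂ) r₀).indicator
      (fun z => ENNReal.ofReal (72 * A ^ 2 * (√(δ * ‖z‖))⁻¹)) z ≤
      ENNReal.ofReal (72 * C * (A ^ 2 * B * ε⁻¹ ^ 4 * δ ^ (1 / 32 : ℝ))) := by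
    calc _ ≤ ∫⁻ z, ENNReal.ofReal (72 * A ^ 2 * δ ^ (1 / 32 : ℝ)) * (closedBall (0 : ℂ) 1).indicator
          (fun z => ENNReal.ofReal (‖z‖ ^ (-(23 / 12 : ℝ)))) z := by
          refine lintegral_mono fun z => ?_
          by_cases hz : ‖z‖ ≤ r₀
          swap
          · rw [Set.indicator_of_notMem (by simpa using hz)]
            exact zero_le
          rw [Set.indicator_of_mem (by simpa using hz),
            Set.indicator_of_mem (by simpa using hz.trans hr1),
            ← ENNReal.ofReal_mul (by positivity)]
          apply ENNReal.ofReal_le_ofReal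
          rcases (norm_nonneg z).eq_or_lt with h0 | h0
          · rw [← h0, mul_zero, Real.sqrt_zero, inv_zero, mul_zero]
            positivity
          rw [mul_assoc (72 * A ^ 2)]
          refine mul_le_mul_of_nonneg_left ?_ (by positivity)
          rw [Real.sqrt_eq_rpow, ← Real.rpow_neg (by positivity), Real.mul_rpow hδ.le h0.le]
          have e1 : ‖z‖ ^ (17 / 12 : ℝ) ≤ r₀ ^ (17 / 12 : ℝ) :=
            Real.rpow_le_rpow h0.le hz (by norm_num)
          calc δ ^ (-(1 / 2 : ℝ)) * ‖z‖ ^ (-(1 / 2 : ℝ))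
              = δ ^ (-(1 / 2 : ℝ)) * (‖z‖ ^ (17 / 12 : ℝ) * ‖z‖ ^ (-(23 / 12 : ℝ))) := by
                rw [← Real.rpow_add h0]; norm_num
            _ ≤ δ ^ (-(1 / 2 : ℝ)) * (r₀ ^ (17 / 12 : ℝ) * ‖z‖ ^ (-(23 / 12 : ℝ))) := by gcongr
            _ = _ := by
                rw [hr, ← Real.rpow_mul hδ.le, ← mul_assoc, ← Real.rpow_add hδ]; norm_num
      _ = ENNReal.ofReal (72 * A ^ 2 * δ ^ (1 / 32 : ℝ)) * ∫⁻ z, (closedBall (0 : ℂ) 1).indicator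
          (fun z => ENNReal.ofReal (‖z‖ ^ (-(23 / 12 : ℝ)))) z :=
          lintegral_const_mul' _ _ ENNReal.ofReal_ne_top
      _ ≤ ENNReal.ofReal (72 * A ^ 2 * δ ^ (1 / 32 : ℝ)) * ENNReal.ofReal C := by gcongr
      _ ≤ _ := by
          rw [← ENNReal.ofReal_mul (by positivity)]
          apply ENNReal.ofReal_le_ofReal
          calc 72 * A ^ 2 * δ ^ (1 / 32 : ℝ) * C = 72 * C * (A ^ 2 * 1 * 1 * δ ^ (1 / 32 : ℝ)) := by
                ring
            _ ≤ _ := by gcongr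
  have h2 : ENNReal.ofReal (20 * A ^ 2 * B * ε⁻¹ ^ 4 * (δ / r₀ ^ 2)) *
      (ENNReal.ofReal 8 ^ 2 * NNReal.pi) ≤
      ENNReal.ofReal (20 * 256 * (A ^ 2 * B * ε⁻¹ ^ 4 * δ ^ (1 / 32 : ℝ))) := by
    rw [← ENNReal.ofReal_pow (by norm_num), ← ENNReal.ofReal_coe_nnreal, NNReal.coe_real_pi,
      ← ENNReal.ofReal_mul (by norm_num), ← ENNReal.ofReal_mul (by positivity)]
    apply ENNReal.ofReal_le_ofReal
    have e1 : δ / r₀ ^ 2 ≤ δ ^ (1 / 32 : ℝ) := by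
      rw [hr, ← Real.rpow_natCast, ← Real.rpow_mul hδ.le]
      nth_rewrite 1 [← Real.rpow_one δ]
      rw [← Real.rpow_sub hδ]
      exact Real.rpow_le_rpow_of_exponent_ge hδ hδ1 (by norm_num)
    calc 20 * A ^ 2 * B * ε⁻¹ ^ 4 * (δ / r₀ ^ 2) * (8 ^ 2 * Real.pi) ≤
        20 * A ^ 2 * B * ε⁻¹ ^ 4 * δ ^ (1 / 32 : ℝ) * (8 ^ 2 * 4) := by
          gcongr
          exact Real.pi_lt_four.le
      _ = _ := by ring
  calc _ ≤ _ := add_le_add h1 h2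
    _ = _ := by
      rw [← ENNReal.ofReal_add (by positivity) (by positivity)]
      ring_nf

lemma exists_selector {ι : Type*} [MeasurableSpace ι] {T : Finset ι} (hT : T.Nonempty)
    {P : ι → Set ℂ} (hP : ∀ b, MeasurableSet (P b)) :
    ∃ q : ℂ → ι, Measurable q ∧ (∀ x, q x ∈ T) ∧ ∀ x, (∃ b ∈ T, x ∈ P b) → x ∈ P (q x) := by
  classical
  induction hT using Finset.Nonempty.cons_induction with
  | singleton a =>
    exact ⟨fun _ => a, measurable_const, by simp, by simp⟩
  | cons a s h hs ih =>
    obtain ⟨q, hq, hqs, hqP⟩ := ih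
    refine ⟨fun x => if x ∈ P a then a else q x, Measurable.ite (hP a) measurable_const hq,
      fun x => ?_, fun x hx => ?_⟩
    · dsimp only
      split_ifs
      · exact Finset.mem_cons_self _ _
      · exact Finset.mem_cons_of_mem (hqs x)
    · dsimp only
      split_ifs with hxa
      · exact hxa
      · obtain ⟨b, hb, hxb⟩ := hx
        rcases Finset.mem_cons.1 hb with rfl | hb
        · exact absurd hxb hxa
        · exact hqP x ⟨b, hb, hxb⟩

/-- Bounded measurable functions of bounded support. -/
structure IsTest (f : ℂ → ℝ) : Prop where
  measurable : Measurable f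
  bdd : ∃ M, ∀ x, |f x| ≤ M
  supp : ∃ R, ∀ x, R < ‖x‖ → f x = 0

lemma IsTest.integrable {f : ℂ → ℝ} (hf : IsTest f) : Integrable f := by
  obtain ⟨M, hM⟩ := hf.bdd
  obtain ⟨R, hR⟩ := hf.supp
  have h1 : IntegrableOn f (closedBall 0 R) :=
    Measure.integrableOn_of_bounded measure_closedBall_lt_top.ne hf.measurable.aestronglyMeasurable
      (M := M) (ae_of_all _ fun x => hM x)
  refine (integrableOn_iff_integrable_of_support_subset fun x hx => ?_).1 h1
  by_contra h
  exact hx (hR x (by simpa using h))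

/-- The linear operator with kernel `labK`. -/
noncomputable def lab {N : ℕ} (φ : Fin N → ℝ → ℝ) (Y : ℂ → ℝ) (f : ℂ → ℝ) (a : ℤ × Fin N)
    (x : ℂ) : ℝ := ∫ y, labK φ Y a (y - x) * f y

section Lab
variable {N : ℕ} {A δ B ε : ℝ} {t : Fin N → ℝ} {Φ φ : Fin N → ℝ → ℝ} {θ : ℂ} {Y : ℂ → ℝ}
  {f : ℂ → ℝ}

lemma IsFamily.measurable_lab (hF : IsFamily A δ t Φ φ) (hY : Measurable Y) (hf : Measurable f)
    (a : ℤ × Fin N) : Measurable (lab φ Y f a) := by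
  have h : Measurable fun p : ℂ × ℂ => labK φ Y a (p.2 - p.1) * f p.2 := by
    have h1 := measurable_kerS (hF.profile a.2) hY (2 ^ a.1)
    exact (h1.comp (measurable_snd.sub measurable_fst)).mul (hf.comp measurable_snd)
  exact h.stronglyMeasurable.integral_prod_right.measurable

lemma IsFamily.integrable_lab (hF : IsFamily A δ t Φ φ) (hY : Measurable Y)
    (hY1 : ∀ w, |Y w| ≤ 1) (hf : IsTest f) (a : ℤ × Fin N) (x : ℂ) :
    Integrable fun y => labK φ Y a (y - x) * f y := by
  refine hf.integrable.bdd_mul (c := (((2 : ℝ) ^ a.1) ^ 2)⁻¹ * (2 * (A / δ))) ?_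
    (ae_of_all _ fun y => ?_)
  · exact ((measurable_kerS (hF.profile a.2) hY (2 ^ a.1)).comp
      (measurable_id.sub_const x)).aestronglyMeasurable
  · exact abs_kerS_le (hF.profile a.2) hY1 (hF.center _) hF.pos hF.le _ _

lemma IsFamily.lab_eq_zero (hF : IsFamily A δ t Φ φ) {R : ℝ} (hR : ∀ x, R < ‖x‖ → f x = 0)
    {a : ℤ × Fin N} {x : ℂ} (hx : R + 3 * 2 ^ a.1 < ‖x‖) : lab φ Y f a x = 0 := by
  refine integral_eq_zero_of_ae (ae_of_all _ fun y => ?_)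
  by_cases hy : R < ‖y‖
  · simp [hR y hy]
  · have : labK φ Y a (y - x) = 0 := by
      refine kerS_eq_zero (hF.profile a.2) (hF.center _) hF.le (by positivity) ?_
      have := norm_sub_norm_le x y
      rw [norm_sub_rev] at this
      linarith
    simp [this]

lemma IsFamily.volume_level_ne_top (hF : IsFamily A δ t Φ φ) (hf : IsTest f)
    (T : Finset (ℤ × Fin N)) {l : ℝ≥0∞} (hl : l ≠ 0) {G : Set ℂ}
    (hG : ∀ x ∈ G, ∃ b ∈ T, l ≤ ‖lab φ Y f b x‖ₑ) : volume G ≠ ⊤ := by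
  obtain ⟨R, hR⟩ := hf.supp
  have : G ⊆ ⋃ b ∈ T, closedBall 0 (R + 3 * 2 ^ b.1) := by
    intro x hx
    obtain ⟨b, hb, hlb⟩ := hG x hx
    simp only [Set.mem_iUnion]
    refine ⟨b, hb, ?_⟩
    by_contra h
    rw [hF.lab_eq_zero hR (by simpa using h)] at hlb
    simp at hlb
    exact hl hlb
  refine ((measure_mono this).trans_lt ?_).ne
  exact (measure_biUnion_lt_top T.finite_toSet fun b _ => measure_closedBall_lt_top)

lemma IsFamily.lab_eq_sum (hF : IsFamily A δ t Φ φ) (hf : IsTest f) {ι : Type*} {S : Finset ι}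
    {Θ : ι → ℂ} {Y : ι → ℂ → ℝ} (hY : ∀ c, IsCutoff B ε (Θ c) (Y c)) (hS : ∀ w, ∑ c ∈ S, Y c w = 1)
    (a : ℤ × Fin N) (x : ℂ) : lab φ 1 f a x = ∑ c ∈ S, lab φ (Y c) f a x := by
  unfold lab
  rw [← integral_finsetSum _ fun c _ =>
    hF.integrable_lab (hY c).measurable (hY c).abs_le_one hf a x]
  refine integral_congr_ae (ae_of_all _ fun y => ?_)
  simp only [labK, kerS, ker, Pi.one_apply]
  rw [← hS ((2 ^ a.1 : ℝ)⁻¹ • (y - x)), Finset.mul_sum, Finset.mul_sum, Finset.sum_mul]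

lemma isSep_filter {L : ℕ} (T : Finset (ℤ × Fin N)) (m : ℕ) :
    IsSep L (T.filter fun b => b.1 % (L : ℤ) = m) := by
  intro a ha b hb hab
  have h1 := (Finset.mem_filter.1 ha).2
  have h2 := (Finset.mem_filter.1 hb).2
  have h3 : (L : ℤ) ∣ a.1 - b.1 := Int.dvd_of_emod_eq_zero (by rw [Int.sub_emod, h1, h2]; simp)
  have := Int.le_of_dvd (by linarith) h3
  linarith

lemma IsSep.subset {L : ℕ} {T T' : Finset (ℤ × Fin N)} (h : IsSep L T) (hT : T' ⊆ T) :
    IsSep L T' := fun a ha b hb => h a (hT ha) b (hT hb)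

/-- Weak-type bound for a single profile and cutoff, over separated scales. -/
lemma IsFamily.weak_single (hF : IsFamily A δ t Φ φ) (hY : IsCutoff B ε θ Y)
    (hε : 0 < ε) (hε' : ε ≤ 1 / 20) (hB : 1 ≤ B) {L : ℕ} (hL : (1 / 2 : ℝ) ^ L ≤ δ ^ 3)
    (hf : IsTest f) {T : Finset (ℤ × Fin N)} (hT : IsSep L T) {i : Fin N}
    (hi : ∀ b ∈ T, b.2 = i) {l : ℝ≥0∞} (hl0 : l ≠ 0) {s C : ℝ} (hs : 0 ≤ s) (hs1 : s ≤ 1)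
    (hC : 0 ≤ C) (hCs : ∫⁻ z, (closedBall (0 : ℂ) 8).indicator
      (fun z => ENNReal.ofReal (‖z‖ ^ (-(2 - 2 * s)))) z ≤ ENNReal.ofReal C) :
    l ^ 2 * volume {x | ∃ b ∈ T, l ≤ ‖lab φ Y f b x‖ₑ} ≤ (∫⁻ y, ‖f y‖ₑ ^ 2) *
      ENNReal.ofReal ((7200 * C + 196608) * (A ^ 2 * B * ε⁻¹ ^ 4) * δ ^ (1 - 2 * s)) := by
  rcases T.eq_empty_or_nonempty with rfl | hTn
  · simp
  have hδ := hF.pos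
  have hε1 : 1 ≤ ε⁻¹ := (one_le_inv₀ hε).2 (by linarith)
  have hmeas : ∀ b, MeasurableSet {x | l ≤ ‖lab φ Y f b x‖ₑ} := fun b =>
    measurableSet_le measurable_const (hF.measurable_lab hY.measurable hf.measurable b).enorm
  obtain ⟨q, hq, hqT, hqP⟩ := exists_selector hTn hmeas
  set G := {x | ∃ b ∈ T, l ≤ ‖lab φ Y f b x‖ₑ} with hG
  have hGm : MeasurableSet G := by
    have : G = ⋃ b ∈ T, {x | l ≤ ‖lab φ Y f b x‖ₑ} := by
      ext x; simp [hG]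
    rw [this]
    exact Finset.measurableSet_biUnion _ fun b _ => hmeas b
  set K := ENNReal.ofReal (7200 * A ^ 2 * B * ε⁻¹ ^ 4 * δ ^ (1 - 2 * s)) with hK
  set R : ℂ → ℝ≥0∞ := fun z => K * (closedBall (0 : ℂ) 8).indicator
      (fun z => ENNReal.ofReal (‖z‖ ^ (-(2 - 2 * s)))) z + ({0} : Set ℂ).indicator (fun _ => ⊤) z
    with hR
  have hRm : Measurable R := by
    refine (Measurable.const_mul (Measurable.indicator ?_ measurableSet_closedBall) _).add
      (measurable_const.indicator (measurableSet_singleton 0))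
    fun_prop
  have hρ : ∫⁻ z, R z ≤ K * ENNReal.ofReal C := by
    rw [hR, lintegral_add_right _ (measurable_const.indicator (measurableSet_singleton 0)),
      lintegral_indicator_const (measurableSet_singleton 0), measure_singleton, mul_zero, add_zero,
      lintegral_const_mul' _ _ ENNReal.ofReal_ne_top]
    gcongr
  have main := hF.weak_of_row_bound hY hε (by linarith) hB hL hq hT hqT hGm
    (hF.volume_level_ne_top hf T hl0 fun x hx => hx) hf.measurable hf.integrable
    (fun x hx => hqP x hx) (W := fun _ _ => 0) (κ := 0) hRm hρ (by simp) (by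
      intro x _ x' _ _
      rw [zero_add]
      gcongr
      by_cases hz : (2 ^ (q x).1 : ℝ)⁻¹ • (x - x') = 0
      · simp [hR, hz]
      · refine le_add_right ?_
        rw [hi _ (hqT x), hi _ (hqT x')]
        refine (enorm_interact_self_le (hF.profile i) hY (hF.center i) hδ hF.le hε hε' hB hs hs1
          hz).trans (le_of_eq ?_)
        rw [hK, Set.indicator_const_mul])
  refine main.trans ?_
  gcongr
  rw [zero_add, hK, ← ENNReal.ofReal_mul (by positivity), ← ENNReal.ofReal_add (by positivity)
    (by positivity)]
  apply ENNReal.ofReal_le_ofReal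
  have e1 : ε⁻¹ ≤ ε⁻¹ ^ 4 := le_self_pow₀ hε1 (by norm_num)
  have e2 : δ ≤ δ ^ (1 - 2 * s) := by
    nth_rewrite 1 [← Real.rpow_one δ]
    exact Real.rpow_le_rpow_of_exponent_ge hδ (by linarith [hF.le]) (by linarith)
  calc _ ≤ 7200 * A ^ 2 * B * ε⁻¹ ^ 4 * δ ^ (1 - 2 * s) * C +
        196608 * A ^ 2 * B * ε⁻¹ ^ 4 * δ ^ (1 - 2 * s) := by gcongr
    _ = _ := by ring

lemma exists_le_of_le_sum {ι : Type*} {S : Finset ι} {a : ι → ℝ} {l : ℝ} (hS : S.Nonempty)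
    (h : l ≤ |∑ c ∈ S, a c|) : ∃ c ∈ S, l / S.card ≤ |a c| := by
  by_contra! hc
  have h1 : |∑ c ∈ S, a c| < ∑ _c ∈ S, l / S.card :=
    (Finset.abs_sum_le_sum_abs _ _).trans_lt (Finset.sum_lt_sum_of_nonempty hS hc)
  have h2 : (S.card : ℝ) ≠ 0 := by exact_mod_cast hS.card_pos.ne'
  rw [Finset.sum_const, nsmul_eq_mul, mul_div_cancel₀ _ h2] at h1
  linarith

/-- The weak-type `L²` bound with arbitrarily small loss. -/
theorem exists_weak_l2 (A : ℝ) {s : ℝ} (hs : 0 < s) (hs1 : s ≤ 1) : ∃ C : ℝ, 0 ≤ C ∧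
    ∀ {N : ℕ} {δ : ℝ} {t : Fin N → ℝ} {Φ φ : Fin N → ℝ → ℝ}, IsFamily A δ t Φ φ →
    ∀ {L : ℕ}, 0 < L → (1 / 2 : ℝ) ^ L ≤ δ ^ 3 → ∀ {f : ℂ → ℝ}, IsTest f →
    ∀ (T : Finset (ℤ × Fin N)) {l : ℝ}, 0 < l →
      ENNReal.ofReal l ^ 2 * volume {x | ∃ b ∈ T, l ≤ |lab φ 1 f b x|} ≤
        ENNReal.ofReal (C * (δ ^ (-(2 * s)) * L)) * ∫⁻ y, ‖f y‖ₑ ^ 2 := by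
  obtain ⟨B, hB, hpart⟩ := exists_partition
  obtain ⟨S, Θ, Y, -, hY, hsum⟩ := hpart (1 / 20) (by norm_num) (by norm_num)
  obtain ⟨C, hC, hCs⟩ := lintegral_norm_rpow_le (γ := 2 - 2 * s) (by linarith) 8
  have hSn : S.Nonempty := by
    rw [Finset.nonempty_iff_ne_empty]
    rintro rfl
    simpa using hsum 0
  have hD : (0 : ℝ) < S.card := by exact_mod_cast hSn.card_pos
  set C₁ := (7200 * C + 196608) * (A ^ 2 * B * (1 / 20)⁻¹ ^ 4) with hC₁
  have hC₁0 : 0 ≤ C₁ := by positivity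
  refine ⟨4 * S.card ^ 3 * C₁, by positivity, ?_⟩
  intro N δ t Φ φ hF L hL0 hL f hf T l hl
  have hδ := hF.pos
  set I := ∫⁻ y, ‖f y‖ₑ ^ 2 with hI
  set D := (S.card : ℝ) with hDdef
  set l' := ENNReal.ofReal (l / D) with hl'
  let G : _ → Fin N → ℕ → Set ℂ := fun c i m =>
    {x | ∃ b ∈ T.filter fun b => b.2 = i ∧ b.1 % (L : ℤ) = m, l' ≤ ‖lab φ (Y c) f b x‖ₑ}
  have hG : ∀ c i m, l' ^ 2 * volume (G c i m) ≤ I * ENNReal.ofReal (C₁ * δ ^ (1 - 2 * s)) := by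
    intro c i m
    refine hF.weak_single (hY c) (by norm_num) le_rfl hB hL hf (i := i) ?_ ?_ ?_ hs.le hs1 hC hCs
    · refine (isSep_filter (L := L) T m).subset fun b hb => ?_
      rw [Finset.mem_filter] at hb ⊢
      exact ⟨hb.1, hb.2.2⟩
    · intro b hb
      exact (Finset.mem_filter.1 hb).2.1
    · rw [hl', Ne, ENNReal.ofReal_eq_zero, not_le]
      positivity
  have hsub : {x | ∃ b ∈ T, l ≤ |lab φ 1 f b x|} ⊆
      ⋃ c ∈ S, ⋃ i ∈ (Finset.univ : Finset (Fin N)), ⋃ m ∈ Finset.range L, G c i m := by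
    rintro x ⟨b, hb, hbx⟩
    rw [hF.lab_eq_sum hf hY hsum] at hbx
    obtain ⟨c, hc, hcx⟩ := exists_le_of_le_sum hSn hbx
    have hL' : (0 : ℤ) < L := by exact_mod_cast hL0
    have h1 := Int.emod_nonneg b.1 hL'.ne'
    have h2 := Int.emod_lt_of_pos b.1 hL'
    simp only [Set.mem_iUnion]
    refine ⟨c, hc, b.2, Finset.mem_univ _, (b.1 % (L : ℤ)).toNat, ?_, b, ?_, ?_⟩
    · rw [Finset.mem_range]
      omega
    · rw [Finset.mem_filter]
      refine ⟨hb, rfl, ?_⟩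
      omega
    · rw [Real.enorm_eq_ofReal_abs]
      exact ENNReal.ofReal_le_ofReal hcx
  have hvol : volume {x | ∃ b ∈ T, l ≤ |lab φ 1 f b x|} ≤
      ∑ c ∈ S, ∑ i : Fin N, ∑ m ∈ Finset.range L, volume (G c i m) := by
    refine (measure_mono hsub).trans ((measure_biUnion_finset_le _ _).trans ?_)
    refine Finset.sum_le_sum fun c _ => (measure_biUnion_finset_le _ _).trans ?_
    exact Finset.sum_le_sum fun i _ => measure_biUnion_finset_le _ _
  have hll : ENNReal.ofReal l = ENNReal.ofReal D * l' := by
    rw [hl', ← ENNReal.ofReal_mul hD.le, mul_div_cancel₀ _ hD.ne']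
  calc _ ≤ (ENNReal.ofReal D * l') ^ 2 *
        ∑ c ∈ S, ∑ i : Fin N, ∑ m ∈ Finset.range L, volume (G c i m) := by rw [hll]; gcongr
    _ = ENNReal.ofReal D ^ 2 *
        ∑ c ∈ S, ∑ i : Fin N, ∑ m ∈ Finset.range L, l' ^ 2 * volume (G c i m) := by
        simp only [Finset.mul_sum, mul_pow, mul_assoc]
    _ ≤ ENNReal.ofReal D ^ 2 * ∑ _c ∈ S, ∑ _i : Fin N, ∑ _m ∈ Finset.range L,
        I * ENNReal.ofReal (C₁ * δ ^ (1 - 2 * s)) := by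
        refine mul_le_mul_right (Finset.sum_le_sum fun c _ => Finset.sum_le_sum fun i _ =>
          Finset.sum_le_sum fun m _ => hG c i m) _
    _ = ENNReal.ofReal (D ^ 3 * (N * (C₁ * δ ^ (1 - 2 * s))) * L) * I := by
        simp only [Finset.sum_const, nsmul_eq_mul, Finset.card_range, Finset.card_univ,
          Fintype.card_fin]
        set x := C₁ * δ ^ (1 - 2 * s) with hx
        have hx0 : 0 ≤ x := by positivity
        clear_value x
        rw [ENNReal.ofReal_mul (by positivity), ENNReal.ofReal_mul (by positivity),
          ENNReal.ofReal_mul (by positivity), ENNReal.ofReal_pow hD.le, hDdef]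
        simp only [ENNReal.ofReal_natCast]
        ring
    _ ≤ _ := by
        gcongr ENNReal.ofReal ?_ * I
        have e1 : δ ^ (1 - 2 * s) = δ * δ ^ (-(2 * s)) := by
          nth_rewrite 2 [← Real.rpow_one δ]
          rw [← Real.rpow_add hδ]
          ring_nf
        have e2 : 0 < δ ^ (-(2 * s)) := Real.rpow_pos_of_pos hδ _
        calc D ^ 3 * (N * (C₁ * δ ^ (1 - 2 * s))) * L
            = (N * δ) * (D ^ 3 * C₁ * δ ^ (-(2 * s)) * L) := by rw [e1]; ring
          _ ≤ 4 * (D ^ 3 * C₁ * δ ^ (-(2 * s)) * L) := by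
            gcongr
            exact hF.card
          _ = _ := by ring

end Lab

/-- A sum of nonnegative terms that is small near every centre has three large terms with
separated centres. -/
lemma exists_separated_triple {ι : Type*} {S : Finset ι} {a : ι → ℝ}
    {Θ : ι → ℂ} {ν l : ℝ} (hl : 0 < l) (h : l ≤ ∑ c ∈ S, a c)
    (ha0 : ∀ c, 0 ≤ a c)
    (hnear : ∀ c₀ ∈ S, ∑ c ∈ S with ‖Θ c - Θ c₀‖ ≤ ν, a c ≤ l / 4) :
    ∃ c₀ ∈ S, ∃ c₁ ∈ S, ∃ c₂ ∈ S, ν < ‖Θ c₁ - Θ c₀‖ ∧ ν < ‖Θ c₂ - Θ c₀‖ ∧ ν < ‖Θ c₂ - Θ c₁‖ ∧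
      l / (4 * S.card) ≤ a c₀ ∧ l / (4 * S.card) ≤ a c₁ ∧ l / (4 * S.card) ≤ a c₂ := by
  classical
  have hSn : S.Nonempty := by
    rw [Finset.nonempty_iff_ne_empty]
    rintro rfl
    simp at h
    linarith
  have hD : (0 : ℝ) < S.card := by exact_mod_cast hSn.card_pos
  have key : ∀ U : ι → ℝ, (∀ c ∈ S, a c ≤ l / (4 * S.card) + U c) → 3 / 4 * l ≤ ∑ c ∈ S, U c := by
    intro U hU
    have := h.trans (Finset.sum_le_sum hU)
    rw [Finset.sum_add_distrib, Finset.sum_const, nsmul_eq_mul] at this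
    have e : (S.card : ℝ) * (l / (4 * S.card)) = l / 4 := by field_simp
    linarith
  let V : ι → ι → ℝ := fun c₀ c => if ‖Θ c - Θ c₀‖ ≤ ν then a c else 0
  have hV : ∀ c₀ ∈ S, ∑ c ∈ S, V c₀ c ≤ l / 4 := fun c₀ hc₀ => by
    have := hnear c₀ hc₀
    rwa [Finset.sum_filter] at this
  have hV0 : ∀ c₀ c, 0 ≤ V c₀ c := fun c₀ c => by
    simp only [V]; split_ifs; exacts [ha0 c, le_rfl]
  have hlD : 0 < l / (4 * S.card) := by positivity
  obtain ⟨c₀, hc₀, h0⟩ : ∃ c₀ ∈ S, l / (4 * S.card) ≤ a c₀ := by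
    by_contra! hc
    have := key (fun _ => 0) fun c hcS => by linarith [hc c hcS]
    simp at this
    linarith
  obtain ⟨c₁, hc₁, h1, h10⟩ : ∃ c₁ ∈ S, l / (4 * S.card) ≤ a c₁ ∧ ν < ‖Θ c₁ - Θ c₀‖ := by
    by_contra! hc
    have := key (V c₀) fun c hcS => by
      by_cases hh : l / (4 * S.card) ≤ a c
      · simp only [V, if_pos (hc c hcS hh)]
        linarith
      · linarith [hV0 c₀ c]
    linarith [hV c₀ hc₀]
  obtain ⟨c₂, hc₂, h2, h20, h21⟩ : ∃ c₂ ∈ S, l / (4 * S.card) ≤ a c₂ ∧ ν < ‖Θ c₂ - Θ c₀‖ ∧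
      ν < ‖Θ c₂ - Θ c₁‖ := by
    by_contra! hc
    have := key (fun c => V c₀ c + V c₁ c) fun c hcS => by
      by_cases hh : l / (4 * S.card) ≤ a c
      · by_cases h3 : ν < ‖Θ c - Θ c₀‖
        · have : V c₁ c = a c := by simp only [V, if_pos (hc c hcS hh h3)]
          linarith [hV0 c₀ c]
        · have : V c₀ c = a c := by simp only [V, if_pos (not_lt.1 h3)]
          linarith [hV0 c₁ c]
      · linarith [hV0 c₀ c, hV0 c₁ c]
    rw [Finset.sum_add_distrib] at this
    linarith [hV c₀ hc₀, hV c₁ hc₁]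
  exact ⟨c₀, hc₀, c₁, hc₁, c₂, hc₂, h10, h20, h21, h0, h1, h2⟩

lemma volume_arc_le {θ : ℂ} (hθ : ‖θ‖ = 1) {ρ : ℝ} (hρ : 0 < ρ) :
    volume {α : ℝ | α ∈ Set.Ioo (-Real.pi) Real.pi ∧ ‖circ 1 0 α - θ‖ ≤ ρ} ≤
      ENNReal.ofReal (16 * ρ) := by
  set Z := {α : ℝ | α ∈ Set.Icc (-Real.pi) Real.pi ∧ |Real.sin α| < ρ} with hZ
  have hsub : {α : ℝ | α ∈ Set.Ioo (-Real.pi) Real.pi ∧ ‖circ 1 0 α - θ‖ ≤ ρ} ⊆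
      (fun α => α - θ.arg) ⁻¹' ((fun x => 2⁻¹ * x) ⁻¹' Z) := by
    rintro α ⟨hα, hn⟩
    have h1 := Complex.neg_pi_lt_arg θ
    have h2 := Complex.arg_le_pi θ
    have hs : ‖circ 1 0 α - θ‖ = 2 * |Real.sin (2⁻¹ * (α - θ.arg))| := by
      have e : circ 1 0 α - θ = Complex.exp (θ.arg * Complex.I) *
          (Complex.exp (Complex.I * ((α - θ.arg : ℝ) : ℂ)) - 1) := by
        have h3 := Complex.norm_mul_exp_arg_mul_I θ
        rw [hθ, Complex.ofReal_one, one_mul] at h3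
        rw [mul_sub, ← Complex.exp_add, mul_one, h3, circ]
        push_cast
        simp only [one_mul, add_zero]
        ring_nf
      rw [e, norm_mul, Complex.norm_exp_ofReal_mul_I, one_mul,
        Complex.norm_exp_I_mul_ofReal_sub_one, Real.norm_eq_abs, abs_mul, abs_two]
      ring_nf
    refine ⟨⟨?_, ?_⟩, ?_⟩
    · show -Real.pi ≤ 2⁻¹ * (α - θ.arg)
      linarith [hα.1]
    · show 2⁻¹ * (α - θ.arg) ≤ Real.pi
      linarith [hα.2]
    · show |Real.sin (2⁻¹ * (α - θ.arg))| < ρ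
      linarith
  refine (measure_mono hsub).trans ?_
  simp only [sub_eq_add_neg]
  rw [measure_preimage_add_right, Real.volume_preimage_mul_left (by norm_num)]
  refine (mul_le_mul_right (volume_abs_sin_lt ρ hρ) _).trans ?_
  rw [← ENNReal.ofReal_mul (by positivity)]
  apply ENNReal.ofReal_le_ofReal
  norm_num
  linarith

section Near
variable {N : ℕ} {A δ B ε : ℝ} {t : Fin N → ℝ} {Φ φ : Fin N → ℝ → ℝ} {f : ℂ → ℝ}

lemma enorm_lab_le (φ : Fin N → ℝ → ℝ) (Y : ℂ → ℝ) {M : ℝ} (hM : ∀ x, |f x| ≤ M)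
    (b : ℤ × Fin N) (x : ℂ) :
    ‖lab φ Y f b x‖ₑ ≤ ENNReal.ofReal M * ∫⁻ v, ‖ker (φ b.2) Y v‖ₑ := by
  calc ‖lab φ Y f b x‖ₑ ≤ ∫⁻ y, ‖labK φ Y b (y - x) * f y‖ₑ := enorm_integral_le_lintegral_enorm _
    _ ≤ ∫⁻ y, ENNReal.ofReal M * ‖kerS (2 ^ b.1) (φ b.2) Y (y - x)‖ₑ := by
        refine lintegral_mono fun y => ?_
        dsimp only
        rw [enorm_mul, mul_comm]
        refine mul_le_mul_left ?_ _
        rw [Real.enorm_eq_ofReal_abs]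
        exact ENNReal.ofReal_le_ofReal (hM y)
    _ = _ := by
        rw [lintegral_const_mul' _ _ ENNReal.ofReal_ne_top, lintegral_kerS _ _ (by positivity)]

/-- The contribution of the sectors near a given direction is small for bounded functions. -/
lemma IsFamily.sum_near_le (hF : IsFamily A δ t Φ φ) (hε : 0 < ε) {ι : Type*} {S : Finset ι}
    {Θ : ι → ℂ} {Y : ι → ℂ → ℝ} (hY : ∀ c, IsCutoff B ε (Θ c) (Y c)) (hS : ∀ w, ∑ c ∈ S, Y c w = 1)
    {M : ℝ} (hM : ∀ x, |f x| ≤ M) {ν : ℝ} (hν : 0 < ν) (c₀ : ι) (b : ℤ × Fin N) (x : ℂ) :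
    ∑ c ∈ S with ‖Θ c - Θ c₀‖ ≤ ν, |lab φ (Y c) f b x| ≤ 32 * A * M * (ν + ε) := by
  set S' := S.filter fun c => ‖Θ c - Θ c₀‖ ≤ ν with hS'
  have hM0 : 0 ≤ M := (abs_nonneg _).trans (hM 0)
  have hA := hF.nonneg
  let g : ℂ → ℝ≥0∞ := fun w => ∑ c ∈ S', ENNReal.ofReal (Y c w)
  have hgm : Measurable g :=
    Finset.measurable_sum _ fun c _ => (hY c).measurable.ennreal_ofReal
  have hg1 : ∀ w, g w ≤ 1 := fun w => by
    calc g w ≤ ∑ c ∈ S, ENNReal.ofReal (Y c w) :=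
          Finset.sum_le_sum_of_subset (Finset.filter_subset _ _)
      _ = 1 := by
        rw [← ENNReal.ofReal_sum_of_nonneg fun c _ => (hY c).nonneg w, hS, ENNReal.ofReal_one]
  have hintg : ∫⁻ α in Set.Ioo (-Real.pi) Real.pi, g (circ 1 0 α) ≤
      ENNReal.ofReal (16 * (ν + ε)) := by
    refine le_trans ?_ (volume_arc_le (hY c₀).norm_center (add_pos hν hε))
    have hEm : MeasurableSet {α : ℝ | α ∈ Set.Ioo (-Real.pi) Real.pi ∧
        ‖circ 1 0 α - Θ c₀‖ ≤ ν + ε} := by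
      have : Measurable fun α => ‖circ 1 0 α - Θ c₀‖ := ((measurable_circ 1 0).sub_const _).norm
      exact measurableSet_Ioo.inter (measurableSet_le this measurable_const)
    rw [← lintegral_indicator measurableSet_Ioo, ← lintegral_indicator_one hEm]
    refine lintegral_mono fun α => ?_
    by_cases hα : α ∈ Set.Ioo (-Real.pi) Real.pi
    · rw [Set.indicator_of_mem hα]
      by_cases hα' : ‖circ 1 0 α - Θ c₀‖ ≤ ν + ε
      · rw [Set.indicator_of_mem (by exact ⟨hα, hα'⟩)]
        exact hg1 _
      · refine le_of_eq_of_le ?_ bot_le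
        refine Finset.sum_eq_zero fun c hc => ?_
        rw [(hY c).eq_zero, ENNReal.ofReal_zero]
        rw [norm_circ_one, mul_one, Complex.ofReal_one, one_mul]
        have := norm_sub_le_norm_sub_add_norm_sub (circ 1 0 α) (Θ c) (Θ c₀)
        have h2 := (Finset.mem_filter.1 hc).2
        linarith
    · rw [Set.indicator_of_notMem hα]
      exact bot_le
  have main : ENNReal.ofReal (∑ c ∈ S', |lab φ (Y c) f b x|) ≤
      ENNReal.ofReal (32 * A * M * (ν + ε)) := by
    calc ENNReal.ofReal (∑ c ∈ S', |lab φ (Y c) f b x|)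
        = ∑ c ∈ S', ‖lab φ (Y c) f b x‖ₑ := by
          rw [ENNReal.ofReal_sum_of_nonneg fun c _ => abs_nonneg _]
          simp only [Real.enorm_eq_ofReal_abs]
      _ ≤ ∑ c ∈ S', ENNReal.ofReal M * ∫⁻ v, ‖ker (φ b.2) (Y c) v‖ₑ :=
          Finset.sum_le_sum fun c _ => enorm_lab_le φ (Y c) hM b x
      _ = ENNReal.ofReal M * ∫⁻ v, ‖‖v‖⁻¹ * φ b.2 ‖v‖‖ₑ * g v := by
          rw [← Finset.mul_sum, ← lintegral_finsetSum _ fun c _ =>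
            (measurable_ker (hF.profile b.2) (hY c).measurable).enorm]
          congr 1
          refine lintegral_congr fun v => ?_
          rw [Finset.mul_sum]
          refine Finset.sum_congr rfl fun c _ => ?_
          rw [ker, enorm_mul, Real.enorm_of_nonneg ((hY c).nonneg v)]
      _ ≤ ENNReal.ofReal M * (ENNReal.ofReal (2 * A) * ENNReal.ofReal (16 * (ν + ε))) := by
          refine mul_le_mul_right ((lintegral_radial_le (hF.profile b.2) hF.pos hgm ?_).trans
            (mul_le_mul_right hintg _)) _
          intro s w hs
          exact Finset.sum_congr rfl fun c _ => by rw [(hY c).homog s w hs]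
      _ = _ := by
          rw [← ENNReal.ofReal_mul (by positivity), ← ENNReal.ofReal_mul hM0]
          ring_nf
  exact (ENNReal.ofReal_le_ofReal_iff (by positivity)).1 main

end Near

lemma measurable_sing : Measurable sing := by
  refine Measurable.indicator ?_ measurableSet_closedBall
  fun_prop

lemma measurable_ind16 : Measurable ind16 :=
  measurable_const.indicator measurableSet_closedBall

lemma lintegral_sing_le : ∃ C : ℝ, 0 ≤ C ∧ ∫⁻ z, sing z ≤ ENNReal.ofReal C := by
  obtain ⟨C, hC, h⟩ := lintegral_norm_rpow_le (γ := 1 / 2) (by norm_num) 16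
  refine ⟨√2 * C, by positivity, ?_⟩
  have hne : ∀ᵐ z : ℂ, z ≠ 0 := by
    simp [ae_iff, measure_singleton]
  calc ∫⁻ z, sing z ≤ ∫⁻ z, ENNReal.ofReal √2 * (closedBall (0 : ℂ) 16).indicator
        (fun z => ENNReal.ofReal (‖z‖ ^ (-(1 / 2) : ℝ))) z := by
        refine lintegral_mono_ae (hne.mono fun z hz => ?_)
        have hz' : 0 < ‖z‖ := norm_pos_iff.2 hz
        unfold sing
        by_cases hm : z ∈ closedBall (0 : ℂ) 16
        · rw [Set.indicator_of_mem hm, Set.indicator_of_mem hm,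
            ← ENNReal.ofReal_inv_of_pos (by positivity), ← ENNReal.ofReal_mul (by positivity)]
          apply ENNReal.ofReal_le_ofReal
          rw [Real.rpow_neg hz'.le, ← Real.sqrt_eq_rpow, Real.sqrt_div hz'.le]
          apply le_of_eq
          field_simp
        · rw [Set.indicator_of_notMem hm]
          exact bot_le
    _ ≤ _ := by
        rw [lintegral_const_mul' _ _ ENNReal.ofReal_ne_top, ENNReal.ofReal_mul (by positivity)]
        gcongr

lemma lintegral_ind16_le : ∫⁻ z, ind16 z ≤ ENNReal.ofReal 1024 := by
  unfold ind16
  rw [lintegral_indicator_const measurableSet_closedBall, Complex.volume_closedBall, one_mul,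
    ← ENNReal.ofReal_pow (by positivity), ← ENNReal.ofReal_coe_nnreal, NNReal.coe_real_pi,
    ← ENNReal.ofReal_mul (by positivity)]
  apply ENNReal.ofReal_le_ofReal
  linarith [Real.pi_lt_four]

section Tan
variable {N : ℕ}

open Classical in
/-- The tangential majorant of the correlation kernel for a choice `q` of labels. -/
noncomputable def tanW (K : ℝ≥0∞) (δ ε r₀ : ℝ) (t : Fin N → ℝ) (q : ℂ → ℤ × Fin N) (θ : ℂ)
    (x x' : ℂ) : ℝ≥0∞ :=
  if (q x).1 = (q x').1 then
    ENNReal.ofReal ((2 ^ (q x').1 : ℝ) ^ 2)⁻¹ * (K * ENNReal.ofReal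
      (tanK δ ε r₀ θ (t (q x).2 - t (q x').2) ((2 ^ (q x').1 : ℝ)⁻¹ • (x - x'))))
  else 0

lemma measurable_tanW (K : ℝ≥0∞) (δ ε r₀ : ℝ) (t : Fin N → ℝ) {q : ℂ → ℤ × Fin N}
    (hq : Measurable q) (θ : ℂ) : Measurable (Function.uncurry (tanW K δ ε r₀ t q θ)) := by
  unfold tanW Function.uncurry
  have h1 : Measurable fun p : ℂ × ℂ => q p.1 := hq.comp measurable_fst
  have h2 : Measurable fun p : ℂ × ℂ => q p.2 := hq.comp measurable_snd
  have hs : Measurable fun p : ℂ × ℂ => (2 ^ (q p.2).1 : ℝ) :=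
    (measurable_of_countable fun a : ℤ × Fin N => (2 ^ a.1 : ℝ)).comp h2
  have ht1 : Measurable fun p : ℂ × ℂ => t (q p.1).2 :=
    (measurable_of_countable fun a : ℤ × Fin N => t a.2).comp h1
  have ht2 : Measurable fun p : ℂ × ℂ => t (q p.2).2 :=
    (measurable_of_countable fun a : ℤ × Fin N => t a.2).comp h2
  refine Measurable.ite ?_ ?_ measurable_const
  · exact measurableSet_eq_fun h1.fst h2.fst
  · refine (hs.pow_const 2).inv.ennreal_ofReal.mul (Measurable.const_mul ?_ _)
    refine ((measurable_tanK δ ε r₀ θ).comp ((ht1.sub ht2).prodMk ?_)).ennreal_ofReal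
    exact hs.inv.smul (measurable_fst.sub measurable_snd)

lemma lintegral_mul_lintegral_swap {μ : Measure ℂ} [SFinite μ] {g : ℂ → ℝ≥0∞} (hg : Measurable g)
    {W : ℂ → ℂ → ℝ≥0∞} (hW : Measurable (Function.uncurry W)) :
    ∫⁻ x, g x * ∫⁻ y, W x y ∂μ ∂μ = ∫⁻ y, ∫⁻ x, g x * W x y ∂μ ∂μ := by
  rw [← lintegral_lintegral_swap ((hg.comp measurable_fst).mul hW).aemeasurable]
  refine lintegral_congr fun x => ?_
  exact (lintegral_const_mul (g x) (hW.comp measurable_prodMk_left)).symm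

lemma lintegral_tanW_le {K : ℝ} (hK : 0 ≤ K) {δ ε r₀ ν : ℝ} {θ₀ θ₁ θ₂ : ℂ} (hδ : 0 < δ)
    (hr : 0 < r₀)
    (hε : 0 < ε) (hν : 0 < ν) (hν1 : ν ≤ 1) (hεν : ε ≤ ν ^ 3 / 256)
    (h0 : ‖θ₀‖ = 1) (h1 : ‖θ₁‖ = 1) (h2 : ‖θ₂‖ = 1)
    (h01 : ν ≤ ‖θ₁ - θ₀‖) (h02 : ν ≤ ‖θ₂ - θ₀‖) (h12 : ν ≤ ‖θ₁ - θ₂‖)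
    (t : Fin N → ℝ) (q : ℂ → ℤ × Fin N) (y₀ y₁ y₂ : ℂ) :
    ∫⁻ x, tanW (ENNReal.ofReal K) δ ε r₀ t q θ₀ x y₀ * tanW (ENNReal.ofReal K) δ ε r₀ t q θ₁ x y₁ *
      tanW (ENNReal.ofReal K) δ ε r₀ t q θ₂ x y₂ ≤
    ENNReal.ofReal (K ^ 3 * (27648 * wtSum ^ 2 * ((√(δ ^ 3))⁻¹ * r₀⁻¹ * (δ * ν⁻¹ ^ 3) ^ 2))) *
      (ENNReal.ofReal ((2 ^ (q y₀).1 : ℝ) ^ 2)⁻¹ * sing ((2 ^ (q y₀).1 : ℝ)⁻¹ • (y₁ - y₀))) *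
      (ENNReal.ofReal ((2 ^ (q y₀).1 : ℝ) ^ 2)⁻¹ * ind16 ((2 ^ (q y₀).1 : ℝ)⁻¹ • (y₂ - y₀))) := by
  by_cases hq : (q y₁).1 = (q y₀).1 ∧ (q y₂).1 = (q y₀).1
  swap
  · refine le_of_eq_of_le ?_ bot_le
    rw [lintegral_eq_zero_of_ae_eq_zero (ae_of_all _ fun x => ?_)]
    · rfl
    · by_contra hne
      apply hq
      simp only [Pi.zero_apply, mul_eq_zero, not_or] at hne
      have e0 : (q x).1 = (q y₀).1 := by by_contra h; exact hne.1.1 (if_neg h)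
      have e1 : (q x).1 = (q y₁).1 := by by_contra h; exact hne.1.2 (if_neg h)
      have e2 : (q x).1 = (q y₂).1 := by by_contra h; exact hne.2 (if_neg h)
      exact ⟨e1.symm.trans e0, e2.symm.trans e0⟩
  set s : ℝ := 2 ^ (q y₀).1 with hs
  have hs0 : 0 < s := by positivity
  set c := ENNReal.ofReal (s ^ 2)⁻¹ with hc
  have hc0 : c ≠ 0 := by
    rw [hc, Ne, ENNReal.ofReal_eq_zero, not_le]; positivity
  have hct : c ≠ ⊤ := ENNReal.ofReal_ne_top
  set k := ENNReal.ofReal K with hk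
  let h : ℂ → ℝ≥0∞ := fun x =>
    ENNReal.ofReal (tanK δ ε r₀ θ₀ (t (q x).2 - t (q y₀).2) (s⁻¹ • x - s⁻¹ • y₀)) *
    ENNReal.ofReal (tanK δ ε r₀ θ₁ (t (q x).2 - t (q y₁).2) (s⁻¹ • x - s⁻¹ • y₁)) *
    ENNReal.ofReal (tanK δ ε r₀ θ₂ (t (q x).2 - t (q y₂).2) (s⁻¹ • x - s⁻¹ • y₂))
  have hsub := lintegral_comp_smul_complex h hs0.ne'
  rw [Complex.finrank_real_complex, abs_of_pos (by positivity), ← hc] at hsub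
  have htri := trilinear_le hδ hr hε hν hν1 hεν h0 h1 h2 h01 h02 h12 (s⁻¹ • y₀) (s⁻¹ • y₁)
    (s⁻¹ • y₂) (t (q y₀).2) (t (q y₁).2) (t (q y₂).2) (fun v => t (q (s • v)).2)
  have hW : ∀ (θ x y : ℂ), (q y).1 = (q y₀).1 → tanW k δ ε r₀ t q θ x y ≤
      c * (k * ENNReal.ofReal (tanK δ ε r₀ θ (t (q x).2 - t (q y).2) (s⁻¹ • x - s⁻¹ • y))) := by
    intro θ x y hy
    unfold tanW
    split_ifs
    · rw [hy, ← hs, smul_sub]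
    · exact bot_le
  calc _ ≤ ∫⁻ x, (c ^ 2 * k ^ 3) * (c * h x) := by
        refine lintegral_mono fun x => ?_
        refine (mul_le_mul' (mul_le_mul' (hW θ₀ x y₀ rfl) (hW θ₁ x y₁ hq.1))
          (hW θ₂ x y₂ hq.2)).trans (le_of_eq ?_)
        simp only [h]
        ring
    _ = (c ^ 2 * k ^ 3) * ∫⁻ v, h (s • v) := by
        rw [lintegral_const_mul' _ _ (by finiteness), lintegral_const_mul' _ _ hct, hsub]
    _ ≤ (c ^ 2 * k ^ 3) * (ENNReal.ofReal (27648 * wtSum ^ 2 *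
        ((√(δ ^ 3))⁻¹ * r₀⁻¹ * (δ * ν⁻¹ ^ 3) ^ 2)) *
        (sing (s⁻¹ • y₁ - s⁻¹ • y₀) * ind16 (s⁻¹ • y₂ - s⁻¹ • y₀))) := by
        refine mul_le_mul_right (le_of_eq_of_le ?_ htri) _
        refine lintegral_congr fun v => ?_
        simp only [h, inv_smul_smul₀ hs0.ne']
    _ = _ := by
        rw [ENNReal.ofReal_mul (pow_nonneg hK 3), ENNReal.ofReal_pow hK, ← hk, smul_sub, smul_sub]
        ring

/-- The trilinear estimate for row sums of the tangential kernels. -/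
lemma exists_trilinear_bound : ∃ C : ℝ, 0 ≤ C ∧ ∀ {N : ℕ} {K : ℝ} (_ : 0 ≤ K) {δ ε r₀ ν : ℝ}
    {θ₀ θ₁ θ₂ : ℂ} (_ : 0 < δ) (_ : 0 < r₀) (_ : 0 < ε) (_ : 0 < ν) (_ : ν ≤ 1)
    (_ : ε ≤ ν ^ 3 / 256)
    (_ : ‖θ₀‖ = 1) (_ : ‖θ₁‖ = 1) (_ : ‖θ₂‖ = 1)
    (_ : ν ≤ ‖θ₁ - θ₀‖) (_ : ν ≤ ‖θ₂ - θ₀‖) (_ : ν ≤ ‖θ₁ - θ₂‖)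
    (t : Fin N → ℝ) {q : ℂ → ℤ × Fin N} (_ : Measurable q) (G : Set ℂ),
    ∫⁻ x in G, (∫⁻ y in G, tanW (ENNReal.ofReal K) δ ε r₀ t q θ₀ x y) *
      (∫⁻ y in G, tanW (ENNReal.ofReal K) δ ε r₀ t q θ₁ x y) *
      (∫⁻ y in G, tanW (ENNReal.ofReal K) δ ε r₀ t q θ₂ x y) ≤
    ENNReal.ofReal (C * (K ^ 3 * ((√(δ ^ 3))⁻¹ * r₀⁻¹ * (δ * ν⁻¹ ^ 3) ^ 2))) * volume G := by
  obtain ⟨C, hC, hsing⟩ := lintegral_sing_le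
  refine ⟨27648 * wtSum ^ 2 * C * 1024, by positivity, ?_⟩
  intro N K hK δ ε r₀ ν θ₀ θ₁ θ₂ hδ hr hε hν hν1 hεν h0 h1 h2 h01 h02 h12 t q hq G
  set k := ENNReal.ofReal K with hk
  have hm : ∀ θ, Measurable (Function.uncurry (tanW k δ ε r₀ t q θ)) := measurable_tanW k δ ε r₀ t hq
  have hmx : ∀ θ y, Measurable fun x => tanW k δ ε r₀ t q θ x y := fun θ y =>
    (hm θ).comp (measurable_id.prodMk measurable_const)
  have hd : ∀ θ, Measurable fun x => ∫⁻ y in G, tanW k δ ε r₀ t q θ x y := fun θ =>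
    (hm θ).lintegral_prod_right'
  set D := ENNReal.ofReal (K ^ 3 * (27648 * wtSum ^ 2 *
    ((√(δ ^ 3))⁻¹ * r₀⁻¹ * (δ * ν⁻¹ ^ 3) ^ 2))) with hD
  have hDt : D ≠ ⊤ := ENNReal.ofReal_ne_top
  have step : ∀ y₀, ∫⁻ y₁ in G, ∫⁻ y₂ in G, ∫⁻ x in G, tanW k δ ε r₀ t q θ₀ x y₀ *
      tanW k δ ε r₀ t q θ₁ x y₁ * tanW k δ ε r₀ t q θ₂ x y₂ ≤
      D * ENNReal.ofReal C * ENNReal.ofReal 1024 := by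
    intro y₀
    set s : ℝ := 2 ^ (q y₀).1 with hs
    have hs0 : 0 < s := by positivity
    calc _ ≤ ∫⁻ y₁, ∫⁻ y₂, D * (ENNReal.ofReal (s ^ 2)⁻¹ * sing (s⁻¹ • (y₁ - y₀))) *
          (ENNReal.ofReal (s ^ 2)⁻¹ * ind16 (s⁻¹ • (y₂ - y₀))) := by
          refine (setLIntegral_le_lintegral _ _).trans (lintegral_mono fun y₁ => ?_)
          refine (setLIntegral_le_lintegral _ _).trans (lintegral_mono fun y₂ => ?_)
          exact (setLIntegral_le_lintegral _ _).trans
            (lintegral_tanW_le hK hδ hr hε hν hν1 hεν h0 h1 h2 h01 h02 h12 t q y₀ y₁ y₂)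
      _ = D * (∫⁻ y, sing y) * ∫⁻ y, ind16 y := by
          have hmi : Measurable fun y₂ => ENNReal.ofReal (s ^ 2)⁻¹ * ind16 (s⁻¹ • (y₂ - y₀)) :=
            (measurable_ind16.comp ((measurable_id.sub_const y₀).const_smul s⁻¹)).const_mul _
          have hms : Measurable fun y₂ => ENNReal.ofReal (s ^ 2)⁻¹ * sing (s⁻¹ • (y₂ - y₀)) :=
            (measurable_sing.comp ((measurable_id.sub_const y₀).const_smul s⁻¹)).const_mul _
          simp only [lintegral_const_mul _ hmi, lintegral_scale ind16 hs0 y₀]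
          rw [lintegral_mul_const _ (hms.const_mul _), lintegral_const_mul _ hms,
            lintegral_scale sing hs0 y₀]
      _ ≤ _ := by
          gcongr
          exact lintegral_ind16_le
  calc _ = ∫⁻ x in G, ((∫⁻ y in G, tanW k δ ε r₀ t q θ₁ x y) *
        (∫⁻ y in G, tanW k δ ε r₀ t q θ₂ x y)) * (∫⁻ y in G, tanW k δ ε r₀ t q θ₀ x y) :=
        lintegral_congr fun x => by ring
    _ = ∫⁻ y₀ in G, ∫⁻ x in G, (tanW k δ ε r₀ t q θ₀ x y₀ *
        (∫⁻ y in G, tanW k δ ε r₀ t q θ₂ x y)) * (∫⁻ y in G, tanW k δ ε r₀ t q θ₁ x y) := by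
        refine (lintegral_mul_lintegral_swap ((hd θ₁).mul (hd θ₂)) (hm θ₀)).trans ?_
        exact lintegral_congr fun y => lintegral_congr fun x => by simp only [Pi.mul_apply]; ring
    _ = ∫⁻ y₀ in G, ∫⁻ y₁ in G, ∫⁻ x in G, (tanW k δ ε r₀ t q θ₀ x y₀ *
        tanW k δ ε r₀ t q θ₁ x y₁) * (∫⁻ y in G, tanW k δ ε r₀ t q θ₂ x y) := by
        refine lintegral_congr fun y₀ => ?_
        refine (lintegral_mul_lintegral_swap ((hmx θ₀ y₀).mul (hd θ₂)) (hm θ₁)).trans ?_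
        exact lintegral_congr fun y => lintegral_congr fun x => by simp only [Pi.mul_apply]; ring
    _ = ∫⁻ y₀ in G, ∫⁻ y₁ in G, ∫⁻ y₂ in G, ∫⁻ x in G, tanW k δ ε r₀ t q θ₀ x y₀ *
        tanW k δ ε r₀ t q θ₁ x y₁ * tanW k δ ε r₀ t q θ₂ x y₂ := by
        refine lintegral_congr fun y₀ => lintegral_congr fun y₁ => ?_
        exact lintegral_mul_lintegral_swap ((hmx θ₀ y₀).mul (hmx θ₁ y₁)) (hm θ₂)
    _ ≤ ∫⁻ y₀ in G, D * ENNReal.ofReal C * ENNReal.ofReal 1024 := lintegral_mono step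
    _ = _ := by
        rw [lintegral_const, Measure.restrict_apply_univ, hD, ← ENNReal.ofReal_mul (by positivity),
          ← ENNReal.ofReal_mul (by positivity)]
        congr 2
        ring

end Tan

/-- If the integral of a product of three functions is small, one of them is small on a large
part of the space. -/
lemma measure_univ_le_of_lintegral_mul_le {X : Type*} [MeasurableSpace X] {μ : Measure X}
    [IsFiniteMeasure μ] {d : Fin 3 → X → ℝ≥0∞} (hd : ∀ a, Measurable (d a)) {κ : ℝ≥0∞}
    (hκ0 : κ ≠ 0) (hκt : κ ≠ ⊤)
    (h : ∫⁻ x, d 0 x * d 1 x * d 2 x ∂μ ≤ κ ^ 3 * (μ Set.univ / 2)) :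
    μ Set.univ ≤ 2 * ∑ a, μ {x | d a x ≤ κ} := by
  have h3 : κ ^ 3 ≠ 0 := pow_ne_zero _ hκ0
  have h3t : κ ^ 3 ≠ ⊤ := ENNReal.pow_ne_top hκt
  have hb : μ {x | κ ^ 3 ≤ d 0 x * d 1 x * d 2 x} ≤ μ Set.univ / 2 := by
    have := (mul_meas_ge_le_lintegral₀ (μ := μ)
      (((hd 0).mul (hd 1)).mul (hd 2)).aemeasurable (κ ^ 3)).trans h
    exact (ENNReal.mul_le_mul_iff_right h3 h3t).1 this
  have hcov : μ Set.univ ≤ μ Set.univ / 2 + ∑ a, μ {x | d a x ≤ κ} := by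
    refine le_trans (measure_mono (t := {x | κ ^ 3 ≤ d 0 x * d 1 x * d 2 x} ∪
      ⋃ a ∈ (Finset.univ : Finset (Fin 3)), {x | d a x ≤ κ}) ?_) ((measure_union_le _ _).trans
        (add_le_add hb (measure_biUnion_finset_le _ _)))
    intro x _
    by_cases hx : ∃ a, d a x ≤ κ
    · obtain ⟨a, ha⟩ := hx
      right
      simp only [Set.mem_iUnion]
      exact ⟨a, Finset.mem_univ _, ha⟩
    · left
      push Not at hx
      show κ ^ 3 ≤ d 0 x * d 1 x * d 2 x
      calc κ ^ 3 = κ * κ * κ := by ring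
        _ ≤ _ := mul_le_mul' (mul_le_mul' (hx 0).le (hx 1).le) (hx 2).le
  have hhalf : μ Set.univ / 2 ≠ ⊤ := (ENNReal.div_lt_top (measure_ne_top _ _) (by norm_num)).ne
  nth_rewrite 1 [← ENNReal.add_halves (μ Set.univ)] at hcov
  have h1 := (ENNReal.add_le_add_iff_left hhalf).1 hcov
  calc μ Set.univ = μ Set.univ / 2 * 2 := (ENNReal.div_mul_cancel (by norm_num) (by norm_num)).symm
    _ ≤ (∑ a, μ {x | d a x ≤ κ}) * 2 := mul_le_mul_left h1 _
    _ = _ := mul_comm _ _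

/-- Weak-type gain when three transversal sectors are simultaneously large. -/
theorem exists_weak_triple (A : ℝ) {B : ℝ} (hB : 1 ≤ B) : ∃ C : ℝ, 0 ≤ C ∧
    ∀ {N : ℕ} {δ : ℝ} {t : Fin N → ℝ} {Φ φ : Fin N → ℝ → ℝ}, IsFamily A δ t Φ φ →
    ∀ {ε ν : ℝ}, 0 < ε → ε ≤ 1 / 20 → 0 < ν → ν ≤ 1 → ε ≤ ν ^ 3 / 256 →
    ∀ {Θ : Fin 3 → ℂ} {Y : Fin 3 → ℂ → ℝ}, (∀ a, IsCutoff B ε (Θ a) (Y a)) →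
    ν ≤ ‖Θ 1 - Θ 0‖ → ν ≤ ‖Θ 2 - Θ 0‖ → ν ≤ ‖Θ 1 - Θ 2‖ →
    ∀ {L : ℕ}, (1 / 2 : ℝ) ^ L ≤ δ ^ 3 → ∀ {f : ℂ → ℝ}, IsTest f →
    ∀ {T : Finset (ℤ × Fin N)}, IsSep L T → ∀ {l : ℝ≥0∞}, l ≠ 0 →
      l ^ 2 * volume {x | ∃ b ∈ T, ∀ a, l ≤ ‖lab φ (Y a) f b x‖ₑ} ≤
        (∫⁻ y, ‖f y‖ₑ ^ 2) * ENNReal.ofReal (C * (ε⁻¹ ^ 4 * δ ^ (1 / 32 : ℝ))) := by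
  obtain ⟨C₀, hC₀, htri⟩ := exists_trilinear_bound
  obtain ⟨C₁, hC₁, hbad⟩ := lintegral_badK_le
  refine ⟨6 * ((2 * C₀ + 1) * (7200 * A ^ 2 * B + 1) + (C₁ * (A ^ 2 * B) + 196608 * A ^ 2 * B)),
    by positivity, ?_⟩
  intro N δ t Φ φ hF ε ν hε hε' hν hν1 hεν Θ Y hY h10 h20 h12 L hL f hf T hT l hl0
  have hδ := hF.pos
  have hδ1 : δ ≤ 1 := by linarith [hF.le]
  rcases T.eq_empty_or_nonempty with rfl | hTn
  · simp
  have hε1 : 1 ≤ ε⁻¹ := (one_le_inv₀ hε).2 (by linarith)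
  have hmeas : ∀ b, MeasurableSet {x | ∀ a, l ≤ ‖lab φ (Y a) f b x‖ₑ} := fun b => by
    rw [Set.ofPred_forall]
    exact MeasurableSet.iInter fun a =>
      measurableSet_le measurable_const (hF.measurable_lab (hY a).measurable hf.measurable b).enorm
  obtain ⟨q, hq, hqT, hqP⟩ := exists_selector hTn hmeas
  set G := {x | ∃ b ∈ T, ∀ a, l ≤ ‖lab φ (Y a) f b x‖ₑ} with hG
  have hGt : volume G ≠ ⊤ := hF.volume_level_ne_top (Y := Y 0) hf T hl0 fun x ⟨b, hb, hbx⟩ =>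
    ⟨b, hb, hbx 0⟩
  have hGm : MeasurableSet G := by
    have : G = ⋃ b ∈ T, {x | ∀ a, l ≤ ‖lab φ (Y a) f b x‖ₑ} := by
      ext x; simp [hG]
    rw [this]
    exact Finset.measurableSet_biUnion _ fun b _ => hmeas b
  set r₀ := δ ^ (3 / 8 : ℝ) with hr₀
  have hr : 0 < r₀ := Real.rpow_pos_of_pos hδ _
  set K := 7200 * A ^ 2 * B * ε⁻¹ with hK
  have hK0 : 0 ≤ K := by positivity
  let d : Fin 3 → ℂ → ℝ≥0∞ := fun a x =>
    ∫⁻ y in G, tanW (ENNReal.ofReal K) δ ε r₀ t q (Θ a) x y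
  have hd : ∀ a, Measurable (d a) := fun a =>
    (measurable_tanW (ENNReal.ofReal K) δ ε r₀ t hq (Θ a)).lintegral_prod_right'
  set κ := (2 * C₀ + 1) * (7200 * A ^ 2 * B + 1) * (ε⁻¹ ^ 2 * δ ^ (1 / 24 : ℝ)) with hκ
  have hd24 : 0 < δ ^ (1 / 24 : ℝ) := Real.rpow_pos_of_pos hδ _
  have hκ0 : 0 < κ := by positivity
  have : IsFiniteMeasure (volume.restrict G) := ⟨by
    rw [Measure.restrict_apply_univ]; exact hGt.lt_top⟩
  have hV : C₀ * (K ^ 3 * ((√(δ ^ 3))⁻¹ * r₀⁻¹ * (δ * ν⁻¹ ^ 3) ^ 2)) ≤ κ ^ 3 / 2 := by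
    have e1 : (√(δ ^ 3))⁻¹ * r₀⁻¹ * δ ^ 2 = (δ ^ (1 / 24 : ℝ)) ^ 3 := by
      rw [Real.sqrt_eq_rpow, hr₀, ← Real.rpow_natCast, ← Real.rpow_natCast, ← Real.rpow_natCast,
        ← Real.rpow_mul hδ.le, ← Real.rpow_mul hδ.le, ← Real.rpow_neg hδ.le,
        ← Real.rpow_neg hδ.le, ← Real.rpow_add hδ, ← Real.rpow_add hδ]
      norm_num
    have e2 : ν⁻¹ ^ 3 ≤ ε⁻¹ := by
      rw [inv_pow]
      have : 0 < ν ^ 3 := by positivity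
      exact inv_anti₀ hε (by linarith)
    have e3 : (C₀ : ℝ) ≤ (2 * C₀ + 1) ^ 3 / 2 := by nlinarith [pow_nonneg hC₀ 2, pow_nonneg hC₀ 3]
    have e4 : (7200 * A ^ 2 * B) ^ 3 ≤ (7200 * A ^ 2 * B + 1) ^ 3 := by
      gcongr
      linarith
    have e5 : ε⁻¹ ^ 5 ≤ ε⁻¹ ^ 6 := pow_le_pow_right₀ hε1 (by norm_num)
    calc C₀ * (K ^ 3 * ((√(δ ^ 3))⁻¹ * r₀⁻¹ * (δ * ν⁻¹ ^ 3) ^ 2))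
        = C₀ * ((7200 * A ^ 2 * B) ^ 3 * (ε⁻¹ ^ 3 * (ν⁻¹ ^ 3) ^ 2 *
          ((√(δ ^ 3))⁻¹ * r₀⁻¹ * δ ^ 2))) := by rw [hK]; ring
      _ ≤ C₀ * ((7200 * A ^ 2 * B) ^ 3 * (ε⁻¹ ^ 3 * ε⁻¹ ^ 2 * (δ ^ (1 / 24 : ℝ)) ^ 3)) := by
          rw [e1]; gcongr
      _ = C₀ * ((7200 * A ^ 2 * B) ^ 3 * (ε⁻¹ ^ 5 * (δ ^ (1 / 24 : ℝ)) ^ 3)) := by ring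
      _ ≤ (2 * C₀ + 1) ^ 3 / 2 * ((7200 * A ^ 2 * B + 1) ^ 3 *
          (ε⁻¹ ^ 6 * (δ ^ (1 / 24 : ℝ)) ^ 3)) := by gcongr
      _ = κ ^ 3 / 2 := by rw [hκ]; ring
  have hbig : volume G ≤ 2 * ∑ a, volume ({x | d a x ≤ ENNReal.ofReal κ} ∩ G) := by
    have h := measure_univ_le_of_lintegral_mul_le (μ := volume.restrict G) hd
      (κ := ENNReal.ofReal κ) (by rw [Ne, ENNReal.ofReal_eq_zero, not_le]; exact hκ0)
      ENNReal.ofReal_ne_top (by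
        refine (htri hK0 hδ hr hε hν hν1 hεν (hY 0).norm_center (hY 1).norm_center
          (hY 2).norm_center h10 h20 h12 t hq G).trans ?_
        rw [Measure.restrict_apply_univ, ← ENNReal.ofReal_pow hκ0.le, ENNReal.div_eq_inv_mul,
          ← mul_assoc (ENNReal.ofReal (κ ^ 3))]
        refine mul_le_mul_left ?_ _
        refine (ENNReal.ofReal_le_ofReal hV).trans (le_of_eq ?_)
        rw [ENNReal.ofReal_div_of_pos (by norm_num), ENNReal.div_eq_inv_mul, mul_comm]
        norm_num)
    rw [Measure.restrict_apply_univ] at h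
    refine h.trans (le_of_eq ?_)
    congr 1
    refine Finset.sum_congr rfl fun a _ => ?_
    rw [Measure.restrict_apply (measurableSet_le (hd a) measurable_const)]
  set ρ := C₁ * (A ^ 2 * B * ε⁻¹ ^ 4 * δ ^ (1 / 32 : ℝ)) with hρ
  have hd32 : 0 < δ ^ (1 / 32 : ℝ) := Real.rpow_pos_of_pos hδ _
  have hone : ∀ a, l ^ 2 * volume ({x | d a x ≤ ENNReal.ofReal κ} ∩ G) ≤ (∫⁻ y, ‖f y‖ₑ ^ 2) *
      (ENNReal.ofReal κ + (ENNReal.ofReal ρ + ENNReal.ofReal (196608 * A ^ 2 * B * ε⁻¹ * δ))) := by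
    intro a
    refine hF.weak_of_row_bound (hY a) hε (by linarith) hB hL hq hT hqT
      ((measurableSet_le (hd a) measurable_const).inter hGm)
      (measure_ne_top_of_subset Set.inter_subset_right hGt) hf.measurable hf.integrable
      (fun x hx => hqP x hx.2 a) (W := tanW (ENNReal.ofReal K) δ ε r₀ t q (Θ a))
      (R := fun z => badK A B δ ε r₀ z + ({0} : Set ℂ).indicator (fun _ => ⊤) z)
      ((measurable_badK _ _ _ _ _).add
        (measurable_const.indicator (measurableSet_singleton 0))) ?_ ?_ ?_
    · rw [lintegral_add_right _ (measurable_const.indicator (measurableSet_singleton 0)),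
        lintegral_indicator_const (measurableSet_singleton 0), measure_singleton, mul_zero, add_zero]
      exact hbad A B δ ε hδ hδ1 hε (by linarith) hB
    · intro x hx
      exact (lintegral_mono_set Set.inter_subset_right).trans hx.1
    · intro x _ x' _ hxx
      unfold tanW
      rw [if_pos hxx, ← hxx, ← mul_add]
      gcongr
      by_cases hz : (2 ^ (q x).1 : ℝ)⁻¹ • (x - x') = 0
      · simp [hz]
      · rw [← add_assoc]
        refine le_add_right ?_
        exact enorm_interact_le (hF.profile _) (hF.profile _) (hY a) (hF.center _) (hF.center _) hδ
          hF.le hε hε' hB hr hz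
  calc l ^ 2 * volume G ≤ l ^ 2 * (2 * ∑ a, volume ({x | d a x ≤ ENNReal.ofReal κ} ∩ G)) := by
        gcongr
    _ = 2 * ∑ a, l ^ 2 * volume ({x | d a x ≤ ENNReal.ofReal κ} ∩ G) := by
        rw [← Finset.mul_sum]; ring
    _ ≤ 2 * ∑ _a : Fin 3, (∫⁻ y, ‖f y‖ₑ ^ 2) * (ENNReal.ofReal κ +
        (ENNReal.ofReal ρ + ENNReal.ofReal (196608 * A ^ 2 * B * ε⁻¹ * δ))) := by
        exact mul_le_mul_right (Finset.sum_le_sum fun a _ => hone a) _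
    _ = (∫⁻ y, ‖f y‖ₑ ^ 2) * (6 * (ENNReal.ofReal κ +
        (ENNReal.ofReal ρ + ENNReal.ofReal (196608 * A ^ 2 * B * ε⁻¹ * δ)))) := by
        rw [Finset.sum_const, Finset.card_univ, Fintype.card_fin, nsmul_eq_mul]
        push_cast
        ring
    _ ≤ _ := by
        gcongr
        rw [← ENNReal.ofReal_add (by positivity) (by positivity),
          ← ENNReal.ofReal_add (by positivity) (by positivity),
          show (6 : ℝ≥0∞) = ENNReal.ofReal 6 by norm_num, ← ENNReal.ofReal_mul (by norm_num)]
        apply ENNReal.ofReal_le_ofReal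
        have f1 : ε⁻¹ ^ 2 ≤ ε⁻¹ ^ 4 := pow_le_pow_right₀ hε1 (by norm_num)
        have f2 : ε⁻¹ ≤ ε⁻¹ ^ 4 := le_self_pow₀ hε1 (by norm_num)
        have f3 : δ ^ (1 / 24 : ℝ) ≤ δ ^ (1 / 32 : ℝ) :=
          Real.rpow_le_rpow_of_exponent_ge hδ hδ1 (by norm_num)
        have f4 : δ ≤ δ ^ (1 / 32 : ℝ) := by
          nth_rewrite 1 [← Real.rpow_one δ]
          exact Real.rpow_le_rpow_of_exponent_ge hδ hδ1 (by norm_num)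
        have g1 : κ ≤ (2 * C₀ + 1) * (7200 * A ^ 2 * B + 1) * (ε⁻¹ ^ 4 * δ ^ (1 / 32 : ℝ)) := by
          rw [hκ]; gcongr
        have g2 : 196608 * A ^ 2 * B * ε⁻¹ * δ ≤
            196608 * A ^ 2 * B * (ε⁻¹ ^ 4 * δ ^ (1 / 32 : ℝ)) := by
          rw [mul_assoc (196608 * A ^ 2 * B)]; gcongr
        have g3 : ρ = C₁ * (A ^ 2 * B) * (ε⁻¹ ^ 4 * δ ^ (1 / 32 : ℝ)) := by rw [hρ]; ring
        rw [g3]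
        linarith

/-- Weak-type gain for functions that are bounded by a moderate multiple of the level. -/
theorem exists_broad {A : ℝ} (hA : 0 ≤ A) : ∃ C : ℝ, 0 ≤ C ∧
    ∀ {N : ℕ} {δ : ℝ} {t : Fin N → ℝ} {Φ φ : Fin N → ℝ → ℝ}, IsFamily A δ t Φ φ →
    ∀ {L : ℕ}, 0 < L → (1 / 2 : ℝ) ^ L ≤ δ ^ 3 → ∀ {f : ℂ → ℝ}, IsTest f →
    ∀ (T : Finset (ℤ × Fin N)) {l R : ℝ}, 0 < l → 1 ≤ R → (∀ x, |f x| ≤ R * l) →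
      ENNReal.ofReal l ^ 2 * volume {x | ∃ b ∈ T, l ≤ |lab φ 1 f b x|} ≤
        ENNReal.ofReal (C * (R ^ 42 * δ ^ (1 / 32 : ℝ) * L)) * ∫⁻ y, ‖f y‖ₑ ^ 2 := by
  obtain ⟨B, hB, hpart⟩ := exists_partition
  obtain ⟨C, hC, htriple⟩ := exists_weak_triple A hB
  refine ⟨16 * 121 ^ 5 * C * (256 * (256 * (A + 1)) ^ 3) ^ 14, by positivity, ?_⟩
  intro N δ t Φ φ hF L hL0 hL f hf T l R hl hR hfR
  have hδ := hF.pos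
  have hd32 : 0 < δ ^ (1 / 32 : ℝ) := Real.rpow_pos_of_pos hδ _
  set ν := (256 * (A + 1) * R)⁻¹ with hν
  have hν0 : 0 < ν := by positivity
  have hν1 : ν ≤ 1 := by
    refine inv_le_one_of_one_le₀ ?_
    nlinarith
  set ε := ν ^ 3 / 256 with hε
  have hε0 : 0 < ε := by positivity
  have hν3 : ν ^ 3 ≤ ν := pow_le_of_le_one hν0.le hν1 (by norm_num)
  have hε' : ε ≤ 1 / 20 := by linarith
  have hεinv : ε⁻¹ = 256 * (256 * (A + 1)) ^ 3 * R ^ 3 := by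
    rw [hε, hν]
    field_simp
  obtain ⟨S, Θ, Y, hcard, hY, hsum⟩ := hpart ε hε0 (by linarith)
  have hnear : ∀ b x, ∀ c₀ ∈ S, ∑ c ∈ S with ‖Θ c - Θ c₀‖ ≤ ν, |lab φ (Y c) f b x| ≤ l / 4 := by
    intro b x c₀ _
    refine (hF.sum_near_le hε0 hY hsum hfR hν0 c₀ b x).trans ?_
    have h1 : 32 * A * (R * l) * (ν + ε) ≤ 32 * (A + 1) * (R * l) * (2 * ν) := by
      gcongr
      · linarith
      · linarith
    refine h1.trans (le_of_eq ?_)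
    rw [hν]
    field_simp
    norm_num
  set D := (S.card : ℝ) with hDdef
  have hSn : S.Nonempty := by
    rw [Finset.nonempty_iff_ne_empty]
    rintro rfl
    simpa using hsum 0
  have hD : (0 : ℝ) < D := by
    rw [hDdef]
    exact_mod_cast hSn.card_pos
  set l' := ENNReal.ofReal (l / (4 * D)) with hl'
  set I := ∫⁻ y, ‖f y‖ₑ ^ 2 with hI
  let P : Finset ((ℕ × ℕ) × (ℕ × ℕ) × (ℕ × ℕ)) := (S ×ˢ S ×ˢ S).filter fun p =>
    ν < ‖Θ p.2.1 - Θ p.1‖ ∧ ν < ‖Θ p.2.2 - Θ p.1‖ ∧ ν < ‖Θ p.2.2 - Θ p.2.1‖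
  let c : ((ℕ × ℕ) × (ℕ × ℕ) × (ℕ × ℕ)) → Fin 3 → ℕ × ℕ := fun p => ![p.1, p.2.1, p.2.2]
  let G : _ → ℕ → Set ℂ := fun p m =>
    {x | ∃ b ∈ T.filter fun b => b.1 % (L : ℤ) = m, ∀ a, l' ≤ ‖lab φ (Y (c p a)) f b x‖ₑ}
  have hG : ∀ p ∈ P, ∀ m, l' ^ 2 * volume (G p m) ≤
      I * ENNReal.ofReal (C * (ε⁻¹ ^ 4 * δ ^ (1 / 32 : ℝ))) := by
    intro p hp m
    obtain ⟨-, h10, h20, h21⟩ := Finset.mem_filter.1 hp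
    refine htriple hF hε0 hε' hν0 hν1 le_rfl (Θ := fun a => Θ (c p a)) (fun a => hY (c p a))
      h10.le h20.le ?_ hL hf (isSep_filter T m) ?_
    · rw [norm_sub_rev]
      exact h21.le
    · rw [hl', Ne, ENNReal.ofReal_eq_zero, not_le]
      positivity
  have hsub : {x | ∃ b ∈ T, l ≤ |lab φ 1 f b x|} ⊆
      ⋃ p ∈ P, ⋃ m ∈ Finset.range L, G p m := by
    rintro x ⟨b, hb, hbx⟩
    rw [hF.lab_eq_sum hf hY hsum] at hbx
    obtain ⟨c₀, hc₀, c₁, hc₁, c₂, hc₂, h10, h20, h21, h0, h1, h2⟩ :=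
      exists_separated_triple (Θ := Θ) hl (hbx.trans (Finset.abs_sum_le_sum_abs _ _))
        (fun c => abs_nonneg _) (hnear b x)
    have hL' : (0 : ℤ) < L := by exact_mod_cast hL0
    have m1 := Int.emod_nonneg b.1 hL'.ne'
    have m2 := Int.emod_lt_of_pos b.1 hL'
    simp only [Set.mem_iUnion]
    refine ⟨(c₀, c₁, c₂), ?_, (b.1 % (L : ℤ)).toNat, ?_, b, ?_, ?_⟩
    · rw [Finset.mem_filter, Finset.mem_product, Finset.mem_product]
      exact ⟨⟨hc₀, hc₁, hc₂⟩, h10, h20, h21⟩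
    · rw [Finset.mem_range]
      omega
    · rw [Finset.mem_filter]
      refine ⟨hb, ?_⟩
      omega
    · intro a
      rw [Real.enorm_eq_ofReal_abs]
      apply ENNReal.ofReal_le_ofReal
      fin_cases a
      exacts [h0, h1, h2]
  have hvol : volume {x | ∃ b ∈ T, l ≤ |lab φ 1 f b x|} ≤
      ∑ p ∈ P, ∑ m ∈ Finset.range L, volume (G p m) := by
    refine (measure_mono hsub).trans ((measure_biUnion_finset_le _ _).trans ?_)
    exact Finset.sum_le_sum fun c _ => measure_biUnion_finset_le _ _
  have hll : ENNReal.ofReal l = ENNReal.ofReal (4 * D) * l' := by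
    rw [hl', ← ENNReal.ofReal_mul (by positivity), mul_div_cancel₀ _ (by positivity)]
  have hPcard : (P.card : ℝ) ≤ D ^ 3 := by
    have h1 : P.card ≤ (S ×ˢ S ×ˢ S).card := Finset.card_filter_le _ _
    rw [Finset.card_product, Finset.card_product] at h1
    calc (P.card : ℝ) ≤ ((S.card * (S.card * S.card) : ℕ) : ℝ) := by exact_mod_cast h1
      _ = D ^ 3 := by push_cast; rw [hDdef]; ring
  clear_value P D
  calc _ ≤ (ENNReal.ofReal (4 * D) * l') ^ 2 *
        ∑ p ∈ P, ∑ m ∈ Finset.range L, volume (G p m) := by rw [hll]; gcongr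
    _ = ENNReal.ofReal (4 * D) ^ 2 *
        ∑ p ∈ P, ∑ m ∈ Finset.range L, l' ^ 2 * volume (G p m) := by
        simp only [Finset.mul_sum, mul_pow, mul_assoc]
    _ ≤ ENNReal.ofReal (4 * D) ^ 2 * ∑ _p ∈ P, ∑ _m ∈ Finset.range L,
        I * ENNReal.ofReal (C * (ε⁻¹ ^ 4 * δ ^ (1 / 32 : ℝ))) := by
        refine mul_le_mul_right (Finset.sum_le_sum fun c hc =>
          Finset.sum_le_sum fun m _ => hG c hc m) _
    _ = ENNReal.ofReal ((4 * D) ^ 2 * (P.card * (L * (C * (ε⁻¹ ^ 4 * δ ^ (1 / 32 : ℝ)))))) * I := by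
        simp only [Finset.sum_const, nsmul_eq_mul, Finset.card_range]
        set x := C * (ε⁻¹ ^ 4 * δ ^ (1 / 32 : ℝ)) with hx
        have hx0 : 0 ≤ x := by positivity
        clear_value x
        rw [ENNReal.ofReal_mul (p := (4 * D) ^ 2) (by positivity),
          ENNReal.ofReal_mul (p := (P.card : ℝ)) (by positivity),
          ENNReal.ofReal_mul (p := (L : ℝ)) (by positivity), ENNReal.ofReal_pow (by positivity)]
        simp only [ENNReal.ofReal_natCast]
        ring
    _ ≤ _ := by
        gcongr ENNReal.ofReal ?_ * I
        calc (4 * D) ^ 2 * (P.card * (L * (C * (ε⁻¹ ^ 4 * δ ^ (1 / 32 : ℝ)))))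
            ≤ (4 * D) ^ 2 * (D ^ 3 * (L * (C * (ε⁻¹ ^ 4 * δ ^ (1 / 32 : ℝ))))) := by gcongr
          _ = 16 * D ^ 5 * (L * (C * (ε⁻¹ ^ 4 * δ ^ (1 / 32 : ℝ)))) := by ring
          _ ≤ 16 * (121 * ε⁻¹ ^ 2) ^ 5 * (L * (C * (ε⁻¹ ^ 4 * δ ^ (1 / 32 : ℝ)))) := by gcongr
          _ = 16 * 121 ^ 5 * C * ε⁻¹ ^ 14 * (δ ^ (1 / 32 : ℝ) * L) := by ring
          _ = _ := by rw [hεinv]; ring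

lemma lintegral_level_eq {f : ℂ → ℝ} (hf : Measurable f) {p c : ℝ} (hp : 2 < p) (hc : 0 < c) :
    ∫⁻ t in Set.Ioi (0 : ℝ), (∫⁻ x in {x | c * t < |f x|}, ‖f x‖ₑ ^ 2) *
      ENNReal.ofReal (t ^ (p - 3)) =
    ENNReal.ofReal (c ^ (-(p - 2)) / (p - 2)) * ∫⁻ x, ENNReal.ofReal (|f x| ^ p) := by
  have hp2 : 0 < p - 2 := by linarith
  have hf2 : Measurable fun x => ‖f x‖ₑ ^ 2 := hf.enorm.pow_const 2
  set ν := (volume : Measure ℂ).withDensity fun x => ‖f x‖ₑ ^ 2 with hν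
  have key := lintegral_rpow_eq_lintegral_meas_lt_mul ν (f := fun x => |f x| / c)
    (ae_of_all _ fun x => by positivity) (hf.abs.div_const c).aemeasurable hp2
  have h1 : ∫⁻ x, ENNReal.ofReal ((|f x| / c) ^ (p - 2)) ∂ν =
      ENNReal.ofReal (c ^ (-(p - 2))) * ∫⁻ x, ENNReal.ofReal (|f x| ^ p) := by
    rw [hν, lintegral_withDensity_eq_lintegral_mul _ hf2
      ((hf.abs.div_const c).pow_const (p - 2)).ennreal_ofReal,
      ← lintegral_const_mul' _ _ ENNReal.ofReal_ne_top]
    refine lintegral_congr fun x => ?_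
    have hcp : 0 < c ^ (-(p - 2)) := Real.rpow_pos_of_pos hc _
    rw [Pi.mul_apply, Real.enorm_eq_ofReal_abs, ← ENNReal.ofReal_pow (abs_nonneg _),
      ← ENNReal.ofReal_mul (by positivity), ← ENNReal.ofReal_mul hcp.le]
    congr 1
    rw [Real.div_rpow (abs_nonneg _) hc.le, Real.rpow_neg hc.le]
    rcases (abs_nonneg (f x)).eq_or_lt with h0 | h0
    · rw [← h0, Real.zero_rpow (by linarith), Real.zero_rpow (by linarith)]
      simp
    · have : |f x| ^ p = |f x| ^ 2 * |f x| ^ (p - 2) := by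
        rw [← Real.rpow_two, ← Real.rpow_add h0]
        ring_nf
      rw [this]
      ring
  have h2 : ∀ t, ν {x | t < |f x| / c} = ∫⁻ x in {x | c * t < |f x|}, ‖f x‖ₑ ^ 2 := by
    intro t
    have : {x | t < |f x| / c} = {x | c * t < |f x|} := by
      ext x
      exact (lt_div_iff₀' hc)
    rw [this, hν, withDensity_apply _ (measurableSet_lt measurable_const hf.abs)]
  rw [h1] at key
  simp only [h2, show p - 2 - 1 = p - 3 by ring] at key
  have h3 : ENNReal.ofReal (c ^ (-(p - 2)) / (p - 2)) =
      (ENNReal.ofReal (p - 2))⁻¹ * ENNReal.ofReal (c ^ (-(p - 2))) := by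
    rw [ENNReal.ofReal_div_of_pos hp2, ENNReal.div_eq_inv_mul]
  rw [h3, mul_assoc, key, ← mul_assoc, ENNReal.inv_mul_cancel, one_mul]
  · rw [Ne, ENNReal.ofReal_eq_zero, not_le]; exact hp2
  · exact ENNReal.ofReal_ne_top

/-- Marcinkiewicz-type interpolation from truncated weak `L²` bounds. -/
theorem lintegral_rpow_le_of_truncated_weak {f g : ℂ → ℝ} (hf : Measurable f) (hg : Measurable g)
    (hg0 : ∀ x, 0 ≤ g x) {p a b c d : ℝ} (hp : 2 < p) (ha : 0 ≤ a) (hb : 0 ≤ b) (hc : 0 < c)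
    (hd : 0 < d)
    (h : ∀ l : ℝ, 0 < l → ENNReal.ofReal l ^ 2 * volume {x | l ≤ g x} ≤
      ENNReal.ofReal a * (∫⁻ x in {x | c * l < |f x|}, ‖f x‖ₑ ^ 2) +
      ENNReal.ofReal b * (∫⁻ x in {x | d * l < |f x|}, ‖f x‖ₑ ^ 2)) :
    ∫⁻ x, ENNReal.ofReal (g x ^ p) ≤
      ENNReal.ofReal (p / (p - 2) * (a * c ^ (-(p - 2)) + b * d ^ (-(p - 2)))) *
        ∫⁻ x, ENNReal.ofReal (|f x| ^ p) := by
  have hp2 : 0 < p - 2 := by linarith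
  have hcp : 0 < c ^ (-(p - 2)) := Real.rpow_pos_of_pos hc _
  have hdp : 0 < d ^ (-(p - 2)) := Real.rpow_pos_of_pos hd _
  rw [lintegral_rpow_eq_lintegral_meas_le_mul volume (ae_of_all _ hg0) hg.aemeasurable
    (by linarith : 0 < p)]
  have hmeas : ∀ c : ℝ, Measurable fun t : ℝ => (∫⁻ x in {x | c * t < |f x|}, ‖f x‖ₑ ^ 2) *
      ENNReal.ofReal (t ^ (p - 3)) := by
    intro c
    refine Measurable.mul ?_ (by fun_prop)
    have : ∀ t : ℝ, ∫⁻ x in {x | c * t < |f x|}, ‖f x‖ₑ ^ 2 =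
        ∫⁻ x, {q : ℝ × ℂ | c * q.1 < |f q.2|}.indicator (fun q => ‖f q.2‖ₑ ^ 2) (t, x) := by
      intro t
      rw [← lintegral_indicator (measurableSet_lt measurable_const hf.abs)]
      rfl
    simp only [this]
    refine Measurable.lintegral_prod_right' (f := fun q : ℝ × ℂ =>
      {q : ℝ × ℂ | c * q.1 < |f q.2|}.indicator (fun q => ‖f q.2‖ₑ ^ 2) q) ?_
    refine ((hf.comp measurable_snd).enorm.pow_const 2).indicator ?_
    exact measurableSet_lt (measurable_fst.const_mul c) (hf.comp measurable_snd).abs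
  calc _ ≤ ENNReal.ofReal p * ∫⁻ t in Set.Ioi (0 : ℝ),
        (ENNReal.ofReal a * ((∫⁻ x in {x | c * t < |f x|}, ‖f x‖ₑ ^ 2) *
          ENNReal.ofReal (t ^ (p - 3))) +
        ENNReal.ofReal b * ((∫⁻ x in {x | d * t < |f x|}, ‖f x‖ₑ ^ 2) *
          ENNReal.ofReal (t ^ (p - 3)))) := by
        refine mul_le_mul_right (setLIntegral_mono' measurableSet_Ioi fun t ht => ?_) _
        have ht0 : (0 : ℝ) < t := ht
        have e : ENNReal.ofReal (t ^ (p - 1)) =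
            ENNReal.ofReal t ^ 2 * ENNReal.ofReal (t ^ (p - 3)) := by
          rw [← ENNReal.ofReal_pow ht0.le, ← ENNReal.ofReal_mul (by positivity), ← Real.rpow_two,
            ← Real.rpow_add ht0]
          ring_nf
        calc volume {x | t ≤ g x} * ENNReal.ofReal (t ^ (p - 1))
            = ENNReal.ofReal t ^ 2 * volume {x | t ≤ g x} * ENNReal.ofReal (t ^ (p - 3)) := by
              rw [e]; ring
          _ ≤ _ := mul_le_mul_left (h t ht0) _
          _ = _ := by ring
    _ = ENNReal.ofReal p * (ENNReal.ofReal a * (ENNReal.ofReal (c ^ (-(p - 2)) / (p - 2)) *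
          ∫⁻ x, ENNReal.ofReal (|f x| ^ p)) + ENNReal.ofReal b *
          (ENNReal.ofReal (d ^ (-(p - 2)) / (p - 2)) * ∫⁻ x, ENNReal.ofReal (|f x| ^ p))) := by
        rw [lintegral_add_left ((hmeas c).const_mul _),
          lintegral_const_mul' _ _ ENNReal.ofReal_ne_top,
          lintegral_const_mul' _ _ ENNReal.ofReal_ne_top, lintegral_level_eq hf hp hc,
          lintegral_level_eq hf hp hd]
    _ = _ := by
        rw [← mul_assoc, ← mul_assoc, ← ENNReal.ofReal_mul ha, ← ENNReal.ofReal_mul hb, ← add_mul,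
          ← ENNReal.ofReal_add (by positivity) (by positivity), ← mul_assoc,
          ← ENNReal.ofReal_mul (by linarith)]
        congr 2
        field_simp

lemma IsTest.indicator {f : ℂ → ℝ} (hf : IsTest f) {S : Set ℂ} (hS : MeasurableSet S) :
    IsTest (S.indicator f) := by
  obtain ⟨M, hM⟩ := hf.bdd
  obtain ⟨R, hR⟩ := hf.supp
  refine ⟨hf.measurable.indicator hS, ⟨M, fun x => ?_⟩, ⟨R, fun x hx => ?_⟩⟩
  · by_cases hx : x ∈ S
    · rw [Set.indicator_of_mem hx]; exact hM x
    · rw [Set.indicator_of_notMem hx, abs_zero]; exact (abs_nonneg _).trans (hM x)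
  · by_cases hx' : x ∈ S
    · rw [Set.indicator_of_mem hx']; exact hR x hx
    · rw [Set.indicator_of_notMem hx']

lemma IsFamily.lab_add {N : ℕ} {A δ : ℝ} {t : Fin N → ℝ} {Φ φ : Fin N → ℝ → ℝ} {f g : ℂ → ℝ}
    (hF : IsFamily A δ t Φ φ) (hf : IsTest f) (hg : IsTest g) (b : ℤ × Fin N) (x : ℂ) :
    lab φ 1 (f + g) b x = lab φ 1 f b x + lab φ 1 g b x := by
  have h1 : ∀ w : ℂ, |(1 : ℂ → ℝ) w| ≤ 1 := fun w => by simp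
  unfold lab
  rw [← integral_add (hF.integrable_lab measurable_one h1 hf b x)
    (hF.integrable_lab measurable_one h1 hg b x)]
  simp only [Pi.add_apply, mul_add]

lemma setLIntegral_enorm_indicator {f : ℂ → ℝ} {S : Set ℂ} (hS : MeasurableSet S) :
    ∫⁻ x, ‖S.indicator f x‖ₑ ^ 2 = ∫⁻ x in S, ‖f x‖ₑ ^ 2 := by
  rw [← lintegral_indicator hS]
  refine lintegral_congr fun x => ?_
  by_cases hx : x ∈ S <;> simp [hx]

/-- Truncated weak-type bound for the frequency-localized maximal operator. -/
lemma exists_truncated_weak {A s : ℝ} (hA : 0 ≤ A) (hs : 0 < s) (hs1 : s ≤ 1) : ∃ C : ℝ, 0 ≤ C ∧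
    ∀ {N : ℕ} {δ : ℝ} {t : Fin N → ℝ} {Φ φ : Fin N → ℝ → ℝ}, IsFamily A δ t Φ φ →
    ∀ {L : ℕ}, 0 < L → (1 / 2 : ℝ) ^ L ≤ δ ^ 3 → ∀ {f : ℂ → ℝ}, IsTest f →
    ∀ (T : Finset (ℤ × Fin N)) {l R : ℝ}, 0 < l → 1 ≤ R →
      ENNReal.ofReal l ^ 2 * volume {x | ∃ b ∈ T, l ≤ |lab φ 1 f b x|} ≤
        ENNReal.ofReal (C * (R ^ 42 * δ ^ (1 / 32 : ℝ) * L)) *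
          (∫⁻ x in {x | (48 * (A + 1))⁻¹ * l < |f x|}, ‖f x‖ₑ ^ 2) +
        ENNReal.ofReal (C * (δ ^ (-(2 * s)) * L)) *
          (∫⁻ x in {x | R / 3 * l < |f x|}, ‖f x‖ₑ ^ 2) := by
  obtain ⟨C₁, hC₁, h1⟩ := exists_broad hA
  obtain ⟨C₂, hC₂, h2⟩ := exists_weak_l2 A hs hs1
  refine ⟨9 * (C₁ + C₂), by positivity, ?_⟩
  intro N δ t Φ φ hF L hL0 hL f hf T l R hl hR
  have hδ := hF.pos
  have hd1 : 0 < δ ^ (1 / 32 : ℝ) := Real.rpow_pos_of_pos hδ _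
  have hd2 : 0 < δ ^ (-(2 * s)) := Real.rpow_pos_of_pos hδ _
  set c := (48 * (A + 1))⁻¹ with hc
  have hc0 : 0 < c := by positivity
  have hc1 : c ≤ 1 / 3 := by
    rw [hc, inv_le_comm₀ (by positivity) (by norm_num)]
    norm_num; linarith
  have hcA : 16 * A * c ≤ 1 / 3 := by
    rw [hc, ← div_eq_mul_inv, div_le_iff₀ (by positivity)]
    linarith
  set S₁ := {x | |f x| ≤ c * l} with hS₁
  set S₃ := {x | R / 3 * l < |f x|} with hS₃
  set S₂ := {x | c * l < |f x| ∧ |f x| ≤ R / 3 * l} with hS₂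
  have hm := hf.measurable
  have mS₁ : MeasurableSet S₁ := measurableSet_le hm.abs measurable_const
  have mS₃ : MeasurableSet S₃ := measurableSet_lt measurable_const hm.abs
  have mS₂ : MeasurableSet S₂ := (measurableSet_lt measurable_const hm.abs).inter
    (measurableSet_le hm.abs measurable_const)
  have hcd : c * l ≤ R / 3 * l := by gcongr; linarith
  have hdec : f = S₁.indicator f + (S₂.indicator f + S₃.indicator f) := by
    funext x
    simp only [Pi.add_apply, Set.indicator_apply, hS₁, hS₂, hS₃, Set.mem_ofPred_eq]
    rcases le_or_gt |f x| (c * l) with h | h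
    · rw [if_pos h, if_neg (fun h' => absurd h'.1 (not_lt.2 h)),
        if_neg (not_lt.2 (h.trans hcd))]
      ring
    · rcases le_or_gt |f x| (R / 3 * l) with h' | h'
      · rw [if_neg (not_le.2 h), if_pos ⟨h, h'⟩, if_neg (not_lt.2 h')]
        ring
      · rw [if_neg (not_le.2 h), if_neg (fun h'' => absurd h''.2 (not_le.2 h')), if_pos h']
        ring
  have ht₁ := hf.indicator mS₁
  have ht₂ := hf.indicator mS₂
  have ht₃ := hf.indicator mS₃
  have ht₂₃ : IsTest (S₂.indicator f + S₃.indicator f) := by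
    have : S₂.indicator f + S₃.indicator f = (S₁ᶜ).indicator f := by
      rw [Set.indicator_compl]
      nth_rewrite 3 [hdec]
      simp
    rw [this]
    exact hf.indicator mS₁.compl
  have hsmall : ∀ b x, |lab φ 1 (S₁.indicator f) b x| ≤ l / 3 := by
    intro b x
    have hM : ∀ x, |S₁.indicator f x| ≤ c * l := by
      intro x
      by_cases hx : x ∈ S₁
      · rw [Set.indicator_of_mem hx]; exact hx
      · rw [Set.indicator_of_notMem hx, abs_zero]; positivity
    have h := (enorm_lab_le φ 1 hM b x).trans (mul_le_mul_right
      (lintegral_ker_le (hF.profile b.2) hδ (fun w => by simp)) _)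
    rw [Real.enorm_eq_ofReal_abs, ← ENNReal.ofReal_mul (by positivity),
      ENNReal.ofReal_le_ofReal_iff (by positivity)] at h
    refine h.trans ?_
    calc c * l * (16 * A) = 16 * A * c * l := by ring
      _ ≤ 1 / 3 * l := by gcongr
      _ = l / 3 := by ring
  set V₂ := {x | ∃ b ∈ T, l / 3 ≤ |lab φ 1 (S₂.indicator f) b x|} with hV₂
  set V₃ := {x | ∃ b ∈ T, l / 3 ≤ |lab φ 1 (S₃.indicator f) b x|} with hV₃
  have hsub : {x | ∃ b ∈ T, l ≤ |lab φ 1 f b x|} ⊆ V₂ ∪ V₃ := by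
    rintro x ⟨b, hb, hbx⟩
    rw [hdec, hF.lab_add ht₁ ht₂₃, hF.lab_add ht₂ ht₃] at hbx
    by_contra hx
    simp only [Set.mem_union, not_or, hV₂, hV₃, Set.mem_ofPred_eq, not_exists, not_and,
      not_le] at hx
    have e1 := hsmall b x
    have e2 := hx.1 b hb
    have e3 := hx.2 b hb
    have e4 := abs_add_three (lab φ 1 (S₁.indicator f) b x) (lab φ 1 (S₂.indicator f) b x)
      (lab φ 1 (S₃.indicator f) b x)
    rw [add_assoc] at e4
    linarith
  have hb2 := h1 hF hL0 hL ht₂ T (l := l / 3) (R := R) (by positivity) hR (by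
    intro x
    by_cases hx : x ∈ S₂
    · rw [Set.indicator_of_mem hx]
      exact hx.2.trans (le_of_eq (by ring))
    · rw [Set.indicator_of_notMem hx, abs_zero]; positivity)
  have hb3 := h2 hF hL0 hL ht₃ T (l := l / 3) (by positivity)
  rw [setLIntegral_enorm_indicator mS₂] at hb2
  rw [setLIntegral_enorm_indicator mS₃] at hb3
  have hl9 : ENNReal.ofReal l ^ 2 = ENNReal.ofReal 9 * ENNReal.ofReal (l / 3) ^ 2 := by
    rw [← ENNReal.ofReal_pow hl.le, ← ENNReal.ofReal_pow (by positivity),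
      ← ENNReal.ofReal_mul (by norm_num)]
    congr 1
    ring
  have hI : ∫⁻ x in S₂, ‖f x‖ₑ ^ 2 ≤ ∫⁻ x in {x | c * l < |f x|}, ‖f x‖ₑ ^ 2 :=
    lintegral_mono_set fun x hx => hx.1
  calc _ ≤ ENNReal.ofReal 9 * ENNReal.ofReal (l / 3) ^ 2 * (volume V₂ + volume V₃) := by
        rw [hl9]
        exact mul_le_mul_right ((measure_mono hsub).trans (measure_union_le _ _)) _
    _ = ENNReal.ofReal 9 * (ENNReal.ofReal (l / 3) ^ 2 * volume V₂) +
        ENNReal.ofReal 9 * (ENNReal.ofReal (l / 3) ^ 2 * volume V₃) := by ring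
    _ ≤ ENNReal.ofReal 9 * (ENNReal.ofReal (C₁ * (R ^ 42 * δ ^ (1 / 32 : ℝ) * L)) *
          ∫⁻ x in {x | c * l < |f x|}, ‖f x‖ₑ ^ 2) +
        ENNReal.ofReal 9 * (ENNReal.ofReal (C₂ * (δ ^ (-(2 * s)) * L)) *
          ∫⁻ x in S₃, ‖f x‖ₑ ^ 2) :=
        add_le_add (mul_le_mul_right (hb2.trans (mul_le_mul_right hI _)) _)
          (mul_le_mul_right hb3 _)
    _ ≤ _ := by
        rw [← mul_assoc (ENNReal.ofReal 9), ← mul_assoc (ENNReal.ofReal 9),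
          ← ENNReal.ofReal_mul (by norm_num), ← ENNReal.ofReal_mul (by norm_num)]
        refine add_le_add (mul_le_mul_left (ENNReal.ofReal_le_ofReal ?_) _)
          (mul_le_mul_left (ENNReal.ofReal_le_ofReal ?_) _)
        · rw [← mul_assoc]
          refine mul_le_mul_of_nonneg_right ?_ (by positivity)
          linarith
        · rw [← mul_assoc]
          refine mul_le_mul_of_nonneg_right ?_ (by positivity)
          linarith

lemma measurable_finset_sup {ι β : Type*} [SemilatticeSup β] [OrderBot β] [MeasurableSpace β]
    [MeasurableSup₂ β] {g : ι → ℂ → β} (hg : ∀ b, Measurable (g b)) (T : Finset ι) :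
    Measurable fun x => T.sup fun b => g b x := by
  have : (fun x => T.sup fun b => g b x) = T.sup g := by
    funext x
    rw [Finset.sup_apply]
  rw [this]
  exact Finset.sup_induction (p := Measurable) measurable_const (fun _ h _ h' => h.sup h')
    fun b _ => hg b

lemma lintegral_iSup_rpow_le {ι : Type*} [Countable ι] {g : ι → ℂ → ℝ≥0∞}
    (hg : ∀ b, Measurable (g b)) {p : ℝ} (hp : 0 < p) {K : ℝ≥0∞}
    (h : ∀ T : Finset ι, ∫⁻ x, (T.sup fun b => g b x) ^ p ≤ K) :
    ∫⁻ x, (⨆ b, g b x) ^ p ≤ K := by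
  classical
  have e : ∀ x, (⨆ b, g b x) ^ p = ⨆ T : Finset ι, (T.sup fun b => g b x) ^ p := by
    intro x
    rw [iSup_eq_iSup_finset]
    simp only [← Finset.sup_eq_iSup]
    exact (ENNReal.orderIsoRpow p hp).map_iSup _
  simp only [e]
  rw [lintegral_iSup_directed]
  · exact iSup_le h
  · intro T
    exact ((measurable_finset_sup hg T).pow_const p).aemeasurable
  · intro T T'
    refine ⟨T ∪ T', fun x => ?_, fun x => ?_⟩
    · exact ENNReal.rpow_le_rpow (Finset.sup_mono Finset.subset_union_left) hp.le
    · exact ENNReal.rpow_le_rpow (Finset.sup_mono Finset.subset_union_right) hp.le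

/-- Interpolation for the maximal function over an arbitrary countable family. -/
lemma lintegral_iSup_rpow_le_of_truncated_weak {ι : Type*} [Countable ι] {f : ℂ → ℝ}
    {g : ι → ℂ → ℝ} (hf : Measurable f) (hg : ∀ b, Measurable (g b))
    {p a b c d : ℝ} (hp : 2 < p) (ha : 0 ≤ a) (hb : 0 ≤ b) (hc : 0 < c) (hd : 0 < d)
    (h : ∀ (T : Finset ι) (l : ℝ), 0 < l →
      ENNReal.ofReal l ^ 2 * volume {x | ∃ i ∈ T, l ≤ |g i x|} ≤
      ENNReal.ofReal a * (∫⁻ x in {x | c * l < |f x|}, ‖f x‖ₑ ^ 2) +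
      ENNReal.ofReal b * (∫⁻ x in {x | d * l < |f x|}, ‖f x‖ₑ ^ 2)) :
    ∫⁻ x, (⨆ i, ‖g i x‖ₑ) ^ p ≤
      ENNReal.ofReal (p / (p - 2) * (a * c ^ (-(p - 2)) + b * d ^ (-(p - 2)))) *
        ∫⁻ x, ‖f x‖ₑ ^ p := by
  refine lintegral_iSup_rpow_le (fun i => (hg i).enorm) (by linarith) fun T => ?_
  have hGm : Measurable fun x => ((T.sup fun i => ‖g i x‖₊ : NNReal) : ℝ) :=
    measurable_coe_nnreal_real.comp (measurable_finset_sup (fun b => (hg b).nnnorm) T)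
  have main := lintegral_rpow_le_of_truncated_weak hf hGm (fun x => NNReal.coe_nonneg _) hp ha hb
    hc hd (by
      intro l hl
      have : {x | l ≤ ((T.sup fun i => ‖g i x‖₊ : NNReal) : ℝ)} = {x | ∃ i ∈ T, l ≤ |g i x|} := by
        ext x
        lift l to NNReal using hl.le
        have hl' : (⊥ : NNReal) < l := by exact_mod_cast hl
        simp only [Set.mem_ofPred_eq, NNReal.coe_le_coe, Finset.le_sup_iff hl']
        rfl
      rw [this]
      exact h T l hl)
  have e1 : ∀ x, (T.sup fun i => ‖g i x‖ₑ) ^ p =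
      ENNReal.ofReal (((T.sup fun i => ‖g i x‖₊ : NNReal) : ℝ) ^ p) := by
    intro x
    rw [← ENNReal.ofReal_rpow_of_nonneg (NNReal.coe_nonneg _) (by linarith),
      ENNReal.ofReal_coe_nnreal]
    congr 1
    exact (Finset.apply_sup_eq_sup_comp (fun r : NNReal => (r : ℝ≥0∞))
      (fun x y => by exact ENNReal.coe_max x y) rfl).symm
  have e2 : ∀ x, ‖f x‖ₑ ^ p = ENNReal.ofReal (|f x| ^ p) := by
    intro x
    rw [← ENNReal.ofReal_rpow_of_nonneg (abs_nonneg _) (by linarith), Real.enorm_eq_ofReal_abs]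
  simp only [e1, e2]
  exact main

/-- Strong-type bound with geometric decay for the frequency-localized maximal operator. -/
theorem exists_strong {A p : ℝ} (hA : 0 ≤ A) (hp : 2 < p) : ∃ C γ : ℝ, 0 ≤ C ∧ 0 < γ ∧
    ∀ {N : ℕ} {δ : ℝ} {t : Fin N → ℝ} {Φ φ : Fin N → ℝ → ℝ}, IsFamily A δ t Φ φ →
    ∀ {L : ℕ}, 0 < L → (1 / 2 : ℝ) ^ L ≤ δ ^ 3 → ∀ {f : ℂ → ℝ}, IsTest f →
      ∫⁻ x, (⨆ b, ‖lab φ 1 f b x‖ₑ) ^ p ≤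
        ENNReal.ofReal (C * (δ ^ γ * L)) * ∫⁻ x, ‖f x‖ₑ ^ p := by
  have hp2 : 0 < p - 2 := by linarith
  set u : ℝ := 1 / 2688 with hu
  set s := min 1 (u * (p - 2) / 4) with hs
  have hs0 : 0 < s := lt_min one_pos (by positivity)
  obtain ⟨C, hC, hweak⟩ := exists_truncated_weak hA hs0 (min_le_left _ _)
  set c := (48 * (A + 1))⁻¹ with hc
  have hc0 : 0 < c := by positivity
  set γ := min (1 / 64) (u * (p - 2) / 2) with hγ
  have hcp : 0 < c ^ (-(p - 2)) := Real.rpow_pos_of_pos hc0 _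
  have h3p : 0 < (1 / 3 : ℝ) ^ (-(p - 2)) := Real.rpow_pos_of_pos (by norm_num) _
  refine ⟨p / (p - 2) * (C * (c ^ (-(p - 2)) + (1 / 3 : ℝ) ^ (-(p - 2)))), γ, by positivity,
    lt_min (by norm_num) (by positivity), ?_⟩
  intro N δ t Φ φ hF L hL0 hL f hf
  have hδ := hF.pos
  have hδ1 : δ ≤ 1 := by linarith [hF.le]
  set R := δ ^ (-u) with hR
  have hR0 : 0 < R := Real.rpow_pos_of_pos hδ _
  have hR1 : 1 ≤ R := by
    rw [hR, Real.rpow_neg hδ.le]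
    exact (one_le_inv₀ (Real.rpow_pos_of_pos hδ _)).2
      (Real.rpow_le_one hδ.le hδ1 (by norm_num))
  have hd1 : 0 < δ ^ (1 / 32 : ℝ) := Real.rpow_pos_of_pos hδ _
  have hd2 : 0 < δ ^ (-(2 * s)) := Real.rpow_pos_of_pos hδ _
  have main := lintegral_iSup_rpow_le_of_truncated_weak (ι := ℤ × Fin N)
    (g := fun b x => lab φ 1 f b x) hf.measurable
    (fun b => hF.measurable_lab measurable_one hf.measurable b) hp
    (a := C * (R ^ 42 * δ ^ (1 / 32 : ℝ) * L)) (b := C * (δ ^ (-(2 * s)) * L))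
    (by positivity) (by positivity) hc0 (by positivity : 0 < R / 3)
    (fun T l hl => hweak hF hL0 hL hf T hl hR1)
  refine main.trans (mul_le_mul_left (ENNReal.ofReal_le_ofReal ?_) _)
  rw [mul_assoc (p / (p - 2))]
  refine mul_le_mul_of_nonneg_left ?_ (by positivity)
  have e1 : R ^ 42 * δ ^ (1 / 32 : ℝ) ≤ δ ^ γ := by
    rw [hR, ← Real.rpow_natCast, ← Real.rpow_mul hδ.le, ← Real.rpow_add hδ]
    refine Real.rpow_le_rpow_of_exponent_ge hδ hδ1 ((min_le_left _ _).trans ?_)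
    rw [hu]
    norm_num
  have e2 : δ ^ (-(2 * s)) * (R / 3) ^ (-(p - 2)) ≤ (1 / 3) ^ (-(p - 2)) * δ ^ γ := by
    rw [div_eq_mul_one_div, Real.mul_rpow hR0.le (by norm_num), ← mul_assoc, mul_comm]
    refine mul_le_mul_of_nonneg_left ?_ h3p.le
    rw [hR, ← Real.rpow_mul hδ.le, ← Real.rpow_add hδ]
    refine Real.rpow_le_rpow_of_exponent_ge hδ hδ1 ((min_le_right _ _).trans ?_)
    have : s ≤ u * (p - 2) / 4 := min_le_right _ _
    linarith
  have hLp : (0 : ℝ) ≤ L := by positivity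
  calc _ = C * c ^ (-(p - 2)) * L * (R ^ 42 * δ ^ (1 / 32 : ℝ)) +
        C * L * (δ ^ (-(2 * s)) * (R / 3) ^ (-(p - 2))) := by ring
    _ ≤ C * c ^ (-(p - 2)) * L * δ ^ γ + C * L * ((1 / 3) ^ (-(p - 2)) * δ ^ γ) := by
        gcongr
    _ = _ := by ring

/-- The normalized indicator of a disc of radius comparable to `s`. -/
noncomputable def discK (s : ℝ) (w : ℂ) : ℝ :=
  (closedBall (0 : ℂ) (4 * s)).indicator (fun _ => (s ^ 2)⁻¹) w

lemma discK_nonneg (s : ℝ) (w : ℂ) : 0 ≤ discK s w :=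
  Set.indicator_nonneg (fun _ _ => by positivity) w

lemma discK_le (s : ℝ) (w : ℂ) : discK s w ≤ (s ^ 2)⁻¹ :=
  Set.indicator_le_self' (fun _ _ => by positivity) w

lemma measurable_discK (s : ℝ) : Measurable (discK s) :=
  measurable_const.indicator measurableSet_closedBall

lemma lintegral_discK_le {s : ℝ} (hs : 0 < s) (x : ℂ) :
    ∫⁻ y, ‖discK s (y - x)‖ₑ ≤ ENNReal.ofReal 64 := by
  rw [lintegral_sub_right_eq_self (fun y => ‖discK s y‖ₑ)]
  have : ∀ y, ‖discK s y‖ₑ =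
      (closedBall (0 : ℂ) (4 * s)).indicator (fun _ => ENNReal.ofReal (s ^ 2)⁻¹) y := by
    intro y
    by_cases hy : y ∈ closedBall (0 : ℂ) (4 * s)
    · rw [discK, Set.indicator_of_mem hy, Set.indicator_of_mem hy,
        Real.enorm_of_nonneg (by positivity)]
    · rw [discK, Set.indicator_of_notMem hy, Set.indicator_of_notMem hy, enorm_zero]
  simp only [this]
  rw [lintegral_indicator_const measurableSet_closedBall, Complex.volume_closedBall,
    ← ENNReal.ofReal_pow (by positivity), ← ENNReal.ofReal_coe_nnreal, NNReal.coe_real_pi,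
    ← ENNReal.ofReal_mul (by positivity), ← ENNReal.ofReal_mul (by positivity)]
  apply ENNReal.ofReal_le_ofReal
  have : (s ^ 2)⁻¹ * ((4 * s) ^ 2 * Real.pi) = 16 * Real.pi := by field_simp; norm_num
  rw [this]
  linarith [Real.pi_lt_four]

/-- The average over a disc of dyadic radius. -/
noncomputable def disc (f : ℂ → ℝ) (k : ℤ) (x : ℂ) : ℝ := ∫ y, discK (2 ^ k) (y - x) * f y

lemma measurable_disc {f : ℂ → ℝ} (hf : Measurable f) (k : ℤ) : Measurable (disc f k) := by
  have h : Measurable fun p : ℂ × ℂ => discK (2 ^ k) (p.2 - p.1) * f p.2 :=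
    ((measurable_discK _).comp (measurable_snd.sub measurable_fst)).mul (hf.comp measurable_snd)
  exact h.stronglyMeasurable.integral_prod_right.measurable

lemma integrable_disc {f : ℂ → ℝ} (hf : IsTest f) (k : ℤ) (x : ℂ) :
    Integrable fun y => discK (2 ^ k) (y - x) * f y := by
  refine hf.integrable.bdd_mul (c := (((2 : ℝ) ^ k) ^ 2)⁻¹) ?_ (ae_of_all _ fun y => ?_)
  · exact ((measurable_discK _).comp (measurable_id.sub_const x)).aestronglyMeasurable
  · rw [Real.norm_of_nonneg (discK_nonneg _ _)]
    exact discK_le _ _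

lemma enorm_disc_le {f : ℂ → ℝ} {M : ℝ} (hM : ∀ x, |f x| ≤ M) (k : ℤ) (x : ℂ) :
    ‖disc f k x‖ₑ ≤ ENNReal.ofReal M * ENNReal.ofReal 64 := by
  calc ‖disc f k x‖ₑ ≤ ∫⁻ y, ‖discK (2 ^ k) (y - x) * f y‖ₑ := enorm_integral_le_lintegral_enorm _
    _ ≤ ∫⁻ y, ENNReal.ofReal M * ‖discK (2 ^ k) (y - x)‖ₑ := by
        refine lintegral_mono fun y => ?_
        dsimp only
        rw [enorm_mul, mul_comm, Real.enorm_eq_ofReal_abs (f y)]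
        exact mul_le_mul_left (ENNReal.ofReal_le_ofReal (hM y)) _
    _ ≤ _ := by
        rw [lintegral_const_mul' _ _ ENNReal.ofReal_ne_top]
        exact mul_le_mul_right (lintegral_discK_le (by positivity) x) _

lemma enorm_corr_discK_le {s s' : ℝ} (hs' : 0 < s') (hss : s' ≤ s) (x x' : ℂ) :
    ‖∫ y, discK s (y - x) * discK s' (y - x')‖ₑ ≤ ENNReal.ofReal 64 * discW s (x' - x) := by
  by_cases hx : x' - x ∈ closedBall (0 : ℂ) (8 * s)
  · rw [discW, Set.indicator_of_mem hx]
    calc _ ≤ ∫⁻ y, ‖discK s (y - x) * discK s' (y - x')‖ₑ := enorm_integral_le_lintegral_enorm _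
      _ ≤ ∫⁻ y, ENNReal.ofReal (s ^ 2)⁻¹ * ‖discK s' (y - x')‖ₑ := by
          refine lintegral_mono fun y => ?_
          dsimp only
          rw [enorm_mul, Real.enorm_of_nonneg (discK_nonneg s _)]
          exact mul_le_mul_left (ENNReal.ofReal_le_ofReal (discK_le _ _)) _
      _ ≤ _ := by
          rw [lintegral_const_mul' _ _ ENNReal.ofReal_ne_top, mul_comm]
          exact mul_le_mul_left (lintegral_discK_le hs' x') _
  · have : ∀ y, discK s (y - x) * discK s' (y - x') = 0 := by
      intro y
      by_cases h1 : y - x ∈ closedBall (0 : ℂ) (4 * s)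
      · by_cases h2 : y - x' ∈ closedBall (0 : ℂ) (4 * s')
        · exfalso
          apply hx
          rw [mem_closedBall_zero_iff] at *
          have := norm_sub_le (y - x) (y - x')
          rw [sub_sub_sub_cancel_left] at this
          linarith
        · rw [discK, discK, Set.indicator_of_notMem h2, mul_zero]
      · rw [discK, Set.indicator_of_notMem h1, zero_mul]
    simp [this]

/-- The weak `L²` bound for the maximal function over dyadic discs. -/
lemma disc_weak {f : ℂ → ℝ} (hf : IsTest f) (T : Finset ℤ) {l : ℝ} (hl : 0 < l) :
    ENNReal.ofReal l ^ 2 * volume {x | ∃ k ∈ T, l ≤ |disc f k x|} ≤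
      ENNReal.ofReal 32768 * ∫⁻ y, ‖f y‖ₑ ^ 2 := by
  rcases T.eq_empty_or_nonempty with rfl | hTn
  · simp
  set G := {x | ∃ k ∈ T, l ≤ |disc f k x|} with hG
  have hmeas : ∀ k, MeasurableSet {x | l ≤ |disc f k x|} := fun k =>
    measurableSet_le measurable_const (measurable_disc hf.measurable k).abs
  obtain ⟨q, hq, hqT, hqP⟩ := exists_selector hTn hmeas
  have hGm : MeasurableSet G := by
    have : G = ⋃ b ∈ T, {x | l ≤ |disc f b x|} := by
      ext x; simp [hG]
    rw [this]
    exact Finset.measurableSet_biUnion _ fun b _ => hmeas b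
  have hGt : volume G ≠ ⊤ := by
    obtain ⟨R, hR⟩ := hf.supp
    have : G ⊆ ⋃ b ∈ T, closedBall 0 (R + 4 * 2 ^ b) := by
      rintro x ⟨b, hb, hlb⟩
      simp only [Set.mem_iUnion]
      refine ⟨b, hb, ?_⟩
      by_contra h
      rw [mem_closedBall_zero_iff, not_le] at h
      have h0 : disc f b x = 0 := by
        refine integral_eq_zero_of_ae (ae_of_all _ fun y => ?_)
        by_cases hy : R < ‖y‖
        · simp [hR y hy]
        · have : y - x ∉ closedBall (0 : ℂ) (4 * 2 ^ b) := by
            rw [mem_closedBall_zero_iff, not_le]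
            have := norm_sub_norm_le x y
            rw [norm_sub_rev] at this
            linarith
          simp [discK, Set.indicator_of_notMem this]
      rw [h0, abs_zero] at hlb
      linarith
    refine ((measure_mono this).trans_lt ?_).ne
    exact (measure_biUnion_lt_top T.finite_toSet fun b _ => measure_closedBall_lt_top)
  have : IsFiniteMeasure (volume.restrict G) := ⟨by
    rw [Measure.restrict_apply_univ]; exact hGt.lt_top⟩
  have hKm : Measurable (Function.uncurry fun x y => discK (2 ^ q x) (y - x)) := by
    have h : Measurable (fun p : ℤ × ℂ => discK (2 ^ p.1) p.2) :=
      measurable_from_prod_countable_right fun a => measurable_discK (2 ^ a)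
    exact h.comp ((hq.comp measurable_fst).prodMk (measurable_snd.sub measurable_fst))
  obtain ⟨M, hM⟩ : ∃ M : ℝ, ∀ a ∈ T, ∀ w, |discK (2 ^ a) w| ≤ M := by
    refine ⟨∑ a ∈ T, ((2 ^ a : ℝ) ^ 2)⁻¹, fun a ha w => ?_⟩
    rw [abs_of_nonneg (discK_nonneg _ _)]
    refine (discK_le _ _).trans ?_
    exact Finset.single_le_sum (f := fun a : ℤ => ((2 ^ a : ℝ) ^ 2)⁻¹)
      (fun _ _ => by positivity) ha
  have hKi : Integrable (Function.uncurry fun x y => discK (2 ^ q x) (y - x))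
      ((volume.restrict G).prod volume) := by
    refine ⟨hKm.aestronglyMeasurable, ?_⟩
    rw [hasFiniteIntegral_iff_enorm, lintegral_prod _ hKm.enorm.aemeasurable]
    calc ∫⁻ x in G, ∫⁻ y, ‖discK (2 ^ q x) (y - x)‖ₑ
        ≤ ∫⁻ x in G, ENNReal.ofReal 64 :=
          lintegral_mono fun x => lintegral_discK_le (by positivity) x
      _ < ⊤ := by
          rw [setLIntegral_const]
          exact ENNReal.mul_lt_top ENNReal.ofReal_lt_top hGt.lt_top
  have hcorr := sq_measure_le_of_correlation (μ := volume.restrict G) (ν := volume)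
    (K := fun x y => discK (2 ^ q x) (y - x)) (f := f) (l := ENNReal.ofReal l) hKm (M := M)
    (fun x y => hM _ (hqT x) _) hKi hf.measurable hf.integrable (by
      filter_upwards [ae_restrict_mem hGm] with x hx
      have := hqP x hx
      rw [Real.enorm_eq_ofReal_abs]
      exact ENNReal.ofReal_le_ofReal this)
  rw [Measure.restrict_apply_univ] at hcorr
  have hrow := setLIntegral_row_le hGm
    (J := fun x x' => ‖∫ y, discK (2 ^ q x) (y - x) * discK (2 ^ q x') (y - x')‖ₑ)
    (W := fun _ _ => 0) (P := fun _ _ => 0) (H := fun x x' => discW (2 ^ q x) (x' - x))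
    (κ := 0) (ρ := 0) (c := ENNReal.ofReal 64) (e := ENNReal.ofReal 256)
    (fun x => measurable_const)
    (measurable_discW_comp (q := fun x => (q x, (0 : Fin 1))) (hq.prodMk measurable_const))
    (by
      intro x _ x' _
      rw [zero_add, zero_add]
      rcases le_total (q x') (q x) with h | h
      · refine le_add_right ?_
        exact enorm_corr_discK_le (by positivity) (zpow_le_zpow_right₀ (by norm_num) h) x x'
      · refine le_add_left ?_
        have := enorm_corr_discK_le (s := 2 ^ q x') (s' := 2 ^ q x) (by positivity)
          (zpow_le_zpow_right₀ (by norm_num) h) x' x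
        simpa only [mul_comm (discK (2 ^ q x') _)] using this)
    (by simp) (by simp) (by
      intro x
      refine (setLIntegral_le_lintegral _ _).trans ?_
      rw [lintegral_sub_right_eq_self (fun y => discW (2 ^ q x) y)]
      exact lintegral_discW_le (by positivity))
  have hfin := hcorr.trans (mul_le_mul_right hrow _)
  rw [zero_add, zero_add, ← mul_assoc, mul_pow, sq (volume G), ← mul_assoc] at hfin
  by_cases hG0 : volume G = 0
  · rw [hG0, mul_zero]; exact zero_le
  have := (ENNReal.mul_le_mul_iff_left hG0 hGt).1 hfin
  refine this.trans (le_of_eq ?_)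
  rw [mul_comm]
  congr 1
  rw [← ENNReal.ofReal_mul (by norm_num), ← ENNReal.ofReal_ofNat 2,
    ← ENNReal.ofReal_mul (by norm_num)]
  norm_num

theorem exists_disc_strong {p : ℝ} (hp : 2 < p) : ∃ C : ℝ, 0 ≤ C ∧ ∀ {f : ℂ → ℝ}, IsTest f →
    ∫⁻ x, (⨆ k, ‖disc f k x‖ₑ) ^ p ≤ ENNReal.ofReal C * ∫⁻ x, ‖f x‖ₑ ^ p := by
  have hp2 : 0 < p - 2 := by linarith
  refine ⟨p / (p - 2) * (131072 * (1 / 128) ^ (-(p - 2)) + 0 * 1 ^ (-(p - 2))), ?_, ?_⟩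
  · have : (0 : ℝ) < (1 / 128) ^ (-(p - 2)) := Real.rpow_pos_of_pos (by norm_num) _
    positivity
  intro f hf
  refine lintegral_iSup_rpow_le_of_truncated_weak hf.measurable
    (fun k => measurable_disc hf.measurable k) hp (by norm_num) le_rfl (by norm_num) one_pos ?_
  intro T l hl
  refine le_add_right ?_
  set S₁ := {x | |f x| ≤ 1 / 128 * l} with hS₁
  set S₂ := {x | 1 / 128 * l < |f x|} with hS₂
  have hm := hf.measurable
  have mS₁ : MeasurableSet S₁ := measurableSet_le hm.abs measurable_const
  have mS₂ : MeasurableSet S₂ := measurableSet_lt measurable_const hm.abs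
  have ht₁ := hf.indicator mS₁
  have ht₂ := hf.indicator mS₂
  have hadd : ∀ k x, disc f k x = disc (S₁.indicator f) k x + disc (S₂.indicator f) k x := by
    intro k x
    unfold disc
    rw [← integral_add (integrable_disc ht₁ k x) (integrable_disc ht₂ k x)]
    refine integral_congr_ae (ae_of_all _ fun y => ?_)
    simp only [Set.indicator_apply, hS₁, hS₂, Set.mem_ofPred_eq]
    rcases le_or_gt |f y| (1 / 128 * l) with h | h
    · rw [if_pos h, if_neg (not_lt.2 h)]; ring
    · rw [if_neg (not_le.2 h), if_pos h]; ring
  have hsmall : ∀ k x, |disc (S₁.indicator f) k x| ≤ l / 2 := by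
    intro k x
    have hM : ∀ x, |S₁.indicator f x| ≤ 1 / 128 * l := by
      intro x
      by_cases hx : x ∈ S₁
      · rw [Set.indicator_of_mem hx]; exact hx
      · rw [Set.indicator_of_notMem hx, abs_zero]; positivity
    have h := enorm_disc_le hM k x
    rw [Real.enorm_eq_ofReal_abs, ← ENNReal.ofReal_mul (by positivity),
      ENNReal.ofReal_le_ofReal_iff (by positivity)] at h
    linarith
  have hsub : {x | ∃ k ∈ T, l ≤ |disc f k x|} ⊆
      {x | ∃ k ∈ T, l / 2 ≤ |disc (S₂.indicator f) k x|} := by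
    rintro x ⟨k, hk, hkx⟩
    refine ⟨k, hk, ?_⟩
    rw [hadd] at hkx
    have e1 := hsmall k x
    have e4 := abs_add_le (disc (S₁.indicator f) k x) (disc (S₂.indicator f) k x)
    linarith
  have hb := disc_weak ht₂ T (l := l / 2) (by positivity)
  rw [setLIntegral_enorm_indicator mS₂] at hb
  have hl4 : ENNReal.ofReal l ^ 2 = ENNReal.ofReal 4 * ENNReal.ofReal (l / 2) ^ 2 := by
    rw [← ENNReal.ofReal_pow hl.le, ← ENNReal.ofReal_pow (by positivity),
      ← ENNReal.ofReal_mul (by norm_num)]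
    congr 1
    ring
  calc _ ≤ ENNReal.ofReal 4 * (ENNReal.ofReal (l / 2) ^ 2 *
        volume {x | ∃ k ∈ T, l / 2 ≤ |disc (S₂.indicator f) k x|}) := by
        rw [hl4, mul_assoc]
        exact mul_le_mul_right (mul_le_mul_right (measure_mono hsub) _) _
    _ ≤ ENNReal.ofReal 4 * (ENNReal.ofReal 32768 * ∫⁻ x in S₂, ‖f x‖ₑ ^ 2) :=
        mul_le_mul_right hb _
    _ = _ := by
        rw [← mul_assoc, ← ENNReal.ofReal_mul (by norm_num)]
        norm_num

/-- A smooth bump of mass one supported in `[τ, τ + δ]`. -/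
noncomputable def etaP (δ τ s : ℝ) : ℝ := 1 / δ * bump (1 / δ * (s - τ))

/-- The (unnormalized) circular mean. -/
noncomputable def circInt (f : ℂ → ℝ) (x : ℂ) (t : ℝ) : ℝ :=
  ∫ α in Set.Ioo (-Real.pi) Real.pi, f (x + t * circ 1 0 α)

lemma continuous_etaP (δ τ : ℝ) : Continuous (etaP δ τ) := by
  have := continuous_bump
  unfold etaP
  fun_prop

lemma etaP_eq_zero {δ τ s : ℝ} (hδ : 0 < δ) (hs : s < τ ∨ τ + δ < s) : etaP δ τ s = 0 := by
  rw [etaP, bump_eq_zero, mul_zero]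
  rcases hs with hs | hs
  · left
    have : 0 < 1 / δ := by positivity
    nlinarith
  · right
    rw [one_div, inv_mul_eq_div, lt_div_iff₀ hδ]
    linarith

lemma etaP_nonneg {δ : ℝ} (hδ : 0 < δ) (τ s : ℝ) : 0 ≤ etaP δ τ s :=
  mul_nonneg (by positivity) (bump_nonneg _)

lemma integrable_etaP {δ : ℝ} (hδ : 0 < δ) (τ : ℝ) : Integrable (etaP δ τ) := by
  refine (continuous_etaP δ τ).integrable_of_hasCompactSupport
    (HasCompactSupport.intro (isCompact_Icc (a := τ) (b := τ + δ)) fun x hx => etaP_eq_zero hδ ?_)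
  by_contra h
  push Not at h
  exact hx ⟨h.1, h.2⟩

lemma integrable_bump : Integrable bump := by
  refine continuous_bump.integrable_of_hasCompactSupport
    (HasCompactSupport.intro (isCompact_Icc (a := 0) (b := 1)) fun x hx => bump_eq_zero ?_)
  by_contra h
  push Not at h
  exact hx ⟨h.1, h.2⟩

lemma integral_bump : ∫ s, bump s = 1 := by
  have h0 : Tendsto Real.smoothTransition atBot (𝓝 0) :=
    tendsto_const_nhds.congr' (by
      filter_upwards [eventually_le_atBot 0] with y hy
      exact (Real.smoothTransition.zero_of_nonpos hy).symm)
  have h1 : Tendsto Real.smoothTransition atTop (𝓝 1) :=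
    tendsto_const_nhds.congr' (by
      filter_upwards [eventually_ge_atTop 1] with y hy
      exact (Real.smoothTransition.one_of_one_le hy).symm)
  rw [integral_of_hasDerivAt_of_tendsto hasDerivAt_smoothTransition integrable_bump h0 h1, sub_zero]

lemma abs_circInt_le {f : ℂ → ℝ} {M : ℝ} (hM : ∀ x, |f x| ≤ M) (x : ℂ) (t : ℝ) :
    |circInt f x t| ≤ M * (2 * Real.pi) := by
  have h := norm_setIntegral_le_of_norm_le_const (μ := volume)
    (s := Set.Ioo (-Real.pi) Real.pi) (f := fun α => f (x + t * circ 1 0 α)) (C := M)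
    (by simp) (fun α _ => hM _)
  rw [Real.norm_eq_abs] at h
  refine h.trans_eq ?_
  rw [Measure.real, Real.volume_Ioo, ENNReal.toReal_ofReal (by linarith [Real.pi_pos])]
  ring

lemma continuous_circInt {f : ℂ → ℝ} (hf : Continuous f) {M : ℝ} (hM : ∀ x, |f x| ≤ M) (x : ℂ) :
    Continuous (circInt f x) := by
  have := continuous_circ 1 0
  refine continuous_of_dominated (bound := fun _ => M) (fun t => ?_) (fun t => ae_of_all _ fun α =>
    hM _) (integrable_const _) (ae_of_all _ fun α => ?_)
  · exact Continuous.aestronglyMeasurable (by fun_prop)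
  · fun_prop

/-- Polar coordinates turn a smoothed circular kernel into an average of circular means. -/
lemma integral_kerS_etaP {f : ℂ → ℝ} (hf : Continuous f) {M : ℝ} (hM : ∀ x, |f x| ≤ M)
    {s δ τ : ℝ} (hs : 0 < s) (hδ : 0 < δ) (hτ : 1 ≤ τ) (x : ℂ) :
    ∫ y, kerS s (etaP δ τ) 1 (y - x) * f y =
      ∫ r, bump r * circInt f x (s * (τ + δ * r)) := by
  have hc := continuous_circ 1 0
  have h1 : ∫ y, kerS s (etaP δ τ) 1 (y - x) * f y =
      ∫ v, f (x + s • v) * ker (etaP δ τ) 1 v := by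
    rw [← integral_scale f _ hs x]
    simp only [kerS, mul_comm (f _)]
  have hcongr : ∫ p in polarCoord.target,
        p.1 • (f (x + s • Complex.polarCoord.symm p) * ker (etaP δ τ) 1 (Complex.polarCoord.symm p)) =
      ∫ p in polarCoord.target, f (x + (s * p.1 : ℝ) * circ 1 0 p.2) * etaP δ τ p.1 := by
    refine setIntegral_congr_fun polarCoord.open_target.measurableSet ?_
    rintro ⟨a, α⟩ hp
    rw [polarCoord_target] at hp
    have ha : 0 < a := hp.1
    dsimp only
    rw [polarCoord_symm_eq, ker, norm_polar ha, Complex.real_smul, smul_eq_mul, Pi.one_apply]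
    push_cast
    rw [mul_assoc (s : ℂ)]
    field_simp
  rw [h1, ← Complex.integral_comp_polarCoord_symm, hcongr, polarCoord_target,
    Measure.volume_eq_prod, setIntegral_prod]
  swap
  · rw [IntegrableOn, ← Measure.prod_restrict]
    have h2 : Integrable (fun p : ℝ × ℝ => etaP δ τ p.1 * (1 : ℝ))
        ((volume.restrict (Set.Ioi 0)).prod (volume.restrict (Set.Ioo (-Real.pi) Real.pi))) :=
      (integrable_etaP hδ τ).integrableOn.mul_prod (integrable_const 1)
    simp only [mul_one] at h2
    refine h2.bdd_mul (c := M) (Continuous.aestronglyMeasurable (by fun_prop)) (ae_of_all _ fun p => hM _)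
  simp only [integral_mul_const]
  rw [setIntegral_eq_integral_of_forall_compl_eq_zero]
  swap
  · intro a ha
    rw [etaP_eq_zero hδ (Or.inl (lt_of_le_of_lt (not_lt.1 ha) (by linarith))), mul_zero]
  have h3 := Measure.integral_comp_mul_left
    (fun a => (∫ α in Set.Ioo (-Real.pi) Real.pi, f (x + (s * (τ + a) : ℝ) * circ 1 0 α)) *
      etaP δ τ (τ + a)) δ
  rw [integral_add_left_eq_self (fun a =>
      (∫ α in Set.Ioo (-Real.pi) Real.pi, f (x + (s * a : ℝ) * circ 1 0 α)) * etaP δ τ a) τ,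
    abs_of_pos (by positivity), smul_eq_mul, eq_comm, inv_mul_eq_iff_eq_mul₀ hδ.ne'] at h3
  rw [h3, ← integral_const_mul]
  congr 1
  funext r
  rw [etaP, add_sub_cancel_left, circInt]
  field_simp

/-- The dyadic thickness `2 ^ (-j - 4)`. -/
noncomputable def thick (j : ℕ) : ℝ := (1 / 2) ^ (j + 4)

lemma thick_pos (j : ℕ) : 0 < thick j := by unfold thick; positivity

lemma thick_succ (j : ℕ) : thick (j + 1) = thick j / 2 := by
  unfold thick
  rw [show j + 1 + 4 = (j + 4) + 1 by ring, pow_succ]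
  ring

lemma thick_le (j : ℕ) : thick j ≤ 1 / 16 := by
  unfold thick
  rw [pow_add]
  have : (1 / 2 : ℝ) ^ j ≤ 1 := pow_le_one₀ (by norm_num) (by norm_num)
  norm_num
  linarith

lemma two_pow_mul_thick (j : ℕ) : (2 : ℝ) ^ (j + 4) * thick j = 1 := by
  rw [thick, ← mul_pow]
  norm_num

lemma half_le {j m : ℕ} (h : m < 2 ^ (j + 5)) : m / 2 ≤ 2 ^ (j + 4) := by
  rw [show j + 5 = (j + 4) + 1 by ring, pow_succ] at h
  omega

/-- The profile comparing thickness `thick (j + 1)` with thickness `thick j`. -/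
noncomputable def diffP (j : ℕ) (i : Fin (2 ^ (j + 5))) (s : ℝ) : ℝ :=
  etaP (thick (j + 1)) (1 + (i : ℕ) * thick (j + 1)) s -
    etaP (thick j) (1 + ((i : ℕ) / 2 : ℕ) * thick j) s

lemma exists_isFamily : ∃ A : ℝ, 1 ≤ A ∧ (∀ s, |bump s| ≤ A) ∧ ∀ j,
    ∃ Φ, IsFamily (5 * A) (thick j) (fun i : Fin (2 ^ (j + 5)) => 1 + ((i : ℕ) / 2 : ℕ) * thick j)
      Φ (diffP j) := by
  obtain ⟨A, hA, hb, hl, -⟩ := exists_bump_bounds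
  refine ⟨A, hA, hb, fun j => ?_⟩
  have hj := thick_pos j
  refine ⟨fun i s => Real.smoothTransition (2 / thick j * (s - (1 + (i : ℕ) * thick (j + 1)))) -
    Real.smoothTransition (1 / thick j * (s - (1 + ((i : ℕ) / 2 : ℕ) * thick j))),
    ⟨fun i => ?_, fun i => ?_, hj, thick_le j, ?_, by positivity⟩⟩
  · have h1 : (((i : ℕ) / 2 : ℕ) : ℝ) * 2 ≤ (i : ℕ) := by exact_mod_cast Nat.div_mul_le_self _ _
    have h2 : ((i : ℕ) : ℝ) ≤ (((i : ℕ) / 2 : ℕ) : ℝ) * 2 + 1 := by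
      have : (i : ℕ) ≤ (i : ℕ) / 2 * 2 + 1 := by omega
      exact_mod_cast this
    have := isProfile_smoothTransition hj hA hb hl (τ := 1 + ((i : ℕ) / 2 : ℕ) * thick j)
      (τ' := 1 + (i : ℕ) * thick (j + 1)) (by rw [thick_succ]; nlinarith)
      (by rw [thick_succ]; nlinarith)
    convert this using 1
    funext s
    rw [diffP, etaP, etaP, show 1 / thick (j + 1) = 2 / thick j by rw [thick_succ]; field_simp]
  · have h1 : (i : ℕ) / 2 ≤ 2 ^ (j + 4) := half_le i.2
    have h2 : (((i : ℕ) / 2 : ℕ) : ℝ) ≤ 2 ^ (j + 4) := by exact_mod_cast h1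
    have h3 := two_pow_mul_thick j
    constructor
    · have : 0 ≤ (((i : ℕ) / 2 : ℕ) : ℝ) * thick j := by positivity
      linarith
    · nlinarith
  · have h3 := two_pow_mul_thick j
    push_cast
    rw [show j + 5 = (j + 4) + 1 by ring, pow_succ]
    linarith

lemma kerS_etaP_nonneg {s δ : ℝ} (hδ : 0 < δ) (τ : ℝ) (w : ℂ) : 0 ≤ kerS s (etaP δ τ) 1 w := by
  have := etaP_nonneg hδ τ ‖s⁻¹ • w‖
  rw [kerS, ker, Pi.one_apply]
  positivity

lemma kerS_etaP_le {A s δ τ : ℝ} (hb : ∀ s, |bump s| ≤ A) (hs : 0 < s) (hδ : 0 < δ)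
    (hδ' : δ ≤ 1) (h1 : 1 ≤ τ) (h2 : τ ≤ 2) (w : ℂ) :
    kerS s (etaP δ τ) 1 w ≤ A / δ * discK s w := by
  have hA : 0 ≤ A := (abs_nonneg _).trans (hb 0)
  have hn : ‖s⁻¹ • w‖ = s⁻¹ * ‖w‖ := by
    rw [norm_smul, norm_inv, Real.norm_of_nonneg hs.le]
  by_cases hz : etaP δ τ ‖s⁻¹ • w‖ = 0
  · rw [kerS, ker, hz]
    have := discK_nonneg s w
    simp only [mul_zero, zero_mul]
    positivity
  · have h3 : τ ≤ ‖s⁻¹ • w‖ ∧ ‖s⁻¹ • w‖ ≤ τ + δ := by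
      by_contra h
      refine hz (etaP_eq_zero hδ ?_)
      by_contra h'
      push Not at h'
      exact h h'
    have hw : w ∈ closedBall (0 : ℂ) (4 * s) := by
      rw [mem_closedBall_zero_iff]
      have := h3.2
      rw [hn, inv_mul_eq_div, div_le_iff₀ hs] at this
      nlinarith
    rw [discK, Set.indicator_of_mem hw, kerS, ker, Pi.one_apply, mul_one, mul_comm (A / δ)]
    gcongr
    have h4 : etaP δ τ ‖s⁻¹ • w‖ ≤ A / δ := by
      rw [etaP, one_div, inv_mul_eq_div]
      gcongr
      exact (le_abs_self _).trans (hb _)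
    have h5 : ‖s⁻¹ • w‖⁻¹ ≤ 1 := inv_le_one_of_one_le₀ (h1.trans h3.1)
    calc _ ≤ 1 * (A / δ) := by
          gcongr
          exact etaP_nonneg hδ _ _
      _ = _ := one_mul _

/-- The smoothed circular mean at thickness `thick j`. -/
noncomputable def smooth (f : ℂ → ℝ) (j m : ℕ) (k : ℤ) (x : ℂ) : ℝ :=
  ∫ y, kerS (2 ^ k) (etaP (thick j) (1 + m * thick j)) 1 (y - x) * f y

lemma radius_mem {j m : ℕ} (hm : m ≤ 2 ^ (j + 4)) :
    1 ≤ 1 + m * thick j ∧ 1 + m * thick j ≤ 2 := by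
  have h3 := two_pow_mul_thick j
  have h1 := thick_pos j
  have h2 : (m : ℝ) ≤ 2 ^ (j + 4) := by exact_mod_cast hm
  constructor
  · have : 0 ≤ m * thick j := by positivity
    linarith
  · nlinarith

lemma integrable_smooth {f : ℂ → ℝ} (hf : IsTest f) {A : ℝ} (hb : ∀ s, |bump s| ≤ A) {j m : ℕ}
    (hm : m ≤ 2 ^ (j + 4)) (k : ℤ) (x : ℂ) :
    Integrable fun y => kerS (2 ^ k) (etaP (thick j) (1 + m * thick j)) 1 (y - x) * f y := by
  have hA : 0 ≤ A := (abs_nonneg _).trans (hb 0)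
  have hj := thick_pos j
  refine hf.integrable.bdd_mul (c := A / thick j * (((2 : ℝ) ^ k) ^ 2)⁻¹) ?_ (ae_of_all _ fun y => ?_)
  · have h1 : Measurable (ker (etaP (thick j) (1 + m * thick j)) 1) :=
      (measurable_norm.inv.mul ((continuous_etaP _ _).measurable.comp measurable_norm)).mul
        measurable_one
    have h2 : Measurable (kerS (2 ^ k) (etaP (thick j) (1 + m * thick j)) 1) :=
      (h1.comp (measurable_const_smul _)).const_mul _
    exact (h2.comp (measurable_id.sub_const x)).aestronglyMeasurable
  · rw [Real.norm_of_nonneg (kerS_etaP_nonneg hj _ _)]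
    refine (kerS_etaP_le hb (by positivity) hj ((thick_le j).trans (by norm_num)) (radius_mem hm).1
      (radius_mem hm).2 _).trans ?_
    gcongr
    exact discK_le _ _

lemma smooth_succ_sub {f : ℂ → ℝ} (hf : IsTest f) {A : ℝ} (hb : ∀ s, |bump s| ≤ A) (j : ℕ)
    (i : Fin (2 ^ (j + 5))) (k : ℤ) (x : ℂ) :
    smooth f (j + 1) i k x - smooth f j ((i : ℕ) / 2) k x = lab (diffP j) 1 f (k, i) x := by
  have h1 : (i : ℕ) ≤ 2 ^ (j + 1 + 4) := i.2.le
  have h2 : (i : ℕ) / 2 ≤ 2 ^ (j + 4) := half_le i.2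
  rw [smooth, smooth, ← integral_sub (integrable_smooth hf hb h1 k x)
    (integrable_smooth hf hb h2 k x), lab]
  congr 1
  funext y
  rw [labK, kerS, kerS, kerS, ker, ker, ker, diffP]
  ring

lemma abs_smooth_zero_le {f : ℂ → ℝ} (hf : IsTest f) (hf0 : ∀ x, 0 ≤ f x) {A : ℝ}
    (hb : ∀ s, |bump s| ≤ A) {m : ℕ} (hm : m ≤ 2 ^ 4) (k : ℤ) (x : ℂ) :
    ‖smooth f 0 m k x‖ₑ ≤ ENNReal.ofReal (16 * A) * ‖disc f k x‖ₑ := by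
  have hA : 0 ≤ A := (abs_nonneg _).trans (hb 0)
  rw [← Real.enorm_of_nonneg (by positivity : 0 ≤ 16 * A), ← enorm_mul, Real.enorm_eq_ofReal_abs,
    Real.enorm_eq_ofReal_abs]
  apply ENNReal.ofReal_le_ofReal
  have h0 : 0 ≤ smooth f 0 m k x := integral_nonneg fun y =>
    mul_nonneg (kerS_etaP_nonneg (thick_pos 0) _ _) (hf0 y)
  rw [abs_of_nonneg h0]
  refine le_trans ?_ (le_abs_self _)
  rw [disc, ← integral_const_mul]
  refine integral_mono (integrable_smooth hf hb hm k x) ((integrable_disc hf k x).const_mul _)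
    fun y => ?_
  dsimp only
  rw [← mul_assoc]
  refine mul_le_mul_of_nonneg_right ?_ (hf0 y)
  refine (kerS_etaP_le hb (by positivity) (thick_pos 0) ((thick_le 0).trans (by norm_num))
    (radius_mem hm).1 (radius_mem hm).2 _).trans_eq ?_
  congr 1
  rw [thick]
  norm_num
  ring

lemma tendsto_smooth {f : ℂ → ℝ} (hf : Continuous f) {M : ℝ} (hM : ∀ x, |f x| ≤ M) {τ : ℝ}
    (h1 : 1 ≤ τ) (k : ℤ) (x : ℂ) :
    Tendsto (fun j => smooth f j ⌊(τ - 1) * 2 ^ (j + 4)⌋₊ k x) atTop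
      (𝓝 (circInt f x (2 ^ k * τ))) := by
  have hN := continuous_circInt hf hM x
  have ht : Tendsto thick atTop (𝓝 0) := by
    have := tendsto_pow_atTop_nhds_zero_of_lt_one (r := (1 / 2 : ℝ)) (by norm_num) (by norm_num)
    exact this.comp (tendsto_add_atTop_nat 4)
  have hr : Tendsto (fun j => 1 + (⌊(τ - 1) * 2 ^ (j + 4)⌋₊ : ℝ) * thick j) atTop (𝓝 τ) := by
    have hlow : Tendsto (fun j => τ - thick j) atTop (𝓝 τ) := by
      simpa using tendsto_const_nhds.sub ht
    refine tendsto_of_tendsto_of_tendsto_of_le_of_le hlow tendsto_const_nhds (fun j => ?_)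
      fun j => ?_
    · have h3 := two_pow_mul_thick j
      have h4 := Nat.lt_floor_add_one ((τ - 1) * 2 ^ (j + 4))
      have h5 := mul_le_mul_of_nonneg_right h4.le (thick_pos j).le
      rw [mul_assoc, h3] at h5
      dsimp only
      linarith
    · have h3 := two_pow_mul_thick j
      have h4 := Nat.floor_le (show 0 ≤ (τ - 1) * 2 ^ (j + 4) from
        mul_nonneg (by linarith) (by positivity))
      have h5 := mul_le_mul_of_nonneg_right h4 (thick_pos j).le
      rw [mul_assoc, h3] at h5
      dsimp only
      linarith
  have hE : ∀ j, smooth f j ⌊(τ - 1) * 2 ^ (j + 4)⌋₊ k x = ∫ r, bump r *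
      circInt f x (2 ^ k * (1 + (⌊(τ - 1) * 2 ^ (j + 4)⌋₊ : ℝ) * thick j + thick j * r)) := fun j =>
    integral_kerS_etaP hf hM (by positivity) (thick_pos j)
      (le_add_of_nonneg_right (by have := thick_pos j; positivity)) x
  simp only [hE]
  have hlim : ∫ r, bump r * circInt f x (2 ^ k * τ) = circInt f x (2 ^ k * τ) := by
    rw [integral_mul_const, integral_bump, one_mul]
  rw [← hlim]
  have hbc := continuous_bump
  refine tendsto_integral_of_dominated_convergence
    (fun r => bump r * (M * (2 * Real.pi))) (fun j => ?_) (integrable_bump.mul_const _)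
    (fun j => ae_of_all _ fun r => ?_) (ae_of_all _ fun r => ?_)
  · exact Continuous.aestronglyMeasurable (by fun_prop)
  · rw [norm_mul, Real.norm_of_nonneg (bump_nonneg r)]
    exact mul_le_mul_of_nonneg_left (abs_circInt_le hM _ _) (bump_nonneg r)
  · refine Tendsto.const_mul _ ((hN.tendsto _).comp (Tendsto.const_mul _ ?_))
    simpa using hr.add (ht.mul_const r)

/-- The circular maximal function is dominated by a disc maximal function and dyadic pieces. -/
lemma enorm_circInt_le {f : ℂ → ℝ} (hf : Continuous f) (hft : IsTest f) (hf0 : ∀ x, 0 ≤ f x) {A : ℝ}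
    (hb : ∀ s, |bump s| ≤ A) (x : ℂ) {t : ℝ} (ht : 0 < t) :
    ‖circInt f x t‖ₑ ≤ ENNReal.ofReal (16 * A) * (⨆ k, ‖disc f k x‖ₑ) +
      ∑' j, ⨆ b, ‖lab (diffP j) 1 f b x‖ₑ := by
  obtain ⟨M, hM⟩ := hft.bdd
  obtain ⟨k, hk1, hk2⟩ := exists_mem_Ico_zpow ht (by norm_num : (1 : ℝ) < 2)
  have hk : (0 : ℝ) < 2 ^ k := by positivity
  set τ := t / 2 ^ k with hτ
  have h1 : 1 ≤ τ := by rwa [hτ, one_le_div hk]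
  have h2 : τ < 2 := by
    rw [hτ, div_lt_iff₀ hk, mul_comm, ← zpow_add_one₀ (by norm_num)]
    exact hk2
  have htτ : t = 2 ^ k * τ := by rw [hτ]; field_simp
  rw [htτ]
  have hn : ∀ j, ⌊(τ - 1) * 2 ^ (j + 4)⌋₊ < 2 ^ (j + 4) := by
    intro j
    rw [Nat.floor_lt (mul_nonneg (by linarith) (by positivity))]
    push_cast
    have : (0 : ℝ) < 2 ^ (j + 4) := by positivity
    nlinarith
  have hhalf : ∀ j, ⌊(τ - 1) * 2 ^ (j + 1 + 4)⌋₊ / 2 = ⌊(τ - 1) * 2 ^ (j + 4)⌋₊ := by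
    intro j
    rw [← Nat.floor_div_ofNat]
    congr 1
    rw [show j + 1 + 4 = (j + 4) + 1 by ring, pow_succ]
    ring
  refine le_of_tendsto (tendsto_smooth hf hM h1 k x).enorm (Eventually.of_forall fun j => ?_)
  have hind : ‖smooth f j ⌊(τ - 1) * 2 ^ (j + 4)⌋₊ k x‖ₑ ≤
      ENNReal.ofReal (16 * A) * (⨆ k, ‖disc f k x‖ₑ) +
      ∑ i ∈ Finset.range j, ⨆ b, ‖lab (diffP i) 1 f b x‖ₑ := by
    induction j with
    | zero =>
      simp only [Finset.range_zero, Finset.sum_empty, add_zero]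
      refine (abs_smooth_zero_le hft hf0 hb (hn 0).le k x).trans ?_
      gcongr
      exact le_iSup (fun k => ‖disc f k x‖ₑ) k
    | succ j ih =>
      have h3 := smooth_succ_sub hft hb j ⟨⌊(τ - 1) * 2 ^ (j + 1 + 4)⌋₊, hn (j + 1)⟩ k x
      dsimp only at h3
      rw [hhalf, sub_eq_iff_eq_add'] at h3
      rw [h3, Finset.sum_range_succ]
      exact ((enorm_add_le _ _).trans (add_le_add ih
        (le_iSup (fun b => ‖lab (diffP j) 1 f b x‖ₑ) _))).trans_eq (add_assoc _ _ _)
  exact hind.trans (by gcongr; exact ENNReal.sum_le_tsum _)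

lemma exists_tsum_rpow_le {p q : ℝ} (hp : 0 < p) (hq : 0 < q) (hq1 : q < 1) :
    ∃ K : ℝ≥0∞, K ≠ ⊤ ∧ ∀ a : ℕ → ℝ≥0∞,
      (∑' j, a j) ^ p ≤ K * ∑' j, ENNReal.ofReal (q ^ j)⁻¹ * a j ^ p := by
  set ρ : ℝ≥0∞ := ENNReal.ofReal (q ^ (1 / p)) with hρ
  have hr0 : 0 < q ^ (1 / p) := Real.rpow_pos_of_pos hq _
  have hr1 : q ^ (1 / p) < 1 := Real.rpow_lt_one hq.le hq1 (by positivity)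
  have hρ0 : ρ ≠ 0 := by simpa [hρ] using hr0
  have hρt : ρ ≠ ⊤ := ENNReal.ofReal_ne_top
  have hρ1 : ρ < 1 := by
    rw [hρ, ENNReal.ofReal_lt_one]
    exact hr1
  have hρp : ∀ j : ℕ, ((ρ ^ j)⁻¹) ^ p = ENNReal.ofReal (q ^ j)⁻¹ := by
    intro j
    rw [ENNReal.inv_rpow, ENNReal.ofReal_inv_of_pos (by positivity), hρ,
      ← ENNReal.ofReal_pow hr0.le, ENNReal.ofReal_rpow_of_pos (by positivity), ← Real.rpow_natCast,
      ← Real.rpow_mul hq.le, ← Real.rpow_mul hq.le, ← Real.rpow_natCast]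
    congr 3
    field_simp
  clear_value ρ
  refine ⟨((1 - ρ)⁻¹) ^ p, ?_, fun a => ?_⟩
  · refine ENNReal.rpow_ne_top_of_nonneg hp.le (ENNReal.inv_ne_top.2 ?_)
    exact (tsub_pos_of_lt hρ1).ne'
  set S := ⨆ j, (ρ ^ j)⁻¹ * a j with hS
  have h1 : ∑' j, a j ≤ (1 - ρ)⁻¹ * S := by
    rw [← ENNReal.tsum_geometric, ← ENNReal.tsum_mul_right]
    refine ENNReal.tsum_le_tsum fun j => ?_
    calc a j = ρ ^ j * ((ρ ^ j)⁻¹ * a j) := by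
          rw [← mul_assoc, ENNReal.mul_inv_cancel (pow_ne_zero _ hρ0) (ENNReal.pow_ne_top hρt),
            one_mul]
      _ ≤ ρ ^ j * S := by
          gcongr
          exact le_iSup (fun j => (ρ ^ j)⁻¹ * a j) j
  have h2 : S ^ p ≤ ∑' j, ENNReal.ofReal (q ^ j)⁻¹ * a j ^ p := by
    rw [← ENNReal.le_rpow_inv_iff hp]
    refine iSup_le fun j => ?_
    rw [ENNReal.le_rpow_inv_iff hp, ENNReal.mul_rpow_of_nonneg _ _ hp.le, hρp]
    exact ENNReal.le_tsum j
  calc _ ≤ ((1 - ρ)⁻¹ * S) ^ p := by gcongr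
    _ = ((1 - ρ)⁻¹) ^ p * S ^ p := ENNReal.mul_rpow_of_nonneg _ _ hp.le
    _ ≤ _ := by gcongr

lemma tsum_weight_ne_top (C : ℝ) {q : ℝ} (hq : 0 < q) (hq1 : q < 1) :
    ∑' j : ℕ, ENNReal.ofReal (C * (q ^ j * (3 * (j + 4)))) ≠ ⊤ := by
  have h : ‖q‖ < 1 := by rwa [Real.norm_of_nonneg hq.le]
  have h1 := summable_pow_mul_geometric_of_norm_lt_one 1 h
  have h0 := summable_pow_mul_geometric_of_norm_lt_one 0 h
  have hs : Summable fun j : ℕ => C * (q ^ j * (3 * ((j : ℝ) + 4))) := by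
    refine (((h1.mul_left 3).add (h0.mul_left 12)).mul_left C).congr fun j => ?_
    ring
  exact hs.tsum_ofReal_ne_top

/-- The circular maximal theorem in the plane, for nonnegative functions. -/
theorem exists_circular {p : ℝ} (hp : 2 < p) : ∃ C : ℝ≥0∞, C ≠ ⊤ ∧ ∀ {f : ℂ → ℝ}, Continuous f →
    IsTest f → (∀ x, 0 ≤ f x) →
    ∫⁻ x, (⨆ (t : ℝ) (_ : 0 < t), ‖circInt f x t‖ₑ) ^ p ≤ C * ∫⁻ x, ‖f x‖ₑ ^ p := by
  have hp0 : 0 < p := by linarith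
  obtain ⟨A, hA, hb, hfam⟩ := exists_isFamily
  obtain ⟨C, γ, hC, hγ, hstr⟩ := exists_strong (A := 5 * A) (by linarith) hp
  obtain ⟨Cd, hCd, hdisc⟩ := exists_disc_strong hp
  have hq : (0 : ℝ) < (1 / 2) ^ (γ / 2) := by positivity
  have hq1 : (1 / 2 : ℝ) ^ (γ / 2) < 1 := Real.rpow_lt_one (by norm_num) (by norm_num) (by positivity)
  set q : ℝ := (1 / 2) ^ (γ / 2) with hqd
  have hδγ : ∀ j, thick j ^ γ ≤ q ^ (2 * j) := by
    intro j
    rw [hqd, thick, ← Real.rpow_natCast, ← Real.rpow_natCast, ← Real.rpow_mul (by norm_num),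
      ← Real.rpow_mul (by norm_num)]
    refine Real.rpow_le_rpow_of_exponent_ge (by norm_num) (by norm_num) ?_
    push_cast
    nlinarith
  clear_value q
  obtain ⟨K, hK, hsum⟩ := exists_tsum_rpow_le hp0 hq hq1
  have hW := tsum_weight_ne_top C hq hq1
  set W := ∑' j : ℕ, ENNReal.ofReal (C * (q ^ j * (3 * (j + 4)))) with hWd
  refine ⟨2 ^ (p - 1) * (ENNReal.ofReal (16 * A) ^ p * ENNReal.ofReal Cd + K * W), ?_, ?_⟩
  · have h2 : (2 : ℝ≥0∞) ^ (p - 1) ≠ ⊤ := ENNReal.rpow_ne_top_of_nonneg (by linarith) (by norm_num)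
    have h3 : ENNReal.ofReal (16 * A) ^ p ≠ ⊤ :=
      ENNReal.rpow_ne_top_of_nonneg hp0.le ENNReal.ofReal_ne_top
    exact ENNReal.mul_ne_top h2 (ENNReal.add_ne_top.2
      ⟨ENNReal.mul_ne_top h3 ENNReal.ofReal_ne_top, ENNReal.mul_ne_top hK hW⟩)
  intro f hfc hf hf0
  set F := ∫⁻ x, ‖f x‖ₑ ^ p with hF
  have hmeas : ∀ j, Measurable fun x => ⨆ b, ‖lab (diffP j) 1 f b x‖ₑ := by
    intro j
    obtain ⟨Φ, hΦ⟩ := hfam j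
    exact Measurable.iSup fun b => (hΦ.measurable_lab measurable_one hf.measurable b).enorm
  have hmeasd : Measurable fun x => ⨆ k, ‖disc f k x‖ₑ :=
    Measurable.iSup fun k => (measurable_disc hf.measurable k).enorm
  have hU : ∀ j, ∫⁻ x, (⨆ b, ‖lab (diffP j) 1 f b x‖ₑ) ^ p ≤
      ENNReal.ofReal (C * (q ^ (2 * j) * (3 * (j + 4)))) * F := by
    intro j
    obtain ⟨Φ, hΦ⟩ := hfam j
    refine (hstr hΦ (L := (j + 4) * 3) (by positivity) (by rw [thick, ← pow_mul]) hf).trans ?_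
    refine mul_le_mul_left (ENNReal.ofReal_le_ofReal ?_) _
    have := hδγ j
    push_cast
    rw [mul_comm (3 : ℝ)]
    gcongr
  have hsumU : ∫⁻ x, (∑' j, ⨆ b, ‖lab (diffP j) 1 f b x‖ₑ) ^ p ≤ K * W * F := by
    calc _ ≤ ∫⁻ x, K * ∑' j, ENNReal.ofReal (q ^ j)⁻¹ * (⨆ b, ‖lab (diffP j) 1 f b x‖ₑ) ^ p :=
          lintegral_mono fun x => hsum _
      _ = K * ∑' j, ENNReal.ofReal (q ^ j)⁻¹ * ∫⁻ x, (⨆ b, ‖lab (diffP j) 1 f b x‖ₑ) ^ p := by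
          rw [lintegral_const_mul' _ _ hK, lintegral_tsum fun j =>
            (((hmeas j).pow_const p).const_mul _).aemeasurable]
          simp only [lintegral_const_mul' _ _ ENNReal.ofReal_ne_top]
      _ ≤ K * ∑' j : ℕ, ENNReal.ofReal (C * (q ^ j * (3 * (j + 4)))) * F := by
          refine mul_le_mul_right (ENNReal.tsum_le_tsum fun j => ?_) _
          refine (mul_le_mul_right (hU j) _).trans_eq ?_
          rw [← mul_assoc, ← ENNReal.ofReal_mul (by positivity)]
          congr 2
          rw [two_mul, pow_add]
          field_simp
      _ = K * W * F := by rw [ENNReal.tsum_mul_right, mul_assoc]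
  calc _ ≤ ∫⁻ x, 2 ^ (p - 1) * ((ENNReal.ofReal (16 * A) * ⨆ k, ‖disc f k x‖ₑ) ^ p +
        (∑' j, ⨆ b, ‖lab (diffP j) 1 f b x‖ₑ) ^ p) := by
        refine lintegral_mono fun x => ?_
        refine le_trans ?_ (ENNReal.rpow_add_le_mul_rpow_add_rpow _ _ (by linarith))
        gcongr
        exact iSup₂_le fun t ht => enorm_circInt_le hfc hf hf0 hb x ht
    _ = 2 ^ (p - 1) * (ENNReal.ofReal (16 * A) ^ p * (∫⁻ x, (⨆ k, ‖disc f k x‖ₑ) ^ p) +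
        ∫⁻ x, (∑' j, ⨆ b, ‖lab (diffP j) 1 f b x‖ₑ) ^ p) := by
        rw [lintegral_const_mul' _ _ (ENNReal.rpow_ne_top_of_nonneg (by linarith) (by norm_num)),
          lintegral_add_left ((hmeasd.const_mul _).pow_const p)]
        simp only [ENNReal.mul_rpow_of_nonneg _ _ hp0.le]
        rw [lintegral_const_mul' _ _ (ENNReal.rpow_ne_top_of_nonneg hp0.le ENNReal.ofReal_ne_top)]
    _ ≤ 2 ^ (p - 1) * (ENNReal.ofReal (16 * A) ^ p * (ENNReal.ofReal Cd * F) + K * W * F) := by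
        gcongr
        exact hdisc hf
    _ = _ := by ring

/-- The orthogonal group of `ℝⁿ`. -/
noncomputable abbrev Rot (n : ℕ) :=
  unitary (EuclideanSpace ℝ (Fin n) →L[ℝ] EuclideanSpace ℝ (Fin n))

instance (n : ℕ) : ContinuousStar (EuclideanSpace ℝ (Fin n) →L[ℝ] EuclideanSpace ℝ (Fin n)) :=
  ⟨(ContinuousLinearMap.adjoint (𝕜 := ℝ) (E := EuclideanSpace ℝ (Fin n))
    (F := EuclideanSpace ℝ (Fin n))).continuous⟩

instance (n : ℕ) : CompactSpace (Rot n) := by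
  refine isCompact_iff_compactSpace.1 (Metric.isCompact_of_isClosed_isBounded
    (isClosed_unitary (R := EuclideanSpace ℝ (Fin n) →L[ℝ] EuclideanSpace ℝ (Fin n))) ?_)
  refine isBounded_iff_forall_norm_le.2 ⟨1, fun u hu => ?_⟩
  exact ContinuousLinearMap.opNorm_le_bound _ zero_le_one fun x =>
    ((Unitary.norm_map ⟨u, hu⟩ x).trans (one_mul _).symm).le

/-- The Haar probability measure on the orthogonal group. -/
noncomputable def rotMeasure (n : ℕ) : Measure (Rot n) :=
  Measure.haarMeasure (⊤ : TopologicalSpace.PositiveCompacts (Rot n))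

instance (n : ℕ) : IsProbabilityMeasure (rotMeasure n) :=
  ⟨Measure.haarMeasure_self (K₀ := (⊤ : TopologicalSpace.PositiveCompacts (Rot n)))⟩

instance (n : ℕ) : (rotMeasure n).IsMulLeftInvariant := by
  unfold rotMeasure; infer_instance

/-- The inverse rotation applied to a vector. -/
noncomputable def act {n : ℕ} (g : Rot n) (x : EuclideanSpace ℝ (Fin n)) :
    EuclideanSpace ℝ (Fin n) :=
  (Unitary.linearIsometryEquiv g).symm x

lemma norm_act {n : ℕ} (g : Rot n) (x : EuclideanSpace ℝ (Fin n)) : ‖act g x‖ = ‖x‖ :=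
  LinearIsometryEquiv.norm_map _ _

lemma continuous_act {n : ℕ} :
    Continuous fun p : Rot n × EuclideanSpace ℝ (Fin n) => act p.1 p.2 := by
  have h : ∀ p : Rot n × EuclideanSpace ℝ (Fin n),
      act p.1 p.2 = ((p.1⁻¹ : Rot n) : EuclideanSpace ℝ (Fin n) →L[ℝ] _) p.2 := fun _ => rfl
  simp only [h]
  exact (continuous_subtype_val.comp continuous_fst.inv).clm_apply continuous_snd

lemma act_mul {n : ℕ} (k g : Rot n) (x : EuclideanSpace ℝ (Fin n)) :
    act (k * g) x = act g (act k x) := by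
  rw [act, map_mul]
  rfl

lemma exists_act_eq {n : ℕ} {x y : EuclideanSpace ℝ (Fin n)} (h : ‖x‖ = ‖y‖) :
    ∃ g : Rot n, act g x = y :=
  ⟨(Unitary.linearIsometryEquiv.symm (Submodule.reflection (Submodule.span ℝ {x - y})ᗮ).symm), by
    rw [act, MulEquiv.apply_symm_apply]
    exact Submodule.reflection_sub h⟩

/-- The action of the orthogonal group on the unit sphere. -/
noncomputable def actS {n : ℕ} (g : Rot n) (ω : sphere (0 : EuclideanSpace ℝ (Fin n)) 1) :
    sphere (0 : EuclideanSpace ℝ (Fin n)) 1 :=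
  ⟨act g ω, by rw [mem_sphere_zero_iff_norm, norm_act]; exact mem_sphere_zero_iff_norm.1 ω.2⟩

lemma continuous_actS {n : ℕ} (g : Rot n) : Continuous (actS g) :=
  Continuous.subtype_mk (continuous_act.comp (by fun_prop : Continuous fun ω : sphere (0 :
    EuclideanSpace ℝ (Fin n)) 1 => (g, (ω : EuclideanSpace ℝ (Fin n))))) _

open scoped Pointwise in
lemma map_actS_surfMeasure {n : ℕ} (g : Rot n) : (surfMeasure n).map (actS g) = surfMeasure n := by
  ext s hs
  rw [Measure.map_apply (continuous_actS g).measurable hs, surfMeasure, Measure.toSphere_apply' _ hs,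
    Measure.toSphere_apply' _ ((continuous_actS g).measurable hs)]
  congr 1
  set T := (Unitary.linearIsometryEquiv g).symm with hT
  symm
  rw [← T.measurePreserving.measure_preimage_emb T.toHomeomorph.measurableEmbedding
    (Set.Ioo (0 : ℝ) 1 • _)]
  congr 1
  ext x
  simp only [Set.mem_smul, Set.mem_image, Set.mem_preimage]
  symm
  constructor
  · rintro ⟨r, hr, _, ⟨ω, hω, rfl⟩, rfl⟩
    exact ⟨r, hr, _, ⟨_, hω, rfl⟩, (T.map_smul r _).symm⟩
  · rintro ⟨r, hr, _, ⟨ω, hω, rfl⟩, h⟩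
    refine ⟨r, hr, T.symm ω, ⟨⟨T.symm ω, ?_⟩, ?_, rfl⟩, ?_⟩
    · rw [mem_sphere_zero_iff_norm, LinearIsometryEquiv.norm_map]
      exact mem_sphere_zero_iff_norm.1 ω.2
    · have : actS g ⟨T.symm ω, by
          rw [mem_sphere_zero_iff_norm, LinearIsometryEquiv.norm_map]
          exact mem_sphere_zero_iff_norm.1 ω.2⟩ = ω := Subtype.ext (T.apply_symm_apply ω)
      rwa [this]
    · rw [← map_smul, h, T.symm_apply_apply]

lemma surfMeasure_univ_ne_zero {n : ℕ} (hn : n ≠ 0) : surfMeasure n Set.univ ≠ 0 := by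
  have : Nonempty (Fin n) := ⟨⟨0, Nat.pos_of_ne_zero hn⟩⟩
  exact Measure.measure_univ_ne_zero.2 (Measure.toSphere_ne_zero _)

instance (n : ℕ) : IsFiniteMeasure (surfMeasure n) := by
  unfold surfMeasure; infer_instance

lemma isProbabilityMeasure_surf {n : ℕ} (hn : n ≠ 0) :
    IsProbabilityMeasure (surfMeasureNorm n) := by
  have := surfMeasure_univ_ne_zero hn
  refine ⟨?_⟩
  rw [surfMeasureNorm, Measure.smul_apply, smul_eq_mul, ENNReal.inv_mul_cancel this
    (measure_ne_top _ _)]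

/-- Integrals over the sphere are averages over the orthogonal group. -/
lemma lintegral_sphere_eq {n : ℕ} (hn : n ≠ 0) {h : EuclideanSpace ℝ (Fin n) → ℝ≥0∞}
    (hh : Measurable h) {e : EuclideanSpace ℝ (Fin n)} (he : ‖e‖ = 1) :
    ∫⁻ ω, h ω ∂(surfMeasureNorm n) = ∫⁻ g, h (act g e) ∂(rotMeasure n) := by
  have := isProbabilityMeasure_surf hn
  have h1 : ∀ g : Rot n, ∫⁻ ω, h (act g ω) ∂(surfMeasureNorm n) = ∫⁻ ω, h ω ∂(surfMeasureNorm n) := by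
    intro g
    have hm : (surfMeasureNorm n).map (actS g) = surfMeasureNorm n := by
      rw [surfMeasureNorm, Measure.map_smul, map_actS_surfMeasure]
    conv_rhs => rw [← hm]
    exact (lintegral_map (hh.comp measurable_subtype_coe) (continuous_actS g).measurable).symm
  have h2 : ∀ ω : sphere (0 : EuclideanSpace ℝ (Fin n)) 1,
      ∫⁻ g, h (act g ω) ∂(rotMeasure n) = ∫⁻ g, h (act g e) ∂(rotMeasure n) := by
    intro ω
    obtain ⟨k, hk⟩ := exists_act_eq (he.trans (mem_sphere_zero_iff_norm.1 ω.2).symm)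
    rw [← hk, ← lintegral_mul_left_eq_self (fun g => h (act g e)) k]
    simp only [act_mul]
  calc _ = ∫⁻ g, ∫⁻ ω, h (act g ω) ∂(surfMeasureNorm n) ∂(rotMeasure n) := by
        simp only [h1]
        rw [lintegral_const, measure_univ, mul_one]
    _ = ∫⁻ ω, ∫⁻ g, h (act g (ω : EuclideanSpace ℝ (Fin n))) ∂(rotMeasure n) ∂(surfMeasureNorm n) := by
        refine lintegral_lintegral_swap (Measurable.aemeasurable ?_)
        exact hh.comp (continuous_act.comp (by fun_prop : Continuous fun p : Rot n × sphere (0 :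
          EuclideanSpace ℝ (Fin n)) 1 => (p.1, (p.2 : EuclideanSpace ℝ (Fin n))))).measurable
    _ = _ := by
        simp only [h2]
        rw [lintegral_const, measure_univ, mul_one]

/-- The identification of `ℂ × ℝᵐ` with `ℝ^{m+2}`. -/
noncomputable def emb {m : ℕ} (z : ℂ) (w : Fin m → ℝ) : EuclideanSpace ℝ (Fin (m + 2)) :=
  WithLp.toLp 2 (Fin.cons z.re (Fin.cons z.im w))

lemma measurePreserving_emb (m : ℕ) :
    MeasurePreserving fun p : ℂ × (Fin m → ℝ) => emb p.1 p.2 := by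
  have h1 : MeasurePreserving (Prod.map Complex.measurableEquivRealProd (id : (Fin m → ℝ) → _)) :=
    Complex.volume_preserving_equiv_real_prod.prod (MeasurePreserving.id volume)
  have h2 : MeasurePreserving (MeasurableEquiv.prodAssoc : (ℝ × ℝ) × (Fin m → ℝ) ≃ᵐ _) :=
    volume_preserving_prodAssoc
  have h3 := (volume_preserving_piFinSuccAbove (fun _ : Fin (m + 1) => ℝ) 0).symm
  have h4 := (MeasurePreserving.id (volume : Measure ℝ)).prod h3
  have h5 := (volume_preserving_piFinSuccAbove (fun _ : Fin (m + 2) => ℝ) 0).symm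
  have h6 := PiLp.volume_preserving_toLp (Fin (m + 2))
  have h := h6.comp (h5.comp (h4.comp (h2.comp h1)))
  convert h using 1
  funext p
  simp only [emb, Function.comp_apply]
  congr 1
  simp [MeasurableEquiv.prodAssoc, MeasurableEquiv.piFinSuccAbove, Fin.insertNthEquiv,
    Complex.measurableEquivRealProd_apply]

lemma continuous_emb (m : ℕ) : Continuous fun p : ℂ × (Fin m → ℝ) => emb p.1 p.2 := by
  refine (PiLp.continuous_toLp 2 _).comp (continuous_pi fun i => ?_)
  refine Fin.cases ?_ (fun i => ?_) i
  · exact Complex.continuous_re.comp continuous_fst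
  · refine Fin.cases ?_ (fun i => ?_) i
    · exact Complex.continuous_im.comp continuous_fst
    · exact (continuous_apply i).comp continuous_snd

lemma emb_add_smul {m : ℕ} (z z' : ℂ) (w : Fin m → ℝ) (t : ℝ) :
    emb z w + t • emb z' 0 = emb (z + t * z') w := by
  ext i
  refine Fin.cases ?_ (fun i => ?_) i
  · simp [emb]
  · refine Fin.cases ?_ (fun i => ?_) i
    · simp [emb]
    · simp [emb]

lemma norm_emb_sq {m : ℕ} (z : ℂ) (w : Fin m → ℝ) : ‖emb z w‖ ^ 2 = ‖z‖ ^ 2 + ∑ i, w i ^ 2 := by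
  rw [EuclideanSpace.norm_sq_eq, Fin.sum_univ_succ, Fin.sum_univ_succ, Complex.sq_norm,
    Complex.normSq_apply]
  simp [emb]
  ring

lemma norm_le_norm_emb {m : ℕ} (z : ℂ) (w : Fin m → ℝ) : ‖z‖ ≤ ‖emb z w‖ := by
  refine abs_le_of_sq_le_sq' ?_ (norm_nonneg _) |>.2
  rw [norm_emb_sq]
  exact le_add_of_nonneg_right (Finset.sum_nonneg fun i _ => sq_nonneg _)

/-- The unit circle in the first two coordinates. -/
noncomputable def circV (m : ℕ) (α : ℝ) : EuclideanSpace ℝ (Fin (m + 2)) := emb (circ 1 0 α) 0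

lemma continuous_circV (m : ℕ) : Continuous (circV m) := by
  have := continuous_circ 1 0
  exact (continuous_emb m).comp (by fun_prop : Continuous fun α : ℝ => (circ 1 0 α, (0 : Fin m → ℝ)))

lemma norm_circV (m : ℕ) (α : ℝ) : ‖circV m α‖ = 1 := by
  have h := norm_emb_sq (circ 1 0 α) (0 : Fin m → ℝ)
  rw [norm_circ_one] at h
  simp only [Pi.zero_apply, ne_eq, OfNat.ofNat_ne_zero, not_false_eq_true, zero_pow,
    Finset.sum_const_zero, add_zero, one_pow] at h
  exact (pow_eq_one_iff_of_nonneg (norm_nonneg _) two_ne_zero).1 h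

/-- The circular maximal theorem in planes parallel to the first two coordinates. -/
lemma exists_slice {p : ℝ} (hp : 2 < p) : ∃ C : ℝ≥0∞, C ≠ ⊤ ∧ ∀ {m : ℕ}
    {φ : EuclideanSpace ℝ (Fin (m + 2)) → ℝ}, Continuous φ → (∀ x, 0 ≤ φ x) →
    ∀ {M R : ℝ}, (∀ x, |φ x| ≤ M) → (∀ x, R < ‖x‖ → φ x = 0) →
    ∫⁻ x, (⨆ (t : ℝ) (_ : 0 < t), ENNReal.ofReal (∫ α in Set.Ioo (-Real.pi) Real.pi,
      φ (x + t • circV m α))) ^ p ≤ C * ∫⁻ x, ‖φ x‖ₑ ^ p := by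
  obtain ⟨C, hC, h⟩ := exists_circular hp
  refine ⟨C, hC, fun {m φ} hφ hφ0 M R hM hR => ?_⟩
  have hcont : ∀ t : ℝ, Continuous fun x => ∫ α in Set.Ioo (-Real.pi) Real.pi,
      φ (x + t • circV m α) := by
    intro t
    have := continuous_circV m
    refine continuous_of_dominated (bound := fun _ => M) (fun x => ?_)
      (fun x => ae_of_all _ fun α => hM _) (integrable_const _) (ae_of_all _ fun α => ?_)
    · exact Continuous.aestronglyMeasurable (by fun_prop)
    · fun_prop
  have hmeas : Measurable fun x => (⨆ (t : ℝ) (_ : 0 < t),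
      ENNReal.ofReal (∫ α in Set.Ioo (-Real.pi) Real.pi, φ (x + t • circV m α))) := by
    refine LowerSemicontinuous.measurable (lowerSemicontinuous_iSup fun t =>
      lowerSemicontinuous_iSup fun _ => Continuous.lowerSemicontinuous ?_)
    exact ENNReal.continuous_ofReal.comp (hcont t)
  have hφm : Measurable fun x => ‖φ x‖ₑ ^ p := hφ.measurable.enorm.pow_const p
  have hΨ := measurePreserving_emb m
  have hm1 : Measurable fun q : ℂ × (Fin m → ℝ) => (⨆ (t : ℝ) (_ : 0 < t),
      ENNReal.ofReal (∫ α in Set.Ioo (-Real.pi) Real.pi,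
        φ (emb q.1 q.2 + t • circV m α))) ^ p := (hmeas.pow_const p).comp hΨ.measurable
  have hm2 : Measurable fun q : ℂ × (Fin m → ℝ) => ‖φ (emb q.1 q.2)‖ₑ ^ p :=
    hφm.comp hΨ.measurable
  rw [← hΨ.lintegral_comp (hmeas.pow_const p), ← hΨ.lintegral_comp hφm, Measure.volume_eq_prod,
    lintegral_prod_symm _ hm1.aemeasurable,
    lintegral_prod_symm _ hm2.aemeasurable, ← lintegral_const_mul' _ _ hC]
  refine lintegral_mono fun w => ?_
  have hc : Continuous fun z => φ (emb z w) :=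
    hφ.comp ((continuous_emb m).comp (by fun_prop : Continuous fun z : ℂ => (z, w)))
  refine le_trans (lintegral_mono fun z => ?_) (h hc ⟨hc.measurable, ⟨M, fun z => hM _⟩,
    ⟨R, fun z hz => hR _ (hz.trans_le (norm_le_norm_emb z w))⟩⟩ fun z => hφ0 _)
  refine ENNReal.rpow_le_rpow (iSup₂_mono fun t _ => le_of_eq ?_) (by linarith)
  have h0 : 0 ≤ circInt (fun z => φ (emb z w)) z t := integral_nonneg fun α => hφ0 _
  rw [Real.enorm_of_nonneg h0]
  simp only [circInt, circV, emb_add_smul]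

/-- The integral of `‖f‖` over a rotated circle. -/
noncomputable def rotInt {m : ℕ} (f : EuclideanSpace ℝ (Fin (m + 2)) → ℂ) (t : ℝ)
    (q : Rot (m + 2) × EuclideanSpace ℝ (Fin (m + 2))) : ℝ :=
  ∫ α in Set.Ioo (-Real.pi) Real.pi, ‖f (q.2 + t • act q.1 (circV m α))‖

lemma continuous_rotInt {m : ℕ} {f : EuclideanSpace ℝ (Fin (m + 2)) → ℂ} (hf : Continuous f) {M : ℝ}
    (hM : ∀ x, ‖f x‖ ≤ M) (t : ℝ) : Continuous (rotInt f t) := by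
  have := continuous_circV m
  refine continuous_of_dominated (bound := fun _ => M) (fun x => ?_)
    (fun x => ae_of_all _ fun α => (norm_norm _).trans_le (hM _)) (integrable_const _)
    (ae_of_all _ fun α => ?_)
  · have := continuous_act.comp (by fun_prop : Continuous fun α => (x.1, circV m α))
    simp only [Function.comp_def] at this
    exact Continuous.aestronglyMeasurable (by fun_prop)
  · have := continuous_act.comp (by fun_prop : Continuous fun x : Rot (m + 2) ×
      EuclideanSpace ℝ (Fin (m + 2)) => (x.1, circV m α))
    simp only [Function.comp_def] at this
    exact (hf.comp (continuous_snd.add (this.const_smul t))).norm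

lemma ofReal_rotInt {m : ℕ} {f : EuclideanSpace ℝ (Fin (m + 2)) → ℂ} (hf : Continuous f) (t : ℝ)
    (g : Rot (m + 2)) (x : EuclideanSpace ℝ (Fin (m + 2))) :
    ENNReal.ofReal (rotInt f t (g, x)) =
      ∫⁻ α in Set.Ioo (-Real.pi) Real.pi, ‖f (x + t • act g (circV m α))‖ₑ := by
  have := continuous_circV m
  have := continuous_act.comp (by fun_prop : Continuous fun α => (g, circV m α))
  simp only [Function.comp_def] at this
  have hc : Continuous fun α => ‖f (x + t • act g (circV m α))‖ := by fun_prop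
  rw [rotInt, ofReal_integral_eq_lintegral_ofReal
    (hc.integrableOn_Icc.mono_set Set.Ioo_subset_Icc_self) (ae_of_all _ fun α => norm_nonneg _)]
  simp only [ofReal_norm]

lemma enorm_sphAvg_le {m : ℕ} {f : EuclideanSpace ℝ (Fin (m + 2)) → ℂ} (hf : Continuous f) (t : ℝ)
    (x : EuclideanSpace ℝ (Fin (m + 2))) :
    ‖sphAvg (m + 2) t f x‖ₑ ≤
      ∫⁻ g, ENNReal.ofReal (rotInt f t (g, x)) ∂(rotMeasure (m + 2)) := by
  set L := ∫⁻ ω, ‖f (x + t • (ω : EuclideanSpace ℝ (Fin (m + 2))))‖ₑ ∂(surfMeasureNorm (m + 2))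
    with hL
  have hh : Measurable fun ω => ‖f (x + t • ω)‖ₑ :=
    (hf.comp (by fun_prop : Continuous fun ω => x + t • ω)).measurable.enorm
  have h1 : ∀ α, ∫⁻ g, ‖f (x + t • act g (circV m α))‖ₑ ∂(rotMeasure (m + 2)) = L := fun α =>
    (lintegral_sphere_eq (by omega) hh (norm_circV m α)).symm
  have hone : (1 : ℝ≥0∞) ≤ volume (Set.Ioo (-Real.pi) Real.pi) := by
    rw [Real.volume_Ioo, ENNReal.one_le_ofReal]
    linarith [Real.pi_gt_three]
  calc _ ≤ L := enorm_integral_le_lintegral_enorm _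
    _ ≤ L * volume (Set.Ioo (-Real.pi) Real.pi) := le_mul_of_one_le_right (zero_le) hone
    _ = ∫⁻ α in Set.Ioo (-Real.pi) Real.pi,
          (∫⁻ g, ‖f (x + t • act g (circV m α))‖ₑ ∂(rotMeasure (m + 2))) := by
        simp only [h1]
        rw [setLIntegral_const]
    _ = ∫⁻ g, (∫⁻ α in Set.Ioo (-Real.pi) Real.pi, ‖f (x + t • act g (circV m α))‖ₑ)
          ∂(rotMeasure (m + 2)) := by
        refine lintegral_lintegral_swap (Measurable.aemeasurable ?_)
        have := continuous_circV m
        exact hh.comp (continuous_act.comp (by fun_prop : Continuous fun q : ℝ × Rot (m + 2) =>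
          (q.2, circV m q.1))).measurable
    _ = _ := by simp only [ofReal_rotInt hf]

lemma lintegral_rpow_le {Ω : Type*} [MeasurableSpace Ω] {μ : Measure Ω} [IsProbabilityMeasure μ]
    {u : Ω → ℝ≥0∞} (hu : AEMeasurable u μ) {p : ℝ} (hp : 1 < p) :
    (∫⁻ a, u a ∂μ) ^ p ≤ ∫⁻ a, u a ^ p ∂μ := by
  have h := ENNReal.lintegral_mul_le_Lp_mul_Lq μ (Real.HolderConjugate.conjExponent hp) hu
    (aemeasurable_const (b := (1 : ℝ≥0∞)))
  simp only [Pi.mul_apply, mul_one, ENNReal.one_rpow, lintegral_const, measure_univ] at h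
  rwa [one_div, ENNReal.le_rpow_inv_iff (by linarith)] at h

/-- The maximal theorem for circles in a rotated plane. -/
lemma exists_rotInt_strong {p : ℝ} (hp : 2 < p) : ∃ C : ℝ≥0∞, C ≠ ⊤ ∧ ∀ {m : ℕ}
    {f : EuclideanSpace ℝ (Fin (m + 2)) → ℂ}, Continuous f → HasCompactSupport f →
    ∀ g : Rot (m + 2), ∫⁻ x, (⨆ (t : ℝ) (_ : 0 < t), ENNReal.ofReal (rotInt f t (g, x))) ^ p ≤
      C * ∫⁻ x, ‖f x‖ₑ ^ p := by
  obtain ⟨C, hC, h⟩ := exists_slice hp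
  refine ⟨C, hC, fun {m f} hf hfs g => ?_⟩
  obtain ⟨M, hM⟩ := hfs.exists_bound_of_continuous hf
  obtain ⟨R, hR⟩ := hfs.isCompact.isBounded.subset_closedBall 0
  set T := (Unitary.linearIsometryEquiv g).symm with hT
  have hc : Continuous fun y => ‖f (act g y)‖ := (hf.comp T.continuous).norm
  have h1 := h hc (fun x => norm_nonneg _) (M := M) (R := R)
    (fun x => (abs_norm _).trans_le (hM _)) (fun x hx => by
      rw [norm_eq_zero]
      by_contra h0
      have := hR (subset_tsupport f h0)
      rw [mem_closedBall_zero_iff, norm_act] at this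
      exact absurd this (not_le.2 hx))
  have hmp := T.measurePreserving
  have hme := T.toHomeomorph.measurableEmbedding
  rw [← hmp.lintegral_comp_emb hme, ← hmp.lintegral_comp_emb hme (fun x => ‖f x‖ₑ ^ p)]
  refine le_trans (lintegral_mono fun y => ?_) (h1.trans_eq ?_)
  · refine ENNReal.rpow_le_rpow (iSup₂_mono fun t _ => le_of_eq ?_) (by linarith)
    have : ∀ v, act g (y + t • v) = T y + t • act g v := fun v =>
      (map_add T y (t • v)).trans (congrArg (T y + ·) (T.map_smul t v))
    simp only [rotInt, this]
  · simp only [enorm_norm]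
    rfl

/-- The method of rotations. -/
lemma exists_sphAvg_strong {p : ℝ} (hp : 2 < p) : ∃ C : ℝ≥0∞, C ≠ ⊤ ∧ ∀ {m : ℕ}
    {f : EuclideanSpace ℝ (Fin (m + 2)) → ℂ}, Continuous f → HasCompactSupport f →
    ∫⁻ x, (⨆ (t : ℝ) (_ : 0 < t), ‖sphAvg (m + 2) t f x‖ₑ) ^ p ≤ C * ∫⁻ x, ‖f x‖ₑ ^ p := by
  obtain ⟨C, hC, h⟩ := exists_rotInt_strong hp
  refine ⟨C, hC, fun {m f} hf hfs => ?_⟩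
  obtain ⟨M, hM⟩ := hfs.exists_bound_of_continuous hf
  set u : Rot (m + 2) × EuclideanSpace ℝ (Fin (m + 2)) → ℝ≥0∞ := fun q =>
    ⨆ (t : ℝ) (_ : 0 < t), ENNReal.ofReal (rotInt f t q) with hu
  have hmeas : Measurable u :=
    LowerSemicontinuous.measurable (lowerSemicontinuous_iSup fun t =>
      lowerSemicontinuous_iSup fun _ => Continuous.lowerSemicontinuous
        (ENNReal.continuous_ofReal.comp (continuous_rotInt hf hM t)))
  calc _ ≤ ∫⁻ x, (∫⁻ g, u (g, x) ∂(rotMeasure (m + 2))) ^ p := by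
        refine lintegral_mono fun x => ENNReal.rpow_le_rpow (iSup₂_le fun t ht => ?_) (by linarith)
        refine (enorm_sphAvg_le hf t x).trans (lintegral_mono fun g => ?_)
        exact le_iSup₂ (f := fun (t : ℝ) (_ : 0 < t) => ENNReal.ofReal (rotInt f t (g, x))) t ht
    _ ≤ ∫⁻ x, (∫⁻ g, u (g, x) ^ p ∂(rotMeasure (m + 2))) :=
        lintegral_mono fun x => lintegral_rpow_le
          (hmeas.comp measurable_prodMk_right).aemeasurable (by linarith)
    _ = ∫⁻ g, (∫⁻ x, u (g, x) ^ p) ∂(rotMeasure (m + 2)) :=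
        lintegral_lintegral_swap ((hmeas.comp measurable_swap).pow_const p).aemeasurable
    _ ≤ ∫⁻ _, (C * ∫⁻ x, ‖f x‖ₑ ^ p) ∂(rotMeasure (m + 2)) := lintegral_mono fun g => h hf hfs g
    _ = _ := by rw [lintegral_const, measure_univ, mul_one]

end SphericalMaximal

/-- The spherical maximal theorem (Stein for `n ≥ 3`, Bourgain for `n = 2`): the full spherical
maximal operator is bounded on `L^p(ℝⁿ)` for `2 < p < ∞`, `n ≥ 2`. -/
theorem spherical_maximal_theorem (n : ℕ) (hn : 2 ≤ n) (p : ℝ) (hp : 2 < p) :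
    ∃ C : ℝ, 0 < C ∧ ∀ f : EuclideanSpace ℝ (Fin n) → ℂ,
      Continuous f → HasCompactSupport f →
      (∫⁻ x, (⨆ (t : ℝ) (_ : 0 < t), (‖sphAvg n t f x‖₊ : ℝ≥0∞)) ^ p) ^ (1 / p) ≤
        ENNReal.ofReal C * eLpNorm f (ENNReal.ofReal p) volume := by
  obtain ⟨m, rfl⟩ := Nat.exists_eq_add_of_le' hn
  have hp0 : 0 < p := by linarith
  obtain ⟨C, hC, h⟩ := SphericalMaximal.exists_sphAvg_strong hp
  have hCp : C ^ (1 / p) ≠ ⊤ := ENNReal.rpow_ne_top_of_nonneg (by positivity) hC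
  refine ⟨(C ^ (1 / p)).toReal + 1, by positivity, fun f hf hfs => ?_⟩
  rw [eLpNorm_eq_lintegral_rpow_enorm_toReal (by simpa using hp0) ENNReal.ofReal_ne_top,
    ENNReal.toReal_ofReal hp0.le]
  calc _ ≤ (C * ∫⁻ x, ‖f x‖ₑ ^ p) ^ (1 / p) := ENNReal.rpow_le_rpow (h hf hfs) (by positivity)
    _ = C ^ (1 / p) * (∫⁻ x, ‖f x‖ₑ ^ p) ^ (1 / p) :=
        ENNReal.mul_rpow_of_nonneg _ _ (by positivity)
    _ ≤ _ := by
        gcongr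
        exact (ENNReal.le_ofReal_iff_toReal_le hCp (by positivity)).2 (by linarith)
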